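/- Let K be a number field of degree n_K = [K:ℚ] ≥ 2 with discriminant Δ_K satisfying |Δ_K| ≥ 5.4·10^6. Assume GRH for the Dedekind zeta function ζ_K and assume the Dedekind conjecture for K, i.e. that ζ_K(s)/ζ(s) extends to an entire function. Let κ_K be the residue of ζ_K at s = 1, i.e. (s−1)·ζ_K(s) → κ_K as s → 1. Then κ_K ≤ (exp(1.271 + 2.475/log log|Δ_K|)·log log|Δ_K|)^{n_K−1}. -/

import Mathlib

open NumberField

section
open Complex Filter Topology

theorem ofReal_digamma {x : ℝ} (hx : 0 < x) :
    digamma (x : ℂ) = ((deriv (Real.log ∘ Real.Gamma) x : ℝ) : ℂ) ∧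
      HasDerivAt (Real.log ∘ Real.Gamma) (deriv (Real.log ∘ Real.Gamma) x) x := by
  have hne : ∀ m : ℕ, x ≠ -m := fun m h => by
    have : (0 : ℝ) ≤ m := Nat.cast_nonneg m
    linarith
  have hd := (Real.differentiableAt_Gamma hne).hasDerivAt
  have hlog := hd.log (Real.Gamma_pos_of_pos hx).ne'
  have h1 : HasDerivAt (fun y : ℝ => Gamma (y : ℂ)) (deriv Gamma (x : ℂ)) x := by
    refine HasDerivAt.comp_ofReal (DifferentiableAt.hasDerivAt ?_)
    refine differentiableAt_Gamma _ fun m h => hne m ?_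
    exact_mod_cast h
  have h2 : HasDerivAt (fun y : ℝ => Gamma (y : ℂ)) ((deriv Real.Gamma x : ℝ) : ℂ) x := by
    simpa only [Gamma_ofReal] using hd.ofReal_comp
  have h3 := h1.unique h2
  have h4 : deriv (Real.log ∘ Real.Gamma) x = deriv Real.Gamma x / Real.Gamma x := hlog.deriv
  refine ⟨?_, ?_⟩
  · rw [digamma_def, logDeriv_apply, h3, h4, Gamma_ofReal]
    push_cast
    rfl
  · rw [h4]
    exact hlog

theorem re_digamma_bounds {x : ℝ} (hx : 0 < x) :
    (digamma (x : ℂ)).re ≤ Real.log x ∧ Real.log x - 1 / x ≤ (digamma (x : ℂ)).re := by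
  obtain ⟨h1, h2⟩ := ofReal_digamma hx
  obtain ⟨h3, h4⟩ := ofReal_digamma (x := x + 1) (by linarith)
  have hadd := digamma_apply_add_one (x : ℂ) (fun m h => by
    have : (0 : ℝ) ≤ m := Nat.cast_nonneg m
    have h' : x = -m := by exact_mod_cast h
    linarith)
  have hG : (Real.log ∘ Real.Gamma) (x + 1) - (Real.log ∘ Real.Gamma) x = Real.log x := by
    simp only [Function.comp]
    rw [Real.Gamma_add_one hx.ne', Real.log_mul hx.ne' (Real.Gamma_pos_of_pos hx).ne']
    ring
  have hc := Real.convexOn_log_Gamma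
  have hx1 : (0 : ℝ) < x + 1 := by linarith
  have a1 := hc.le_slope_of_hasDerivAt (x := x) (y := x + 1) hx hx1 (by linarith) h2
  have a2 := hc.slope_le_of_hasDerivAt (x := x) (y := x + 1) hx hx1 (by linarith) h4
  have hs : slope (Real.log ∘ Real.Gamma) x (x + 1) = Real.log x := by
    rw [slope_def_field, hG]; simp
  rw [hs] at a1 a2
  have e1 : (digamma (x : ℂ)).re = deriv (Real.log ∘ Real.Gamma) x := by rw [h1, ofReal_re]
  have e2 : (digamma (x : ℂ)).re + 1 / x = deriv (Real.log ∘ Real.Gamma) (x + 1) := by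
    have := congrArg Complex.re hadd
    rw [show (x : ℂ) + 1 = ((x + 1 : ℝ) : ℂ) by push_cast; rfl, h3, ofReal_re, add_re,
      ← ofReal_inv, ofReal_re] at this
    rw [this]; simp
  constructor
  · rw [e1]; exact a1
  · linarith

theorem norm_natCast_add_ge {u : ℂ} {c : ℝ} (hu : c ≤ u.re) (k : ℕ) :
    (k : ℝ) + c ≤ ‖(k : ℂ) + u‖ := by
  refine le_trans ?_ (re_le_norm _)
  simp
  exact hu

theorem norm_digamma_term_le {u : ℂ} {c : ℝ} (hc : 0 < c) (hc1 : c ≤ 1) (hu : c ≤ u.re) (k : ℕ) :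
    ‖1 / ((k : ℂ) + 1) - 1 / ((k : ℂ) + u)‖ ≤ ‖u - 1‖ * (1 / c * (1 / ((k : ℝ) + 1) ^ 2)) := by
  have hk : (0 : ℝ) ≤ k := Nat.cast_nonneg k
  have h := norm_natCast_add_ge hu k
  have hpos : 0 < ‖(k : ℂ) + u‖ := by linarith
  have hne : (k : ℂ) + u ≠ 0 := norm_pos_iff.mp hpos
  have hne1 : (k : ℂ) + 1 ≠ 0 := Nat.cast_add_one_ne_zero k
  have hn1 : ‖(k : ℂ) + 1‖ = (k : ℝ) + 1 := by
    exact_mod_cast Complex.norm_natCast (k + 1)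
  rw [show 1 / ((k : ℂ) + 1) - 1 / ((k : ℂ) + u) = (u - 1) / (((k : ℂ) + 1) * (k + u)) by
    field_simp; ring, norm_div, norm_mul, hn1, div_eq_mul_inv]
  refine mul_le_mul_of_nonneg_left ?_ (norm_nonneg _)
  have : c * ((k : ℝ) + 1) ≤ ‖(k : ℂ) + u‖ := by nlinarith
  calc (((k : ℝ) + 1) * ‖(k : ℂ) + u‖)⁻¹ ≤ (((k : ℝ) + 1) * (c * ((k : ℝ) + 1)))⁻¹ := by
        gcongr
    _ = _ := by field_simp

theorem summable_inv_add_one_sq : Summable fun k : ℕ => 1 / ((k : ℝ) + 1) ^ 2 := by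
  have := (summable_nat_add_iff 1).mpr (Real.summable_one_div_nat_pow.mpr (le_refl 2))
  simpa using this

theorem summable_digamma_term {u : ℂ} (hu : 0 < u.re) :
    Summable fun k : ℕ => 1 / ((k : ℂ) + 1) - 1 / ((k : ℂ) + u) := by
  refine Summable.of_norm_bounded ((summable_inv_add_one_sq.mul_left
    (1 / min u.re 1)).mul_left ‖u - 1‖) fun k => ?_
  exact norm_digamma_term_le (lt_min hu one_pos) (min_le_right _ _) (min_le_left _ _) k

theorem differentiableOn_digammaSum : DifferentiableOn ℂ
    (fun u : ℂ => ∑' k : ℕ, (1 / ((k : ℂ) + 1) - 1 / ((k : ℂ) + u))) {u | 0 < u.re} := by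
  have hopen : IsOpen {u : ℂ | 0 < u.re} := isOpen_lt continuous_const continuous_re
  intro u hu
  refine DifferentiableAt.differentiableWithinAt ?_
  have hu' : 0 < u.re := hu
  set c := min (u.re / 2) 1 with hc
  have hc0 : 0 < c := lt_min (by linarith) one_pos
  set V : Set ℂ := {v | c < v.re} ∩ Metric.ball 0 (‖u‖ + 1)
  have hV : IsOpen V := (isOpen_lt continuous_const continuous_re).inter Metric.isOpen_ball
  have huV : u ∈ V := by
    refine ⟨?_, by simp⟩
    exact lt_of_le_of_lt (min_le_left (u.re / 2) 1) (by linarith)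
  refine (differentiableOn_tsum_of_summable_norm
    (u := fun k : ℕ => (‖u‖ + 2) * (1 / c * (1 / ((k : ℝ) + 1) ^ 2)))
    ((summable_inv_add_one_sq.mul_left _).mul_left _) (fun k v hv => ?_) hV
    (fun k v hv => ?_)).differentiableAt (hV.mem_nhds huV)
  · refine DifferentiableAt.differentiableWithinAt ?_
    have hne : (k : ℂ) + v ≠ 0 := by
      refine norm_pos_iff.mp (lt_of_lt_of_le ?_ (norm_natCast_add_ge (le_of_lt hv.1) k))
      positivity
    fun_prop (disch := assumption)
  · refine (norm_digamma_term_le hc0 (min_le_right _ _) (le_of_lt hv.1) k).trans ?_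
    have : ‖v - 1‖ ≤ ‖u‖ + 2 := by
      have h1 := norm_sub_le v 1
      have h2 : ‖v‖ < ‖u‖ + 1 := by simpa using hv.2
      simp at h1
      linarith
    gcongr

theorem re_pos_ne_neg_nat {u : ℂ} (hu : 0 < u.re) (m : ℕ) : u ≠ -m := fun h => by
  have : (0 : ℝ) ≤ m := Nat.cast_nonneg m
  rw [h] at hu
  simp at hu
  linarith

theorem differentiableOn_digamma : DifferentiableOn ℂ digamma {u | 0 < u.re} := by
  have hopen : IsOpen {u : ℂ | 0 < u.re} := isOpen_lt continuous_const continuous_re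
  have h : DifferentiableOn ℂ Gamma {u | 0 < u.re} := fun u hu =>
    (differentiableAt_Gamma u (re_pos_ne_neg_nat hu)).differentiableWithinAt
  exact (h.deriv hopen).div h fun u hu => Gamma_ne_zero_of_re_pos hu

theorem digamma_add_natCast {u : ℂ} (hu : 0 < u.re) (n : ℕ) :
    digamma (u + n) = digamma u + ∑ k ∈ Finset.range n, 1 / ((k : ℂ) + u) := by
  induction n with
  | zero => simp
  | succ n ih =>
    have hu' : 0 < (u + n).re := by
      have : (0 : ℝ) ≤ n := Nat.cast_nonneg n
      simp; linarith
    rw [Finset.sum_range_succ, Nat.cast_succ, ← add_assoc,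
      digamma_apply_add_one _ (re_pos_ne_neg_nat hu'), ih]
    rw [add_comm u (n : ℂ), one_div]
    ring

theorem tendsto_re_digamma_sub {x : ℝ} (hx : 0 < x) :
    Tendsto (fun n : ℕ => (digamma ((x : ℂ) + n)).re - Real.log n) atTop (𝓝 0) := by
  have h1 : Tendsto (fun n : ℕ => Real.log (x + n) - Real.log n) atTop (𝓝 0) := by
    have : Tendsto (fun n : ℕ => Real.log (1 + x / n)) atTop (𝓝 (Real.log (1 + 0))) := by
      refine Tendsto.log ?_ (by norm_num)
      exact tendsto_const_nhds.add (tendsto_const_div_atTop_nhds_zero_nat x)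
    rw [add_zero, Real.log_one] at this
    refine this.congr' ?_
    filter_upwards [eventually_gt_atTop 0] with n hn
    have hn' : (0 : ℝ) < n := by exact_mod_cast hn
    rw [← Real.log_div (by positivity) hn'.ne']
    congr 1
    field_simp
    ring
  have h2 : Tendsto (fun n : ℕ => 1 / (x + n)) atTop (𝓝 0) := by
    have : Tendsto (fun n : ℕ => x + (n : ℝ)) atTop atTop :=
      tendsto_atTop_add_const_left _ _ tendsto_natCast_atTop_atTop
    simpa [Function.comp_def] using tendsto_inv_atTop_zero.comp this
  have h3 := h1.sub h2
  rw [sub_zero] at h3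
  have hb := fun n : ℕ => re_digamma_bounds (x := x + n) (by positivity)
  push_cast at hb
  refine tendsto_of_tendsto_of_tendsto_of_le_of_le h3 h1 (fun n => ?_) (fun n => ?_)
  · have := (hb n).2
    simp only
    linarith
  · have := (hb n).1
    simp only
    linarith

theorem digamma_eq_tsum {u : ℂ} (hu : 0 < u.re) :
    digamma u = -Real.eulerMascheroniConstant +
      ∑' k : ℕ, (1 / ((k : ℂ) + 1) - 1 / ((k : ℂ) + u)) := by
  have hopen : IsOpen {u : ℂ | 0 < u.re} := isOpen_lt continuous_const continuous_re
  have hreal : ∀ x : ℝ, 0 < x → digamma (x : ℂ) = -Real.eulerMascheroniConstant +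
      ∑' k : ℕ, (1 / ((k : ℂ) + 1) - 1 / ((k : ℂ) + x)) := by
    intro x hx
    have hs := (summable_digamma_term (u := x) (by simpa using hx)).hasSum.tendsto_sum_nat
    have e : ∀ n : ℕ, ∑ k ∈ Finset.range n, (1 / ((k : ℂ) + 1) - 1 / ((k : ℂ) + x)) =
        digamma (x : ℂ) - digamma 1 - ((((digamma ((x : ℂ) + n)).re - Real.log n) -
          ((digamma (((1 : ℝ) : ℂ) + n)).re - Real.log n) : ℝ) : ℂ) := by
      intro n
      have a1 := digamma_add_natCast (u := x) (by simpa using hx) n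
      have a2 := digamma_add_natCast (u := 1) (by simp) n
      have r1 : ((digamma ((x : ℂ) + n)).re : ℂ) = digamma ((x : ℂ) + n) := by
        have := (ofReal_digamma (x := x + n) (by positivity)).1
        push_cast at this
        rw [this]; simp
      have r2 : ((digamma (((1 : ℝ) : ℂ) + n)).re : ℂ) = digamma (1 + n) := by
        have := (ofReal_digamma (x := 1 + n) (by positivity)).1
        push_cast at this
        push_cast
        rw [this]; simp
      push_cast at r2 ⊢
      rw [r1, r2, Finset.sum_sub_distrib, a1, a2]
      ring
    have hl := ((tendsto_re_digamma_sub hx).sub (tendsto_re_digamma_sub one_pos)).ofReal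
    have hl2 := (tendsto_const_nhds (x := digamma (x : ℂ) - digamma 1)).sub hl
    have := tendsto_nhds_unique hs (hl2.congr fun n => (e n).symm)
    rw [this, digamma_one]
    push_cast
    ring
  have hpre : IsPreconnected {u : ℂ | 0 < u.re} :=
    (convex_halfSpace_re_gt 0).isPreconnected
  refine (differentiableOn_digamma.analyticOnNhd hopen).eqOn_of_preconnected_of_frequently_eq
    ((differentiableOn_digammaSum.const_add _).analyticOnNhd hopen) hpre (z₀ := 1) (by simp) ?_ hu
  have ht : Tendsto (fun n : ℕ => ((1 + 1 / ((n : ℝ) + 1) : ℝ) : ℂ)) atTop (𝓝[≠] 1) := by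
    refine tendsto_nhdsWithin_iff.mpr ⟨?_, Eventually.of_forall fun n => ?_⟩
    · have := (tendsto_one_div_add_atTop_nhds_zero_nat (𝕜 := ℝ)).const_add 1
      rw [add_zero] at this
      exact_mod_cast this.ofReal
    · simp only [Set.mem_compl_iff, Set.mem_singleton_iff]
      intro h
      have h' : (1 + 1 / ((n : ℝ) + 1) : ℝ) = 1 := by exact_mod_cast h
      have : (0 : ℝ) < 1 / ((n : ℝ) + 1) := by positivity
      linarith
  refine ht.frequently (Frequently.of_forall fun n => ?_)
  exact hreal _ (by positivity)

/-- Linear growth of the digamma function in half-planes `c ≤ re u`. -/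
theorem exists_norm_digamma_le {c : ℝ} (hc : 0 < c) :
    ∃ A, 0 ≤ A ∧ ∀ u : ℂ, c ≤ u.re → ‖digamma u‖ ≤ A * (1 + ‖u‖) := by
  set c' := min c 1
  have hc' : 0 < c' := lt_min hc one_pos
  set S := ∑' k : ℕ, 1 / c' * (1 / ((k : ℝ) + 1) ^ 2)
  have hsum := summable_inv_add_one_sq.mul_left (1 / c')
  have hS : 0 ≤ S := tsum_nonneg fun k => by positivity
  refine ⟨|Real.eulerMascheroniConstant| + S, by positivity, fun u hu => ?_⟩
  have hu0 : 0 < u.re := by linarith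
  rw [digamma_eq_tsum hu0]
  have h1 : ‖∑' k : ℕ, (1 / ((k : ℂ) + 1) - 1 / ((k : ℂ) + u))‖ ≤ ‖u - 1‖ * S := by
    refine tsum_of_norm_bounded (hsum.hasSum.mul_left _) fun k => ?_
    exact norm_digamma_term_le hc' (min_le_right _ _) ((min_le_left _ _).trans hu) k
  have h2 : ‖u - 1‖ ≤ 1 + ‖u‖ := by
    have := norm_sub_le u 1
    simp at this
    linarith
  refine (norm_add_le _ _).trans ?_
  rw [norm_neg, norm_real, Real.norm_eq_abs]
  have h3 := norm_nonneg u
  nlinarith [mul_le_mul_of_nonneg_right h2 hS, abs_nonneg Real.eulerMascheroniConstant,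
    mul_nonneg (abs_nonneg Real.eulerMascheroniConstant) h3]

/-- Duplication-type difference bound. -/
theorem norm_digamma_add_half_sub_le {u : ℂ} (hu : 1 / 4 ≤ u.re) :
    ‖digamma (u + 1 / 2) - digamma u‖ ≤ 3.2 := by
  have hu0 : 0 < u.re := by linarith
  have hu1 : 0 < (u + 1 / 2).re := by
    simp
    norm_num
    linarith
  have s1 := (summable_digamma_term hu0).hasSum
  have s2 := (summable_digamma_term hu1).hasSum
  rw [digamma_eq_tsum hu0, digamma_eq_tsum hu1]
  rw [add_sub_add_left_eq_sub]
  have hs := s2.sub s1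
  have hb : ∀ k : ℕ, ‖1 / ((k : ℂ) + 1) - 1 / ((k : ℂ) + (u + 1 / 2)) -
      (1 / ((k : ℂ) + 1) - 1 / ((k : ℂ) + u))‖ ≤
      1 / 2 * (1 / (((k : ℝ) + 1 / 4) * ((k : ℝ) + 3 / 4))) := by
    intro k
    have hk : (0 : ℝ) ≤ k := Nat.cast_nonneg k
    have n1 := norm_natCast_add_ge hu k
    have n2 := norm_natCast_add_ge (c := 3 / 4) (u := u + 1 / 2) (by
      simp
      norm_num
      linarith) k
    have p1 : 0 < ‖(k : ℂ) + u‖ := by linarith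
    have p2 : 0 < ‖(k : ℂ) + (u + 1 / 2)‖ := by linarith
    have e1 := norm_pos_iff.mp p1
    have e2 := norm_pos_iff.mp p2
    rw [show 1 / ((k : ℂ) + 1) - 1 / ((k : ℂ) + (u + 1 / 2)) -
      (1 / ((k : ℂ) + 1) - 1 / ((k : ℂ) + u)) =
      1 / 2 * (1 / (((k : ℂ) + u) * ((k : ℂ) + (u + 1 / 2)))) by
        rw [sub_sub_sub_cancel_left, div_sub_div _ _ e1 e2]
        ring]
    rw [norm_mul, norm_div (1 : ℂ) (((k : ℂ) + u) * _), norm_mul]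
    simp only [norm_div, norm_one, RCLike.norm_ofNat]
    gcongr
  have hsum : Summable fun k : ℕ => 1 / 2 * (1 / (((k : ℝ) + 1 / 4) * ((k : ℝ) + 3 / 4))) := by
    refine Summable.of_nonneg_of_le (fun k => by positivity) (fun k => ?_)
      (summable_inv_add_one_sq.mul_left 6)
    have hk : (0 : ℝ) ≤ k := Nat.cast_nonneg k
    rw [mul_one_div, mul_one_div, div_le_div_iff₀ (by positivity) (by positivity)]
    nlinarith
  have htel : HasSum (fun k : ℕ => 1 / ((k : ℝ) + 3 / 4) - 1 / ((k : ℝ) + 1 + 3 / 4)) (4 / 3) := by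
    have ht : Tendsto (fun n : ℕ => ∑ k ∈ Finset.range n,
        (1 / ((k : ℝ) + 3 / 4) - 1 / ((k : ℝ) + 1 + 3 / 4))) atTop (𝓝 (4 / 3)) := by
      have e : ∀ n : ℕ, ∑ k ∈ Finset.range n,
          (1 / ((k : ℝ) + 3 / 4) - 1 / ((k : ℝ) + 1 + 3 / 4)) = 4 / 3 - 1 / ((n : ℝ) + 3 / 4) := by
        intro n
        have := Finset.sum_range_sub' (fun k : ℕ => 1 / ((k : ℝ) + 3 / 4)) n
        push_cast at this
        rw [this]
        norm_num
      simp_rw [e]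
      have : Tendsto (fun n : ℕ => (n : ℝ) + 3 / 4) atTop atTop :=
        tendsto_atTop_add_const_right _ _ tendsto_natCast_atTop_atTop
      simpa [Function.comp_def] using (tendsto_inv_atTop_zero.comp this).const_sub (4 / 3)
    rw [hasSum_iff_tendsto_nat_of_nonneg]
    · exact ht
    · intro k
      have hk : (0 : ℝ) ≤ k := Nat.cast_nonneg k
      rw [sub_nonneg]
      gcongr
      linarith
  have hbound : ∑' k : ℕ, 1 / 2 * (1 / (((k : ℝ) + 1 / 4) * ((k : ℝ) + 3 / 4))) ≤ 3.2 := by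
    rw [hsum.tsum_eq_zero_add]
    have : ∑' k : ℕ, 1 / 2 * (1 / ((((k + 1 : ℕ) : ℝ) + 1 / 4) * (((k + 1 : ℕ) : ℝ) + 3 / 4))) ≤
        1 / 3 * (4 / 3) + 0.088 := by
      have hs' := (summable_nat_add_iff 1).mpr hsum
      rw [hs'.tsum_eq_zero_add]
      have htel' := (hasSum_nat_add_iff' 1).mpr htel
      refine (add_le_add_right (Summable.tsum_le_tsum (fun k => ?_)
        ((summable_nat_add_iff 1).mpr hs') (htel'.summable.mul_left (0.51))) _).trans ?_
      · have hk : (0 : ℝ) ≤ k := Nat.cast_nonneg k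
        push_cast
        rw [div_sub_div _ _ (by positivity) (by positivity), mul_one_div, mul_div,
          div_le_div_iff₀ (by positivity) (by positivity)]
        nlinarith [mul_nonneg hk hk, mul_nonneg (mul_nonneg hk hk) hk]
      · rw [tsum_mul_left, htel'.tsum_eq]
        norm_num
    norm_num at this ⊢
    linarith
  rw [← hs.tsum_eq] 
  exact (tsum_of_norm_bounded hsum.hasSum hb).trans hbound

end

section
open Complex Filter Topology Metric

/-- Borel–Carathéodory for the logarithm of a zero-free function. -/
theorem norm_logDeriv_le_of_zero_free {f : ℂ → ℂ} {c : ℂ} {R r M : ℝ} (hr : 0 ≤ r) (hrR : r < R)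
    (hM : 0 < M) (hf : DifferentiableOn ℂ f (ball c R)) (h0 : ∀ s ∈ ball c R, f s ≠ 0)
    (hb : ∀ s ∈ ball c R, ‖f s‖ ≤ Real.exp M * ‖f c‖) {s : ℂ} (hs : dist s c ≤ r) :
    ‖logDeriv f s‖ ≤ 8 * R / (R - r) ^ 2 * M ∧
      Real.exp (-(2 * R / (R - r) * M)) * ‖f c‖ ≤ ‖f s‖ := by
  have hR : 0 < R := by linarith
  have hRr : 0 < R - r := by linarith
  have hcR : c ∈ ball c R := mem_ball_self hR
  have hlog : DifferentiableOn ℂ (logDeriv f) (ball c R) :=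
    (hf.deriv isOpen_ball).div hf h0
  obtain ⟨g, hg0, hg⟩ := hlog.isExactOn_ball.with_val_at c 0
  have hgd : DifferentiableOn ℂ g (ball c R) := fun w hw =>
    (hg w hw).differentiableAt.differentiableWithinAt
  have hfe : ∀ w ∈ ball c R, f w = f c * exp (g w) := by
    have hconst : ∀ w ∈ ball c R, HasDerivAt (fun w => f w * exp (-g w)) 0 w := by
      intro w hw
      have h1 := (hf.differentiableAt (isOpen_ball.mem_nhds hw)).hasDerivAt
      have h2 := (hg w hw).neg.cexp
      have h3 := h1.mul h2
      convert! h3 using 1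
      rw [logDeriv_apply]
      field_simp [h0 w hw]
      ring
    intro w hw
    have := (convex_ball c R).is_const_of_fderivWithin_eq_zero (𝕜 := ℂ)
      (f := fun w => f w * exp (-g w))
      (fun z hz => (hconst z hz).differentiableAt.differentiableWithinAt)
      (fun z hz => by
        rw [fderivWithin_of_isOpen isOpen_ball hz]
        ext
        simp [(hconst z hz).deriv]) hw hcR
    simp only [hg0, neg_zero, exp_zero, mul_one] at this
    rw [← this, mul_assoc, ← exp_add]
    simp
  have hre : ∀ w ∈ ball c R, (g w).re ≤ M := by
    intro w hw
    have h1 := hb w hw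
    rw [hfe w hw, norm_mul, norm_exp, mul_comm] at h1
    have := le_of_mul_le_mul_right h1 (norm_pos_iff.mpr (h0 c hcR))
    exact Real.exp_le_exp.mp this
  have hbc : ∀ w ∈ ball c R, ‖g w‖ ≤ 2 * M * dist w c / (R - dist w c) := by
    intro w hw
    have := borelCaratheodory_zero (f := fun z => g (z + c)) (z := w - c) (R := R) hM ?_ ?_ hR ?_ ?_
    · simpa [dist_eq_norm] using this
    · refine hgd.comp (by fun_prop) fun z hz => ?_
      simpa using hz
    · intro z hz
      refine hre _ ?_
      simpa using hz
    · simpa [dist_eq_norm] using hw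
    · simp [hg0]
  have hsR : s ∈ ball c R := lt_of_le_of_lt hs hrR
  constructor
  · set ρ := (R - r) / 2 with hρ
    have hρ0 : 0 < ρ := by positivity
    have hsub : closedBall s ρ ⊆ ball c R := by
      intro w hw
      rw [mem_closedBall] at hw
      rw [mem_ball]
      have := dist_triangle w s c
      linarith
    have := norm_deriv_le_of_forall_mem_sphere_norm_le (f := g) (c := s) (R := ρ)
      (C := 2 * M * R / ρ) hρ0 ?_ ?_
    · rw [(hg s hsR).deriv] at this
      refine this.trans (le_of_eq ?_)
      rw [hρ]
      field_simp
      ring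
    · exact (hgd.mono hsub).diffContOnCl_ball subset_rfl
    · intro w hw
      have hw' := hsub (sphere_subset_closedBall hw)
      refine (hbc w hw').trans ?_
      have h1 := dist_triangle w s c
      rw [mem_sphere.mp hw] at h1
      have h2 : dist w c ≤ R := (mem_ball.mp hw').le
      have h3 : ρ ≤ R - dist w c := by linarith
      gcongr
  · rw [hfe s hsR, norm_mul, norm_exp, mul_comm]
    gcongr
    have h1 := hbc s hsR
    have h2 : ‖g s‖ ≤ 2 * R / (R - r) * M := by
      refine h1.trans ?_
      rw [div_mul_eq_mul_div, show 2 * R * M = 2 * M * R by ring]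
      have : R - r ≤ R - dist s c := by linarith
      have h5 : dist s c ≤ R := by linarith
      gcongr
    have h3 := (abs_le.mp (abs_re_le_norm (g s))).1
    linarith

theorem norm_betaIntegral_le {u : ℂ} {η : ℝ} {c : ℝ} (hc : 0 < c) (hη : 0 < η) (hu : c ≤ u.re) :
    ‖betaIntegral u η‖ ≤ ∫ x in (0 : ℝ)..1, x ^ (c - 1) * (1 - x) ^ (η - 1) := by
  rw [betaIntegral]
  have hconv := betaIntegral_convergent (u := (c : ℂ)) (v := (η : ℂ)) (by simpa using hc)
    (by simpa using hη)
  have hkey : ∀ (v : ℂ) (x : ℝ), x ∈ Set.Ioo (0 : ℝ) 1 →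
      ‖(x : ℂ) ^ (v - 1) * (1 - (x : ℂ)) ^ ((η : ℂ) - 1)‖ = x ^ (v.re - 1) * (1 - x) ^ (η - 1) := by
    intro v x hx
    have h1 : (0 : ℝ) < 1 - x := by linarith [hx.2]
    rw [norm_mul, norm_cpow_eq_rpow_re_of_pos hx.1,
      show (1 - (x : ℂ)) = ((1 - x : ℝ) : ℂ) by push_cast; rfl, norm_cpow_eq_rpow_re_of_pos h1]
    simp
  rw [intervalIntegral.integral_of_le zero_le_one, intervalIntegral.integral_of_le zero_le_one,
    MeasureTheory.integral_Ioc_eq_integral_Ioo, MeasureTheory.integral_Ioc_eq_integral_Ioo]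
  refine MeasureTheory.norm_integral_le_of_norm_le ?_ ?_
  · have h2 := hconv.norm
    rw [intervalIntegrable_iff_integrableOn_Ioo_of_le zero_le_one] at h2
    refine h2.congr_fun (fun x hx => ?_) measurableSet_Ioo
    simpa using hkey c x hx
  · refine (MeasureTheory.ae_restrict_iff' measurableSet_Ioo).mpr (Eventually.of_forall fun x hx => ?_)
    rw [hkey u x hx]
    refine mul_le_mul_of_nonneg_right ?_ (Real.rpow_nonneg (by linarith [hx.2]) _)
    exact Real.rpow_le_rpow_of_exponent_ge hx.1 hx.2.le (by linarith)

theorem exists_norm_Gamma_le_mul {c η : ℝ} (hc : 0 < c) (hη : 0 < η) :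
    ∃ B, 0 ≤ B ∧ ∀ u : ℂ, c ≤ u.re → ‖Gamma u‖ ≤ B * ‖Gamma (u + η)‖ := by
  have hG : 0 < ‖Gamma (η : ℂ)‖ := norm_pos_iff.mpr (Gamma_ne_zero_of_re_pos (by simpa using hη))
  set J := ∫ x in (0 : ℝ)..1, x ^ (c - 1) * (1 - x) ^ (η - 1)
  have hJ : 0 ≤ J := (norm_nonneg _).trans
    (norm_betaIntegral_le (u := (c : ℂ)) hc hη (by simp))
  refine ⟨J / ‖Gamma (η : ℂ)‖, by positivity, fun u hu => ?_⟩
  have h := Gamma_mul_Gamma_eq_betaIntegral (s := u) (t := (η : ℂ)) (by linarith) (by simpa using hη)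
  have h' := congrArg norm h
  rw [norm_mul, norm_mul] at h'
  rw [div_mul_eq_mul_div, le_div_iff₀ hG, h', mul_comm]
  exact mul_le_mul_of_nonneg_right (norm_betaIntegral_le hc hη hu) (norm_nonneg _)

theorem exists_norm_GammaR_le_mul {c η : ℝ} (hc : 0 < c) (hη : 0 < η) :
    ∃ B, 0 ≤ B ∧ ∀ u : ℂ, c ≤ u.re → ‖Gammaℝ u‖ ≤ B * ‖Gammaℝ (u + η)‖ := by
  obtain ⟨B, hB, h⟩ := exists_norm_Gamma_le_mul (c := c / 2) (η := η / 2) (by positivity)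
    (by positivity)
  refine ⟨B * Real.pi ^ (η / 2), by positivity, fun u hu => ?_⟩
  have h1 := h (u / 2) (by simp; linarith)
  rw [Gammaℝ_def, Gammaℝ_def, norm_mul, norm_mul, norm_cpow_eq_rpow_re_of_pos Real.pi_pos,
    norm_cpow_eq_rpow_re_of_pos Real.pi_pos]
  have e1 : u / 2 + ((η / 2 : ℝ) : ℂ) = (u + η) / 2 := by push_cast; ring
  rw [e1] at h1
  have e2 : Real.pi ^ ((-u / 2).re) = Real.pi ^ (η / 2) * Real.pi ^ ((-(u + η) / 2).re) := by
    rw [← Real.rpow_add Real.pi_pos]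
    congr 1
    simp
    ring
  rw [e2]
  have : 0 ≤ Real.pi ^ (η / 2) * Real.pi ^ ((-(u + η) / 2).re) := by positivity
  nlinarith [mul_le_mul_of_nonneg_left h1 this]

theorem GammaR_conj (s : ℂ) : Gammaℝ (starRingEnd ℂ s) = starRingEnd ℂ (Gammaℝ s) := by
  have h2 : starRingEnd ℂ 2 = 2 := by exact_mod_cast conj_ofReal 2
  have h := cpow_conj (Real.pi : ℂ) (-s / 2)
    (by rw [arg_ofReal_of_nonneg Real.pi_pos.le]; exact Real.pi_pos.ne)
  rw [conj_ofReal, map_div₀, map_neg, h2] at h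
  rw [Gammaℝ_def, Gammaℝ_def, map_mul, ← Gamma_conj, map_div₀, h2, h]

theorem differentiableAt_GammaR {s : ℂ} (hs : 0 < s.re) : DifferentiableAt ℂ Gammaℝ s := by
  have h1 : DifferentiableAt ℂ (fun s : ℂ => (Real.pi : ℂ) ^ (-s / 2)) s :=
    DifferentiableAt.const_cpow (by fun_prop) (Or.inl (by exact_mod_cast Real.pi_ne_zero))
  have h2 : DifferentiableAt ℂ (fun s : ℂ => Gamma (s / 2)) s :=
    (differentiableAt_Gamma (s / 2) (re_pos_ne_neg_nat (by simp; linarith))).comp s (by fun_prop)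
  exact h1.mul h2

theorem logDeriv_GammaR {s : ℂ} (hs : 0 < s.re) :
    logDeriv Gammaℝ s = -(Real.log Real.pi) / 2 + digamma (s / 2) / 2 := by
  have hs2 : 0 < (s / 2).re := by simp; linarith
  have hpi : (Real.pi : ℂ) ≠ 0 := by exact_mod_cast Real.pi_ne_zero
  have h1 : HasDerivAt (fun s : ℂ => (Real.pi : ℂ) ^ (-s / 2))
      ((Real.pi : ℂ) ^ (-s / 2) * Complex.log Real.pi * (-1 / 2)) s :=
    HasDerivAt.const_cpow ((hasDerivAt_id s).neg.div_const 2) (Or.inl hpi)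
  have h2 : HasDerivAt (fun s : ℂ => Gamma (s / 2)) (deriv Gamma (s / 2) * (1 / 2)) s :=
    HasDerivAt.comp s (differentiableAt_Gamma (s / 2) (re_pos_ne_neg_nat hs2)).hasDerivAt
      ((hasDerivAt_id s).div_const 2)
  have h3 : HasDerivAt Gammaℝ _ s := h1.mul h2
  rw [logDeriv_apply, h3.deriv, Gammaℝ_def, digamma_def, logDeriv_apply,
    ofReal_log Real.pi_pos.le]
  have g0 := Gamma_ne_zero_of_re_pos hs2
  have p0 : (Real.pi : ℂ) ^ (-s / 2) ≠ 0 := by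
    rw [Ne, cpow_eq_zero_iff]; tauto
  field_simp
  try ring

end

section
open Complex Filter Topology Metric

/-- The completed function `s D^{s/2} Γ_ℝ(s)^a Γ_ℝ(s+1)^b F(s)`. -/
noncomputable def xiFun (F : ℂ → ℂ) (a b : ℕ) (D : ℝ) (s : ℂ) : ℂ :=
  s * (D : ℂ) ^ (s / 2) * Gammaℝ s ^ a * Gammaℝ (s + 1) ^ b * F s

/-- The analytic properties of `(s - 1) ζ(s)` used in the argument, including the Riemann
hypothesis. -/
structure ZetaData (F : ℂ → ℂ) (a b : ℕ) (D : ℝ) : Prop where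
  D_pos : 0 < D
  diff : DifferentiableOn ℂ F {s | 0 < s.re}
  ne_zero : ∀ s : ℂ, 1 / 2 < s.re → F s ≠ 0
  conj : ∀ s : ℂ, 0 < s.re → F (starRingEnd ℂ s) = starRingEnd ℂ (F s)
  fe : ∀ s : ℂ, 0 < s.re → s.re < 1 → xiFun F a b D (1 - s) = xiFun F a b D s
  growth : ∃ C : ℝ, ∀ s : ℂ, 1 / 4 ≤ s.re → ‖F s‖ ≤ Real.exp (C * (1 + ‖s‖))
  right : ∃ σ c C : ℝ, 0 < c ∧ 1 ≤ σ ∧ ∀ s : ℂ, σ ≤ s.re →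
    c * (1 + ‖s‖) ≤ ‖F s‖ ∧ ‖F s‖ ≤ C * (1 + ‖s‖)

namespace ZetaData

variable {F : ℂ → ℂ} {a b : ℕ} {D : ℝ}

theorem exists_logDeriv_bound (h : ZetaData F a b D) {δ : ℝ} (hδ : 0 < δ) :
    ∃ A : ℝ, 0 ≤ A ∧ ∀ s : ℂ, 1 / 2 + δ ≤ s.re →
      ‖logDeriv F s‖ ≤ A * (1 + ‖s‖) ∧ Real.exp (-(A * (1 + ‖s‖))) ≤ ‖F s‖ := by
  obtain ⟨C0, hC0⟩ := h.growth
  obtain ⟨σ, c, C1, hc, hσ, hright⟩ := h.right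
  set C := max C0 0
  have hC : 0 ≤ C := le_max_right _ _
  set δ' := min δ (1 / 4)
  have hδ' : 0 < δ' := lt_min hδ (by norm_num)
  have hδ4 : δ' ≤ 1 / 4 := min_le_right _ _
  set R := σ - 1 / 2
  set r := σ - 1 / 2 - δ'
  have hr : 0 ≤ r := by simp only [r]; linarith
  have hrR : r < R := by simp only [r, R]; linarith
  have hR : 0 < R := by linarith
  have hRr : 0 < R - r := by linarith
  set M0 : ℝ := C * (1 + 2 * σ) + |Real.log c| + 1
  have hM0 : 0 < M0 := by
    have := abs_nonneg (Real.log c)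
    have : 0 ≤ C * (1 + 2 * σ) := by positivity
    simp only [M0]; linarith
  set A1 := 8 * R / (R - r) ^ 2 * M0
  set A2 := 2 * R / (R - r) * M0 + |Real.log c|
  have hA1 : 0 ≤ A1 := by positivity
  have hA2 : 0 ≤ A2 := by positivity
  refine ⟨A1 + A2, by positivity, fun s hs => ?_⟩
  set s0 : ℂ := ⟨max s.re σ, s.im⟩
  have hs0re : σ ≤ s0.re := le_max_right _ _
  have hdist : dist s s0 ≤ r := by
    rw [dist_eq_norm]
    have e : s - s0 = ((s.re - max s.re σ : ℝ) : ℂ) := by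
      apply Complex.ext <;> simp [s0]
    rw [e, norm_real, Real.norm_eq_abs, abs_le]
    have : δ' ≤ δ := min_le_left _ _
    rcases le_total s.re σ with h1 | h1
    · rw [max_eq_right h1]
      constructor <;> simp only [r] <;> linarith
    · rw [max_eq_left h1]
      constructor <;> linarith
  have hs0n : ‖s0‖ ≤ ‖s‖ + R := by
    have h1 := norm_sub_norm_le s0 s
    rw [← dist_eq_norm, dist_comm] at h1
    linarith
  have hre : ∀ w ∈ ball s0 R, 1 / 2 < w.re := by
    intro w hw
    rw [mem_ball, dist_eq_norm] at hw
    have h1 := (abs_le.mp (abs_re_le_norm (w - s0))).1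
    rw [sub_re] at h1
    simp only [R] at hw
    linarith
  have hn : 0 ≤ ‖s‖ := norm_nonneg s
  have hF0 : c ≤ ‖F s0‖ := by
    refine le_trans ?_ (hright s0 hs0re).1
    nlinarith [norm_nonneg s0]
  have key := norm_logDeriv_le_of_zero_free (f := F) (c := s0) (R := R) (r := r)
    (M := M0 * (1 + ‖s‖)) (s := s) hr hrR (by positivity)
    (h.diff.mono fun w hw => by
      have := hre w hw
      simp only [Set.mem_ofPred_eq]; linarith)
    (fun w hw => h.ne_zero w (hre w hw)) (fun w hw => ?_) hdist
  · refine ⟨key.1.trans ?_, le_trans ?_ key.2⟩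
    · rw [← mul_assoc]
      have : 0 ≤ A2 * (1 + ‖s‖) := by positivity
      nlinarith
    · have hcl : Real.exp (-|Real.log c|) ≤ ‖F s0‖ := by
        refine le_trans ?_ hF0
        calc Real.exp (-|Real.log c|) ≤ Real.exp (Real.log c) :=
              Real.exp_le_exp.mpr (neg_abs_le _)
          _ = c := Real.exp_log hc
      calc Real.exp (-((A1 + A2) * (1 + ‖s‖)))
          ≤ Real.exp (-(2 * R / (R - r) * (M0 * (1 + ‖s‖)))) * Real.exp (-|Real.log c|) := by
            rw [← Real.exp_add]
            apply Real.exp_le_exp.mpr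
            simp only [A2]
            have : 0 ≤ A1 * (1 + ‖s‖) := by positivity
            have : 0 ≤ |Real.log c| * ‖s‖ := by positivity
            nlinarith
        _ ≤ _ := by gcongr
  · have hw1 := hre w hw
    have hwn : ‖w‖ ≤ ‖s‖ + 2 * σ := by
      rw [mem_ball, dist_eq_norm] at hw
      have := norm_sub_norm_le w s0
      simp only [R] at *
      linarith
    calc ‖F w‖ ≤ Real.exp (C0 * (1 + ‖w‖)) := hC0 w (by linarith)
      _ ≤ Real.exp (M0 * (1 + ‖s‖) - |Real.log c|) := by
          apply Real.exp_le_exp.mpr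
          have h1 : C0 * (1 + ‖w‖) ≤ C * (1 + ‖w‖) := by
            gcongr
            exact le_max_left _ _
          have h2 : C * (1 + ‖w‖) ≤ C * (1 + (‖s‖ + 2 * σ)) := by gcongr
          have h3 : 0 ≤ |Real.log c| * ‖s‖ := by positivity
          have h4 : 0 ≤ C * σ * ‖s‖ := by positivity
          simp only [M0]
          nlinarith
      _ ≤ Real.exp (M0 * (1 + ‖s‖)) * c := by
          rw [sub_eq_add_neg, Real.exp_add]
          gcongr
          calc Real.exp (-|Real.log c|) ≤ Real.exp (Real.log c) :=
              Real.exp_le_exp.mpr (neg_abs_le _)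
          _ = c := Real.exp_log hc
      _ ≤ _ := by gcongr

theorem xiFun_ne_zero (h : ZetaData F a b D) {s : ℂ} (hs : 1 / 2 < s.re) :
    xiFun F a b D s ≠ 0 := by
  have hs0 : 0 < s.re := by linarith
  have h1 : s ≠ 0 := fun e => by simp [e] at hs0
  have h2 : (D : ℂ) ^ (s / 2) ≠ 0 := by
    rw [Ne, cpow_eq_zero_iff]
    have : (D : ℂ) ≠ 0 := by exact_mod_cast h.D_pos.ne'
    tauto
  have h3 := Gammaℝ_ne_zero_of_re_pos hs0
  have h4 := Gammaℝ_ne_zero_of_re_pos (s := s + 1) (by simp; linarith)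
  exact mul_ne_zero (mul_ne_zero (mul_ne_zero (mul_ne_zero h1 h2) (pow_ne_zero _ h3))
    (pow_ne_zero _ h4)) (h.ne_zero s hs)

theorem diffAt (h : ZetaData F a b D) {s : ℂ} (hs : 0 < s.re) : DifferentiableAt ℂ F s :=
  h.diff.differentiableAt ((isOpen_lt continuous_const continuous_re).mem_nhds hs)

theorem differentiableAt_GammaR_add_one {s : ℂ} (hs : 0 < s.re) :
    DifferentiableAt ℂ (fun s => Gammaℝ (s + 1)) s :=
  DifferentiableAt.comp (f := fun s : ℂ => s + 1) s
    (differentiableAt_GammaR (s := s + 1) (by simp; linarith)) (by fun_prop)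

theorem differentiableAt_xiFun (h : ZetaData F a b D) {s : ℂ} (hs : 0 < s.re) :
    DifferentiableAt ℂ (xiFun F a b D) s := by
  have h1 : DifferentiableAt ℂ (fun s : ℂ => (D : ℂ) ^ (s / 2)) s :=
    DifferentiableAt.const_cpow (by fun_prop) (Or.inl (by exact_mod_cast h.D_pos.ne'))
  exact (((differentiableAt_id.mul h1).mul ((differentiableAt_GammaR hs).pow a)).mul
    ((differentiableAt_GammaR_add_one hs).pow b)).mul (h.diffAt hs)

theorem xiFun_conj (h : ZetaData F a b D) {s : ℂ} (hs : 0 < s.re) :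
    xiFun F a b D (starRingEnd ℂ s) = starRingEnd ℂ (xiFun F a b D s) := by
  have h2 : starRingEnd ℂ 2 = 2 := by exact_mod_cast conj_ofReal 2
  have hc := cpow_conj (D : ℂ) (s / 2)
    (by rw [arg_ofReal_of_nonneg h.D_pos.le]; exact Real.pi_pos.ne)
  rw [conj_ofReal, map_div₀, h2] at hc
  have h1 : Gammaℝ (starRingEnd ℂ s + 1) = starRingEnd ℂ (Gammaℝ (s + 1)) := by
    rw [← GammaR_conj]; simp
  simp only [xiFun, map_mul, map_pow, h.conj s hs, GammaR_conj, h1, hc]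

set_option maxHeartbeats 1000000 in
/-- The completed function grows away from the critical line. -/
theorem norm_xiFun_sub_le (h : ZetaData F a b D) {δ : ℝ} (hδ : 0 < δ) (hδ4 : δ ≤ 1 / 8) {s : ℂ}
    (hs : 1 / 2 + δ ≤ s.re) :
    ‖xiFun F a b D (s - 2 * δ)‖ ≤ ‖xiFun F a b D s‖ := by
  obtain ⟨A, hA, hlow⟩ := h.exists_logDeriv_bound hδ
  obtain ⟨C0, hC0⟩ := h.growth
  obtain ⟨σ, c, C1, hc, hσ, hright⟩ := h.right
  obtain ⟨B, hB, hBG⟩ := exists_norm_GammaR_le_mul (c := 1 / 4) (η := 2 * δ) (by norm_num)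
    (by positivity)
  obtain ⟨f, hf⟩ : ∃ f : ℂ → ℂ, f = fun z =>
    xiFun F a b D (z + (1 / 2 - δ : ℝ)) / xiFun F a b D (z + (1 / 2 + δ : ℝ)) := ⟨_, rfl⟩
  have hdiffAt : ∀ z : ℂ, 0 ≤ z.re → DifferentiableAt ℂ f z := by
    intro z hz
    have e1 : 0 < (z + (1 / 2 - δ : ℝ)).re := by rw [add_re, ofReal_re]; linarith
    have e2 : 1 / 2 < (z + (1 / 2 + δ : ℝ)).re := by rw [add_re, ofReal_re]; linarith
    have d1 := DifferentiableAt.comp (f := fun z : ℂ => z + (1 / 2 - δ : ℝ)) z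
      (h.differentiableAt_xiFun e1) (by fun_prop)
    have d2 := DifferentiableAt.comp (f := fun z : ℂ => z + (1 / 2 + δ : ℝ)) z
      (h.differentiableAt_xiFun (by linarith)) (by fun_prop)
    rw [hf]
    exact d1.div d2 (h.xiFun_ne_zero e2)
  obtain ⟨K, hK⟩ : ∃ K : ℝ, K = D ^ (-δ) * B ^ a * B ^ b := ⟨_, rfl⟩
  have hK0 : 0 ≤ K := by
    have := h.D_pos
    rw [hK]
    positivity
  have hnorms : ∀ z : ℂ, 0 ≤ z.re →
      ‖z + (1 / 2 - δ : ℝ)‖ ≤ ‖z + (1 / 2 + δ : ℝ)‖ ∧ ‖z + (1 / 2 + δ : ℝ)‖ ≤ ‖z‖ + 1 := by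
    intro z hz
    constructor
    · rw [norm_def, norm_def, normSq_apply, normSq_apply]
      apply Real.sqrt_le_sqrt
      simp only [add_re, add_im, ofReal_re, ofReal_im, add_zero]
      nlinarith
    · refine (norm_add_le _ _).trans ?_
      rw [norm_real, Real.norm_eq_abs, abs_of_pos (by linarith)]
      linarith
  have hratio : ∀ z : ℂ, 0 ≤ z.re → ‖f z‖ ≤ K *
      (‖F (z + (1 / 2 - δ : ℝ))‖ / ‖F (z + (1 / 2 + δ : ℝ))‖) := by
    intro z hz
    obtain ⟨hn1, -⟩ := hnorms z hz
    set u : ℂ := z + (1 / 2 - δ : ℝ) with hu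
    set v : ℂ := z + (1 / 2 + δ : ℝ) with hv0
    have hv : v = u + (2 * δ : ℝ) := by simp only [u, v]; push_cast; ring
    have hure : u.re = z.re + (1 / 2 - δ) := by simp only [u]; rw [add_re, ofReal_re]
    have hvre : v.re = z.re + (1 / 2 + δ) := by simp only [v]; rw [add_re, ofReal_re]
    have g1 := hBG u (by rw [hure]; linarith)
    have g2 := hBG (u + 1) (by rw [add_re, hure, one_re]; linarith)
    rw [← hv] at g1
    rw [show u + 1 + ((2 * δ : ℝ) : ℂ) = v + 1 by rw [hv]; ring] at g2
    have hx : xiFun F a b D v ≠ 0 := h.xiFun_ne_zero (by rw [hvre]; linarith)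
    have hFv := norm_pos_iff.mpr (h.ne_zero v (by rw [hvre]; linarith))
    have hD : ‖(D : ℂ) ^ (u / 2)‖ = D ^ (-δ) * ‖(D : ℂ) ^ (v / 2)‖ := by
      rw [norm_cpow_eq_rpow_re_of_pos h.D_pos, norm_cpow_eq_rpow_re_of_pos h.D_pos,
        ← Real.rpow_add h.D_pos]
      congr 1
      rw [div_ofNat_re, div_ofNat_re, hure, hvre]
      ring
    simp only [hf, ← hu, ← hv0]
    rw [norm_div, div_le_iff₀ (norm_pos_iff.mpr hx)]
    have hDδ : 0 ≤ D ^ (-δ) := Real.rpow_nonneg h.D_pos.le _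
    simp only [xiFun, norm_mul, norm_pow]
    rw [hD]
    calc ‖u‖ * (D ^ (-δ) * ‖(D : ℂ) ^ (v / 2)‖) * ‖Gammaℝ u‖ ^ a * ‖Gammaℝ (u + 1)‖ ^ b * ‖F u‖
        ≤ ‖v‖ * (D ^ (-δ) * ‖(D : ℂ) ^ (v / 2)‖) * (B * ‖Gammaℝ v‖) ^ a *
          (B * ‖Gammaℝ (v + 1)‖) ^ b * ‖F u‖ := by gcongr
      _ = _ := by
          rw [hK, mul_pow, mul_pow]
          field_simp
  set C := max C0 0
  have hC : 0 ≤ C := le_max_right _ _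
  have hexp : ∀ z : ℂ, 0 ≤ z.re → ‖f z‖ ≤ K * Real.exp ((2 * C + 2 * A) * (1 + ‖z‖)) := by
    intro z hz
    refine (hratio z hz).trans ?_
    obtain ⟨hn1, hn2⟩ := hnorms z hz
    have b1 := hC0 (z + (1 / 2 - δ : ℝ)) (by rw [add_re, ofReal_re]; linarith)
    have b2 := (hlow (z + (1 / 2 + δ : ℝ)) (by rw [add_re, ofReal_re]; linarith)).2
    gcongr
    rw [div_le_iff₀ (lt_of_lt_of_le (Real.exp_pos _) b2)]
    refine b1.trans (le_trans ?_ (mul_le_mul_of_nonneg_left b2 (Real.exp_pos _).le))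
    rw [← Real.exp_add]
    apply Real.exp_le_exp.mpr
    have hz0 := norm_nonneg z
    have h1 : C0 * (1 + ‖z + (1 / 2 - δ : ℝ)‖) ≤ C * (1 + ‖z + (1 / 2 - δ : ℝ)‖) := by
      gcongr
      exact le_max_left _ _
    have h2 : C * (1 + ‖z + (1 / 2 - δ : ℝ)‖) ≤ C * (2 + ‖z‖) := by
      exact mul_le_mul_of_nonneg_left (by linarith) hC
    have h3 : A * (1 + ‖z + (1 / 2 + δ : ℝ)‖) ≤ A * (2 + ‖z‖) := by
      exact mul_le_mul_of_nonneg_left (by linarith) hA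
    have h4 : 0 ≤ C * ‖z‖ := by positivity
    have h5 : 0 ≤ A * ‖z‖ := by positivity
    nlinarith
  have hpl := PhragmenLindelof.right_half_plane_of_bounded_on_real (f := f) (C := 1)
    (z := s - (1 / 2 + δ : ℝ)) ?_ ?_ ?_ ?_ ?_
  · simp only [hf] at hpl
    rw [show s - ((1 / 2 + δ : ℝ) : ℂ) + ((1 / 2 - δ : ℝ) : ℂ) = s - 2 * δ by push_cast; ring,
      sub_add_cancel, norm_div, div_le_one] at hpl
    · exact hpl
    · exact norm_pos_iff.mpr (h.xiFun_ne_zero (by linarith))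
  · refine DifferentiableOn.diffContOnCl fun z hz => (hdiffAt z ?_).differentiableWithinAt
    rwa [Complex.closure_setOfPred_lt_re] at hz
  · refine ⟨1, by norm_num, 2 * C + 2 * A, ?_⟩
    refine Asymptotics.IsBigO.of_bound (K * Real.exp (2 * C + 2 * A)) ?_
    refine eventually_inf_principal.mpr (Eventually.of_forall fun z hz => ?_)
    refine (hexp z (le_of_lt hz)).trans (le_of_eq ?_)
    rw [Real.norm_eq_abs, Real.abs_exp, Real.rpow_one, mul_assoc K, ← Real.exp_add, mul_add,
      mul_one]
  · refine isBoundedUnder_of_eventually_le (a := K * (C1 / c)) ?_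
    filter_upwards [eventually_ge_atTop σ] with x hx
    have hx0 : 0 ≤ (x : ℂ).re := by rw [ofReal_re]; linarith
    refine (hratio x hx0).trans ?_
    obtain ⟨hn1, -⟩ := hnorms x hx0
    have e1 : σ ≤ ((x : ℂ) + (1 / 2 - δ : ℝ)).re := by rw [add_re, ofReal_re, ofReal_re]; linarith
    have e2 : σ ≤ ((x : ℂ) + (1 / 2 + δ : ℝ)).re := by rw [add_re, ofReal_re, ofReal_re]; linarith
    have b1 := hright _ e1
    have b2 := (hright _ e2).1
    have hC1 : 0 ≤ C1 := by
      have := b1.1.trans b1.2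
      have h1 := le_of_mul_le_mul_right this (by positivity)
      linarith
    refine mul_le_mul_of_nonneg_left ?_ hK0
    rw [div_le_div_iff₀ (lt_of_lt_of_le (by positivity) b2) hc]
    calc _ ≤ C1 * (1 + ‖(x : ℂ) + (1 / 2 - δ : ℝ)‖) * c := by gcongr; exact b1.2
      _ ≤ C1 * (1 + ‖(x : ℂ) + (1 / 2 + δ : ℝ)‖) * c := by gcongr
      _ = C1 * (c * (1 + ‖(x : ℂ) + (1 / 2 + δ : ℝ)‖)) := by ring
      _ ≤ _ := by gcongr
  · intro y
    simp only [hf]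
    set v : ℂ := (y : ℂ) * I + (1 / 2 + δ : ℝ) with hv
    have hvre : v.re = 1 / 2 + δ := by rw [hv]; simp
    have e : (y : ℂ) * I + (1 / 2 - δ : ℝ) = 1 - starRingEnd ℂ v := by
      apply Complex.ext
      · simp [hv]; ring
      · simp [hv]
    rw [e, h.fe _ (by rw [conj_re, hvre]; linarith) (by rw [conj_re, hvre]; linarith),
      h.xiFun_conj (by rw [hvre]; linarith), norm_div, norm_conj]
    exact div_self_le_one _
  · rw [sub_re, ofReal_re]; linarith

theorem re_logDeriv_xiFun_nonneg (h : ZetaData F a b D) {s : ℂ} (hs : 1 / 2 < s.re) :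
    0 ≤ (logDeriv (xiFun F a b D) s).re := by
  set X := xiFun F a b D
  have hX : X s ≠ 0 := h.xiFun_ne_zero hs
  have hd : HasDerivAt X (deriv X s) s := (h.differentiableAt_xiFun (by linarith)).hasDerivAt
  have hl : HasDerivAt (fun t : ℝ => X (s - t) / X s) (-logDeriv X s) 0 := by
    have h1 : HasDerivAt (fun t : ℂ => s - t) (-1) ((0 : ℝ) : ℂ) := by
      simpa using (hasDerivAt_id (((0 : ℝ) : ℂ))).const_sub s
    have h2 : HasDerivAt (fun t : ℂ => X (s - t)) (deriv X s * -1) ((0 : ℝ) : ℂ) :=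
      HasDerivAt.comp (h₂ := X) (h := fun t : ℂ => s - t) _ (by simpa using hd) h1
    have h3 := (h2.comp_ofReal).div_const (X s)
    convert! h3 using 1
    rw [logDeriv_apply]
    ring
  have hre : HasDerivAt (fun t : ℝ => (X (s - t) / X s).re) (-(logDeriv X s).re) 0 := by
    have := reCLM.hasFDerivAt.comp_hasDerivAt (0 : ℝ) hl
    simpa [Function.comp_def] using this
  by_contra hneg
  push Not at hneg
  have hpos : 0 < -(logDeriv X s).re := by linarith
  have hev := (hasDerivAt_iff_tendsto_slope.mp hre).eventually (eventually_gt_nhds hpos)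
  have hev2 : ∀ᶠ t : ℝ in 𝓝[>] 0, 0 < slope (fun t : ℝ => (X (s - t) / X s).re) 0 t :=
    hev.filter_mono (nhdsWithin_mono _ fun x hx => ne_of_gt hx)
  have hev3 : ∀ᶠ t : ℝ in 𝓝[>] 0, t < min (1 / 4) (s.re - 1 / 2) :=
    (eventually_lt_nhds (lt_min (by norm_num) (by linarith))).filter_mono nhdsWithin_le_nhds
  obtain ⟨t, ⟨ht1, ht2⟩, ht0⟩ := ((hev2.and hev3).and self_mem_nhdsWithin).exists
  have ht0' : 0 < t := ht0
  have hq : (X (s - t) / X s).re ≤ 1 := by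
    refine (re_le_norm _).trans ?_
    rw [norm_div, div_le_one (norm_pos_iff.mpr hX)]
    have := h.norm_xiFun_sub_le (δ := t / 2) (s := s) (by positivity)
      (by linarith [min_le_left (1 / 4) (s.re - 1 / 2)])
      (by linarith [min_le_right (1 / 4) (s.re - 1 / 2)])
    rwa [show s - 2 * ((t / 2 : ℝ) : ℂ) = s - t by push_cast; ring] at this
  rw [slope_def_field] at ht1
  simp only [ofReal_zero, sub_zero, div_self hX, one_re] at ht1
  have := div_nonpos_of_nonpos_of_nonneg (sub_nonpos.mpr hq) ht0'.le
  linarith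

theorem logDeriv_xiFun (h : ZetaData F a b D) {s : ℂ} (hs : 1 / 2 < s.re) :
    logDeriv (xiFun F a b D) s = 1 / s + Real.log D / 2 + a * logDeriv Gammaℝ s +
      b * logDeriv Gammaℝ (s + 1) + logDeriv F s := by
  have hs0 : 0 < s.re := by linarith
  have h1 : s ≠ 0 := fun e => by simp [e] at hs0
  have hD : (D : ℂ) ≠ 0 := by exact_mod_cast h.D_pos.ne'
  have h2 : (D : ℂ) ^ (s / 2) ≠ 0 := by
    rw [Ne, cpow_eq_zero_iff]
    tauto
  have h3 := Gammaℝ_ne_zero_of_re_pos hs0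
  have h4 := Gammaℝ_ne_zero_of_re_pos (s := s + 1) (by simp; linarith)
  have dD : HasDerivAt (fun s : ℂ => (D : ℂ) ^ (s / 2))
      ((D : ℂ) ^ (s / 2) * Complex.log D * (1 / 2)) s :=
    HasDerivAt.const_cpow ((hasDerivAt_id s).div_const 2) (Or.inl hD)
  have dG := differentiableAt_GammaR hs0
  have dG1 := differentiableAt_GammaR_add_one hs0
  have dF := h.diffAt hs0
  have hp1 : DifferentiableAt ℂ (fun s : ℂ => s * (D : ℂ) ^ (s / 2)) s :=
    differentiableAt_id.mul dD.differentiableAt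
  have hp2 : DifferentiableAt ℂ (fun s : ℂ => s * (D : ℂ) ^ (s / 2) * Gammaℝ s ^ a) s :=
    hp1.mul (dG.pow a)
  have hp3 : DifferentiableAt ℂ
      (fun s : ℂ => s * (D : ℂ) ^ (s / 2) * Gammaℝ s ^ a * Gammaℝ (s + 1) ^ b) s :=
    hp2.mul (dG1.pow b)
  have e : xiFun F a b D =
      fun s => s * (D : ℂ) ^ (s / 2) * Gammaℝ s ^ a * Gammaℝ (s + 1) ^ b * F s := rfl
  rw [e, logDeriv_mul (f := fun s : ℂ => s * (D : ℂ) ^ (s / 2) * Gammaℝ s ^ a * Gammaℝ (s + 1) ^ b) (g := F)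
    s (mul_ne_zero (mul_ne_zero (mul_ne_zero h1 h2) (pow_ne_zero _ h3))
    (pow_ne_zero _ h4)) (h.ne_zero s hs) hp3 dF,
    logDeriv_mul (f := fun s : ℂ => s * (D : ℂ) ^ (s / 2) * Gammaℝ s ^ a)
      (g := fun s : ℂ => Gammaℝ (s + 1) ^ b) s
      (mul_ne_zero (mul_ne_zero h1 h2) (pow_ne_zero _ h3)) (pow_ne_zero _ h4) hp2
      (dG1.pow b),
    logDeriv_mul (f := fun s : ℂ => s * (D : ℂ) ^ (s / 2))
      (g := fun s : ℂ => Gammaℝ s ^ a) s (mul_ne_zero h1 h2) (pow_ne_zero _ h3) hp1 (dG.pow a),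
    logDeriv_mul (f := fun s : ℂ => s)
      (g := fun s : ℂ => (D : ℂ) ^ (s / 2)) s h1 h2 differentiableAt_id dD.differentiableAt,
    logDeriv_fun_pow dG, logDeriv_fun_pow dG1]
  have c1 : logDeriv (fun s : ℂ => (D : ℂ) ^ (s / 2)) s = Real.log D / 2 := by
    rw [logDeriv_apply, dD.deriv, ofReal_log h.D_pos.le]
    field_simp
  have c2 : logDeriv (fun s : ℂ => Gammaℝ (s + 1)) s = logDeriv Gammaℝ (s + 1) := by
    rw [logDeriv_apply, logDeriv_apply, deriv_comp_add_const]
  rw [c1, c2]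
  simp [logDeriv_apply]

/-- Linear growth of the logarithmic derivative of the completed function. -/
theorem exists_logDeriv_xiFun_bound (h : ZetaData F a b D) {δ : ℝ} (hδ : 0 < δ) :
    ∃ A : ℝ, 0 ≤ A ∧ ∀ s : ℂ, 1 / 2 + δ ≤ s.re →
      ‖logDeriv (xiFun F a b D) s‖ ≤ A * (1 + ‖s‖) := by
  obtain ⟨A, hA, hlow⟩ := h.exists_logDeriv_bound hδ
  obtain ⟨G, hG, hdig⟩ := exists_norm_digamma_le (c := 1 / 4) (by norm_num)
  have hR : ∀ s : ℂ, 1 / 2 ≤ s.re →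
      ‖logDeriv Gammaℝ s‖ ≤ (|Real.log Real.pi| / 2 + G / 2) * (1 + ‖s‖) := by
    intro s hs
    rw [logDeriv_GammaR (by linarith)]
    have h1 := hdig (s / 2) (by rw [div_ofNat_re]; linarith)
    have h2 : ‖s / 2‖ ≤ ‖s‖ := by
      rw [norm_div, RCLike.norm_ofNat]
      linarith [norm_nonneg s]
    refine (norm_add_le _ _).trans ?_
    rw [norm_div, norm_neg, norm_real, Real.norm_eq_abs, norm_div, RCLike.norm_ofNat]
    have h3 : G * (1 + ‖s / 2‖) ≤ G * (1 + ‖s‖) := by gcongr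
    have h4 : 0 ≤ |Real.log Real.pi| * ‖s‖ := by positivity
    linarith
  set Γ0 := |Real.log Real.pi| / 2 + G / 2
  have hΓ : 0 ≤ Γ0 := by positivity
  refine ⟨2 + |Real.log D| / 2 + a * Γ0 + b * (2 * Γ0) + A, by positivity, fun s hs => ?_⟩
  have hs2 : 1 / 2 < s.re := by linarith
  have hn := norm_nonneg s
  rw [h.logDeriv_xiFun hs2]
  have b1 : ‖1 / s‖ ≤ 2 * (1 + ‖s‖) := by
    have : 1 / 2 ≤ ‖s‖ := hs2.le.trans (re_le_norm s)
    rw [norm_div, norm_one, div_le_iff₀ (by linarith)]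
    nlinarith
  have b2 : ‖(Real.log D : ℂ) / 2‖ ≤ |Real.log D| / 2 * (1 + ‖s‖) := by
    rw [norm_div, norm_real, Real.norm_eq_abs, RCLike.norm_ofNat]
    have : 0 ≤ |Real.log D| / 2 * ‖s‖ := by positivity
    linarith
  have b3 : ‖(a : ℂ) * logDeriv Gammaℝ s‖ ≤ a * Γ0 * (1 + ‖s‖) := by
    rw [norm_mul, norm_natCast, mul_assoc]
    exact mul_le_mul_of_nonneg_left (hR s hs2.le) (Nat.cast_nonneg a)
  have b4 : ‖(b : ℂ) * logDeriv Gammaℝ (s + 1)‖ ≤ b * (2 * Γ0) * (1 + ‖s‖) := by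
    rw [norm_mul, norm_natCast, mul_assoc]
    refine mul_le_mul_of_nonneg_left ((hR (s + 1) (by simp; linarith)).trans ?_) (Nat.cast_nonneg b)
    have : ‖s + 1‖ ≤ ‖s‖ + 1 := by simpa using norm_add_le s 1
    have h5 : Γ0 * (1 + ‖s + 1‖) ≤ Γ0 * (2 + ‖s‖) :=
      mul_le_mul_of_nonneg_left (by linarith) hΓ
    have h6 : 0 ≤ Γ0 * ‖s‖ := by positivity
    linarith
  have b5 := (hlow s hs).1
  refine (norm_add_le _ _).trans ((add_le_add ((norm_add_le _ _).trans (add_le_add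
    ((norm_add_le _ _).trans (add_le_add ((norm_add_le _ _).trans (add_le_add b1 b2)) b3)) b4))
    b5).trans (le_of_eq ?_))
  ring

end ZetaData

end

section ExpSlope
open Complex Filter Topology Set
open scoped ComplexConjugate

noncomputable def expSlope (Y c : ℝ) (w : ℂ) : ℂ := dslope (fun w : ℂ => exp (Y * w)) c w

theorem expSlope_of_ne {Y c : ℝ} {w : ℂ} (h : w ≠ c) :
    expSlope Y c w = (exp (Y * w) - exp (Y * c)) / (w - c) := by
  rw [expSlope, dslope_of_ne _ h, slope_def_field]

theorem hasDerivAt_exp_ofReal_mul (Y : ℝ) (w : ℂ) :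
    HasDerivAt (fun w : ℂ => exp (Y * w)) (exp (Y * w) * Y) w := by
  simpa using ((hasDerivAt_id w).const_mul (Y : ℂ)).cexp

theorem differentiable_expSlope (Y c : ℝ) : Differentiable ℂ (expSlope Y c) := by
  have h : DifferentiableOn ℂ (dslope (fun w : ℂ => exp (Y * w)) c) univ :=
    (differentiableOn_dslope univ_mem).mpr
      (fun w _ => (hasDerivAt_exp_ofReal_mul Y w).differentiableAt.differentiableWithinAt)
  exact differentiableOn_univ.mp h

theorem norm_exp_ofReal_mul (Y : ℝ) (w : ℂ) : ‖exp (Y * w)‖ = Real.exp (Y * w.re) := by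
  rw [norm_exp, re_ofReal_mul]

theorem norm_expSlope_le {Y c : ℝ} {w : ℂ} (hc : |c| ≤ 2) (hw : |w.re| ≤ 2) :
    ‖expSlope Y c w‖ ≤ |Y| * Real.exp (2 * |Y|) := by
  have hb : ∀ v : ℂ, |v.re| ≤ 2 → ‖exp (Y * v) * Y‖ ≤ |Y| * Real.exp (2 * |Y|) := fun v hv => by
    rw [norm_mul, norm_exp_ofReal_mul, norm_real, Real.norm_eq_abs, mul_comm]
    refine mul_le_mul_of_nonneg_left (Real.exp_le_exp.mpr ?_) (abs_nonneg _)
    calc Y * v.re ≤ |Y * v.re| := le_abs_self _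
      _ = |v.re| * |Y| := by rw [abs_mul, mul_comm]
      _ ≤ 2 * |Y| := mul_le_mul_of_nonneg_right hv (abs_nonneg _)
  by_cases h : w = c
  · rw [h, expSlope, dslope_same, (hasDerivAt_exp_ofReal_mul Y c).deriv]
    exact hb c (by simpa using hc)
  · have hconv : Convex ℝ {v : ℂ | |v.re| ≤ 2} := by
      have : {v : ℂ | |v.re| ≤ 2} = reLm ⁻¹' (Icc (-2) 2) := by
        ext v; simp [abs_le]
      rw [this]
      exact (convex_Icc _ _).linear_preimage _
    have h1 := hconv.norm_image_sub_le_of_norm_hasDerivWithin_le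
      (f := fun w : ℂ => exp (Y * w)) (f' := fun w : ℂ => exp (Y * w) * Y)
      (fun v _ => (hasDerivAt_exp_ofReal_mul Y v).hasDerivWithinAt) (fun v hv => hb v hv)
      (x := (c : ℂ)) (y := w) (show |(c : ℂ).re| ≤ 2 by simpa using hc) hw
    rw [expSlope_of_ne h, norm_div]
    exact div_le_of_le_mul₀ (norm_nonneg _) (by positivity) h1

theorem re_expSlope_add_eq_zero {Y c : ℝ} {w : ℂ} (hc : c ≠ 0) (hw : w.re = 0) :
    (expSlope Y c w + expSlope (-Y) (-c) w).re = 0 := by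
  have h1 : w ≠ c := fun h => hc (by rw [h] at hw; simpa using hw)
  have h2 : w ≠ ((-c : ℝ) : ℂ) := fun h => hc (by rw [h] at hw; simpa using hw)
  have hcw : conj w = -w := by
    apply Complex.ext <;> simp [hw]
  have h3 : conj (expSlope Y c w) = -expSlope (-Y) (-c) w := by
    rw [expSlope_of_ne h1, expSlope_of_ne h2, map_div₀, map_sub, map_sub, ← exp_conj, ← exp_conj,
      map_mul, map_mul, conj_ofReal, conj_ofReal, hcw, ← div_neg]
    congr 1
    · push_cast; congr 2 <;> ring
    · push_cast; ring
  have h4 := congrArg re h3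
  rw [conj_re, neg_re] at h4
  rw [add_re, h4, neg_add_cancel]

theorem expSlope_ofReal {Y c w : ℝ} (h : w ≠ c) :
    expSlope Y c w = (((Real.exp (Y * w) - Real.exp (Y * c)) / (w - c) : ℝ) : ℂ) := by
  rw [expSlope_of_ne (by exact_mod_cast h)]
  push_cast
  rfl

end ExpSlope

section RightHalfPlane
open Complex Filter Topology Set Asymptotics Bornology
open scoped ComplexConjugate

theorem re_nonneg_of_re_nonneg_on_imaginary_axis {V : ℂ → ℂ} (hd : DiffContOnCl ℂ V {z | 0 < z.re})
    (him : ∀ t : ℝ, 0 ≤ (V (t * I)).re) {A r B : ℝ} (hA : 0 ≤ A)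
    (hstrip : ∀ w : ℂ, 0 ≤ w.re → w.re ≤ r → -(A * (1 + ‖w‖)) ≤ (V w).re)
    (hbig : ∀ w : ℂ, r ≤ w.re → -B ≤ (V w).re) {w : ℂ} (hw : 0 ≤ w.re) : 0 ≤ (V w).re := by
  have hn : ∀ z, ‖exp (-V z)‖ = Real.exp (-(V z).re) := fun z => by rw [norm_exp, neg_re]
  have h := PhragmenLindelof.right_half_plane_of_bounded_on_real (f := fun z => exp (-V z))
    (C := 1) (z := w) ?_ ⟨1, by norm_num, A, ?_⟩ ⟨Real.exp B, ?_⟩ (fun t => ?_) hw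
  · rw [hn, Real.exp_le_one_iff] at h
    linarith
  · exact differentiable_exp.comp_diffContOnCl hd.neg
  · refine IsBigO.of_bound (Real.exp (A + |B|)) ?_
    filter_upwards [inter_mem_inf univ_mem (mem_principal_self _)] with z hz
    have hz' : 0 < z.re := hz.2
    rw [hn, Real.norm_eq_abs, Real.abs_exp, ← Real.exp_add, Real.exp_le_exp, Real.rpow_one]
    have h0 := abs_nonneg B
    have h1 := le_abs_self B
    have h2 : 0 ≤ A * ‖z‖ := by positivity
    rcases le_total z.re r with h3 | h3
    · have := hstrip z hz'.le h3
      linarith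
    · have := hbig z h3
      linarith
  · rw [eventually_map]
    filter_upwards [eventually_ge_atTop r] with t ht
    rw [hn, Real.exp_le_exp]
    have := hbig t (by simpa using ht)
    linarith
  · rw [hn, Real.exp_le_one_iff]
    linarith [him t]

/-- The data of a comparison between two functions with non-negative real part on the half plane
`1 / 2 < re s`, whose difference is given by a Dirichlet series for `1 < re s`. -/
structure ComparisonData (H₁ H₂ g : ℂ → ℂ) (d : ℕ → ℝ) (N C cg : ℝ) : Prop where
  diff₁ : DifferentiableOn ℂ H₁ {s | 1 / 2 < s.re}
  diff₂ : DifferentiableOn ℂ H₂ {s | 1 / 2 < s.re}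
  diffg : DifferentiableOn ℂ g {s | 1 / 2 < s.re}
  re₁ : ∀ s : ℂ, 1 / 2 < s.re → 0 ≤ (H₁ s).re
  re₂ : ∀ s : ℂ, 1 / 2 < s.re → 0 ≤ (H₂ s).re
  growth : ∀ δ : ℝ, 0 < δ → ∃ A : ℝ, 0 ≤ A ∧ ∀ s : ℂ, 1 / 2 + δ ≤ s.re →
    ‖H₁ s‖ ≤ A * (1 + ‖s‖) ∧ ‖H₂ s‖ ≤ A * (1 + ‖s‖)
  norm_g : ∀ s : ℂ, 1 / 2 < s.re → ‖g s‖ ≤ cg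
  N_nonneg : 0 ≤ N
  d_nonneg : ∀ m, 0 ≤ d m
  summable : ∀ σ : ℝ, 1 < σ → Summable fun m : ℕ => d m * (m : ℝ) ^ (-σ)
  hasSum : ∀ s : ℂ, 1 < s.re → HasSum (fun m : ℕ => (d m : ℂ) * (m : ℂ) ^ (-s))
    (N * (1 / s + 1 / (s - 1)) - C + g s - (H₁ s - H₂ s))

noncomputable def comparisonFun (H₁ H₂ g : ℂ → ℂ) (d : ℕ → ℝ) (N C cg Y : ℝ) (S : Finset ℕ)
    (α : ℝ) (w : ℂ) : ℂ :=
  exp (Y * w) * (-C + g (α + w) - (H₁ (α + w) - H₂ (α + w)) -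
      ∑ m ∈ S, (d m : ℂ) * (m : ℂ) ^ (-(α + w))) +
    2 * (H₁ (α + w) + H₂ (α + w)) +
    exp ((-Y : ℝ) * w) * (C - (H₁ (α + w) - H₂ (α + w)) +
      ∑ m ∈ S, (d m : ℂ) * (m : ℂ) ^ (w - α)) + cg +
    N * (expSlope Y (1 - α) w + expSlope (-Y) α w + expSlope Y (-α) w +
      expSlope (-Y) (-(1 - α)) w)

namespace ComparisonData
variable {H₁ H₂ g : ℂ → ℂ} {d : ℕ → ℝ} {N C cg Y α : ℝ} {S : Finset ℕ}

theorem diffContOnCl (h : ComparisonData H₁ H₂ g d N C cg) (hα : 1 / 2 < α)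
    (hS : ∀ m ∈ S, 1 ≤ m) :
    DiffContOnCl ℂ (comparisonFun H₁ H₂ g d N C cg Y S α) {z | 0 < z.re} := by
  refine DifferentiableOn.diffContOnCl ?_
  rw [Complex.closure_setOfPred_lt_re]
  intro w hw
  have hw : 0 ≤ w.re := hw
  have hmem : {s : ℂ | 1 / 2 < s.re} ∈ 𝓝 ((α : ℂ) + w) :=
    (isOpen_lt continuous_const continuous_re).mem_nhds (by
      change 1 / 2 < ((α : ℂ) + w).re
      simp only [add_re, ofReal_re]; linarith)
  have hshift : DifferentiableAt ℂ (fun w : ℂ => (α : ℂ) + w) w := by fun_prop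
  have h1 : DifferentiableAt ℂ (fun w : ℂ => H₁ (α + w)) w :=
    (h.diff₁.differentiableAt hmem).comp w hshift
  have h2 : DifferentiableAt ℂ (fun w : ℂ => H₂ (α + w)) w :=
    (h.diff₂.differentiableAt hmem).comp w hshift
  have h3 : DifferentiableAt ℂ (fun w : ℂ => g (α + w)) w :=
    (h.diffg.differentiableAt hmem).comp w hshift
  have h4 : DifferentiableAt ℂ
      (fun w : ℂ => ∑ m ∈ S, (d m : ℂ) * (m : ℂ) ^ (-((α : ℂ) + w))) w :=
    DifferentiableAt.fun_sum fun m hm => by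
      have hm0 : (m : ℂ) ≠ 0 := by exact_mod_cast (Nat.pos_of_ne_zero (Nat.one_le_iff_ne_zero.mp (hS m hm))).ne'
      exact ((hshift.neg).const_cpow (Or.inl hm0)).const_mul _
  have h5 : DifferentiableAt ℂ
      (fun w : ℂ => ∑ m ∈ S, (d m : ℂ) * (m : ℂ) ^ (w - (α : ℂ))) w :=
    DifferentiableAt.fun_sum fun m hm => by
      have hm0 : (m : ℂ) ≠ 0 := by exact_mod_cast (Nat.pos_of_ne_zero (Nat.one_le_iff_ne_zero.mp (hS m hm))).ne'
      exact ((differentiableAt_id.sub_const _).const_cpow (Or.inl hm0)).const_mul _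
  have h6 := fun Y c => (differentiable_expSlope Y c) w
  have h7 := fun Y : ℝ => (hasDerivAt_exp_ofReal_mul Y w).differentiableAt
  refine DifferentiableAt.differentiableWithinAt ?_
  unfold comparisonFun
  exact (((((h7 Y).mul (((h3.const_add _).sub (h1.sub h2)).sub h4)).add
    ((h1.add h2).const_mul _)).add ((h7 (-Y)).mul (((h1.sub h2).const_sub _).add h5))).add_const
    _).add (((((h6 Y (1 - α)).add (h6 (-Y) α)).add (h6 Y (-α))).add
      (h6 (-Y) (-(1 - α)))).const_mul _)

theorem re_comparisonFun_mul_I (h : ComparisonData H₁ H₂ g d N C cg) (hα : 1 / 2 < α)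
    (hα1 : α < 1) (t : ℝ) :
    0 ≤ (comparisonFun H₁ H₂ g d N C cg Y S α (t * I)).re := by
  obtain ⟨w, hw⟩ : ∃ w : ℂ, w = t * I := ⟨_, rfl⟩
  rw [← hw]
  have hw0 : w.re = 0 := by simp [hw]
  have hcw : conj w = -w := by
    apply Complex.ext <;> simp [hw]
  have hs : 1 / 2 < ((α : ℂ) + w).re := by simp only [add_re, ofReal_re, hw0]; linarith
  have hQ : (expSlope Y (1 - α) w + expSlope (-Y) α w + expSlope Y (-α) w +
      expSlope (-Y) (-(1 - α)) w).re = 0 := by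
    have e1 := re_expSlope_add_eq_zero (Y := Y) (c := 1 - α) (w := w) (by linarith) hw0
    have e2 := re_expSlope_add_eq_zero (Y := Y) (c := -α) (w := w) (by linarith) hw0
    rw [neg_neg] at e2
    simp only [add_re] at e1 e2 ⊢
    linarith
  have hsum : ∑ m ∈ S, (d m : ℂ) * (m : ℂ) ^ (w - α) =
      conj (∑ m ∈ S, (d m : ℂ) * (m : ℂ) ^ (-(α + w))) := by
    rw [map_sum]
    refine Finset.sum_congr rfl fun m _ => ?_
    have e1 : w - α = conj (-(α + w)) := by
      rw [map_neg, map_add, conj_ofReal, hcw]; ring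
    rw [map_mul, conj_ofReal, e1, cpow_conj, map_natCast]
    rw [natCast_arg]; exact Real.pi_pos.ne
  have he : exp ((-Y : ℝ) * w) = conj (exp (Y * w)) := by
    rw [← exp_conj, map_mul, conj_ofReal, hcw]; congr 1; push_cast; ring
  have hn : ‖exp (Y * w)‖ = 1 := by rw [norm_exp_ofReal_mul, hw0]; simp
  have hg1 : -cg ≤ (exp (Y * w) * g (α + w)).re := by
    have h1 := (abs_le.mp (abs_re_le_norm (exp (Y * w) * g (α + w)))).1
    rw [norm_mul, hn, one_mul] at h1
    linarith [h.norm_g _ hs]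
  have hre := (abs_le.mp ((abs_re_le_norm (exp (Y * w))).trans_eq hn))
  have hr1 := h.re₁ _ hs
  have hr2 := h.re₂ _ hs
  unfold comparisonFun
  rw [hsum, he]
  generalize expSlope Y (1 - α) w + expSlope (-Y) α w + expSlope Y (-α) w +
      expSlope (-Y) (-(1 - α)) w = q at *
  generalize ∑ m ∈ S, (d m : ℂ) * (m : ℂ) ^ (-(α + w)) = σ at *
  generalize exp (Y * w) = e at *
  generalize H₁ (α + w) = a at *
  generalize H₂ (α + w) = b at *
  generalize g (α + w) = γ at *
  have hmain : (e * (-C + γ - (a - b) - σ) + 2 * (a + b) + conj e * (C - (a - b) + conj σ) + cg +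
      N * q).re = (e * γ).re + cg + 2 * a.re * (1 - e.re) + 2 * b.re * (1 + e.re) + N * q.re := by
    simp only [add_re, mul_re, sub_re, neg_re, ofReal_re, conj_re, conj_im, sub_im, add_im, neg_im,
      ofReal_im, re_ofNat, im_ofNat]
    ring
  rw [hmain, hQ]
  have p1 : 0 ≤ a.re * (1 - e.re) := mul_nonneg hr1 (by linarith)
  have p2 : 0 ≤ b.re * (1 + e.re) := mul_nonneg hr2 (by linarith)
  linarith

end ComparisonData
end RightHalfPlane

section ComparisonGrowth
open Complex Filter Topology Set Asymptotics Bornology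

theorem norm_natCast_cpow_eq_exp {m : ℕ} (hm : 1 ≤ m) (s : ℂ) :
    ‖(m : ℂ) ^ s‖ = Real.exp (s.re * Real.log m) := by
  rw [norm_natCast_cpow_of_pos (by omega), Real.rpow_def_of_pos (by exact_mod_cast hm), mul_comm]

theorem norm_div_le_two_mul {a b : ℂ} {c : ℝ} (ha : ‖a‖ ≤ c) (hb : 1 / 2 ≤ b.re) :
    ‖a / b‖ ≤ 2 * c := by
  have h1 : 1 / 2 ≤ ‖b‖ := hb.trans (re_le_norm b)
  have h0 := norm_nonneg a
  rw [norm_div]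
  refine div_le_of_le_mul₀ (norm_nonneg _) (by linarith) ?_
  nlinarith

theorem norm_expSlope_neg_le {Y c : ℝ} {w : ℂ} (hY : 0 ≤ Y) (hc : |c| ≤ 1) (hw : 3 / 2 ≤ w.re) :
    ‖expSlope (-Y) c w‖ ≤ 2 * (1 + Real.exp Y) := by
  have hc' := abs_le.mp hc
  have hwc : 1 / 2 ≤ (w - c).re := by
    simp only [sub_re, ofReal_re]; linarith
  have hne : w ≠ c := fun h => by
    rw [h, sub_self, zero_re] at hwc; linarith
  rw [expSlope_of_ne hne]
  refine norm_div_le_two_mul ((norm_sub_le _ _).trans ?_) hwc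
  rw [norm_exp_ofReal_mul, norm_exp_ofReal_mul, ofReal_re]
  refine add_le_add (Real.exp_le_one_iff.mpr ?_) (Real.exp_le_exp.mpr ?_)
  · have : 0 ≤ Y * w.re := mul_nonneg hY (by linarith)
    linarith
  · have : 0 ≤ Y * (1 + c) := mul_nonneg hY (by linarith)
    linarith

namespace ComparisonData
variable {H₁ H₂ g : ℂ → ℂ} {d : ℕ → ℝ} {N C cg Y α : ℝ} {S : Finset ℕ}

theorem norm_sum_neg_le (h : ComparisonData H₁ H₂ g d N C cg) (hS : ∀ m ∈ S, 1 ≤ m) {s : ℂ}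
    (hs : s.re ≤ 2) :
    ‖∑ m ∈ S, (d m : ℂ) * (m : ℂ) ^ s‖ ≤ ∑ m ∈ S, d m * (m : ℝ) ^ (2 : ℕ) := by
  refine norm_sum_le_of_le _ fun m hm => ?_
  have hm1 : (1 : ℝ) ≤ m := by exact_mod_cast hS m hm
  rw [norm_mul, norm_real, Real.norm_of_nonneg (h.d_nonneg m),
    norm_natCast_cpow_of_pos (hS m hm)]
  refine mul_le_mul_of_nonneg_left ?_ (h.d_nonneg m)
  rw [← Real.rpow_natCast]
  exact Real.rpow_le_rpow_of_exponent_le hm1 (by exact_mod_cast hs)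

theorem exists_strip_bound (h : ComparisonData H₁ H₂ g d N C cg) (hα : 1 / 2 < α) (hα1 : α < 1)
    (hY : 0 ≤ Y) (hS : ∀ m ∈ S, 1 ≤ m) :
    ∃ A : ℝ, 0 ≤ A ∧ ∀ w : ℂ, 0 ≤ w.re → w.re ≤ 3 / 2 →
      -(A * (1 + ‖w‖)) ≤ (comparisonFun H₁ H₂ g d N C cg Y S α w).re := by
  obtain ⟨A, hA, hH⟩ := h.growth (α - 1 / 2) (by linarith)
  obtain ⟨D, hD⟩ : ∃ D : ℝ, D = ∑ m ∈ S, d m * (m : ℝ) ^ (2 : ℕ) := ⟨_, rfl⟩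
  have hD0 : 0 ≤ D := by
    rw [hD]; exact Finset.sum_nonneg fun m _ => mul_nonneg (h.d_nonneg m) (by positivity)
  obtain ⟨E, hE⟩ : ∃ E : ℝ, E = Real.exp (2 * |Y|) := ⟨_, rfl⟩
  have hE1 : 1 ≤ E := by rw [hE]; exact Real.one_le_exp (by positivity)
  have hcg : 0 ≤ cg := (norm_nonneg _).trans (h.norm_g 1 (by norm_num))
  have hN := h.N_nonneg
  refine ⟨E * (2 * |C| + cg + 8 * A + 2 * D) + 8 * A + cg + 4 * N * (|Y| * E), by positivity,
    fun w hw0 hw1 => ?_⟩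
  obtain ⟨t, ht⟩ : ∃ t : ℝ, t = 1 + ‖w‖ := ⟨_, rfl⟩
  have ht1 : 1 ≤ t := by rw [ht]; linarith [norm_nonneg w]
  have hs : ((α : ℂ) + w).re = α + w.re := by simp
  have hns : 1 + ‖(α : ℂ) + w‖ ≤ 2 * t := by
    have := norm_add_le (α : ℂ) w
    rw [norm_real, Real.norm_of_nonneg (by linarith)] at this
    linarith [norm_nonneg w]
  have hHs := hH (α + w) (by rw [hs]; linarith)
  have hb1 : ‖H₁ (α + w)‖ ≤ 2 * A * t := hHs.1.trans (by nlinarith)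
  have hb2 : ‖H₂ (α + w)‖ ≤ 2 * A * t := hHs.2.trans (by nlinarith)
  have hbg := h.norm_g (α + w) (by rw [hs]; linarith)
  have he1 : ‖exp (Y * w)‖ ≤ E := by
    rw [norm_exp_ofReal_mul, hE, Real.exp_le_exp, abs_of_nonneg hY]; nlinarith
  have he2 : ‖exp ((-Y : ℝ) * w)‖ ≤ E := by
    rw [norm_exp_ofReal_mul, hE, Real.exp_le_exp, abs_of_nonneg hY]; nlinarith
  have hs1 : ‖∑ m ∈ S, (d m : ℂ) * (m : ℂ) ^ (-(α + w))‖ ≤ D := by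
    rw [hD]; exact h.norm_sum_neg_le hS (by rw [neg_re, hs]; linarith)
  have hs2 : ‖∑ m ∈ S, (d m : ℂ) * (m : ℂ) ^ (w - α)‖ ≤ D := by
    rw [hD]; exact h.norm_sum_neg_le hS (by simp only [sub_re, ofReal_re]; linarith)
  have hwr : |w.re| ≤ 2 := abs_le.mpr ⟨by linarith, by linarith⟩
  have hq : ∀ c : ℝ, |c| ≤ 2 → ‖expSlope Y c w‖ ≤ |Y| * E := fun c hc => by
    rw [hE]; exact norm_expSlope_le hc hwr
  have hq' : ∀ c : ℝ, |c| ≤ 2 → ‖expSlope (-Y) c w‖ ≤ |Y| * E := fun c hc => by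
    have := norm_expSlope_le (Y := -Y) hc hwr
    rwa [abs_neg, ← hE] at this
  have q1 := hq (1 - α) (abs_le.mpr ⟨by linarith, by linarith⟩)
  have q2 := hq' α (abs_le.mpr ⟨by linarith, by linarith⟩)
  have q3 := hq (-α) (abs_le.mpr ⟨by linarith, by linarith⟩)
  have q4 := hq' (-(1 - α)) (abs_le.mpr ⟨by linarith, by linarith⟩)
  have hle : ‖comparisonFun H₁ H₂ g d N C cg Y S α w‖ ≤
      (E * (2 * |C| + cg + 8 * A + 2 * D) + 8 * A + cg + 4 * N * (|Y| * E)) * t := by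
    unfold comparisonFun
    generalize expSlope Y (1 - α) w = Q1 at *
    generalize expSlope (-Y) α w = Q2 at *
    generalize expSlope Y (-α) w = Q3 at *
    generalize expSlope (-Y) (-(1 - α)) w = Q4 at *
    generalize ∑ m ∈ S, (d m : ℂ) * (m : ℂ) ^ (-(α + w)) = s1 at *
    generalize ∑ m ∈ S, (d m : ℂ) * (m : ℂ) ^ (w - α) = s2 at *
    generalize exp (Y * w) = e1 at *
    generalize exp ((-Y : ℝ) * w) = e2 at *
    generalize H₁ (α + w) = a at *
    generalize H₂ (α + w) = b at *
    generalize g (α + w) = γ at *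
    have hC : ‖(C : ℂ)‖ = |C| := by rw [norm_real, Real.norm_eq_abs]
    have i1 : ‖-(C : ℂ) + γ - (a - b) - s1‖ ≤ |C| + cg + 4 * A * t + D := by
      have j1 := norm_sub_le (-(C : ℂ) + γ - (a - b)) s1
      have j2 := norm_sub_le (-(C : ℂ) + γ) (a - b)
      have j3 := norm_add_le (-(C : ℂ)) γ
      have j4 := norm_sub_le a b
      rw [norm_neg] at j3
      linarith
    have i2 : ‖(C : ℂ) - (a - b) + s2‖ ≤ |C| + 4 * A * t + D := by
      have j1 := norm_add_le ((C : ℂ) - (a - b)) s2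
      have j2 := norm_sub_le (C : ℂ) (a - b)
      have j4 := norm_sub_le a b
      linarith
    have i3 : ‖(2 : ℂ) * (a + b)‖ ≤ 8 * A * t := by
      have j4 := norm_add_le a b
      rw [norm_mul]
      norm_num
      linarith
    have i4 : ‖(N : ℂ) * (Q1 + Q2 + Q3 + Q4)‖ ≤ N * (4 * (|Y| * E)) := by
      rw [norm_mul, norm_real, Real.norm_of_nonneg hN]
      refine mul_le_mul_of_nonneg_left ?_ hN
      have j1 := norm_add_le (Q1 + Q2 + Q3) Q4
      have j2 := norm_add_le (Q1 + Q2) Q3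
      have j3 := norm_add_le Q1 Q2
      linarith
    have i5 : ‖e1 * (-(C : ℂ) + γ - (a - b) - s1)‖ ≤ E * (|C| + cg + 4 * A * t + D) := by
      rw [norm_mul]; exact mul_le_mul he1 i1 (norm_nonneg _) (by linarith)
    have i6 : ‖e2 * ((C : ℂ) - (a - b) + s2)‖ ≤ E * (|C| + 4 * A * t + D) := by
      rw [norm_mul]; exact mul_le_mul he2 i2 (norm_nonneg _) (by linarith)
    have hcg' : ‖(cg : ℂ)‖ = cg := by rw [norm_real, Real.norm_of_nonneg hcg]
    have k1 := norm_add_le (e1 * (-(C : ℂ) + γ - (a - b) - s1) + 2 * (a + b) +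
      e2 * ((C : ℂ) - (a - b) + s2) + cg) ((N : ℂ) * (Q1 + Q2 + Q3 + Q4))
    have k2 := norm_add_le (e1 * (-(C : ℂ) + γ - (a - b) - s1) + 2 * (a + b) +
      e2 * ((C : ℂ) - (a - b) + s2)) cg
    have k3 := norm_add_le (e1 * (-(C : ℂ) + γ - (a - b) - s1) + 2 * (a + b))
      (e2 * ((C : ℂ) - (a - b) + s2))
    have k4 := norm_add_le (e1 * (-(C : ℂ) + γ - (a - b) - s1)) (2 * (a + b))
    have k5 : 0 ≤ (E * (2 * |C| + cg + 2 * D) + cg + 4 * N * (|Y| * E)) * (t - 1) :=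
      mul_nonneg (by positivity) (by linarith)
    nlinarith
  have := (abs_le.mp (abs_re_le_norm (comparisonFun H₁ H₂ g d N C cg Y S α w))).1
  rw [← ht]
  linarith

theorem exists_right_bound (h : ComparisonData H₁ H₂ g d N C cg) (hα : 1 / 2 < α) (hα1 : α < 1)
    (hY : 0 ≤ Y) (hS : ∀ m ∈ S, 1 ≤ m ∧ Real.log m ≤ Y)
    (hS' : ∀ m : ℕ, 1 ≤ m → m ∉ S → Y ≤ Real.log m) :
    ∃ B : ℝ, ∀ w : ℂ, 3 / 2 ≤ w.re →
      -B ≤ (comparisonFun H₁ H₂ g d N C cg Y S α w).re := by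
  obtain ⟨D, hD⟩ : ∃ D : ℝ, D = ∑ m ∈ S, d m := ⟨_, rfl⟩
  have hsum2 := h.summable 2 (by norm_num)
  obtain ⟨T₂, hT₂⟩ : ∃ T₂ : ℝ, T₂ = ∑' m : ℕ, d m * (m : ℝ) ^ (-2 : ℝ) := ⟨_, rfl⟩
  have hT0 : 0 ≤ T₂ := by
    rw [hT₂]; exact tsum_nonneg fun m => mul_nonneg (h.d_nonneg m) (by positivity)
  have hcg : 0 ≤ cg := (norm_nonneg _).trans (h.norm_g 1 (by norm_num))
  have hN := h.N_nonneg
  refine ⟨Real.exp (2 * Y) * T₂ + (2 * |C| + cg + T₂ + N * 4 + D) + cg +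
    N * (2 * Real.exp Y + 2 * (1 + Real.exp Y) + 2 * Real.exp Y + 2 * (1 + Real.exp Y)),
    fun w hw => ?_⟩
  have hs : ((α : ℂ) + w).re = α + w.re := by simp
  have hs1 : 1 < ((α : ℂ) + w).re := by rw [hs]; linarith
  have hsum := h.hasSum _ hs1
  have hs0 : (α : ℂ) + w ≠ 0 := fun e => by rw [e, zero_re] at hs1; linarith
  have hre₁ := h.re₁ (α + w) (by linarith)
  have hre₂ := h.re₂ (α + w) (by linarith)
  have hbg := h.norm_g (α + w) (by linarith)
  obtain ⟨T, hT⟩ : ∃ T : ℂ, T = N * (1 / ((α : ℂ) + w) + 1 / ((α : ℂ) + w - 1)) - C +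
    g ((α : ℂ) + w) - (H₁ ((α : ℂ) + w) - H₂ ((α : ℂ) + w)) := ⟨_, rfl⟩
  rw [← hT] at hsum
  have hterm : ∀ m : ℕ, ‖(d m : ℂ) * (m : ℂ) ^ (-(α + w))‖ ≤ d m * (m : ℝ) ^ (-2 : ℝ) := by
    intro m
    rcases Nat.eq_zero_or_pos m with rfl | hm
    · rw [Nat.cast_zero, zero_cpow (neg_ne_zero.mpr hs0)]; simp
    · rw [norm_mul, norm_real, Real.norm_of_nonneg (h.d_nonneg m), norm_natCast_cpow_of_pos hm]
      refine mul_le_mul_of_nonneg_left ?_ (h.d_nonneg m)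
      refine Real.rpow_le_rpow_of_exponent_le (by exact_mod_cast hm) ?_
      rw [neg_re, hs]; linarith
  have hTn : ‖T‖ ≤ T₂ := by
    rw [← hsum.tsum_eq, hT₂]
    exact tsum_of_norm_bounded hsum2.hasSum hterm
  have htail : ‖exp (Y * w) * (T - ∑ m ∈ S, (d m : ℂ) * (m : ℂ) ^ (-(α + w)))‖ ≤
      Real.exp (2 * Y) * T₂ := by
    have h1 : HasSum (fun m : ℕ => if m ∈ S then (d m : ℂ) * (m : ℂ) ^ (-(α + w)) else 0)
        (∑ m ∈ S, (d m : ℂ) * (m : ℂ) ^ (-(α + w))) := by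
      have := hasSum_sum_of_ne_finset_zero (s := S) (L := SummationFilter.unconditional ℕ)
        (f := fun m : ℕ => if m ∈ S then (d m : ℂ) * (m : ℂ) ^ (-(α + w)) else 0)
        (fun m hm => if_neg hm)
      rwa [Finset.sum_congr rfl (fun m hm => if_pos hm)] at this
    have h2 := (hsum.sub h1).mul_left (exp (Y * w))
    rw [← h2.tsum_eq]
    refine tsum_of_norm_bounded (hT₂ ▸ hsum2.hasSum.mul_left _) fun m => ?_
    by_cases hm : m ∈ S
    · rw [if_pos hm, sub_self, mul_zero, norm_zero]
      exact mul_nonneg (Real.exp_pos _).le (mul_nonneg (h.d_nonneg m) (by positivity))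
    · rw [if_neg hm, sub_zero]
      rcases Nat.eq_zero_or_pos m with rfl | hm1
      · rw [Nat.cast_zero, zero_cpow (neg_ne_zero.mpr hs0)]; simp
      · have hYm := hS' m hm1 hm
        rw [norm_mul, norm_mul, norm_real, Real.norm_of_nonneg (h.d_nonneg m),
          norm_exp_ofReal_mul, norm_natCast_cpow_eq_exp hm1, mul_left_comm, mul_left_comm _ (d m)]
        refine mul_le_mul_of_nonneg_left ?_ (h.d_nonneg m)
        rw [Real.rpow_def_of_pos (by exact_mod_cast hm1), ← Real.exp_add, ← Real.exp_add,
          Real.exp_le_exp, neg_re, hs]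
        have p1 : 0 ≤ (Real.log m - Y) * (w.re - 3 / 2) :=
          mul_nonneg (by linarith) (by linarith)
        have p2 : 0 ≤ Real.log m * (α - 1 / 2) := mul_nonneg (by linarith) (by linarith)
        nlinarith
  have hs2 : ‖exp ((-Y : ℝ) * w) * ∑ m ∈ S, (d m : ℂ) * (m : ℂ) ^ (w - α)‖ ≤ D := by
    rw [Finset.mul_sum, hD]
    refine norm_sum_le_of_le _ fun m hm => ?_
    obtain ⟨hm1, hmY⟩ := hS m hm
    rw [norm_mul, norm_mul, norm_real, Real.norm_of_nonneg (h.d_nonneg m),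
      norm_exp_ofReal_mul, norm_natCast_cpow_eq_exp hm1, mul_left_comm, ← Real.exp_add]
    refine mul_le_of_le_one_right (h.d_nonneg m) (Real.exp_le_one_iff.mpr ?_)
    rw [sub_re, ofReal_re]
    have p1 : 0 ≤ (Y - Real.log m) * w.re := mul_nonneg (by linarith) (by linarith)
    have p2 : 0 ≤ Real.log m * α := mul_nonneg (Real.log_natCast_nonneg m) (by linarith)
    nlinarith
  have he2 : ‖exp ((-Y : ℝ) * w)‖ ≤ 1 := by
    rw [norm_exp_ofReal_mul, Real.exp_le_one_iff]
    have : 0 ≤ Y * w.re := mul_nonneg hY (by linarith)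
    linarith
  have hv1 : ‖(1 : ℂ) / (α + w)‖ ≤ 2 * 1 := norm_div_le_two_mul (by simp) (by linarith)
  have hv2 : ‖(1 : ℂ) / (α + w - 1)‖ ≤ 2 * 1 :=
    norm_div_le_two_mul (by simp) (by rw [sub_re, hs, one_re]; linarith)
  have q2 := norm_expSlope_neg_le (c := α) hY (abs_le.mpr ⟨by linarith, by linarith⟩) hw
  have q4 := norm_expSlope_neg_le (c := -(1 - α)) hY (abs_le.mpr ⟨by linarith, by linarith⟩) hw
  have hw1 : w ≠ ((1 - α : ℝ) : ℂ) := fun e => by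
    rw [e, ofReal_re] at hw; linarith
  have hw3 : w ≠ ((-α : ℝ) : ℂ) := fun e => by
    rw [e, ofReal_re] at hw; linarith
  have q1 : ‖exp (Y * ((1 - α : ℝ) : ℂ)) / (α + w - 1)‖ ≤ 2 * Real.exp Y :=
    norm_div_le_two_mul (by
      rw [norm_exp_ofReal_mul, ofReal_re, Real.exp_le_exp]; nlinarith)
      (by rw [sub_re, hs, one_re]; linarith)
  have q3 : ‖exp (Y * ((-α : ℝ) : ℂ)) / (α + w)‖ ≤ 2 * Real.exp Y :=
    norm_div_le_two_mul (by
      rw [norm_exp_ofReal_mul, ofReal_re, Real.exp_le_exp]; nlinarith) (by linarith)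
  have heq : comparisonFun H₁ H₂ g d N C cg Y S α w =
      exp (Y * w) * (T - ∑ m ∈ S, (d m : ℂ) * (m : ℂ) ^ (-(α + w))) +
      2 * (H₁ (α + w) + H₂ (α + w)) +
      (exp ((-Y : ℝ) * w) * (2 * C - g (α + w) + T -
        N * (1 / ((α : ℂ) + w) + 1 / ((α : ℂ) + w - 1))) +
      exp ((-Y : ℝ) * w) * ∑ m ∈ S, (d m : ℂ) * (m : ℂ) ^ (w - α)) + cg +
      N * (-(exp (Y * ((1 - α : ℝ) : ℂ)) / (α + w - 1)) + expSlope (-Y) α w -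
        exp (Y * ((-α : ℝ) : ℂ)) / (α + w) + expSlope (-Y) (-(1 - α)) w) := by
    have e1 : w - ((1 - α : ℝ) : ℂ) = α + w - 1 := by push_cast; ring
    have e3 : w - ((-α : ℝ) : ℂ) = α + w := by push_cast; ring
    rw [comparisonFun, expSlope_of_ne hw1, expSlope_of_ne hw3, hT, e1, e3]
    ring
  rw [heq]
  have k3 : ‖exp ((-Y : ℝ) * w) * (2 * C - g (α + w) + T -
        N * (1 / ((α : ℂ) + w) + 1 / ((α : ℂ) + w - 1)))‖ ≤ 2 * |C| + cg + T₂ + N * 4 := by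
    rw [norm_mul]
    refine (mul_le_of_le_one_left (norm_nonneg _) he2).trans ?_
    have j1 := norm_sub_le (2 * (C : ℂ) - g (α + w) + T)
      (N * (1 / ((α : ℂ) + w) + 1 / ((α : ℂ) + w - 1)))
    have j2 := norm_add_le (2 * (C : ℂ) - g (α + w)) T
    have j3 := norm_sub_le (2 * (C : ℂ)) (g (α + w))
    have j4 : ‖2 * (C : ℂ)‖ = 2 * |C| := by
      rw [norm_mul, norm_real, Real.norm_eq_abs]; norm_num
    have j5 : ‖(N : ℂ) * (1 / ((α : ℂ) + w) + 1 / ((α : ℂ) + w - 1))‖ ≤ N * 4 := by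
      rw [norm_mul, norm_real, Real.norm_of_nonneg hN]
      refine mul_le_mul_of_nonneg_left ?_ hN
      have := norm_add_le (1 / ((α : ℂ) + w)) (1 / ((α : ℂ) + w - 1))
      linarith
    linarith
  generalize exp ((-Y : ℝ) * w) * (2 * C - g (α + w) + T -
        N * (1 / ((α : ℂ) + w) + 1 / ((α : ℂ) + w - 1))) = z3 at *
  generalize exp ((-Y : ℝ) * w) * ∑ m ∈ S, (d m : ℂ) * (m : ℂ) ^ (w - α) = z4 at *
  generalize exp (Y * w) * (T - ∑ m ∈ S, (d m : ℂ) * (m : ℂ) ^ (-(α + w))) = z1 at *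
  generalize exp (Y * ((1 - α : ℝ) : ℂ)) / (α + w - 1) = p1 at *
  generalize exp (Y * ((-α : ℝ) : ℂ)) / (α + w) = p3 at *
  generalize expSlope (-Y) α w = p2 at *
  generalize expSlope (-Y) (-(1 - α)) w = p4 at *
  have r : ∀ z : ℂ, -‖z‖ ≤ z.re ∧ z.re ≤ ‖z‖ := fun z => abs_le.mp (abs_re_le_norm z)
  have hQ : -(2 * Real.exp Y + 2 * (1 + Real.exp Y) + 2 * Real.exp Y + 2 * (1 + Real.exp Y)) ≤
      -p1.re + p2.re - p3.re + p4.re := by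
    linarith [(r p1).2, (r p2).1, (r p3).2, (r p4).1]
  have hQN := mul_le_mul_of_nonneg_left hQ hN
  simp only [add_re, mul_re, sub_re, neg_re, ofReal_re, ofReal_im, re_ofNat, im_ofNat, zero_mul,
    sub_zero]
  linarith [(r z1).1, (r z3).1, (r z4).1]

theorem re_comparisonFun_nonneg (h : ComparisonData H₁ H₂ g d N C cg) (hα : 1 / 2 < α)
    (hα1 : α < 1) (hY : 0 ≤ Y) (hS : ∀ m ∈ S, 1 ≤ m ∧ Real.log m ≤ Y)
    (hS' : ∀ m : ℕ, 1 ≤ m → m ∉ S → Y ≤ Real.log m) {w : ℂ} (hw : 0 ≤ w.re) :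
    0 ≤ (comparisonFun H₁ H₂ g d N C cg Y S α w).re := by
  obtain ⟨A, hA, hstrip⟩ := h.exists_strip_bound hα hα1 hY (fun m hm => (hS m hm).1)
  obtain ⟨B, hbig⟩ := h.exists_right_bound hα hα1 hY hS hS'
  exact re_nonneg_of_re_nonneg_on_imaginary_axis
    (h.diffContOnCl hα fun m hm => (hS m hm).1) (h.re_comparisonFun_mul_I hα hα1) hA hstrip hbig hw

end ComparisonData
end ComparisonGrowth

section ComparisonReal
open Complex Filter Topology Set

namespace ComparisonData
variable {H₁ H₂ g : ℂ → ℂ} {d : ℕ → ℝ} {N C cg Y α : ℝ} {S : Finset ℕ}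

theorem hasSum_ofReal_one_lt (h : ComparisonData H₁ H₂ g d N C cg) {σ : ℝ} (hσ : 1 < σ) :
    N * (1 / (σ : ℂ) + 1 / ((σ : ℂ) - 1)) - C + g σ - (H₁ σ - H₂ σ) =
      ((∑' m : ℕ, d m * (m : ℝ) ^ (-σ) : ℝ) : ℂ) := by
  rw [← (h.hasSum σ (by simpa using hσ)).tsum_eq, ofReal_tsum]
  refine tsum_congr fun m => ?_
  rw [ofReal_mul, ofReal_cpow (Nat.cast_nonneg _)]
  push_cast
  rfl

theorem re_comparisonFun_ofReal (h : ComparisonData H₁ H₂ g d N C cg) {σ : ℝ} (hσ : 1 < σ)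
    (hα : α < 1) (hα2 : 2 * α ≠ σ) :
    (comparisonFun H₁ H₂ g d N C cg Y S α ((σ - α : ℝ) : ℂ)).re =
      Real.exp (Y * (σ - α)) * (∑' m : ℕ, d m * (m : ℝ) ^ (-σ) - N * (1 / σ + 1 / (σ - 1)) -
        ∑ m ∈ S, d m * (m : ℝ) ^ (-σ)) + 2 * ((H₁ σ).re + (H₂ σ).re) +
      Real.exp (-Y * (σ - α)) * (C - ((H₁ σ).re - (H₂ σ).re) +
        ∑ m ∈ S, d m * (m : ℝ) ^ (σ - 2 * α)) + cg +
      N * ((Real.exp (Y * (σ - α)) - Real.exp (Y * (1 - α))) / (σ - α - (1 - α)) +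
        (Real.exp (-Y * (σ - α)) - Real.exp (-Y * α)) / (σ - α - α) +
        (Real.exp (Y * (σ - α)) - Real.exp (Y * (-α))) / (σ - α - (-α)) +
        (Real.exp (-Y * (σ - α)) - Real.exp (-Y * (-(1 - α)))) / (σ - α - (-(1 - α)))) := by
  have hs : (α : ℂ) + ((σ - α : ℝ) : ℂ) = σ := by push_cast; ring
  have hT := h.hasSum_ofReal_one_lt hσ
  have h1 : -(C : ℂ) + g σ - (H₁ σ - H₂ σ) - ∑ m ∈ S, (d m : ℂ) * (m : ℂ) ^ (-(σ : ℂ)) =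
      ((∑' m : ℕ, d m * (m : ℝ) ^ (-σ) - N * (1 / σ + 1 / (σ - 1)) -
        ∑ m ∈ S, d m * (m : ℝ) ^ (-σ) : ℝ) : ℂ) := by
    have e : ∑ m ∈ S, (d m : ℂ) * (m : ℂ) ^ (-(σ : ℂ)) =
        ((∑ m ∈ S, d m * (m : ℝ) ^ (-σ) : ℝ) : ℂ) := by
      rw [ofReal_sum]
      refine Finset.sum_congr rfl fun m _ => ?_
      rw [ofReal_mul, ofReal_cpow (Nat.cast_nonneg _)]
      push_cast
      rfl
    rw [e, ofReal_sub, ofReal_sub, ← hT]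
    push_cast
    ring
  have h2 : ∑ m ∈ S, (d m : ℂ) * (m : ℂ) ^ (((σ - α : ℝ) : ℂ) - α) =
      ((∑ m ∈ S, d m * (m : ℝ) ^ (σ - 2 * α) : ℝ) : ℂ) := by
    rw [ofReal_sum]
    refine Finset.sum_congr rfl fun m _ => ?_
    rw [ofReal_mul, ofReal_cpow (Nat.cast_nonneg _)]
    push_cast
    congr 2
    ring
  have e1 : exp ((Y : ℂ) * ((σ - α : ℝ) : ℂ)) = ((Real.exp (Y * (σ - α)) : ℝ) : ℂ) := by
    push_cast; rfl
  have e2 : exp (((-Y : ℝ) : ℂ) * ((σ - α : ℝ) : ℂ)) = ((Real.exp (-Y * (σ - α)) : ℝ) : ℂ) := by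
    push_cast; rfl
  rw [comparisonFun, hs, h1, h2, e1, e2, expSlope_ofReal (by linarith),
    expSlope_ofReal (fun e => hα2 (by linarith)), expSlope_ofReal (by linarith),
    expSlope_ofReal (by linarith), ← ofReal_mul, ← ofReal_add, ← ofReal_add, ← ofReal_add,
    ← ofReal_mul]
  simp only [add_re, sub_re, ofReal_re, ofReal_im, mul_re, re_ofNat, im_ofNat, zero_mul,
    sub_zero]

theorem le_exp_mul_tail (h : ComparisonData H₁ H₂ g d N C cg) (hY : 0 ≤ Y)
    (hS : ∀ m ∈ S, 1 ≤ m ∧ Real.log m ≤ Y)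
    (hS' : ∀ m : ℕ, 1 ≤ m → m ∉ S → Y ≤ Real.log m) {σ : ℝ} (hσ : 1 < σ) :
    N * Real.exp (Y / 2) * (1 / (σ - 1) + 1 / σ) - 2 * ((H₁ σ).re + (H₂ σ).re) - cg -
      Real.exp (-(Y * (σ - 1 / 2))) * (C - ((H₁ σ).re - (H₂ σ).re) +
        ∑ m ∈ S, d m * (m : ℝ) ^ (σ - 1)) ≤
      Real.exp (Y * (σ - 1 / 2)) *
        (∑' m : ℕ, d m * (m : ℝ) ^ (-σ) - ∑ m ∈ S, d m * (m : ℝ) ^ (-σ)) := by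
  obtain ⟨T, hT⟩ : ∃ T : ℝ, T = ∑' m : ℕ, d m * (m : ℝ) ^ (-σ) - N * (1 / σ + 1 / (σ - 1)) -
    ∑ m ∈ S, d m * (m : ℝ) ^ (-σ) := ⟨_, rfl⟩
  obtain ⟨V, hV⟩ : ∃ V : ℝ → ℝ, V = fun α => Real.exp (Y * (σ - α)) * T +
      2 * ((H₁ σ).re + (H₂ σ).re) +
      Real.exp (-Y * (σ - α)) * (C - ((H₁ σ).re - (H₂ σ).re) +
        ∑ m ∈ S, d m * (m : ℝ) ^ (σ - 2 * α)) + cg +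
      N * ((Real.exp (Y * (σ - α)) - Real.exp (Y * (1 - α))) / (σ - α - (1 - α)) +
        (Real.exp (-Y * (σ - α)) - Real.exp (-Y * α)) / (σ - α - α) +
        (Real.exp (Y * (σ - α)) - Real.exp (Y * (-α))) / (σ - α - (-α)) +
        (Real.exp (-Y * (σ - α)) - Real.exp (-Y * (-(1 - α)))) / (σ - α - (-(1 - α)))) := ⟨_, rfl⟩
  have hcont : ContinuousAt V (1 / 2) := by
    have hsum : ContinuousAt (fun α : ℝ => ∑ m ∈ S, d m * (m : ℝ) ^ (σ - 2 * α)) (1 / 2) := by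
      refine tendsto_finsetSum _ fun m hm => ?_
      have hm0 : (m : ℝ) ≠ 0 := by
        have := (hS m hm).1
        positivity
      have hc : Continuous fun α : ℝ => d m * (m : ℝ) ^ (σ - 2 * α) :=
        continuous_const.mul ((Real.continuous_const_rpow hm0).comp (by fun_prop))
      exact hc.continuousAt
    have d1 : σ - 1 / 2 - (1 - 1 / 2) ≠ 0 := by linarith
    have d2 : σ - 1 / 2 - 1 / 2 ≠ 0 := by linarith
    have d3 : σ - 1 / 2 - -(1 / 2) ≠ 0 := by linarith
    have d4 : σ - 1 / 2 - -(1 - 1 / 2) ≠ 0 := by linarith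
    rw [hV]
    fun_prop (disch := assumption)
  have hev : ∀ᶠ α in 𝓝[>] (1 / 2 : ℝ), 0 ≤ V α := by
    have h3 : (1 / 2 : ℝ) < min 1 (σ / 2) := lt_min (by norm_num) (by linarith)
    filter_upwards [Ioo_mem_nhdsGT h3] with α hα
    have hα1 : α < 1 := hα.2.trans_le (min_le_left _ _)
    have hα2 : α < σ / 2 := hα.2.trans_le (min_le_right _ _)
    have h4 := h.re_comparisonFun_nonneg hα.1 hα1 hY hS hS' (w := ((σ - α : ℝ) : ℂ))
      (by rw [ofReal_re]; linarith)
    rw [h.re_comparisonFun_ofReal hσ hα1 (by linarith), ← hT] at h4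
    rw [hV]
    exact h4
  have h5 : 0 ≤ V (1 / 2) := ge_of_tendsto (hcont.mono_left nhdsWithin_le_nhds) hev
  rw [hV] at h5
  simp only at h5
  have e1 : σ - 2 * (1 / 2) = σ - 1 := by ring
  have e2 : -Y * (σ - 1 / 2) = -(Y * (σ - 1 / 2)) := by ring
  have e3 : Y * (1 - 1 / 2) = Y / 2 := by ring
  have e4 : -Y * (-(1 - 1 / 2)) = Y / 2 := by ring
  have e5 : -Y * (1 / 2) = -(Y / 2) := by ring
  have e6 : Y * (-(1 / 2)) = -(Y / 2) := by ring
  have e7 : σ - 1 / 2 - (1 - 1 / 2) = σ - 1 := by ring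
  have e8 : σ - 1 / 2 - 1 / 2 = σ - 1 := by ring
  have e9 : σ - 1 / 2 - -(1 / 2) = σ := by ring
  have e10 : σ - 1 / 2 - -(1 - 1 / 2) = σ := by ring
  rw [e1, e2, e3, e4, e5, e6, e7, e8, e9, e10, hT] at h5
  have hle : Real.exp (-(Y * (σ - 1 / 2))) ≤ Real.exp (-(Y / 2)) := by
    rw [Real.exp_le_exp]; nlinarith
  have h6 : 0 ≤ N * ((Real.exp (-(Y / 2)) - Real.exp (-(Y * (σ - 1 / 2)))) *
      (1 / (σ - 1) + 1 / σ)) := by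
    have : 0 < σ - 1 := by linarith
    exact mul_nonneg h.N_nonneg (mul_nonneg (by linarith) (by positivity))
  have h7 : N * ((Real.exp (Y * (σ - 1 / 2)) - Real.exp (Y / 2)) / (σ - 1) +
        (Real.exp (-(Y * (σ - 1 / 2))) - Real.exp (-(Y / 2))) / (σ - 1) +
        (Real.exp (Y * (σ - 1 / 2)) - Real.exp (-(Y / 2))) / σ +
        (Real.exp (-(Y * (σ - 1 / 2))) - Real.exp (Y / 2)) / σ) =
      Real.exp (Y * (σ - 1 / 2)) * (N * (1 / σ + 1 / (σ - 1))) -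
        N * Real.exp (Y / 2) * (1 / (σ - 1) + 1 / σ) -
      N * ((Real.exp (-(Y / 2)) - Real.exp (-(Y * (σ - 1 / 2)))) *
      (1 / (σ - 1) + 1 / σ)) := by ring
  rw [h7] at h5
  linarith

end ComparisonData
end ComparisonReal

section
open Complex Filter Topology Asymptotics Set MeasureTheory

theorem integrableOn_log_mul_exp_neg :
    IntegrableOn (fun t : ℝ => Real.log t * Real.exp (-t)) (Ioi 0) ∧
      ∫ t in Ioi (0 : ℝ), Real.log t * Real.exp (-t) = -Real.eulerMascheroniConstant := by
  have h1 := mellin_hasDerivAt_of_isBigO_rpow (E := ℂ) (f := fun x : ℝ => (Real.exp (-x) : ℂ))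
    (a := 2) (b := 0) (s := 1)
    (by
      refine (Continuous.continuousOn ?_).locallyIntegrableOn measurableSet_Ioi
      fun_prop)
    (by
      rw [← isBigO_norm_left]
      simp_rw [norm_real, isBigO_norm_left]
      simpa only [neg_one_mul] using (isLittleO_exp_neg_mul_rpow_atTop zero_lt_one _).isBigO)
    (by simp) (by
      simp_rw [neg_zero, Real.rpow_zero]
      refine isBigO_const_of_tendsto (?_ : Tendsto _ _ (𝓝 (1 : ℂ))) one_ne_zero
      rw [(by simp : (1 : ℂ) = Real.exp (-0))]
      exact (continuous_ofReal.comp (Real.continuous_exp.comp continuous_neg)).continuousWithinAt)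
    (by simp)
  have e : EqOn (fun t : ℝ => (t : ℂ) ^ ((1 : ℂ) - 1) • (Real.log t • (Real.exp (-t) : ℂ)))
      (fun t : ℝ => ((Real.log t * Real.exp (-t) : ℝ) : ℂ)) (Ioi 0) := by
    intro t ht
    simp
  have hI : IntegrableOn (fun t : ℝ => ((Real.log t * Real.exp (-t) : ℝ) : ℂ)) (Ioi 0) :=
    IntegrableOn.congr_fun h1.1 e measurableSet_Ioi
  refine ⟨?_, ?_⟩
  · have h := hI.re
    exact h
  · have h2 := h1.2
    rw [← GammaIntegral_eq_mellin] at h2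
    have h3 : HasDerivAt GammaIntegral (-(Real.eulerMascheroniConstant : ℂ)) 1 := by
      refine hasDerivAt_Gamma_one.congr_of_eventuallyEq ?_
      have : {s : ℂ | 0 < s.re} ∈ 𝓝 (1 : ℂ) :=
        (isOpen_lt continuous_const continuous_re).mem_nhds (by simp)
      filter_upwards [this] with s hs
      exact (Gamma_eq_integral hs).symm
    have h4 := h2.unique h3
    rw [mellin, setIntegral_congr_fun measurableSet_Ioi e] at h4
    have h5 : ∫ t in Ioi (0:ℝ), ((Real.log t * Real.exp (-t) : ℝ) : ℂ) =
      ((∫ t in Ioi (0:ℝ), Real.log t * Real.exp (-t) : ℝ) : ℂ) := integral_ofReal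
    rw [h5] at h4
    exact_mod_cast h4

/-- The exponential integral `∫_ε^∞ e^{-t} / t dt` for `ε > 0`, in integrated form. -/
noncomputable def expIntegral (ε : ℝ) : ℝ :=
  -Real.eulerMascheroniConstant - (∫ t in (0 : ℝ)..ε, Real.log t * Real.exp (-t)) -
    Real.log ε * Real.exp (-ε)

theorem intervalIntegrable_log_mul_exp_neg (a b : ℝ) :
    IntervalIntegrable (fun t : ℝ => Real.log t * Real.exp (-t)) volume a b :=
  intervalIntegral.intervalIntegrable_log'.mul_continuousOn (by fun_prop)

theorem hasDerivAt_expIntegral {ε : ℝ} (hε : 0 < ε) :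
    HasDerivAt expIntegral (-(Real.exp (-ε) / ε)) ε := by
  have h0 : ContinuousAt (fun t : ℝ => Real.log t * Real.exp (-t)) ε :=
    (Real.continuousAt_log hε.ne').mul (by fun_prop)
  have h1 := intervalIntegral.integral_hasDerivAt_right
    (intervalIntegrable_log_mul_exp_neg 0 ε)
    (Measurable.stronglyMeasurable (by fun_prop)).stronglyMeasurableAtFilter h0
  have h2 := (Real.hasDerivAt_log hε.ne').mul ((Real.hasDerivAt_exp (-ε)).comp ε (hasDerivAt_neg ε))
  have h3 := (h1.const_sub (-Real.eulerMascheroniConstant)).sub h2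
  have h4 : HasDerivAt expIntegral _ ε := h3
  convert h4 using 1
  simp only [Function.comp]
  field_simp
  ring

theorem tendsto_expIntegral_atTop : Tendsto expIntegral atTop (𝓝 0) := by
  have h1 := intervalIntegral_tendsto_integral_Ioi 0 integrableOn_log_mul_exp_neg.1
    (tendsto_id (α := ℝ) (x := atTop))
  rw [integrableOn_log_mul_exp_neg.2] at h1
  have h2 : Tendsto (fun ε : ℝ => Real.log ε * Real.exp (-ε)) atTop (𝓝 0) := by
    have h3 := Real.tendsto_pow_mul_exp_neg_atTop_nhds_zero 1
    refine squeeze_zero' ?_ ?_ h3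
    · filter_upwards [eventually_ge_atTop 1] with x hx
      exact mul_nonneg (Real.log_nonneg hx) (Real.exp_pos _).le
    · filter_upwards [eventually_ge_atTop 1] with x hx
      rw [pow_one]
      exact mul_le_mul_of_nonneg_right (Real.log_le_self (by linarith)) (Real.exp_pos _).le
  have h3 := (h1.const_sub (-Real.eulerMascheroniConstant)).sub h2
  rw [sub_self, sub_zero] at h3
  exact h3

theorem tendsto_expIntegral_add_log :
    Tendsto (fun ε => expIntegral ε + Real.log ε) (𝓝[>] 0) (𝓝 (-Real.eulerMascheroniConstant)) := by
  have h1 : Tendsto (fun ε : ℝ => ∫ t in (0 : ℝ)..ε, Real.log t * Real.exp (-t)) (𝓝[>] 0) (𝓝 0) := by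
    have := (intervalIntegral.continuous_primitive intervalIntegrable_log_mul_exp_neg 0).tendsto 0
    simp only [intervalIntegral.integral_same] at this
    exact this.mono_left nhdsWithin_le_nhds
  have h2 : Tendsto (fun ε : ℝ => Real.log ε * (1 - Real.exp (-ε))) (𝓝[>] 0) (𝓝 0) := by
    have h3 : Tendsto (fun ε : ℝ => Real.log ε * ε) (𝓝[>] 0) (𝓝 0) := by
      have h := (Real.continuous_mul_log.tendsto 0).mono_left (nhdsWithin_le_nhds (s := Ioi 0))
      simpa [mul_comm] using h
    refine squeeze_zero_norm' ?_ (by simpa using h3.norm)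
    filter_upwards [self_mem_nhdsWithin] with ε (hε : 0 < ε)
    rw [norm_mul]
    refine mul_le_mul_of_nonneg_left ?_ (norm_nonneg _)
    have h4 := Real.add_one_le_exp (-ε)
    have h5 : Real.exp (-ε) ≤ 1 := Real.exp_le_one_iff.2 (by linarith)
    rw [Real.norm_of_nonneg (by linarith), abs_of_pos hε]
    linarith
  have h3 := (h1.const_sub (-Real.eulerMascheroniConstant)).add h2
  simp only [sub_zero, add_zero] at h3
  refine h3.congr fun ε => ?_
  simp only [expIntegral]
  ring

/-- Integrating the differential inequality `G' ≤ -e^{-uY} (N / u - P - Q u)` from `0` to `∞`. -/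
theorem neg_mul_log_add_le_of_hasDerivAt {G G' : ℝ → ℝ} {N Y P Q R : ℝ} (hY : 0 < Y)
    (hG : ∀ u, 0 < u → HasDerivAt G (G' u) u)
    (hG' : ∀ u, 0 < u → G' u ≤ -(Real.exp (-(u * Y)) * (N / u - P - Q * u)))
    (htop : Tendsto G atTop (𝓝 0))
    (hzero : Tendsto (fun u => G u + N * Real.log u) (𝓝[>] 0) (𝓝 R)) :
    -(N * (Real.eulerMascheroniConstant + Real.log Y)) - P / Y - Q / Y ^ 2 ≤ R := by
  obtain ⟨W, hW⟩ : ∃ W : ℝ → ℝ, W = fun u => Real.exp (-(u * Y)) * (P / Y + Q * u / Y + Q / Y ^ 2) :=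
    ⟨_, rfl⟩
  have hWd : ∀ u, HasDerivAt W (-(Real.exp (-(u * Y)) * (P + Q * u))) u := by
    intro u
    have h1 : HasDerivAt (fun u : ℝ => Real.exp (-(u * Y))) (Real.exp (-(u * Y)) * (-(1 * Y))) u :=
      ((hasDerivAt_id u).mul_const Y).neg.exp
    have h2 : HasDerivAt (fun u : ℝ => P / Y + Q * u / Y + Q / Y ^ 2) (Q * 1 / Y) u :=
      ((((hasDerivAt_id u).const_mul Q).div_const Y).const_add (P / Y)).add_const _
    have h3 := h1.mul h2
    rw [hW]
    have h4 : HasDerivAt (fun u => Real.exp (-(u * Y)) * (P / Y + Q * u / Y + Q / Y ^ 2)) _ u := h3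
    convert h4 using 1
    field_simp
    ring
  obtain ⟨Φ, hΦ⟩ : ∃ Φ : ℝ → ℝ, Φ = fun u => G u - N * expIntegral (u * Y) + W u := ⟨_, rfl⟩
  have hΦd : ∀ u, 0 < u → HasDerivAt Φ
      (G' u + Real.exp (-(u * Y)) * (N / u - P - Q * u)) u := by
    intro u hu
    have h1 : HasDerivAt (fun u => expIntegral (u * Y)) (-(Real.exp (-(u * Y)) / (u * Y)) * (1 * Y)) u :=
      HasDerivAt.comp (h₂ := expIntegral) (h := fun u => u * Y) u
        (hasDerivAt_expIntegral (mul_pos hu hY)) ((hasDerivAt_id u).mul_const Y)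
    have h2 : HasDerivAt (fun u => G u - N * expIntegral (u * Y) + W u) _ u :=
      ((hG u hu).sub (h1.const_mul N)).add (hWd u)
    rw [hΦ]
    convert h2 using 1
    field_simp
    ring
  have hanti : AntitoneOn Φ (Ioi 0) := by
    refine antitoneOn_of_deriv_nonpos (convex_Ioi 0)
      (fun u hu => (hΦd u hu).continuousAt.continuousWithinAt) ?_ ?_
    · rw [interior_Ioi]
      exact fun u hu => (hΦd u hu).differentiableAt.differentiableWithinAt
    · rw [interior_Ioi]
      intro u hu
      rw [(hΦd u hu).deriv]
      linarith [hG' u hu]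
  have hWtop : Tendsto W atTop (𝓝 0) := by
    have hm : Tendsto (fun u : ℝ => u * Y) atTop atTop := tendsto_id.atTop_mul_const hY
    have h1 := (Real.tendsto_pow_mul_exp_neg_atTop_nhds_zero 1).comp hm
    have h0 := (Real.tendsto_pow_mul_exp_neg_atTop_nhds_zero 0).comp hm
    have h2 := (h0.const_mul (P / Y + Q / Y ^ 2)).add (h1.const_mul (Q / Y ^ 2))
    simp only [mul_zero, add_zero] at h2
    refine h2.congr fun u => ?_
    rw [hW]
    simp only [Function.comp, pow_zero, pow_one]
    field_simp
    ring
  have hΦtop : Tendsto Φ atTop (𝓝 0) := by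
    have hm : Tendsto (fun u : ℝ => u * Y) atTop atTop := tendsto_id.atTop_mul_const hY
    have := (htop.sub ((tendsto_expIntegral_atTop.comp hm).const_mul N)).add hWtop
    rw [hΦ]
    simpa [Function.comp_def] using this
  have hnonneg : ∀ u, 0 < u → 0 ≤ Φ u := by
    intro u hu
    refine le_of_tendsto hΦtop ?_
    filter_upwards [eventually_ge_atTop u] with v hv
    exact hanti hu (show (0:ℝ) < v by linarith) hv
  have hm0 : Tendsto (fun u : ℝ => u * Y) (𝓝[>] 0) (𝓝[>] 0) := by
    refine tendsto_nhdsWithin_iff.2 ⟨?_, ?_⟩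
    · have : Tendsto (fun u : ℝ => u * Y) (𝓝 0) (𝓝 (0 * Y)) := (continuous_mul_const Y).tendsto 0
      rw [zero_mul] at this
      exact this.mono_left nhdsWithin_le_nhds
    · filter_upwards [self_mem_nhdsWithin] with u (hu : 0 < u)
      exact mul_pos hu hY
  have hW0 : Tendsto W (𝓝[>] 0) (𝓝 (P / Y + Q / Y ^ 2)) := by
    have := ((hWd 0).continuousAt.tendsto).mono_left (nhdsWithin_le_nhds (s := Ioi 0))
    have e : W 0 = P / Y + Q / Y ^ 2 := by rw [hW]; simp
    rwa [e] at this
  have hlim : Tendsto Φ (𝓝[>] 0)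
      (𝓝 (R - N * (-Real.eulerMascheroniConstant) + N * Real.log Y + (P / Y + Q / Y ^ 2))) := by
    have h1 := (((hzero.sub ((tendsto_expIntegral_add_log.comp hm0).const_mul N)).add_const
      (N * Real.log Y))).add hW0
    refine h1.congr' ?_
    filter_upwards [self_mem_nhdsWithin] with u (hu : 0 < u)
    rw [hΦ]
    simp only [Function.comp, Real.log_mul hu.ne' hY.ne']
    ring
  have := ge_of_tendsto hlim (by
    filter_upwards [self_mem_nhdsWithin] with u (hu : 0 < u)
    exact hnonneg u hu)
  linarith

end

section Harnack
open Complex Filter Topology Set Metric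
open scoped ComplexConjugate

theorem normSq_sub_lt_normSq_add_conj {w w₁ : ℂ} (hw : 0 < w.re) (hw₁ : 0 < w₁.re) :
    normSq (w - w₁) < normSq (w + conj w₁) := by
  simp only [normSq_apply, sub_re, sub_im, add_re, add_im, conj_re, conj_im]
  nlinarith [mul_pos hw hw₁]

theorem add_conj_ne_zero {w w₁ : ℂ} (hw : 0 < w.re) (hw₁ : 0 < w₁.re) : w + conj w₁ ≠ 0 := by
  intro h
  have := congrArg re h
  simp only [add_re, conj_re, zero_re] at this
  linarith

theorem one_sub_mul_re_le_of_norm_sub_le {w w₁ : ℂ} {q : ℝ} (hw : 0 < w.re) (hw₁ : 0 < w₁.re)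
    (hq : 0 ≤ q) (hq1 : q < 1) (h : ‖(w - w₁) / (w + conj w₁)‖ ≤ q) :
    (1 - q) * w.re ≤ (1 + q) * w₁.re := by
  have hne := add_conj_ne_zero hw hw₁
  rw [norm_div, div_le_iff₀ (norm_pos_iff.2 hne)] at h
  have h2 : normSq (w - w₁) ≤ q ^ 2 * normSq (w + conj w₁) := by
    rw [normSq_eq_norm_sq, normSq_eq_norm_sq, ← mul_pow]
    exact pow_le_pow_left₀ (norm_nonneg _) h 2
  simp only [normSq_apply, sub_re, sub_im, add_re, add_im, conj_re, conj_im] at h2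
  have h3 : (w.re - w₁.re) ^ 2 ≤ (q * (w.re + w₁.re)) ^ 2 := by
    nlinarith [mul_nonneg (show 0 ≤ 1 - q ^ 2 by nlinarith) (sq_nonneg (w.im - w₁.im))]
  have h4 := abs_le_of_sq_le_sq h3 (by positivity)
  linarith [(abs_le.1 h4).2]

/-- Harnack's inequality for the real part of a holomorphic function on `1 / 2 < re s`, with base
point `5 / 4`. -/
theorem re_le_mul_re_five_quarters_of_pos {h : ℂ → ℂ} (hd : DifferentiableOn ℂ h {s | 1 / 2 < s.re})
    (hre : ∀ s : ℂ, 1 / 2 < s.re → 0 < (h s).re) {σ : ℝ} (hσ : 1 ≤ σ) :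
    (h σ).re ≤ (3 / 2 + 4 / 3 * (σ - 1)) * (h (5 / 4 : ℝ)).re := by
  obtain ⟨w₁, hw₁⟩ : ∃ w₁, w₁ = h (5 / 4 : ℝ) := ⟨_, rfl⟩
  have hw₁p : 0 < w₁.re := by rw [hw₁]; exact hre _ (by norm_num)
  obtain ⟨m, hm⟩ : ∃ m : ℂ → ℂ, m = fun w => 1 / 2 + 3 / 4 * (1 + w) / (1 - w) := ⟨_, rfl⟩
  have hne : ∀ w ∈ ball (0 : ℂ) 1, 1 - w ≠ 0 := by
    intro w hw h0
    rw [mem_ball_zero_iff, ← sub_eq_zero.1 h0, norm_one] at hw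
    exact lt_irrefl _ hw
  have hmre : ∀ w ∈ ball (0 : ℂ) 1, 1 / 2 < (m w).re := by
    intro w hw
    have h1 := normSq_pos.2 (hne w hw)
    have hw' : normSq w < 1 := by
      rw [mem_ball_zero_iff] at hw
      rw [normSq_eq_norm_sq]
      nlinarith [norm_nonneg w]
    have h2 : (m w).re = 1 / 2 + 3 / 4 * (1 - normSq w) / normSq (1 - w) := by
      rw [hm]
      simp only [add_re, div_re, mul_re, mul_im]
      simp [normSq_apply]
      field_simp
      ring
    rw [h2]
    have : 0 < 3 / 4 * (1 - normSq w) / normSq (1 - w) := by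
      apply div_pos _ h1
      linarith
    linarith
  have hmd : DifferentiableOn ℂ m (ball 0 1) := by
    rw [hm]
    intro w hw
    have := hne w hw
    fun_prop (disch := assumption)
  obtain ⟨f, hf⟩ : ∃ f : ℂ → ℂ, f = fun w => (h (m w) - w₁) / (h (m w) + conj w₁) := ⟨_, rfl⟩
  have hfd : DifferentiableOn ℂ f (ball 0 1) := by
    have hc : DifferentiableOn ℂ (fun w => h (m w)) (ball 0 1) :=
      hd.comp hmd fun w hw => hmre w hw
    rw [hf]
    exact (hc.sub_const _).div (hc.add_const _) fun w hw =>
      add_conj_ne_zero (hre _ (hmre w hw)) hw₁p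
  have hf0 : f 0 = 0 := by
    have : m 0 = (5 / 4 : ℝ) := by rw [hm]; push_cast; norm_num
    simp [hf, this, hw₁]
  have hmaps : MapsTo f (ball 0 1) (ball 0 1) := by
    intro w hw
    have hp := hre _ (hmre w hw)
    have h1 := normSq_sub_lt_normSq_add_conj hp hw₁p
    rw [normSq_eq_norm_sq, normSq_eq_norm_sq] at h1
    rw [mem_ball_zero_iff, hf]
    simp only [norm_div]
    rw [div_lt_one (norm_pos_iff.2 (add_conj_ne_zero hp hw₁p))]
    exact lt_of_pow_lt_pow_left₀ 2 (norm_nonneg _) h1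
  obtain ⟨p, hp⟩ : ∃ p : ℝ, p = (σ - 5 / 4) / (σ + 1 / 4) := ⟨_, rfl⟩
  have hpos : 0 < σ + 1 / 4 := by linarith
  have hp1 : |p| < 1 := by
    rw [hp, abs_lt, lt_div_iff₀ hpos, div_lt_iff₀ hpos]
    constructor <;> linarith
  have hpb : (p : ℂ) ∈ ball (0 : ℂ) 1 := by simpa using hp1
  have hmp : m p = σ := by
    have h1 : (1 : ℂ) - p ≠ 0 := hne _ hpb
    rw [hm]
    have h2 : (1 / 2 + 3 / 4 * (1 + p) / (1 - p) : ℝ) = σ := by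
      have h3 : 1 - p = (3 / 2) / (σ + 1 / 4) := by rw [hp]; field_simp; ring
      have h4 : 1 + p = (2 * σ - 1) / (σ + 1 / 4) := by rw [hp]; field_simp; ring
      rw [h3, h4]
      field_simp
      ring
    rw [← h2]
    push_cast
    rfl
  have hs := norm_le_norm_of_mapsTo_ball (f := f) hfd (hmaps.mono_right ball_subset_closedBall) hf0 (z := (p : ℂ))
    (by simpa using hp1)
  rw [hf] at hs
  simp only [hmp, norm_real, Real.norm_eq_abs] at hs
  have hfin := one_sub_mul_re_le_of_norm_sub_le (hre _ (by rw [ofReal_re]; linarith)) hw₁p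
    (abs_nonneg p) hp1 hs
  rw [← hw₁]
  rcases le_total (5 / 4) σ with hc | hc
  · have : |p| = p := abs_of_nonneg (by rw [hp]; apply div_nonneg <;> linarith)
    rw [this] at hfin
    have e1 : 1 - p = (3 / 2) / (σ + 1 / 4) := by rw [hp]; field_simp; ring
    have e2 : 1 + p = (2 * σ - 1) / (σ + 1 / 4) := by rw [hp]; field_simp; ring
    rw [e1, e2, div_mul_eq_mul_div _ _ (h σ).re,
      div_mul_eq_mul_div _ _ w₁.re, div_le_div_iff_of_pos_right hpos] at hfin
    nlinarith
  · have : |p| = -p := abs_of_nonpos (by rw [hp]; apply div_nonpos_of_nonpos_of_nonneg <;> linarith)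
    rw [this] at hfin
    have e1 : 1 - p = (3 / 2) / (σ + 1 / 4) := by rw [hp]; field_simp; ring
    have e2 : 1 + p = (2 * σ - 1) / (σ + 1 / 4) := by rw [hp]; field_simp; ring
    rw [sub_neg_eq_add, ← sub_eq_add_neg, e1, e2, div_mul_eq_mul_div _ _ (h σ).re,
      div_mul_eq_mul_div _ _ w₁.re,
      div_le_div_iff_of_pos_right hpos] at hfin
    have h0 := hre σ (by rw [ofReal_re]; linarith)
    nlinarith

theorem re_le_mul_re_five_quarters {h : ℂ → ℂ} (hd : DifferentiableOn ℂ h {s | 1 / 2 < s.re})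
    (hre : ∀ s : ℂ, 1 / 2 < s.re → 0 ≤ (h s).re) {σ : ℝ} (hσ : 1 ≤ σ) :
    (h σ).re ≤ (3 / 2 + 4 / 3 * (σ - 1)) * (h (5 / 4 : ℝ)).re := by
  refine le_of_forall_pos_le_add fun ε hε => ?_
  have hk : 0 < 3 / 2 + 4 / 3 * (σ - 1) := by linarith
  have := re_le_mul_re_five_quarters_of_pos (h := fun s => h s + (ε / (3 / 2 + 4 / 3 * (σ - 1)) : ℝ))
    (hd.add_const _) (fun s hs => by
      have h1 := hre s hs
      have h2 : 0 < ε / (3 / 2 + 4 / 3 * (σ - 1)) := by positivity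
      rw [add_re, ofReal_re]
      linarith) hσ
  simp only [add_re, ofReal_re, mul_add, mul_div_cancel₀ _ hk.ne'] at this
  have h2 : 0 < ε / (3 / 2 + 4 / 3 * (σ - 1)) := by positivity
  linarith

end Harnack

section
open MeasureTheory Set

section UnitBox
variable {ι : Type*} [Fintype ι]

/-- The half-open unit box. -/
def unitBox (ι : Type*) : Set (ι → ℝ) := {x | ∀ i, x i ∈ Ioc (0 : ℝ) 1}

theorem measurableSet_unitBox : MeasurableSet (unitBox ι) := by
  have : unitBox ι = Set.univ.pi fun _ => Ioc (0 : ℝ) 1 := by ext; simp [unitBox]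
  rw [this]
  exact MeasurableSet.univ_pi fun _ => measurableSet_Ioc

theorem volume_unitBox : volume (unitBox ι) = 1 := by
  have : unitBox ι = Set.univ.pi fun _ => Ioc (0 : ℝ) 1 := by ext; simp [unitBox]
  rw [this, Real.volume_pi_Ioc]
  simp

theorem unitBox_translates_disjoint :
    Pairwise (Function.onFun Disjoint
      fun k : ι → ℤ => (fun x : ι → ℝ => x + fun i => (k i : ℝ)) ⁻¹' unitBox ι) := by
  intro k l hkl
  rw [Function.onFun, Set.disjoint_left]
  intro x hx hy
  apply hkl
  ext i
  have h1 := hx i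
  have h2 := hy i
  simp only [Pi.add_apply, mem_Ioc] at h1 h2
  have h3 : (k i : ℝ) < l i + 1 := by linarith
  have h4 : (l i : ℝ) < k i + 1 := by linarith
  norm_cast at h3 h4
  omega

theorem iUnion_unitBox_translates :
    ⋃ k : ι → ℤ, (fun x : ι → ℝ => x + fun i => (k i : ℝ)) ⁻¹' unitBox ι = univ := by
  refine eq_univ_of_forall fun x => mem_iUnion.mpr ⟨fun i => 1 - ⌈x i⌉, fun i => ?_⟩
  simp only [Pi.add_apply, mem_Ioc]
  push_cast
  have := Int.ceil_lt_add_one (x i)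
  have := Int.le_ceil (x i)
  constructor <;> linarith

theorem measurableSet_unitBox_translate (k : ι → ℤ) :
    MeasurableSet ((fun x : ι → ℝ => x + fun i => (k i : ℝ)) ⁻¹' unitBox ι) :=
  measurableSet_unitBox.preimage (by fun_prop)

theorem lintegral_eq_tsum_unitBox (g : (ι → ℝ) → ENNReal) :
    ∫⁻ x, g x = ∑' k : ι → ℤ, ∫⁻ x in unitBox ι, g (x + fun i => (k i : ℝ)) := by
  rw [← setLIntegral_univ, ← iUnion_unitBox_translates,
    lintegral_iUnion measurableSet_unitBox_translate unitBox_translates_disjoint,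
    ← (Equiv.neg (ι → ℤ)).tsum_eq]
  refine tsum_congr fun k => ?_
  have hmp := measurePreserving_add_right (volume : Measure (ι → ℝ)) fun i => (((-k) i : ℤ) : ℝ)
  have h := hmp.setLIntegral_comp_preimage_emb (measurableEmbedding_addRight _)
    (fun y => g (y + fun i => (k i : ℝ))) (unitBox ι)
  rw [← h]
  refine lintegral_congr fun x => ?_
  congr 1
  ext i
  simp

theorem hasSum_integral_unitBox {E : Type*} [NormedAddCommGroup E] [NormedSpace ℝ E]
    {g : (ι → ℝ) → E} (hg : Integrable g) :
    HasSum (fun k : ι → ℤ => ∫ x in unitBox ι, g (x + fun i => (k i : ℝ))) (∫ x, g x) := by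
  have h0 := hasSum_integral_iUnion (μ := volume) (f := g)
    (measurableSet_unitBox_translate (ι := ι))
    unitBox_translates_disjoint hg.integrableOn
  rw [iUnion_unitBox_translates, setIntegral_univ] at h0
  rw [← (Equiv.neg (ι → ℤ)).hasSum_iff] at h0
  convert! h0 using 1
  ext k
  have hmp := measurePreserving_add_right (volume : Measure (ι → ℝ)) fun i => (((-k) i : ℤ) : ℝ)
  have h := hmp.setIntegral_preimage_emb (measurableEmbedding_addRight _)
    (fun y => g (y + fun i => (k i : ℝ))) (unitBox ι)
  simp only [Function.comp_apply, Equiv.neg_apply]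
  rw [← h]
  refine integral_congr_ae (Filter.Eventually.of_forall fun x => ?_)
  simp only
  congr 1
  ext i
  simp

end UnitBox

end

section
open MeasureTheory Set Matrix

section GaussianPoisson
variable {ι : Type*} [Fintype ι]

theorem summable_pi_prod {κ : Type*} {f : κ → ℝ} (h0 : ∀ j, 0 ≤ f j) (hf : Summable f) :
    Summable fun k : ι → κ => ∏ i, f (k i) := by
  classical
  refine summable_of_sum_le (c := ∏ _i : ι, ∑' j, f j)
    (fun k => Finset.prod_nonneg fun i _ => h0 _) fun s => ?_
  have hs : s ⊆ Fintype.piFinset fun i => s.image fun k => k i := by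
    intro k hk
    rw [Fintype.mem_piFinset]
    exact fun i => Finset.mem_image_of_mem _ hk
  refine (Finset.sum_le_sum_of_subset_of_nonneg hs
    fun k _ _ => Finset.prod_nonneg fun i _ => h0 _).trans ?_
  rw [← Finset.prod_univ_sum (fun i => s.image fun k => k i) fun _ j => f j]
  exact Finset.prod_le_prod (fun i _ => Finset.sum_nonneg fun j _ => h0 j)
    fun i _ => hf.sum_le_tsum _ fun j _ => h0 j

theorem summable_exp_neg_mul_int_sq {c : ℝ} (hc : 0 < c) :
    Summable fun j : ℤ => Real.exp (-(c * (j : ℝ) ^ 2)) := by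
  have h1 : Summable fun n : ℕ => Real.exp (-(c * (n : ℝ) ^ 2)) := by
    refine Summable.of_nonneg_of_le (fun n => (Real.exp_pos _).le) (fun n => ?_)
      (Real.summable_exp_nat_mul_iff.mpr (neg_lt_zero.mpr hc))
    apply Real.exp_le_exp.mpr
    have : (n : ℝ) ≤ (n : ℝ) ^ 2 := by exact_mod_cast Nat.le_self_pow two_ne_zero n
    nlinarith
  refine Summable.of_nat_of_neg (by simpa using h1) (by simpa using h1)

theorem summable_exp_neg_mul_sum_sq {c : ℝ} (hc : 0 < c) :
    Summable fun k : ι → ℤ => Real.exp (-(c * ∑ i, (k i : ℝ) ^ 2)) := by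
  refine (summable_pi_prod (ι := ι) (f := fun j : ℤ => Real.exp (-(c * (j : ℝ) ^ 2)))
    (fun j => (Real.exp_pos _).le) (summable_exp_neg_mul_int_sq hc)).congr fun k => ?_
  rw [← Real.exp_sum, Finset.mul_sum, Finset.sum_neg_distrib]

/-- The real quadratic form `v ↦ ‖B v‖²`. -/
noncomputable def gramForm (B : Matrix ι ι ℝ) (v : ι → ℝ) : ℝ := ∑ i, (B *ᵥ v) i ^ 2

theorem continuous_gramForm (B : Matrix ι ι ℝ) : Continuous (gramForm B) := by
  have : Continuous fun v => B *ᵥ v := by fun_prop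
  unfold gramForm
  fun_prop

theorem exists_le_gramForm [DecidableEq ι] {B : Matrix ι ι ℝ} (hB : B.det ≠ 0) :
    ∃ c : ℝ, 0 < c ∧ ∀ v, c * ∑ i, v i ^ 2 ≤ gramForm B v := by
  have hu : IsUnit B.det := hB.isUnit
  set S : ℝ := ∑ i, ∑ j, (B⁻¹ i j) ^ 2
  have hS : 0 ≤ S := by positivity
  refine ⟨(S + 1)⁻¹, by positivity, fun v => ?_⟩
  rw [inv_mul_le_iff₀ (by positivity)]
  have hv : v = B⁻¹ *ᵥ (B *ᵥ v) := by rw [mulVec_mulVec, nonsing_inv_mul _ hu, one_mulVec]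
  have hg : 0 ≤ gramForm B v := by unfold gramForm; positivity
  calc ∑ i, v i ^ 2 ≤ ∑ i, (∑ j, (B⁻¹ i j) ^ 2) * gramForm B v := by
        refine Finset.sum_le_sum fun i _ => ?_
        conv_lhs => rw [hv]
        exact Finset.sum_mul_sq_le_sq_mul_sq _ _ _
    _ = S * gramForm B v := by rw [← Finset.sum_mul]
    _ ≤ (S + 1) * gramForm B v := by nlinarith

theorem exp_gramForm_translate_le {B : Matrix ι ι ℝ} {c : ℝ} (hc : 0 < c)
    (h : ∀ v, c * ∑ i, v i ^ 2 ≤ gramForm B v) {R : ℝ} {v : ι → ℝ} (hv : ∀ i, |v i| ≤ R)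
    (k : ι → ℤ) :
    Real.exp (-(Real.pi * gramForm B (v + fun i => (k i : ℝ)))) ≤
      Real.exp (Real.pi * c * ∑ _i : ι, R ^ 2) *
        Real.exp (-(Real.pi * c / 2 * ∑ i, (k i : ℝ) ^ 2)) := by
  rw [← Real.exp_add]
  apply Real.exp_le_exp.mpr
  have h1 := h (v + fun i => (k i : ℝ))
  have h2 : ∑ i, (k i : ℝ) ^ 2 ≤ 2 * ∑ i, (v + fun i => (k i : ℝ)) i ^ 2 + 2 * ∑ _i : ι, R ^ 2 := by
    rw [Finset.mul_sum, Finset.mul_sum, ← Finset.sum_add_distrib]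
    refine Finset.sum_le_sum fun i _ => ?_
    simp only [Pi.add_apply]
    have : v i ^ 2 ≤ R ^ 2 := sq_le_sq' (abs_le.mp (hv i)).1 (abs_le.mp (hv i)).2
    nlinarith [sq_nonneg (2 * v i + k i)]
  have hp := Real.pi_pos
  have h3 := mul_le_mul_of_nonneg_left h1 hp.le
  have h4 := mul_le_mul_of_nonneg_left h2 (by positivity : 0 ≤ Real.pi * c / 2)
  nlinarith

theorem summable_exp_gramForm_translate [DecidableEq ι] {B : Matrix ι ι ℝ} (hB : B.det ≠ 0)
    (v : ι → ℝ) :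
    Summable fun k : ι → ℤ => Real.exp (-(Real.pi * gramForm B (v + fun i => (k i : ℝ)))) := by
  obtain ⟨c, hc, h⟩ := exists_le_gramForm hB
  have hR : ∀ i, |v i| ≤ ∑ i, |v i| := fun i =>
    Finset.single_le_sum (f := fun i => |v i|) (fun j _ => abs_nonneg _) (Finset.mem_univ i)
  have hp : 0 < Real.pi * c / 2 := by have := Real.pi_pos; positivity
  have hs := (summable_exp_neg_mul_sum_sq (ι := ι) hp).mul_left
    (Real.exp (Real.pi * c * ∑ _i : ι, (∑ i, |v i|) ^ 2))
  exact Summable.of_nonneg_of_le (fun k => (Real.exp_pos _).le)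
    (fun k => exp_gramForm_translate_le hc h hR k) hs

/-- The periodization of a Gaussian. -/
noncomputable def gaussPeriod (B : Matrix ι ι ℝ) (v : ι → ℝ) : ℝ :=
  ∑' k : ι → ℤ, Real.exp (-(Real.pi * gramForm B (v + fun i => (k i : ℝ))))

theorem continuous_gaussPeriod [DecidableEq ι] {B : Matrix ι ι ℝ} (hB : B.det ≠ 0) :
    Continuous (gaussPeriod B) := by
  obtain ⟨c, hc, h⟩ := exists_le_gramForm hB
  rw [continuous_iff_continuousAt]
  intro v
  have hball : Metric.ball v 1 ∈ nhds v := Metric.ball_mem_nhds v one_pos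
  refine ContinuousOn.continuousAt (s := Metric.ball v 1) ?_ hball
  have hp : 0 < Real.pi * c / 2 := by have := Real.pi_pos; positivity
  have hs := (summable_exp_neg_mul_sum_sq (ι := ι) hp).mul_left
    (Real.exp (Real.pi * c * ∑ _i : ι, (‖v‖ + 1) ^ 2))
  refine continuousOn_tsum (fun k => ?_) hs fun k w hw => ?_
  · have := continuous_gramForm B
    exact Continuous.continuousOn (by fun_prop)
  · rw [Real.norm_eq_abs, Real.abs_exp]
    refine exp_gramForm_translate_le hc h (fun i => ?_) k
    rw [Metric.mem_ball, dist_eq_norm] at hw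
    have h1 : ‖w i‖ ≤ ‖w‖ := norm_le_pi_norm w i
    have h2 := norm_sub_norm_le w v
    rw [Real.norm_eq_abs] at h1
    linarith

theorem gaussPeriod_add_int (B : Matrix ι ι ℝ) (v : ι → ℝ) (m : ι → ℤ) :
    gaussPeriod B (v + fun i => (m i : ℝ)) = gaussPeriod B v := by
  unfold gaussPeriod
  rw [← (Equiv.addLeft m).tsum_eq fun k : ι → ℤ =>
    Real.exp (-(Real.pi * gramForm B (v + fun i => (k i : ℝ))))]
  refine tsum_congr fun k => ?_
  congr 4
  ext i
  simp [add_assoc]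

theorem integrable_exp_gramForm [DecidableEq ι] {B : Matrix ι ι ℝ} (hB : B.det ≠ 0) :
    Integrable fun v : ι → ℝ => Real.exp (-(Real.pi * gramForm B v)) := by
  obtain ⟨c, hc, h⟩ := exists_le_gramForm hB
  have hp := Real.pi_pos
  have h1 : Integrable fun v : ι → ℝ => ∏ i, Real.exp (-(Real.pi * c) * (v i) ^ 2) :=
    Integrable.fintype_prod (f := fun _ x => Real.exp (-(Real.pi * c) * x ^ 2))
      fun i => integrable_exp_neg_mul_sq (by positivity)
  refine h1.mono' ?_ (Filter.Eventually.of_forall fun v => ?_)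
  · have := continuous_gramForm B
    exact Continuous.aestronglyMeasurable (by fun_prop)
  · rw [Real.norm_eq_abs, Real.abs_exp, ← Real.exp_sum, ← Finset.mul_sum]
    apply Real.exp_le_exp.mpr
    have := mul_le_mul_of_nonneg_left (h v) hp.le
    linarith

theorem integral_char_mul_gauss [DecidableEq ι] {B : Matrix ι ι ℝ} (hB : B.det ≠ 0) (n : ι → ℝ) :
    ∫ v : ι → ℝ, Complex.exp (-(2 * Real.pi * Complex.I * ∑ i, (n i : ℂ) * v i)) *
      (Real.exp (-(Real.pi * gramForm B v)) : ℂ) =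
      ((|B.det|⁻¹ * Real.exp (-(Real.pi * ∑ i, (n ᵥ* B⁻¹) i ^ 2)) : ℝ) : ℂ) := by
  have hu : IsUnit B.det := hB.isUnit
  have hp := Real.pi_pos
  set m := n ᵥ* B⁻¹ with hm
  have key := GaussianFourier.integral_cexp_neg_mul_sum_add (b := (Real.pi : ℂ))
    (by rw [Complex.ofReal_re]; exact hp) (fun i => -(2 * Real.pi * Complex.I * (m i : ℂ)))
  have hmap := Real.map_matrix_volume_pi_eq_smul_volume_pi hB
  have hemb : MeasurableEmbedding (toLin' B) :=
    ((LinearEquiv.ofIsUnitDet (f := toLin' B) (v := Pi.basisFun ℝ ι) (v' := Pi.basisFun ℝ ι)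
      (by simpa [LinearMap.toMatrix_eq_toMatrix'] using hu)).toContinuousLinearEquiv).toHomeomorph.measurableEmbedding
  have h2 := hemb.integral_map (μ := volume) (fun w : ι → ℝ =>
    Complex.exp (-(Real.pi : ℂ) * ∑ i, (w i : ℂ) ^ 2 + ∑ i, -(2 * Real.pi * Complex.I * (m i : ℂ)) * w i))
  rw [hmap, integral_smul_measure, key] at h2
  have h3 : ∀ v : ι → ℝ, Complex.exp (-(2 * Real.pi * Complex.I * ∑ i, (n i : ℂ) * v i)) *
      (Real.exp (-(Real.pi * gramForm B v)) : ℂ) = Complex.exp (-(Real.pi : ℂ) *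
      ∑ i, ((toLin' B v) i : ℂ) ^ 2 + ∑ i, -(2 * Real.pi * Complex.I * (m i : ℂ)) * (toLin' B v) i) := by
    intro v
    have e1 : ∑ i, (n i : ℂ) * v i = ∑ i, (m i : ℂ) * (toLin' B v) i := by
      have : n ⬝ᵥ v = m ⬝ᵥ (B *ᵥ v) := by
        rw [hm, dotProduct_mulVec, vecMul_vecMul, nonsing_inv_mul _ hu, vecMul_one]
      simp only [dotProduct] at this
      rw [toLin'_apply]
      exact_mod_cast this
    rw [Complex.ofReal_exp, ← Complex.exp_add, e1, toLin'_apply, gramForm]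
    congr 1
    push_cast
    simp only [neg_mul, Finset.sum_neg_distrib, mul_assoc, ← Finset.mul_sum]
    ring
  rw [integral_congr_ae (Filter.Eventually.of_forall h3), ← h2]
  rw [ENNReal.toReal_ofReal (abs_nonneg _), div_self (by exact_mod_cast hp.ne'), Complex.one_cpow,
    one_mul, abs_inv, Complex.real_smul]
  push_cast
  congr 2
  rw [div_eq_iff (by simp [hp.ne'])]
  simp only [neg_sq, mul_pow, Complex.I_sq, ← Finset.mul_sum]
  ring

end GaussianPoisson

end

section
open MeasureTheory Set Matrix

section GaussianPoisson
variable {ι : Type*} [Fintype ι]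

noncomputable local instance : MeasureSpace UnitAddCircle := ⟨AddCircle.haarAddCircle⟩

/-- The quotient map from real vectors to the torus. -/
def toTorus (v : ι → ℝ) : UnitAddTorus ι := fun i => (v i : UnitAddCircle)

omit [Fintype ι] in
theorem isOpenQuotientMap_toTorus : IsOpenQuotientMap (toTorus (ι := ι)) :=
  IsOpenQuotientMap.piMap fun _ => QuotientAddGroup.isOpenQuotientMap_mk

omit [Fintype ι] in
theorem exists_int_of_toTorus_eq {v w : ι → ℝ} (h : toTorus v = toTorus w) :
    ∃ m : ι → ℤ, v = w + fun i => (m i : ℝ) := by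
  have : ∀ i, ∃ m : ℤ, v i = w i + m := by
    intro i
    have hi : ((v i : ℝ) : UnitAddCircle) = (w i : ℝ) := congrFun h i
    rw [← sub_eq_zero, ← AddCircle.coe_sub, AddCircle.coe_eq_zero_iff] at hi
    obtain ⟨m, hm⟩ := hi
    rw [zsmul_eq_mul, mul_one] at hm
    exact ⟨m, by linarith⟩
  choose m hm using this
  exact ⟨m, funext hm⟩

theorem mFourier_neg_toTorus (n : ι → ℤ) (v : ι → ℝ) :
    UnitAddTorus.mFourier (-n) (toTorus v) =
      Complex.exp (-(2 * Real.pi * Complex.I * ∑ i, ((n i : ℝ) : ℂ) * v i)) := by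
  simp only [UnitAddTorus.mFourier, toTorus, ContinuousMap.coe_mk, fourier_coe_apply,
    ← Complex.exp_sum, Pi.neg_apply]
  congr 1
  rw [Finset.mul_sum, ← Finset.sum_neg_distrib]
  refine Finset.sum_congr rfl fun i _ => ?_
  push_cast
  ring

/-- The periodized Gaussian as a function on the torus. -/
noncomputable def gaussTorus [DecidableEq ι] {B : Matrix ι ι ℝ} (hB : B.det ≠ 0) :
    C(UnitAddTorus ι, ℂ) where
  toFun t := (gaussPeriod B (Function.surjInv isOpenQuotientMap_toTorus.surjective t) : ℂ)
  continuous_toFun := by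
    rw [isOpenQuotientMap_toTorus.isQuotientMap.continuous_iff]
    have h : (fun t => (gaussPeriod B
        (Function.surjInv isOpenQuotientMap_toTorus.surjective t) : ℂ)) ∘ toTorus =
        fun v => (gaussPeriod B v : ℂ) := by
      funext v
      obtain ⟨m, hm⟩ := exists_int_of_toTorus_eq
        (Function.surjInv_eq isOpenQuotientMap_toTorus.surjective (toTorus v))
      simp only [Function.comp_apply]
      rw [hm, gaussPeriod_add_int]
    rw [h]
    exact Complex.continuous_ofReal.comp (continuous_gaussPeriod hB)

theorem gaussTorus_toTorus [DecidableEq ι] {B : Matrix ι ι ℝ} (hB : B.det ≠ 0) (v : ι → ℝ) :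
    gaussTorus hB (toTorus v) = gaussPeriod B v := by
  obtain ⟨m, hm⟩ := exists_int_of_toTorus_eq
    (Function.surjInv_eq isOpenQuotientMap_toTorus.surjective (toTorus v))
  simp only [gaussTorus, ContinuousMap.coe_mk]
  rw [hm, gaussPeriod_add_int]

theorem mFourierCoeff_gaussTorus [DecidableEq ι] {B : Matrix ι ι ℝ} (hB : B.det ≠ 0) (n : ι → ℤ) :
    UnitAddTorus.mFourierCoeff (gaussTorus hB) n =
      ((|B.det|⁻¹ * Real.exp (-(Real.pi * ∑ i, ((fun i => (n i : ℝ)) ᵥ* B⁻¹) i ^ 2)) : ℝ) : ℂ) := by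
  rw [UnitAddTorus.mFourierCoeff_eq_integral _ n 0]
  set e : (ι → ℝ) → ℂ := fun v =>
    Complex.exp (-(2 * Real.pi * Complex.I * ∑ i, ((n i : ℝ) : ℂ) * v i)) with he
  set G : (ι → ℝ) → ℂ := fun v => e v * (Real.exp (-(Real.pi * gramForm B v)) : ℂ) with hG
  have hecont : Continuous e := by rw [he]; fun_prop
  have henorm : ∀ v, ‖e v‖ = 1 := by
    intro v
    simp only [he]
    rw [show -(2 * (Real.pi : ℂ) * Complex.I * ∑ i, ((n i : ℝ) : ℂ) * v i) =
      ((-(2 * Real.pi * ∑ i, (n i : ℝ) * v i) : ℝ) : ℂ) * Complex.I by push_cast; ring]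
    exact Complex.norm_exp_ofReal_mul_I _
  have hGcont : Continuous G := by
    have := continuous_gramForm B
    rw [hG]
    exact hecont.mul (Complex.continuous_ofReal.comp (by fun_prop))
  have hGnorm : ∀ v, ‖G v‖ = Real.exp (-(Real.pi * gramForm B v)) := by
    intro v
    simp only [hG]
    rw [norm_mul, henorm, one_mul, Complex.norm_real, Real.norm_eq_abs, Real.abs_exp]
  have hGint : Integrable G := by
    refine (integrable_exp_gramForm hB).mono' hGcont.aestronglyMeasurable
      (Filter.Eventually.of_forall fun v => (hGnorm v).le)
  have heper : ∀ (v : ι → ℝ) (k : ι → ℤ), e (v + fun i => (k i : ℝ)) = e v := by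
    intro v k
    have : toTorus (v + fun i => (k i : ℝ)) = toTorus v := by
      funext i
      simp [toTorus]
    simp only [he]
    rw [← mFourier_neg_toTorus, ← mFourier_neg_toTorus, this]
  have hsum := hasSum_integral_unitBox hGint
  have hsumN := (hasSum_integral_unitBox hGint.norm).summable
  have hsum2 := hasSum_integral_of_summable_integral_norm
    (μ := (volume : Measure (ι → ℝ)).restrict (unitBox ι))
    (F := fun (k : ι → ℤ) v => G (v + fun i => (k i : ℝ)))
    (fun k => (hGint.comp_add_right _).integrableOn) hsumN
  rw [← integral_char_mul_gauss hB]
  change _ = ∫ v, G v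
  have hset : {x : ι → ℝ | ∀ i, x i ∈ Ioc ((0 : ι → ℝ) i) ((0 : ι → ℝ) i + 1)} = unitBox ι := by
    simp [unitBox]
  rw [hset, hsum.unique hsum2]
  refine setIntegral_congr_fun measurableSet_unitBox fun v _ => ?_
  change UnitAddTorus.mFourier (-n) (toTorus v) • gaussTorus hB (toTorus v) =
    ∑' k : ι → ℤ, G (v + fun i => (k i : ℝ))
  rw [mFourier_neg_toTorus, gaussTorus_toTorus]
  simp only [smul_eq_mul, hG, heper]
  rw [tsum_mul_left, gaussPeriod, Complex.ofReal_tsum]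

/-- Poisson summation for Gaussians of a lattice. -/
theorem tsum_exp_gramForm [DecidableEq ι] {B : Matrix ι ι ℝ} (hB : B.det ≠ 0) :
    ∑' k : ι → ℤ, Real.exp (-(Real.pi * gramForm B fun i => (k i : ℝ))) =
      |B.det|⁻¹ * ∑' n : ι → ℤ, Real.exp (-(Real.pi * gramForm B⁻¹ᵀ fun i => (n i : ℝ))) := by
  have hu : IsUnit B.det := hB.isUnit
  have hB' : (B⁻¹ᵀ).det ≠ 0 := by
    rw [det_transpose, det_nonsing_inv, Ring.inverse_eq_inv']
    exact inv_ne_zero hB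
  have hs : Summable fun n : ι → ℤ =>
      |B.det|⁻¹ * Real.exp (-(Real.pi * gramForm B⁻¹ᵀ fun i => (n i : ℝ))) := by
    have := summable_exp_gramForm_translate hB' 0
    simp only [zero_add] at this
    exact this.mul_left _
  have hc : UnitAddTorus.mFourierCoeff (gaussTorus hB) = fun n : ι → ℤ =>
      ((|B.det|⁻¹ * Real.exp (-(Real.pi * gramForm B⁻¹ᵀ fun i => (n i : ℝ))) : ℝ) : ℂ) := by
    funext n
    rw [mFourierCoeff_gaussTorus]
    simp only [gramForm, mulVec_transpose]
  have h := UnitAddTorus.hasSum_mFourier_series_apply_of_summable (f := gaussTorus hB)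
    (by rw [hc]; exact_mod_cast hs) (toTorus 0)
  rw [gaussTorus_toTorus, hc] at h
  have h1 : ∀ n : ι → ℤ, UnitAddTorus.mFourier n (toTorus (0 : ι → ℝ)) = 1 := by
    intro n
    have := mFourier_neg_toTorus (-n) (0 : ι → ℝ)
    simpa using this
  simp only [h1, smul_eq_mul, mul_one] at h
  have h2 := h.tsum_eq
  rw [← Complex.ofReal_tsum, tsum_mul_left] at h2
  have h3 := Complex.ofReal_injective h2
  rw [h3, gaussPeriod]
  simp only [zero_add]

end GaussianPoisson

end

section NumberFieldTheta
open Module Matrix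
open scoped Classical

variable {K : Type*} [Field K] [NumberField K]

theorem sum_embeddings_eq_sum_places (f : InfinitePlace K → ℝ) :
    ∑ σ : K →+* ℂ, f (InfinitePlace.mk σ) = ∑ w : InfinitePlace K, w.mult * f w := by
  rw [← Finset.sum_fiberwise Finset.univ (fun σ : K →+* ℂ => InfinitePlace.mk σ)]
  refine Finset.sum_congr rfl fun w _ => ?_
  rw [Finset.sum_congr rfl (g := fun _ => f w) (by intro σ hσ; simp at hσ; rw [hσ]),
    Finset.sum_const, InfinitePlace.card_filter_mk_eq, nsmul_eq_mul]

theorem prod_embeddings_eq_prod_places (f : InfinitePlace K → ℝ) :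
    ∏ σ : K →+* ℂ, f (InfinitePlace.mk σ) = ∏ w : InfinitePlace K, f w ^ w.mult := by
  rw [← Finset.prod_fiberwise Finset.univ (fun σ : K →+* ℂ => InfinitePlace.mk σ)]
  refine Finset.prod_congr rfl fun w _ => ?_
  rw [Finset.prod_congr rfl (g := fun _ => f w) (by intro σ hσ; simp at hσ; rw [hσ]),
    Finset.prod_const, InfinitePlace.card_filter_mk_eq]

/-- Sums over embeddings which are odd under complex conjugation vanish. -/
theorem sum_embeddings_odd (f : (K →+* ℂ) → ℝ)
    (hf : ∀ σ, f (ComplexEmbedding.conjugate σ) = -f σ) : ∑ σ, f σ = 0 := by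
  have h := Equiv.sum_comp
    (Function.Involutive.toPerm _ (ComplexEmbedding.involutive_conjugate K)) f
  have h2 : ∑ σ, f σ = -∑ σ, f σ := by
    rw [← Finset.sum_neg_distrib, ← h]
    exact Finset.sum_congr rfl fun σ _ => hf σ
  linarith

/-- The weighted sum of squares of the absolute values of `x` at the infinite places. -/
noncomputable def placeForm (y : InfinitePlace K → ℝ) (x : K) : ℝ :=
  ∑ w : InfinitePlace K, w.mult * (y w * w x ^ 2)

/-- The real matrix with entries `re + s * im` of the conjugates of a basis. -/
noncomputable def casMatrix (s : ℝ) (b : (K →+* ℂ) → K) :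
    Matrix (K →+* ℂ) (K →+* ℂ) ℝ :=
  of fun σ i => (σ (b i)).re + s * (σ (b i)).im

noncomputable def sqrtDiag (y : InfinitePlace K → ℝ) :
    Matrix (K →+* ℂ) (K →+* ℂ) ℝ := diagonal fun σ => √(y (InfinitePlace.mk σ))

theorem placeForm_eq_sum_embeddings (y : InfinitePlace K → ℝ) (x : K) :
    placeForm y x = ∑ σ : K →+* ℂ, y (InfinitePlace.mk σ) * ‖σ x‖ ^ 2 := by
  rw [placeForm, ← sum_embeddings_eq_sum_places (fun w => y w * w x ^ 2)]
  simp only [InfinitePlace.apply]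

theorem gramForm_casMatrix {s : ℝ} (hs : s ^ 2 = 1) {y : InfinitePlace K → ℝ}
    (hy : ∀ w, 0 ≤ y w) (b : (K →+* ℂ) → K) (k : (K →+* ℂ) → ℤ) :
    gramForm (sqrtDiag y * casMatrix s b) (fun i => (k i : ℝ)) =
      placeForm y (∑ i, k i • b i) := by
  set x := ∑ i, k i • b i with hx
  have h1 : ∀ σ : K →+* ℂ, ((sqrtDiag y * casMatrix s b) *ᵥ (fun i => (k i : ℝ))) σ =
      √(y (InfinitePlace.mk σ)) * ((σ x).re + s * (σ x).im) := by
    intro σ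
    rw [← mulVec_mulVec, sqrtDiag, mulVec_diagonal]
    congr 1
    simp only [casMatrix, mulVec, dotProduct, of_apply, hx, map_sum, zsmul_eq_mul,
      Complex.re_sum, Complex.im_sum, Finset.mul_sum, ← Finset.sum_add_distrib]
    refine Finset.sum_congr rfl fun i _ => ?_
    simp
    ring
  rw [placeForm_eq_sum_embeddings, gramForm]
  simp only [h1, mul_pow, Real.sq_sqrt (hy _)]
  have h2 : ∀ σ : K →+* ℂ, y (InfinitePlace.mk σ) * ((σ x).re + s * (σ x).im) ^ 2 =
      y (InfinitePlace.mk σ) * ‖σ x‖ ^ 2 +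
        2 * s * (y (InfinitePlace.mk σ) * ((σ x).re * (σ x).im)) := by
    intro σ
    rw [Complex.sq_norm, Complex.normSq_apply]
    linear_combination y (InfinitePlace.mk σ) * (σ x).im ^ 2 * hs
  simp only [h2]
  rw [Finset.sum_add_distrib, ← Finset.mul_sum, add_eq_left]
  refine mul_eq_zero_of_right _ (sum_embeddings_odd _ fun σ => ?_)
  rw [InfinitePlace.mk_conjugate_eq, ComplexEmbedding.conjugate_coe_eq]
  simp

theorem casMatrix_transpose_mul (b b' : (K →+* ℂ) → K) :
    (casMatrix 1 b)ᵀ * casMatrix (-1) b' =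
      of fun i j => ((Algebra.trace ℚ K (b i * b' j) : ℚ) : ℝ) := by
  ext i j
  rw [mul_apply]
  have h1 : ((Algebra.trace ℚ K (b i * b' j) : ℚ) : ℝ) =
      ∑ σ : K →+* ℂ, (σ (b i) * σ (b' j)).re := by
    have := trace_eq_sum_embeddings (K := ℚ) (L := K) ℂ (x := b i * b' j)
    have h2 := congrArg Complex.re this
    rw [← (RingHom.equivRatAlgHom K ℂ).symm.sum_comp] at *
    rw [Complex.re_sum] at h2
    simpa using h2
  simp only [transpose_apply, casMatrix, of_apply, h1]
  have h3 : ∀ σ : K →+* ℂ, ((σ (b i)).re + 1 * (σ (b i)).im) *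
      ((σ (b' j)).re + -1 * (σ (b' j)).im) = (σ (b i) * σ (b' j)).re +
        ((σ (b i)).im * (σ (b' j)).re - (σ (b i)).re * (σ (b' j)).im) := by
    intro σ
    rw [Complex.mul_re]; ring
  simp only [h3]
  rw [Finset.sum_add_distrib, add_eq_left]
  refine sum_embeddings_odd _ fun σ => ?_
  rw [ComplexEmbedding.conjugate_coe_eq, ComplexEmbedding.conjugate_coe_eq]
  simp
  ring

theorem abs_det_casMatrix_neg (b : (K →+* ℂ) → K) :
    |(casMatrix (-1) b).det| = |(casMatrix 1 b).det| := by
  have : casMatrix (-1) b = (casMatrix 1 b).submatrix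
      (Function.Involutive.toPerm _ (ComplexEmbedding.involutive_conjugate K)) id := by
    ext σ i
    simp [casMatrix, ComplexEmbedding.conjugate_coe_eq]
  rw [this, det_permute, abs_mul]
  rcases Int.units_eq_one_or (Equiv.Perm.sign
    (Function.Involutive.toPerm _ (ComplexEmbedding.involutive_conjugate K))) with h | h <;>
  rw [h] <;> simp

theorem det_casMatrix_sq (b : Basis (K →+* ℂ) ℚ K) :
    |(casMatrix 1 b).det| ^ 2 = |((Algebra.discr ℚ b : ℚ) : ℝ)| := by
  have h := casMatrix_transpose_mul (K := K) b b
  have h2 := congrArg det h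
  rw [det_mul, det_transpose] at h2
  have h3 : (of fun i j => ((Algebra.trace ℚ K (b i * b j) : ℚ) : ℝ)).det =
      ((Algebra.discr ℚ b : ℚ) : ℝ) := by
    rw [Algebra.discr_def, ← Rat.coe_castHom, RingHom.map_det]
    rfl
  rw [← h3, ← h2, abs_mul, abs_det_casMatrix_neg, sq]

theorem det_casMatrix_ne_zero (b : Basis (K →+* ℂ) ℚ K) : (casMatrix 1 b).det ≠ 0 := by
  have h := det_casMatrix_sq b
  intro h0
  rw [h0] at h
  have := Algebra.discr_not_zero_of_basis ℚ b
  exact this (by simpa using h.symm)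

theorem det_sqrtDiag {y : InfinitePlace K → ℝ} (hy : ∀ w, 0 ≤ y w) :
    (sqrtDiag y).det = √(∏ w : InfinitePlace K, y w ^ w.mult) := by
  rw [sqrtDiag, det_diagonal, ← prod_embeddings_eq_prod_places, Real.sqrt_prod]
  intro i _; exact hy _

theorem casMatrix_inverse_transpose {y : InfinitePlace K → ℝ} (hy : ∀ w, 0 < y w)
    (b : Basis (K →+* ℂ) ℚ K) :
    (sqrtDiag y * casMatrix 1 b)⁻¹ᵀ = sqrtDiag (fun w => (y w)⁻¹) * casMatrix (-1) b.traceDual := by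
  rw [transpose_nonsing_inv]
  refine inv_eq_right_inv ?_
  rw [transpose_mul, Matrix.mul_assoc, ← Matrix.mul_assoc (sqrtDiag y)ᵀ]
  have h1 : (sqrtDiag y)ᵀ * sqrtDiag (fun w => (y w)⁻¹) = 1 := by
    rw [sqrtDiag, sqrtDiag, diagonal_transpose, diagonal_mul_diagonal, ← diagonal_one]
    congr 1
    funext σ
    rw [Real.sqrt_inv, mul_inv_cancel₀ (Real.sqrt_ne_zero'.mpr (hy _))]
  rw [h1, Matrix.one_mul, casMatrix_transpose_mul]
  ext i j
  rw [of_apply, Basis.trace_mul_traceDual, one_apply]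
  split_ifs <;> simp

theorem tsum_placeForm {y : InfinitePlace K → ℝ} (hy : ∀ w, 0 < y w)
    (b : Basis (K →+* ℂ) ℚ K) :
    ∑' k : (K →+* ℂ) → ℤ, Real.exp (-(Real.pi * placeForm y (∑ i, k i • b i))) =
      (√(∏ w : InfinitePlace K, y w ^ w.mult) * √|((Algebra.discr ℚ b : ℚ) : ℝ)|)⁻¹ *
      ∑' k : (K →+* ℂ) → ℤ, Real.exp
        (-(Real.pi * placeForm (fun w => (y w)⁻¹) (∑ i, k i • b.traceDual i))) := by
  have hd : (sqrtDiag y).det ≠ 0 := by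
    rw [det_sqrtDiag fun w => (hy w).le]
    exact (Real.sqrt_pos.mpr (Finset.prod_pos fun w _ => pow_pos (hy w) _)).ne'
  have hB : (sqrtDiag y * casMatrix 1 b).det ≠ 0 := by
    rw [det_mul]; exact mul_ne_zero hd (det_casMatrix_ne_zero b)
  have h := tsum_exp_gramForm hB
  rw [casMatrix_inverse_transpose hy] at h
  simp only [gramForm_casMatrix (one_pow 2) (fun w => (hy w).le),
    gramForm_casMatrix (s := -1) (by norm_num) (fun w => (inv_pos.mpr (hy w)).le)] at h
  rw [h, det_mul, abs_mul, det_sqrtDiag fun w => (hy w).le, abs_of_nonneg (Real.sqrt_nonneg _),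
    ← det_casMatrix_sq, Real.sqrt_sq (abs_nonneg _)]

theorem exists_le_placeForm_basis (b : Basis (K →+* ℂ) ℚ K) :
    ∃ c, 0 < c ∧ ∀ k : (K →+* ℂ) → ℤ,
      c * ∑ i, (k i : ℝ) ^ 2 ≤ placeForm (fun _ => 1) (∑ i, k i • b i) := by
  have hd : (sqrtDiag (K := K) fun _ => 1).det ≠ 0 := by
    rw [det_sqrtDiag fun w => zero_le_one]; simp
  have hB : (sqrtDiag (fun _ => 1) * casMatrix 1 b).det ≠ 0 := by
    rw [det_mul]; exact mul_ne_zero hd (det_casMatrix_ne_zero b)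
  obtain ⟨c, hc, h⟩ := exists_le_gramForm hB
  refine ⟨c, hc, fun k => ?_⟩
  rw [← gramForm_casMatrix (one_pow 2) (fun w => zero_le_one)]
  exact h _

end NumberFieldTheta

section IdealTheta
open Module nonZeroDivisors
open scoped Classical

variable {K : Type*} [Field K] [NumberField K]

/-- The lattice points `∑ kᵢ bᵢ`, as an equivalence with the `ℤ`-span of `b`. -/
theorem exists_equiv_of_span {ι : Type*} [Fintype ι] (b : Basis ι ℚ K) (S : K → Prop)
    (hS : ∀ x, x ∈ Submodule.span ℤ (Set.range b) ↔ S x) :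
    ∃ e : (ι → ℤ) ≃ {x : K // S x}, ∀ k, (e k : K) = ∑ i, k i • b i := by
  let b' := b.restrictScalars ℤ
  refine ⟨b'.equivFun.symm.toEquiv.trans (Equiv.subtypeEquivRight hS), fun k => ?_⟩
  simp only [Equiv.trans_apply, LinearEquiv.coe_toEquiv, Basis.equivFun_symm_apply,
    Equiv.subtypeEquivRight_apply_coe, Submodule.coe_sum, Submodule.coe_smul]
  simp [b', Basis.restrictScalars_apply]

/-- The covolume of the lattice attached to a fractional ideal. -/
noncomputable def covol (J : (FractionalIdeal (𝓞 K)⁰ K)ˣ) : ℝ :=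
  ((FractionalIdeal.absNorm J.1 : ℚ) : ℝ) * √|(discr K : ℝ)|

theorem covol_pos (J : (FractionalIdeal (𝓞 K)⁰ K)ˣ) : 0 < covol J := by
  refine mul_pos ?_ (Real.sqrt_pos.mpr (abs_pos.mpr (by exact_mod_cast discr_ne_zero K)))
  have h0 := FractionalIdeal.absNorm_nonneg J.1
  have h1 : FractionalIdeal.absNorm J.1 ≠ 0 := by
    rw [Ne, FractionalIdeal.absNorm_eq_zero_iff]
    exact J.ne_zero
  exact_mod_cast lt_of_le_of_ne h0 h1.symm

theorem dual_unit_ne_zero (J : (FractionalIdeal (𝓞 K)⁰ K)ˣ) :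
    FractionalIdeal.dual ℤ ℚ J.1 ≠ 0 := FractionalIdeal.dual_ne_zero ℤ ℚ J.ne_zero

/-- The trace dual of a fractional ideal, as a unit. -/
noncomputable def dualUnit (J : (FractionalIdeal (𝓞 K)⁰ K)ˣ) : (FractionalIdeal (𝓞 K)⁰ K)ˣ :=
  Units.mk0 _ (dual_unit_ne_zero J)

theorem dualUnit_dualUnit (J : (FractionalIdeal (𝓞 K)⁰ K)ˣ) : dualUnit (dualUnit J) = J := by
  ext1
  exact FractionalIdeal.dual_dual ℤ ℚ J.1

theorem exists_basis_of_fractionalIdeal (J : (FractionalIdeal (𝓞 K)⁰ K)ˣ) :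
    ∃ b : Basis (K →+* ℂ) ℚ K,
      (∀ x, x ∈ Submodule.span ℤ (Set.range b) ↔ x ∈ J.1) ∧
      (∀ x, x ∈ Submodule.span ℤ (Set.range b.traceDual) ↔ x ∈ (dualUnit J).1) ∧
      √|((Algebra.discr ℚ b : ℚ) : ℝ)| = covol J := by
  have hc : Fintype.card (K →+* ℂ) = Fintype.card (Free.ChooseBasisIndex ℤ J.1) := by
    rw [NumberField.Embeddings.card, finrank_eq_card_basis (basisOfFractionalIdeal K J)]
  have hc' : Fintype.card (Free.ChooseBasisIndex ℤ (𝓞 K)) =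
      Fintype.card (Free.ChooseBasisIndex ℤ J.1) := by
    rw [← hc, NumberField.Embeddings.card, finrank_eq_card_basis (integralBasis K)]
  let e := Fintype.equivOfCardEq hc
  let e' := Fintype.equivOfCardEq hc'
  let b := (basisOfFractionalIdeal K J).reindex e.symm
  have hspan : ∀ x, x ∈ Submodule.span ℤ (Set.range b) ↔ x ∈ J.1 := by
    intro x
    rw [Basis.range_reindex, mem_span_basisOfFractionalIdeal]
    rfl
  refine ⟨b, hspan, ?_, ?_⟩
  · intro x
    have hJ : (J.1 : Submodule (𝓞 K) K).restrictScalars ℤ = Submodule.span ℤ (Set.range b) := by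
      ext x
      rw [hspan]; rfl
    have h := Submodule.traceDual_span_of_basis ℤ (K := ℚ) (J.1 : Submodule (𝓞 K) K) b hJ
    rw [← h, dualUnit, Units.val_mk0, ← FractionalIdeal.mem_coe,
      FractionalIdeal.coe_dual ℤ ℚ J.ne_zero]
    rfl
  · have h1 : Algebra.discr ℚ b =
        (FractionalIdeal.absNorm J.1) ^ 2 * (discr K : ℚ) := by
      have h2 : Algebra.discr ℚ b =
          Algebra.discr ℚ ((basisOfFractionalIdeal K J).reindex e'.symm) := by
        have := Algebra.discr_reindex ℚ ((basisOfFractionalIdeal K J).reindex e.symm)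
          (e.trans e'.symm)
        rw [← this]
        congr 1
        ext i
        simp
      rw [h2, coe_discr, ← det_basisOfFractionalIdeal_eq_absNorm K J e', sq_abs,
        Basis.det_apply, ← Algebra.discr_of_matrix_vecMul]
      congr 1
      exact ((integralBasis K).toMatrix_map_vecMul _).symm
    rw [h1, covol, Rat.cast_mul, abs_mul, Rat.cast_pow, abs_pow, Real.sqrt_mul (by positivity),
      Real.sqrt_sq (abs_nonneg _), abs_of_nonneg, Rat.cast_intCast]
    exact_mod_cast FractionalIdeal.absNorm_nonneg J.1

/-- The theta function of a fractional ideal. -/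
noncomputable def idealTheta (J : (FractionalIdeal (𝓞 K)⁰ K)ˣ) (y : InfinitePlace K → ℝ) : ℝ :=
  ∑' x : {x : K // x ∈ J.1}, Real.exp (-(Real.pi * placeForm y x))

theorem placeForm_mono {y y' : InfinitePlace K → ℝ} (h : ∀ w, y w ≤ y' w) (x : K) :
    placeForm y x ≤ placeForm y' x := by
  unfold placeForm
  gcongr with w
  exact h w

theorem placeForm_const_mul (c : ℝ) (y : InfinitePlace K → ℝ) (x : K) :
    placeForm (fun w => c * y w) x = c * placeForm y x := by
  unfold placeForm
  rw [Finset.mul_sum]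
  exact Finset.sum_congr rfl fun w _ => by ring

theorem summable_idealTheta (J : (FractionalIdeal (𝓞 K)⁰ K)ˣ) {y : InfinitePlace K → ℝ}
    (hy : ∀ w, 0 < y w) :
    Summable fun x : {x : K // x ∈ J.1} => Real.exp (-(Real.pi * placeForm y x)) := by
  obtain ⟨b, hb, -, -⟩ := exists_basis_of_fractionalIdeal J
  obtain ⟨e, he⟩ := exists_equiv_of_span b _ hb
  obtain ⟨c, hc, hlow⟩ := exists_le_placeForm_basis b
  rw [← e.summable_iff]
  obtain ⟨m, hm, hmy⟩ : ∃ m, 0 < m ∧ ∀ w, m ≤ y w := by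
    obtain ⟨w0, hw0⟩ := Finite.exists_min y
    exact ⟨y w0, hy w0, hw0⟩
  have hs := summable_exp_neg_mul_sum_sq (ι := K →+* ℂ) (c := Real.pi * (m * c)) (by positivity)
  refine hs.of_nonneg_of_le (fun _ => (Real.exp_pos _).le) fun k => ?_
  simp only [Function.comp_apply, he]
  rw [Real.exp_le_exp, neg_le_neg_iff, mul_assoc]
  refine mul_le_mul_of_nonneg_left ?_ Real.pi_pos.le
  rw [mul_assoc]
  calc m * (c * ∑ i, (k i : ℝ) ^ 2) ≤ m * placeForm (fun _ => 1) (∑ i, k i • b i) :=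
        mul_le_mul_of_nonneg_left (hlow k) hm.le
    _ = placeForm (fun _ => m * 1) (∑ i, k i • b i) := (placeForm_const_mul _ _ _).symm
    _ ≤ _ := placeForm_mono (fun w => by simpa using hmy w) _

theorem idealTheta_pos (J : (FractionalIdeal (𝓞 K)⁰ K)ˣ) {y : InfinitePlace K → ℝ}
    (hy : ∀ w, 0 < y w) : 0 < idealTheta J y :=
  (summable_idealTheta J hy).tsum_pos (fun _ => (Real.exp_pos _).le) ⟨0, J.1.zero_mem⟩
    (Real.exp_pos _)

theorem idealTheta_eq (J : (FractionalIdeal (𝓞 K)⁰ K)ˣ) {y : InfinitePlace K → ℝ}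
    (hy : ∀ w, 0 < y w) :
    idealTheta J y = (√(∏ w : InfinitePlace K, y w ^ w.mult) * covol J)⁻¹ *
      idealTheta (dualUnit J) (fun w => (y w)⁻¹) := by
  obtain ⟨b, hb, hb', hd⟩ := exists_basis_of_fractionalIdeal J
  obtain ⟨e, he⟩ := exists_equiv_of_span b _ hb
  obtain ⟨e', he'⟩ := exists_equiv_of_span b.traceDual _ hb'
  have h := tsum_placeForm hy b
  rw [hd] at h
  rw [idealTheta, idealTheta, ← e.tsum_eq, ← e'.tsum_eq]
  simp only [he, he']
  exact h

theorem covol_dualUnit (J : (FractionalIdeal (𝓞 K)⁰ K)ˣ) :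
    covol J * covol (dualUnit J) = 1 := by
  have h1 := idealTheta_eq J (y := fun _ => 1) (fun _ => one_pos)
  have h2 := idealTheta_eq (dualUnit J) (y := fun _ => 1) (fun _ => one_pos)
  rw [dualUnit_dualUnit] at h2
  have hp := idealTheta_pos J (y := fun _ => 1) (fun _ => one_pos)
  have c1 := covol_pos J
  have c2 := covol_pos (dualUnit J)
  simp only [one_pow, Finset.prod_const_one, Real.sqrt_one, one_mul, inv_one] at h1 h2
  rw [h2] at h1
  field_simp at h1
  nlinarith

end IdealTheta

section UnitScaling
open Module nonZeroDivisors MeasureTheory Set NumberField.Units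
open scoped Classical

variable {K : Type*} [Field K] [NumberField K]

variable (K) in
/-- Exponential coordinates on the norm one hypersurface, adapted to a fundamental system of
units. -/
noncomputable def unitScale (c : Fin (rank K) → ℝ) (w : InfinitePlace K) : ℝ :=
  Real.exp (∑ j, c j * (2 * Real.log (w (fundSystem K j : 𝓞 K))))

theorem unitScale_pos (c : Fin (rank K) → ℝ) (w : InfinitePlace K) : 0 < unitScale K c w :=
  Real.exp_pos _

theorem unitScale_neg (c : Fin (rank K) → ℝ) (w : InfinitePlace K) :
    unitScale K (-c) w = (unitScale K c w)⁻¹ := by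
  rw [unitScale, unitScale, ← Real.exp_neg, ← Finset.sum_neg_distrib]
  simp

theorem continuous_unitScale : Continuous fun c : Fin (rank K) → ℝ => unitScale K c := by
  unfold unitScale
  fun_prop

omit [NumberField K] in
theorem place_unit_pos (w : InfinitePlace K) (u : (𝓞 K)ˣ) : 0 < w (u : 𝓞 K) :=
  w.pos_iff.mpr (NumberField.Units.coe_ne_zero u)

theorem unitScale_add_int (c : Fin (rank K) → ℝ) (m : Fin (rank K) → ℤ) (w : InfinitePlace K) :
    unitScale K (c + fun j => (m j : ℝ)) w =
      unitScale K c w * w ((∏ j, fundSystem K j ^ m j : (𝓞 K)ˣ) : 𝓞 K) ^ 2 := by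
  have h1 : w ((∏ j, fundSystem K j ^ m j : (𝓞 K)ˣ) : 𝓞 K) ^ 2 =
      Real.exp (∑ j, (m j : ℝ) * (2 * Real.log (w (fundSystem K j : 𝓞 K)))) := by
    have h2 : ((∏ j, fundSystem K j ^ m j : (𝓞 K)ˣ) : K) =
        ∏ j, ((fundSystem K j ^ m j : (𝓞 K)ˣ) : K) :=
      map_prod ((algebraMap (𝓞 K) K).toMonoidHom.comp (Units.coeHom (𝓞 K))) _ _
    rw [Real.exp_sum]
    change w ((∏ j, fundSystem K j ^ m j : (𝓞 K)ˣ) : K) ^ 2 = _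
    rw [h2, map_prod, ← Finset.prod_pow]
    refine Finset.prod_congr rfl fun j _ => ?_
    rw [NumberField.Units.coe_zpow, map_zpow₀]
    have hp := place_unit_pos w (fundSystem K j)
    rw [← Real.exp_log (pow_pos (zpow_pos hp _) 2), Real.log_pow, Real.log_zpow]
    congr 1
    push_cast; ring
  rw [h1, unitScale, unitScale, ← Real.exp_add, ← Finset.sum_add_distrib]
  simp only [Pi.add_apply, add_mul]

theorem prod_unitScale (c : Fin (rank K) → ℝ) :
    ∏ w : InfinitePlace K, unitScale K c w ^ w.mult = 1 := by
  simp only [unitScale, ← Real.exp_nat_mul]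
  rw [← Real.exp_sum, Real.exp_eq_one_iff]
  simp only [Finset.mul_sum]
  rw [Finset.sum_comm]
  refine Finset.sum_eq_zero fun j _ => ?_
  have h := sum_mult_mul_log (fundSystem K j)
  calc _ = 2 * c j * ∑ w : InfinitePlace K, w.mult * Real.log (w (fundSystem K j : 𝓞 K)) := by
        rw [Finset.mul_sum]; exact Finset.sum_congr rfl fun w _ => by ring
    _ = 0 := by rw [h, mul_zero]

theorem placeForm_mul (y : InfinitePlace K → ℝ) (x z : K) :
    placeForm y (x * z) = placeForm (fun w => y w * w x ^ 2) z := by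
  unfold placeForm
  refine Finset.sum_congr rfl fun w _ => ?_
  rw [map_mul]; ring

/-- Multiplication by a unit permutes a fractional ideal. -/
noncomputable def unitEquiv (J : FractionalIdeal (𝓞 K)⁰ K) (u : (𝓞 K)ˣ) :
    {x : K // x ∈ J} ≃ {x : K // x ∈ J} where
  toFun x := ⟨((u : 𝓞 K) : K) * x, by
    have := Submodule.smul_mem (J : Submodule (𝓞 K) K) (u : 𝓞 K) x.2
    rwa [Algebra.smul_def] at this⟩
  invFun x := ⟨((u⁻¹ : (𝓞 K)ˣ) : K) * x, by
    have := Submodule.smul_mem (J : Submodule (𝓞 K) K) ((u⁻¹ : (𝓞 K)ˣ) : 𝓞 K) x.2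
    rwa [Algebra.smul_def] at this⟩
  left_inv x := by ext; simp
  right_inv x := by ext; simp

theorem idealTheta_mul_unit (J : (FractionalIdeal (𝓞 K)⁰ K)ˣ) (y : InfinitePlace K → ℝ)
    (u : (𝓞 K)ˣ) :
    idealTheta J (fun w => y w * w (u : 𝓞 K) ^ 2) = idealTheta J y := by
  rw [idealTheta, idealTheta, ← (unitEquiv J.1 u).tsum_eq
    (fun x => Real.exp (-(Real.pi * placeForm y x)))]
  simp only [unitEquiv, Equiv.coe_fn_mk, placeForm_mul]

theorem continuousAt_idealTheta (J : (FractionalIdeal (𝓞 K)⁰ K)ˣ) {y₀ : InfinitePlace K → ℝ}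
    (hy : ∀ w, 0 < y₀ w) : ContinuousAt (idealTheta J) y₀ := by
  have hopen : IsOpen {y : InfinitePlace K → ℝ | ∀ w, y₀ w / 2 < y w} := by
    rw [ofPred_forall]
    exact isOpen_iInter_of_finite fun w => isOpen_lt continuous_const (continuous_apply w)
  have hmem : y₀ ∈ {y : InfinitePlace K → ℝ | ∀ w, y₀ w / 2 < y w} := fun w => half_lt_self (hy w)
  have hs := summable_idealTheta J (y := fun w => y₀ w / 2) (fun w => half_pos (hy w))
  have : ContinuousOn (idealTheta J) {y : InfinitePlace K → ℝ | ∀ w, y₀ w / 2 < y w} := by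
    refine continuousOn_tsum (fun x => ?_) hs ?_
    · unfold placeForm
      fun_prop
    · intro x y hy'
      rw [Real.norm_eq_abs, abs_of_pos (Real.exp_pos _), Real.exp_le_exp, neg_le_neg_iff]
      exact mul_le_mul_of_nonneg_left (placeForm_mono (fun w => (hy' w).le) _) Real.pi_pos.le
  exact this.continuousAt (hopen.mem_nhds hmem)

theorem idealTheta_anti (J : (FractionalIdeal (𝓞 K)⁰ K)ˣ) {y y' : InfinitePlace K → ℝ}
    (hy : ∀ w, 0 < y w) (h : ∀ w, y w ≤ y' w) : idealTheta J y' ≤ idealTheta J y := by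
  refine (summable_idealTheta J fun w => (hy w).trans_le (h w)).tsum_le_tsum (fun x => ?_)
    (summable_idealTheta J hy)
  rw [Real.exp_le_exp, neg_le_neg_iff]
  exact mul_le_mul_of_nonneg_left (placeForm_mono h _) Real.pi_pos.le

/-- The normalised theta function in terms of a scale and unit coordinates. -/
noncomputable def scaledTheta (J : (FractionalIdeal (𝓞 K)⁰ K)ˣ) (t : ℝ)
    (c : Fin (rank K) → ℝ) : ℝ :=
  idealTheta J fun w => t * covol J ^ (-(2 : ℝ) / finrank ℚ K) * unitScale K c w

theorem scale_pos (J : (FractionalIdeal (𝓞 K)⁰ K)ˣ) {t : ℝ} (ht : 0 < t)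
    (c : Fin (rank K) → ℝ) (w : InfinitePlace K) :
    0 < t * covol J ^ (-(2 : ℝ) / finrank ℚ K) * unitScale K c w :=
  mul_pos (mul_pos ht (Real.rpow_pos_of_pos (covol_pos J) _)) (unitScale_pos c w)

theorem scaledTheta_add_int (J : (FractionalIdeal (𝓞 K)⁰ K)ˣ) (t : ℝ)
    (c : Fin (rank K) → ℝ) (m : Fin (rank K) → ℤ) :
    scaledTheta J t (c + fun j => (m j : ℝ)) = scaledTheta J t c := by
  refine Eq.trans ?_ (idealTheta_mul_unit J _ (∏ j, fundSystem K j ^ m j))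
  rw [scaledTheta]
  congr 1
  funext w
  rw [unitScale_add_int]; ring

theorem continuous_scaledTheta (J : (FractionalIdeal (𝓞 K)⁰ K)ˣ) {t : ℝ} (ht : 0 < t) :
    Continuous (scaledTheta J t) := by
  rw [continuous_iff_continuousAt]
  intro c
  refine ContinuousAt.comp (g := idealTheta J) (continuousAt_idealTheta J (scale_pos J ht c)) ?_
  refine Continuous.continuousAt ?_
  have := continuous_unitScale (K := K)
  fun_prop

theorem scaledTheta_inv (J : (FractionalIdeal (𝓞 K)⁰ K)ˣ) {t : ℝ} (ht : 0 < t)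
    (c : Fin (rank K) → ℝ) :
    scaledTheta J (1 / t) c = t ^ ((finrank ℚ K : ℝ) / 2) * scaledTheta (dualUnit J) t (-c) := by
  have hn : (finrank ℚ K : ℝ) ≠ 0 := by
    exact_mod_cast (Module.finrank_pos (R := ℚ) (M := K)).ne'
  have hJ := covol_pos J
  have hv : 0 < covol J ^ (-(2 : ℝ) / finrank ℚ K) := Real.rpow_pos_of_pos hJ _
  rw [scaledTheta, idealTheta_eq J (scale_pos J (one_div_pos.mpr ht) c), scaledTheta]
  congr 1
  · simp only [mul_pow]
    rw [Finset.prod_mul_distrib, prod_unitScale, mul_one]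
    simp only [← mul_pow]
    rw [Finset.prod_pow_eq_pow_sum, InfinitePlace.sum_mult_eq, Real.sqrt_eq_rpow,
      ← Real.rpow_natCast, Real.mul_rpow (by positivity) hv.le, ← Real.rpow_mul hJ.le,
      div_mul_cancel₀ _ hn, Real.mul_rpow (by positivity) (by positivity), ← Real.rpow_mul hJ.le,
      one_div, Real.inv_rpow ht.le, Real.inv_rpow (by positivity), ← Real.rpow_mul ht.le]
    have : covol J ^ (-(2 : ℝ) * (2 : ℝ)⁻¹) = (covol J)⁻¹ := by
      rw [show (-(2 : ℝ) * (2 : ℝ)⁻¹) = -1 by norm_num, Real.rpow_neg_one]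
    rw [← one_div, show (1 : ℝ) / 2 = (2 : ℝ)⁻¹ by norm_num, this]
    field_simp
  · congr 1
    funext w
    have h2 := covol_dualUnit J
    have h3 : covol (dualUnit J) = (covol J)⁻¹ := eq_inv_of_mul_eq_one_right h2
    rw [unitScale_neg, h3, Real.inv_rpow hJ.le, mul_inv, mul_inv, one_div, inv_inv]

end UnitScaling

section HeckeTheta
open Module nonZeroDivisors MeasureTheory Set NumberField.Units
open scoped Classical

variable {K : Type*} [Field K] [NumberField K]

theorem idealTheta_eq_one_add (J : (FractionalIdeal (𝓞 K)⁰ K)ˣ) {y : InfinitePlace K → ℝ}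
    (hy : ∀ w, 0 < y w) :
    Summable (fun x : {x : K // x ∈ J.1 ∧ x ≠ 0} => Real.exp (-(Real.pi * placeForm y x))) ∧
    idealTheta J y = 1 + ∑' x : {x : K // x ∈ J.1 ∧ x ≠ 0},
      Real.exp (-(Real.pi * placeForm y x)) := by
  have hs := summable_idealTheta J hy
  obtain ⟨f, hf⟩ : ∃ f : K → ℝ, f = fun x => Real.exp (-(Real.pi * placeForm y x)) := ⟨_, rfl⟩
  have hf0 : f 0 = 1 := by rw [hf]; simp [placeForm]
  have hU : ({0} ∪ {x : K | x ∈ J.1 ∧ x ≠ 0} : Set K) = {x | x ∈ J.1} := by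
    ext x
    simp only [mem_union, mem_singleton_iff, mem_ofPred_eq]
    constructor
    · rintro (rfl | h)
      · exact J.1.zero_mem
      · exact h.1
    · intro h
      by_cases h0 : x = 0
      · exact Or.inl h0
      · exact Or.inr ⟨h, h0⟩
  have hs' : Summable (f ∘ ((↑) : {x : K | x ∈ J.1} → K)) := by rw [hf]; exact hs
  have h2 : Summable (f ∘ ((↑) : {x : K | x ∈ J.1 ∧ x ≠ 0} → K)) :=
by
    have hinj : Function.Injective fun x : {x : K | x ∈ J.1 ∧ x ≠ 0} =>
        (⟨x.1, x.2.1⟩ : {x : K | x ∈ J.1}) := by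
      intro a b h
      have h' := congrArg Subtype.val h
      exact Subtype.ext h'
    exact hs'.comp_injective hinj
  have h1 : Summable (f ∘ ((↑) : ({0} : Set K) → K)) := Summable.of_finite
  have hd : Disjoint ({0} : Set K) {x : K | x ∈ J.1 ∧ x ≠ 0} := by simp
  have h := Summable.tsum_union_disjoint hd h1 h2
  rw [hU, tsum_singleton, hf0] at h
  rw [hf] at h h2
  exact ⟨h2, h⟩

theorem exists_le_placeForm (J : (FractionalIdeal (𝓞 K)⁰ K)ˣ) :
    ∃ c, 0 < c ∧ ∀ x ∈ J.1, x ≠ 0 → c ≤ placeForm (fun _ => 1) x := by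
  obtain ⟨b, hb, -, -⟩ := exists_basis_of_fractionalIdeal J
  obtain ⟨e, he⟩ := exists_equiv_of_span b _ hb
  obtain ⟨c, hc, hlow⟩ := exists_le_placeForm_basis b
  refine ⟨c, hc, fun x hx h0 => ?_⟩
  obtain ⟨k, hk⟩ := e.surjective ⟨x, hx⟩
  have hk2 : ∑ i, k i • b i = x := by rw [← he, hk]
  have hne : k ≠ 0 := by
    rintro rfl
    apply h0
    rw [← hk2]; simp
  obtain ⟨i, hi⟩ := Function.ne_iff.mp hne
  rw [← hk2]
  refine le_trans ?_ (hlow k)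
  have h1 : (1 : ℝ) ≤ (k i : ℝ) ^ 2 := by
    have : 1 ≤ (k i) ^ 2 := Int.one_le_abs (by simpa using hi) |>.trans (by
      rw [← sq_abs]; nlinarith [Int.one_le_abs (show k i ≠ 0 by simpa using hi)])
    exact_mod_cast this
  have h2 : (k i : ℝ) ^ 2 ≤ ∑ i, (k i : ℝ) ^ 2 :=
    Finset.single_le_sum (f := fun i => (k i : ℝ) ^ 2) (fun _ _ => sq_nonneg _) (Finset.mem_univ i)
  nlinarith

theorem unitBox_subset_Icc {ι : Type*} : unitBox ι ⊆ Icc 0 1 := fun _ hx =>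
  ⟨fun i => (hx i).1.le, fun i => (hx i).2⟩

theorem exists_le_unitScale : ∃ m, 0 < m ∧ ∀ c ∈ unitBox (Fin (rank K)), ∀ w,
    m ≤ unitScale K c w := by
  have h : ∀ w : InfinitePlace K, ∃ m, 0 < m ∧ ∀ c ∈ unitBox (Fin (rank K)),
      m ≤ unitScale K c w := by
    intro w
    have hc : ContinuousOn (fun c => unitScale K c w) (Icc 0 1) := by
      have := continuous_unitScale (K := K)
      fun_prop
    obtain ⟨c0, -, h0⟩ := isCompact_Icc.exists_isMinOn (nonempty_Icc.mpr zero_le_one) hc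
    exact ⟨_, unitScale_pos c0 w, fun c hc => h0 (unitBox_subset_Icc hc)⟩
  choose m hm h using h
  obtain ⟨w0, hw0⟩ := Finite.exists_min m
  exact ⟨m w0, hm w0, fun c hc w => (hw0 w).trans (h w c hc)⟩

/-- Hecke's theta function: the average of the theta function over a fundamental domain for the
units. -/
noncomputable def heckeTheta (J : (FractionalIdeal (𝓞 K)⁰ K)ˣ) (t : ℝ) : ℝ :=
  ∫ c in unitBox (Fin (rank K)), scaledTheta J t c

theorem integrableOn_scaledTheta (J : (FractionalIdeal (𝓞 K)⁰ K)ˣ) {t : ℝ} (ht : 0 < t) :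
    IntegrableOn (scaledTheta J t) (unitBox (Fin (rank K))) :=
  (continuous_scaledTheta J ht).integrableOn_Icc.mono_set unitBox_subset_Icc

theorem setIntegral_unitBox_neg {ι : Type*} [Fintype ι] (G : (ι → ℝ) → ℝ)
    (hG : ∀ c (m : ι → ℤ), G (c + fun j => (m j : ℝ)) = G c) :
    ∫ c in unitBox ι, G (-c) = ∫ c in unitBox ι, G c := by
  rw [← integral_indicator (measurableSet_unitBox), ← integral_indicator (measurableSet_unitBox),
    ← integral_sub_left_eq_self (fun c => (unitBox ι).indicator G c) volume (fun _ => 1)]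
  refine integral_congr_ae ?_
  have h1 : (unitBox ι : Set (ι → ℝ)) =ᵐ[volume] Icc 0 1 := by
    have := (Measure.univ_pi_Ioc_ae_eq_Icc (μ := fun _ : ι => (volume : Measure ℝ)) (f := fun _ => 0)
      (g := fun _ => 1))
    have e : unitBox ι = univ.pi fun _ : ι => Ioc (0 : ℝ) 1 := by ext x; simp [unitBox]
    rw [e]; exact this
  have h2 : ({c : ι → ℝ | (fun _ => 1) - c ∈ unitBox ι} : Set (ι → ℝ)) =ᵐ[volume] Icc 0 1 := by
    have := (Measure.univ_pi_Ico_ae_eq_Icc (μ := fun _ : ι => (volume : Measure ℝ)) (f := fun _ => 0)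
      (g := fun _ => 1))
    have e : {c : ι → ℝ | (fun _ => 1) - c ∈ unitBox ι} = univ.pi fun _ : ι => Ico (0 : ℝ) 1 := by
      ext x; simp [unitBox, and_comm]
    rw [e]; exact this
  have h3 := h1.trans h2.symm
  filter_upwards [h3] with c hc
  have hc' : c ∈ unitBox ι ↔ (fun _ => 1) - c ∈ unitBox ι := by
    have := hc
    exact Iff.of_eq this
  have hG' : G ((fun _ => 1) - c) = G (-c) := by
    have := hG (-c) (fun _ => 1)
    rw [← this]; congr 1; ext i; simp; ring
  by_cases h : c ∈ unitBox ι
  · rw [indicator_of_mem h, indicator_of_mem (hc'.mp h), hG']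
  · rw [indicator_of_notMem h, indicator_of_notMem (mt hc'.mpr h)]

theorem heckeTheta_inv (J : (FractionalIdeal (𝓞 K)⁰ K)ˣ) {t : ℝ} (ht : 0 < t) :
    heckeTheta J (1 / t) = t ^ ((finrank ℚ K : ℝ) / 2) * heckeTheta (dualUnit J) t := by
  rw [heckeTheta, heckeTheta]
  simp only [scaledTheta_inv J ht]
  rw [integral_const_mul, setIntegral_unitBox_neg _ (scaledTheta_add_int (dualUnit J) t)]

theorem antitoneOn_heckeTheta (J : (FractionalIdeal (𝓞 K)⁰ K)ˣ) :
    AntitoneOn (heckeTheta J) (Ioi 0) := by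
  intro t ht t' ht' htt
  refine setIntegral_mono (integrableOn_scaledTheta J ht') (integrableOn_scaledTheta J ht) ?_
  intro c
  refine idealTheta_anti J (scale_pos J ht c) fun w => ?_
  have := unitScale_pos c w
  have := Real.rpow_pos_of_pos (covol_pos J) (-(2 : ℝ) / finrank ℚ K)
  gcongr

theorem exists_heckeTheta_sub_one_le (J : (FractionalIdeal (𝓞 K)⁰ K)ˣ) :
    ∃ C δ, 0 < δ ∧ ∀ t, 1 ≤ t → |heckeTheta J t - 1| ≤ C * Real.exp (-δ * t) := by
  obtain ⟨c0, hc0, hlow⟩ := exists_le_placeForm J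
  obtain ⟨m, hm, hmw⟩ := exists_le_unitScale (K := K)
  have hv := Real.rpow_pos_of_pos (covol_pos J) (-(2 : ℝ) / finrank ℚ K)
  obtain ⟨v, hvdef⟩ : ∃ v, v = covol J ^ (-(2 : ℝ) / finrank ℚ K) := ⟨_, rfl⟩
  rw [← hvdef] at hv
  obtain ⟨δ, hδ⟩ : ∃ δ, δ = Real.pi * (v * m * c0) := ⟨_, rfl⟩
  have hδ0 : 0 < δ := by rw [hδ]; have := Real.pi_pos; positivity
  have hvol : volume.real (unitBox (Fin (rank K))) = 1 := by
    rw [Measure.real, volume_unitBox]; rfl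
  have hsub : ∀ t, 0 < t → heckeTheta J t - 1 =
      ∫ c in unitBox (Fin (rank K)), (scaledTheta J t c - 1) := by
    intro t ht
    rw [integral_sub (integrableOn_scaledTheta J ht)
      (integrableOn_const (by rw [volume_unitBox]; simp)), setIntegral_const, hvol]
    simp [heckeTheta]
  have hone : ∀ t c, 0 < t → 0 ≤ scaledTheta J t c - 1 := by
    intro t c ht
    rw [scaledTheta, (idealTheta_eq_one_add J (scale_pos J ht c)).2, add_sub_cancel_left]
    exact tsum_nonneg fun _ => (Real.exp_pos _).le
  have hInt : ∀ t, 0 < t → IntegrableOn (fun c => scaledTheta J t c - 1)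
      (unitBox (Fin (rank K))) := fun t ht =>
    (integrableOn_scaledTheta J ht).sub (integrableOn_const (by rw [volume_unitBox]; simp))
  refine ⟨(heckeTheta J 1 - 1) * Real.exp δ, δ, hδ0, fun t ht => ?_⟩
  have ht0 : 0 < t := one_pos.trans_le ht
  rw [hsub t ht0, hsub 1 one_pos, abs_of_nonneg (integral_nonneg fun c => hone t c ht0),
    mul_assoc, ← Real.exp_add, ← integral_mul_const]
  refine setIntegral_mono_on (hInt t ht0) ((hInt 1 one_pos).mul_const _)
    (measurableSet_unitBox) fun c hc => ?_
  obtain ⟨s1, e1⟩ := idealTheta_eq_one_add J (scale_pos J ht0 c)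
  obtain ⟨s2, e2⟩ := idealTheta_eq_one_add J (scale_pos J one_pos c)
  rw [scaledTheta, scaledTheta, e1, e2, add_sub_cancel_left, add_sub_cancel_left, ← tsum_mul_right]
  refine s1.tsum_le_tsum (fun x => ?_) (s2.mul_right _)
  rw [← Real.exp_add, Real.exp_le_exp, ← hvdef]
  obtain ⟨q, hq⟩ : ∃ q, q = placeForm (fun w => v * unitScale K c w) (x : K) := ⟨_, rfl⟩
  have h1 : placeForm (fun w => t * v * unitScale K c w) (x : K) = t * q := by
    rw [hq, ← placeForm_const_mul]; congr 1; funext w; ring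
  have h2 : placeForm (fun w => 1 * v * unitScale K c w) (x : K) = q := by
    rw [hq]; congr 1; funext w; ring
  have h3 : v * m * c0 ≤ q := by
    calc v * m * c0 ≤ v * m * placeForm (fun _ => 1) (x : K) :=
          mul_le_mul_of_nonneg_left (hlow _ x.2.1 x.2.2) (by positivity)
      _ = placeForm (fun _ => v * m * 1) (x : K) := (placeForm_const_mul _ _ _).symm
      _ ≤ q := by
          rw [hq]
          refine placeForm_mono (fun w => ?_) _
          rw [mul_one]
          exact mul_le_mul_of_nonneg_left (hmw c hc w) hv.le
  rw [h1, h2, hδ]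
  have h4 := mul_le_mul_of_nonneg_left h3 (mul_nonneg Real.pi_pos.le (sub_nonneg.mpr ht))
  linarith

end HeckeTheta

section UnitCoordinates
open Module MeasureTheory Set NumberField.Units
open scoped Classical

variable {K : Type*} [Field K] [NumberField K]

variable (K) in
/-- Logarithmic scale and unit coordinates. -/
noncomputable def unitCoords : (ℝ × (Fin (rank K) → ℝ)) →ₗ[ℝ] (InfinitePlace K → ℝ) where
  toFun p w := p.1 + ∑ j, p.2 j * (2 * Real.log (w (fundSystem K j : 𝓞 K)))
  map_add' p q := by
    funext w
    simp only [Prod.fst_add, Prod.snd_add, Pi.add_apply, add_mul, Finset.sum_add_distrib]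
    ring
  map_smul' a p := by
    funext w
    simp only [Prod.smul_fst, Prod.smul_snd, Pi.smul_apply, smul_eq_mul, RingHom.id_apply,
      mul_add, Finset.mul_sum, mul_assoc]

theorem exp_unitCoords (p : ℝ × (Fin (rank K) → ℝ)) (w : InfinitePlace K) :
    Real.exp (unitCoords K p w) = Real.exp p.1 * unitScale K p.2 w := by
  rw [unitScale, ← Real.exp_add]; rfl

theorem sum_mult_unitCoords (p : ℝ × (Fin (rank K) → ℝ)) :
    ∑ w : InfinitePlace K, w.mult * unitCoords K p w = finrank ℚ K * p.1 := by
  have h : ∀ w : InfinitePlace K, w.mult * unitCoords K p w = w.mult * p.1 +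
      w.mult * ∑ j, p.2 j * (2 * Real.log (w (fundSystem K j : 𝓞 K))) := fun w => mul_add _ _ _
  simp only [h]
  rw [Finset.sum_add_distrib, ← Finset.sum_mul, ← InfinitePlace.sum_mult_eq]
  push_cast
  rw [add_eq_left]
  simp only [Finset.mul_sum]
  rw [Finset.sum_comm]
  refine Finset.sum_eq_zero fun j _ => ?_
  have h := sum_mult_mul_log (fundSystem K j)
  calc _ = 2 * p.2 j * ∑ w : InfinitePlace K, w.mult * Real.log (w (fundSystem K j : 𝓞 K)) := by
        rw [Finset.mul_sum]; exact Finset.sum_congr rfl fun w _ => by ring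
    _ = 0 := by rw [h, mul_zero]

theorem injective_unitCoords : Function.Injective (unitCoords K) := by
  rw [injective_iff_map_eq_zero]
  intro p hp
  have hn : (finrank ℚ K : ℝ) ≠ 0 := by
    exact_mod_cast (Module.finrank_pos (R := ℚ) (M := K)).ne'
  have h1 : p.1 = 0 := by
    have := sum_mult_unitCoords p
    rw [hp] at this
    simpa [hn] using this
  have h2 : p.2 = 0 := by
    have hli := Fintype.linearIndependent_iff.mp (isMaxRank_fundSystem K) p.2 (by
      funext w
      have hw := congrFun hp w.1
      change p.1 + _ = 0 at hw
      rw [h1, zero_add] at hw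
      simp only [Finset.sum_apply, Pi.smul_apply, smul_eq_mul, Pi.zero_apply]
      have hc : ∀ j, p.2 j * logEmbedding K (Additive.ofMul (fundSystem K j)) w =
          w.1.mult / 2 * (p.2 j * (2 * Real.log (w.1 (fundSystem K j : 𝓞 K)))) := by
        intro j
        rw [dirichletUnitTheorem.logEmbedding_component]
        change p.2 j * (w.1.mult * Real.log (w.1 (fundSystem K j : 𝓞 K))) = _
        ring
      simp only [hc]
      rw [← Finset.mul_sum, hw, mul_zero])
    funext j; exact hli j
  exact Prod.ext h1 h2

theorem exists_lintegral_unitCoords : ∃ C : ENNReal, C ≠ 0 ∧ C ≠ ⊤ ∧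
    ∀ f : (InfinitePlace K → ℝ) → ENNReal, Measurable f →
      ∫⁻ τ : ℝ, ∫⁻ c, f (unitCoords K (τ, c)) = C * ∫⁻ z, f z := by
  have hdim : finrank ℝ (ℝ × (Fin (rank K) → ℝ)) = finrank ℝ (InfinitePlace K → ℝ) := by
    rw [finrank_prod, finrank_self, finrank_fintype_fun_eq_card, finrank_fintype_fun_eq_card,
      Fintype.card_fin, rank]
    have := Fintype.card_pos (α := InfinitePlace K)
    omega
  obtain ⟨e, he⟩ : ∃ e : (ℝ × (Fin (rank K) → ℝ)) ≃L[ℝ] (InfinitePlace K → ℝ),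
      ∀ p, e p = unitCoords K p :=
    ⟨((unitCoords K).linearEquivOfInjective injective_unitCoords hdim).toContinuousLinearEquiv,
      fun p => rfl⟩
  have hV : (volume : Measure (ℝ × (Fin (rank K) → ℝ))).IsAddHaarMeasure := by
    rw [Measure.volume_eq_prod]; infer_instance
  have hH : (Measure.map e (volume : Measure (ℝ × (Fin (rank K) → ℝ)))).IsAddHaarMeasure :=
    e.isAddHaarMeasure_map _
  obtain ⟨r, hr, heq⟩ : ∃ r : NNReal, r ≠ 0 ∧
      Measure.map e (volume : Measure (ℝ × (Fin (rank K) → ℝ))) = r • volume :=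
    ⟨_, (Measure.addHaarScalarFactor_pos_of_isAddHaarMeasure _ _).ne',
      Measure.isAddLeftInvariant_eq_smul _ _⟩
  refine ⟨r, ENNReal.coe_ne_zero.mpr hr, ENNReal.coe_ne_top, fun f hf => ?_⟩
  · have hfe : Measurable fun p => f (e p) := hf.comp e.continuous.measurable
    calc ∫⁻ τ : ℝ, ∫⁻ c, f (unitCoords K (τ, c)) = ∫⁻ p, f (e p) := by
          rw [Measure.volume_eq_prod, lintegral_prod _ hfe.aemeasurable]
          simp only [he]
      _ = ∫⁻ z, f z ∂(Measure.map e volume) :=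
          (lintegral_map hf e.continuous.measurable).symm
      _ = _ := by
          rw [heq, lintegral_smul_measure]
          simp [ENNReal.smul_def]

theorem lintegral_comp_exp (g : ℝ → ENNReal) :
    ∫⁻ x in Ioi 0, g x = ∫⁻ τ, ENNReal.ofReal (Real.exp τ) * g (Real.exp τ) := by
  have h := lintegral_image_eq_lintegral_abs_deriv_mul (s := univ) (f := Real.exp)
    MeasurableSet.univ (fun x _ => (Real.hasDerivAt_exp x).hasDerivWithinAt)
    Real.exp_injective.injOn g
  rw [image_univ, Real.range_exp, Measure.restrict_univ] at h
  simpa only [Real.abs_exp] using h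

theorem lintegral_gamma {p a : ℝ} (hp : 0 < p) (ha : 0 < a) :
    ∫⁻ τ, ENNReal.ofReal (Real.exp (p * τ) * Real.exp (-(a * Real.exp τ))) =
      ENNReal.ofReal (Real.Gamma p * a ^ (-p)) := by
  have h1 := lintegral_comp_exp
    (fun t => ENNReal.ofReal (t ^ (p - 1) * Real.exp (-(a * t))))
  have h2 := Real.integral_rpow_mul_exp_neg_mul_Ioi hp ha
  have hInt : IntegrableOn (fun t : ℝ => t ^ (p - 1) * Real.exp (-(a * t))) (Ioi 0) := by
    have := integrableOn_rpow_mul_exp_neg_mul_rpow (p := 1) (s := p - 1) (by linarith) one_pos ha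
    simpa using this
  rw [← ofReal_integral_eq_lintegral_ofReal hInt ?_, h2] at h1
  · rw [one_div, Real.inv_rpow ha.le, ← Real.rpow_neg ha.le, mul_comm] at h1
    rw [h1]
    refine lintegral_congr fun τ => ?_
    rw [← ENNReal.ofReal_mul (Real.exp_pos _).le, ← mul_assoc, ← Real.exp_mul, ← Real.exp_add,
      ← Real.exp_add, ← Real.exp_add]
    congr 2; ring
  · refine (ae_restrict_mem measurableSet_Ioi).mono fun t ht => ?_
    exact mul_nonneg (Real.rpow_nonneg (le_of_lt ht) _) (Real.exp_pos _).le

theorem lintegral_pi_prod {ι : Type*} [Fintype ι] {f : ι → ℝ → ℝ} (hm : ∀ i, Continuous (f i))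
    (h0 : ∀ i t, 0 ≤ f i t) {v : ι → ℝ}
    (hv : ∀ i, ∫⁻ t, ENNReal.ofReal (f i t) = ENNReal.ofReal (v i)) (hv0 : ∀ i, 0 ≤ v i) :
    ∫⁻ z : ι → ℝ, ENNReal.ofReal (∏ i, f i (z i)) = ENNReal.ofReal (∏ i, v i) := by
  have hInt : ∀ i, Integrable (f i) := by
    intro i
    refine ⟨(hm i).aestronglyMeasurable, ?_⟩
    rw [hasFiniteIntegral_iff_ofReal (Filter.Eventually.of_forall (h0 i)), hv]
    exact ENNReal.ofReal_lt_top
  have hval : ∀ i, ∫ t, f i t = v i := by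
    intro i
    have := ofReal_integral_eq_lintegral_ofReal (hInt i) (Filter.Eventually.of_forall (h0 i))
    rw [hv] at this
    exact (ENNReal.ofReal_eq_ofReal_iff (integral_nonneg (h0 i)) (hv0 i)).mp this
  have hI : Integrable (fun z : ι → ℝ => ∏ i, f i (z i)) := Integrable.fintype_prod hInt
  rw [← ofReal_integral_eq_lintegral_ofReal hI
    (Filter.Eventually.of_forall fun z => Finset.prod_nonneg fun i _ => h0 i _),
    integral_fintype_prod_volume_eq_prod]
  simp only [hval]

theorem exists_lintegral_gamma_unitCoords : ∃ C : ENNReal, C ≠ 0 ∧ C ≠ ⊤ ∧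
    ∀ (b : InfinitePlace K → ℝ) (_ : ∀ w, 0 < b w) (s : ℝ) (_ : 0 < s),
    ∫⁻ t in Ioi 0, ENNReal.ofReal (t ^ (finrank ℚ K * s / 2 - 1)) *
      ∫⁻ c, ENNReal.ofReal (Real.exp (-∑ w, w.mult * (t * unitScale K c w * b w))) =
    C * ENNReal.ofReal (∏ w : InfinitePlace K,
      Real.Gamma (w.mult * s / 2) * (w.mult * b w) ^ (-(w.mult * s / 2))) := by
  obtain ⟨C, hC0, hC, h⟩ := exists_lintegral_unitCoords (K := K)
  refine ⟨C, hC0, hC, fun b hb s hs => ?_⟩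
  have hmult : ∀ w : InfinitePlace K, (0 : ℝ) < w.mult := fun w => by
    exact_mod_cast InfinitePlace.mult_pos
  have hprod := lintegral_pi_prod (ι := InfinitePlace K)
    (f := fun w τ => Real.exp ((w.mult * s / 2) * τ) * Real.exp (-((w.mult * b w) * Real.exp τ)))
    (v := fun w => Real.Gamma (w.mult * s / 2) * (w.mult * b w) ^ (-(w.mult * s / 2)))
    (fun w => by fun_prop) (fun w t => by positivity)
    (fun w => lintegral_gamma (by have := hmult w; positivity) (mul_pos (hmult w) (hb w)))
    (fun w => by
      have := hmult w
      have := Real.Gamma_pos_of_pos (s := w.mult * s / 2) (by positivity)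
      have := Real.rpow_pos_of_pos (mul_pos (hmult w) (hb w)) (-(w.mult * s / 2))
      positivity)
  rw [← hprod, ← h _ (by fun_prop), lintegral_comp_exp]
  refine lintegral_congr fun τ => ?_
  rw [← mul_assoc, ← ENNReal.ofReal_mul (Real.exp_pos _).le, ← lintegral_const_mul]
  · refine lintegral_congr fun c => ?_
    rw [← ENNReal.ofReal_mul (by positivity), Finset.prod_mul_distrib, ← Real.exp_sum,
      ← Real.exp_sum]
    congr 2
    · rw [← Real.exp_mul, ← Real.exp_add]
      congr 1
      have := sum_mult_unitCoords (τ, c)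
      have h2 : ∑ w : InfinitePlace K, w.mult * s / 2 * unitCoords K (τ, c) w =
          s / 2 * ∑ w : InfinitePlace K, w.mult * unitCoords K (τ, c) w := by
        rw [Finset.mul_sum]; exact Finset.sum_congr rfl fun w _ => by ring
      rw [h2, this]; ring
    · rw [← Finset.sum_neg_distrib]
      congr 1
      refine Finset.sum_congr rfl fun w _ => ?_
      rw [exp_unitCoords]; ring
  · have := continuous_unitScale (K := K)
    fun_prop

end UnitCoordinates

section Unfolding
open Module nonZeroDivisors MeasureTheory Set NumberField.Units
open scoped Classical

variable {K : Type*} [Field K] [NumberField K]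

theorem bijective_unit_decomposition :
    Function.Bijective (fun p : torsion K × (Fin (rank K) → ℤ) =>
      ((p.1 : (𝓞 K)ˣ) * ∏ j, fundSystem K j ^ p.2 j)) := by
  rw [Function.bijective_iff_existsUnique]
  intro u
  obtain ⟨p, hp, hu⟩ := exist_unique_eq_mul_prod K u
  exact ⟨p, hp.symm, fun q hq => hu q hq.symm⟩

/-- The Gaussian attached to `x` at scale `a` and unit coordinates `c`. -/
noncomputable def unitGauss (x : K) (a : ℝ) (c : Fin (rank K) → ℝ) : ENNReal :=
  ENNReal.ofReal (Real.exp (-(Real.pi * placeForm (fun w => a * unitScale K c w) x)))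

theorem measurable_unitGauss (x : K) :
    Measurable fun p : ℝ × (Fin (rank K) → ℝ) => unitGauss x p.1 p.2 := by
  unfold unitGauss placeForm
  have := continuous_unitScale (K := K)
  fun_prop

theorem tsum_unit_unitGauss (x : K) (a : ℝ) :
    ∑' u : (𝓞 K)ˣ, ∫⁻ c in unitBox (Fin (rank K)), unitGauss (x * (u : 𝓞 K)) a c =
      (torsionOrder K : ENNReal) * ∫⁻ c, unitGauss x a c := by
  have key : ∀ (p : torsion K × (Fin (rank K) → ℤ)) (c : Fin (rank K) → ℝ),
      unitGauss (x * (((p.1 : (𝓞 K)ˣ) * ∏ j, fundSystem K j ^ p.2 j : (𝓞 K)ˣ) : 𝓞 K)) a c =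
        unitGauss x a (c + fun j => (p.2 j : ℝ)) := by
    intro p c
    have h1 : ∀ w : InfinitePlace K,
        w ((((p.1 : (𝓞 K)ˣ) * ∏ j, fundSystem K j ^ p.2 j : (𝓞 K)ˣ) : 𝓞 K) : K) =
        w ((∏ j, fundSystem K j ^ p.2 j : (𝓞 K)ˣ) : 𝓞 K) := by
      intro w
      have := (mem_torsion K).mp p.1.2 w
      have h2 := NumberField.Units.coe_mul (p.1 : (𝓞 K)ˣ) (∏ j, fundSystem K j ^ p.2 j)
      refine (congrArg w h2).trans ?_
      rw [map_mul, this, one_mul]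
    rw [unitGauss, unitGauss]
    congr 4
    unfold placeForm
    refine Finset.sum_congr rfl fun w _ => ?_
    have h2 := unitScale_add_int c p.2 w
    simp only [map_mul, h1, h2]
    ring
  rw [← (Equiv.ofBijective _ (bijective_unit_decomposition (K := K))).tsum_eq]
  simp only [Equiv.ofBijective_apply, key]
  rw [ENNReal.tsum_prod (f := fun (_ : torsion K) (m : Fin (rank K) → ℤ) =>
    ∫⁻ c in unitBox (Fin (rank K)), unitGauss x a (c + fun j => (m j : ℝ))), ENNReal.tsum_const,
    ← lintegral_eq_tsum_unitBox]
  congr 1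
  rw [torsionOrder, ENat.card_eq_coe_natCard]
  rfl

variable (K) in
/-- The product of Gamma factors over the infinite places. -/
noncomputable def gammaWeight (s : ℝ) : ℝ :=
  ∏ w : InfinitePlace K, Real.Gamma (w.mult * s / 2) * (w.mult * Real.pi) ^ (-(w.mult * s / 2))

theorem gammaWeight_pos {s : ℝ} (hs : 0 < s) : 0 < gammaWeight K s := by
  refine Finset.prod_pos fun w _ => ?_
  have hm : (0 : ℝ) < w.mult := by exact_mod_cast InfinitePlace.mult_pos
  have := Real.pi_pos
  exact mul_pos (Real.Gamma_pos_of_pos (by positivity)) (Real.rpow_pos_of_pos (by positivity) _)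

theorem exists_lintegral_unitGauss : ∃ C : ENNReal, C ≠ 0 ∧ C ≠ ⊤ ∧
    ∀ (x : K) (_ : x ≠ 0) (v : ℝ) (_ : 0 < v) (s : ℝ) (_ : 0 < s),
    ∫⁻ t in Ioi 0, ENNReal.ofReal (t ^ (finrank ℚ K * s / 2 - 1)) *
      ∫⁻ c, unitGauss x (t * v) c =
    C * ENNReal.ofReal (gammaWeight K s * v ^ (-(finrank ℚ K * s / 2)) *
      ((|Algebra.norm ℚ x| : ℚ) : ℝ) ^ (-s)) := by
  obtain ⟨C, hC0, hC, h⟩ := exists_lintegral_gamma_unitCoords (K := K)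
  refine ⟨C, hC0, hC, fun x hx v hv s hs => ?_⟩
  have hwx : ∀ w : InfinitePlace K, 0 < w x := fun w => w.pos_iff.mpr hx
  have hpi := Real.pi_pos
  have hb : ∀ w : InfinitePlace K, 0 < Real.pi * v * w x ^ 2 := fun w => by
    have := hwx w; positivity
  have h1 := h _ hb s hs
  have h2 : ∀ (t : ℝ) (c : Fin (rank K) → ℝ), unitGauss x (t * v) c = ENNReal.ofReal (Real.exp
      (-∑ w : InfinitePlace K, w.mult * (t * unitScale K c w * (Real.pi * v * w x ^ 2)))) := by
    intro t c
    rw [unitGauss, placeForm, Finset.mul_sum]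
    congr 3
    exact Finset.sum_congr rfl fun w _ => by ring
  simp only [h2]
  rw [h1]
  congr 2
  obtain ⟨gw, hgw⟩ : ∃ gw : InfinitePlace K → ℝ, gw = fun w =>
    Real.Gamma (w.mult * s / 2) * (w.mult * Real.pi) ^ (-(w.mult * s / 2)) := ⟨_, rfl⟩
  have h3 : ∀ w : InfinitePlace K, Real.Gamma (w.mult * s / 2) *
      (w.mult * (Real.pi * v * w x ^ 2)) ^ (-(w.mult * s / 2)) =
      gw w * ((v ^ w.mult) ^ (-(s / 2)) * (w x ^ w.mult) ^ (-s)) := by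
    intro w
    have hm : (0 : ℝ) < w.mult := by exact_mod_cast InfinitePlace.mult_pos
    have := hwx w
    rw [show (w.mult : ℝ) * (Real.pi * v * w x ^ 2) = (w.mult * Real.pi) * (v * w x ^ 2) by ring,
      Real.mul_rpow (by positivity) (by positivity), Real.mul_rpow hv.le (by positivity),
      ← Real.rpow_natCast, ← Real.rpow_natCast, ← Real.rpow_natCast, ← Real.rpow_mul hv.le,
      ← Real.rpow_mul this.le, ← Real.rpow_mul this.le]
    have e1 : (w.mult : ℝ) * -(s / 2) = -(w.mult * s / 2) := by ring
    have e2 : ((2 : ℕ) : ℝ) * -(w.mult * s / 2) = w.mult * -s := by push_cast; ring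
    rw [e1, e2, hgw]; ring
  simp only [h3]
  have h4 : gammaWeight K s = ∏ w, gw w := by rw [hgw]; rfl
  rw [h4, Finset.prod_mul_distrib, Finset.prod_mul_distrib, ← mul_assoc]
  congr 2
  · rw [Real.finsetProd_rpow _ _ fun w _ => by positivity, Finset.prod_pow_eq_pow_sum,
      InfinitePlace.sum_mult_eq, ← Real.rpow_natCast, ← Real.rpow_mul hv.le]
    congr 1; ring
  · rw [Real.finsetProd_rpow _ _ fun w _ => pow_nonneg (hwx w).le _,
      InfinitePlace.prod_eq_abs_norm]

theorem exists_ideal_mul_eq (J : (FractionalIdeal (𝓞 K)⁰ K)ˣ) (x : {x : K // x ∈ J.1 ∧ x ≠ 0}) :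
    ∃ I : {I : Ideal (𝓞 K) // I ≠ ⊥},
      (I.1 : FractionalIdeal (𝓞 K)⁰ K) * J.1 = FractionalIdeal.spanSingleton (𝓞 K)⁰ x.1 := by
  have h1 : FractionalIdeal.spanSingleton (𝓞 K)⁰ x.1 * (J⁻¹).1 ≤ 1 := by
    rw [← J.mul_inv]
    exact mul_le_mul_left (FractionalIdeal.spanSingleton_le_iff_mem.mpr x.2.1) _
  obtain ⟨I, hI⟩ := FractionalIdeal.le_one_iff_exists_coeIdeal.mp h1
  have h2 : (I : FractionalIdeal (𝓞 K)⁰ K) * J.1 = FractionalIdeal.spanSingleton (𝓞 K)⁰ x.1 := by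
    rw [hI, mul_assoc, J.inv_mul, mul_one]
  refine ⟨⟨I, ?_⟩, h2⟩
  rintro rfl
  have h3 := (FractionalIdeal.spanSingleton_ne_zero_iff (R := 𝓞 K) (S := (𝓞 K)⁰)).mpr x.2.2
  apply h3
  rw [← h2]
  simp

theorem tsum_fiber_eq (J : (FractionalIdeal (𝓞 K)⁰ K)ˣ) (A : K → ENNReal) (I : Ideal (𝓞 K))
    {x₀ : K} (h0 : x₀ ≠ 0)
    (hx : (I : FractionalIdeal (𝓞 K)⁰ K) * J.1 = FractionalIdeal.spanSingleton (𝓞 K)⁰ x₀)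
    (P : {x : K // x ∈ J.1 ∧ x ≠ 0} → Prop)
    (hP : ∀ x, P x ↔ (I : FractionalIdeal (𝓞 K)⁰ K) * J.1 =
      FractionalIdeal.spanSingleton (𝓞 K)⁰ x.1) :
    ∑' x : {x // P x}, A x.1.1 = ∑' u : (𝓞 K)ˣ, A (x₀ * (u : 𝓞 K)) := by
  have hxJ : x₀ ∈ J.1 := by
    rw [← FractionalIdeal.spanSingleton_le_iff_mem, ← hx]
    calc (I : FractionalIdeal (𝓞 K)⁰ K) * J.1 ≤ 1 * J.1 :=
          mul_le_mul_left FractionalIdeal.coeIdeal_le_one _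
      _ = J.1 := one_mul _
  have hu : ∀ u : (𝓞 K)ˣ, x₀ * (u : 𝓞 K) ∈ J.1 ∧ x₀ * ((u : 𝓞 K) : K) ≠ 0 := by
    intro u
    refine ⟨?_, mul_ne_zero h0 (NumberField.Units.coe_ne_zero u)⟩
    have := Submodule.smul_mem (J.1 : Submodule (𝓞 K) K) (u : 𝓞 K) hxJ
    rw [Algebra.smul_def] at this
    rw [mul_comm]
    exact this
  have hspan : ∀ u : (𝓞 K)ˣ, FractionalIdeal.spanSingleton (𝓞 K)⁰ (x₀ * ((u : 𝓞 K) : K)) =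
      FractionalIdeal.spanSingleton (𝓞 K)⁰ x₀ := by
    intro u
    rw [eq_comm, FractionalIdeal.spanSingleton_eq_spanSingleton]
    exact ⟨u, by rw [Units.smul_def, Algebra.smul_def, mul_comm]⟩
  have hbij : Function.Bijective (fun u : (𝓞 K)ˣ =>
      (⟨⟨x₀ * ((u : 𝓞 K) : K), hu u⟩, (hP _).mpr (by rw [hx, hspan])⟩ : {x // P x})) := by
    constructor
    · intro u v huv
      have h1 := congrArg (fun y : {x // P x} => y.1.1) huv
      have h2 := mul_left_cancel₀ h0 h1
      exact Units.ext (RingOfIntegers.ext h2)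
    · rintro ⟨x, hxP⟩
      have h1 := (hP x).mp hxP
      rw [hx, FractionalIdeal.spanSingleton_eq_spanSingleton] at h1
      obtain ⟨u, hu'⟩ := h1
      refine ⟨u, Subtype.ext (Subtype.ext ?_)⟩
      have h2 : u • x₀ = x₀ * ((u : 𝓞 K) : K) := by
        rw [Units.smul_def, Algebra.smul_def, mul_comm]
      exact h2.symm.trans hu'
  rw [← (Equiv.ofBijective _ hbij).tsum_eq]
  simp only [Equiv.ofBijective_apply]

end Unfolding

section Mellin
open Module nonZeroDivisors MeasureTheory Set NumberField.Units
open scoped Classical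

variable {K : Type*} [Field K] [NumberField K]

theorem ofReal_heckeTheta_sub_one (J : (FractionalIdeal (𝓞 K)⁰ K)ˣ) {t : ℝ} (ht : 0 < t) :
    ENNReal.ofReal (heckeTheta J t - 1) = ∑' x : {x : K // x ∈ J.1 ∧ x ≠ 0},
      ∫⁻ c in unitBox (Fin (rank K)), unitGauss (x : K) (t * covol J ^ (-(2 : ℝ) / finrank ℚ K)) c := by
  have hcount : Countable K := (Module.finBasis ℚ K).equivFun.toEquiv.countable_iff.mpr inferInstance
  have hvol : volume.real (unitBox (Fin (rank K))) = 1 := by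
    rw [Measure.real, volume_unitBox]; rfl
  have hsub : heckeTheta J t - 1 =
      ∫ c in unitBox (Fin (rank K)), (scaledTheta J t c - 1) := by
    rw [integral_sub (integrableOn_scaledTheta J ht)
      (integrableOn_const (by rw [volume_unitBox]; simp)), setIntegral_const, hvol]
    simp [heckeTheta]
  have hone : ∀ c, 0 ≤ scaledTheta J t c - 1 := by
    intro c
    rw [scaledTheta, (idealTheta_eq_one_add J (scale_pos J ht c)).2, add_sub_cancel_left]
    exact tsum_nonneg fun _ => (Real.exp_pos _).le
  have hInt : IntegrableOn (fun c => scaledTheta J t c - 1) (unitBox (Fin (rank K))) :=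
    (integrableOn_scaledTheta J ht).sub (integrableOn_const (by rw [volume_unitBox]; simp))
  rw [hsub, ofReal_integral_eq_lintegral_ofReal hInt (ae_of_all _ hone), ← lintegral_tsum]
  · refine lintegral_congr fun c => ?_
    obtain ⟨s1, e1⟩ := idealTheta_eq_one_add J (scale_pos J ht c)
    rw [scaledTheta, e1, add_sub_cancel_left,
      ENNReal.ofReal_tsum_of_nonneg (fun _ => (Real.exp_pos _).le) s1]
    rfl
  · intro x
    have h1 := measurable_unitGauss (x : K)
    have h2 : Measurable fun c : Fin (rank K) → ℝ =>
        ((t * covol J ^ (-(2 : ℝ) / finrank ℚ K), c) : ℝ × (Fin (rank K) → ℝ)) :=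
      measurable_const.prodMk measurable_id
    have h3 := h1.comp h2
    exact h3.aemeasurable

theorem measurable_lintegral_unitGauss (x : K) (v : ℝ) (μ : Measure (Fin (rank K) → ℝ))
    [SFinite μ] : Measurable fun t : ℝ => ∫⁻ c, unitGauss x (t * v) c ∂μ := by
  have h2 : Measurable fun p : ℝ × (Fin (rank K) → ℝ) =>
      ((p.1 * v, p.2) : ℝ × (Fin (rank K) → ℝ)) :=
    (measurable_fst.mul_const v).prodMk measurable_snd
  have h1 := (measurable_unitGauss x).comp h2
  have h3 := h1.lintegral_prod_right' (ν := μ)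
  exact h3

set_option maxHeartbeats 1000000 in
variable (K) in
/-- The Mellin transform of the averaged theta function of `J` is a partial zeta function. -/
theorem exists_lintegral_heckeTheta : ∃ C : ENNReal, C ≠ 0 ∧ C ≠ ⊤ ∧
    ∀ (J : (FractionalIdeal (𝓞 K)⁰ K)ˣ) (s : ℝ), 0 < s →
    ∫⁻ t in Ioi 0, ENNReal.ofReal (t ^ (finrank ℚ K * s / 2 - 1)) *
      ENNReal.ofReal (heckeTheta J t - 1) =
    C * ENNReal.ofReal (gammaWeight K s * √|(discr K : ℝ)| ^ s) *
      ∑' I : {I : Ideal (𝓞 K) // I ≠ ⊥},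
        if (∃ x : K, (I.1 : FractionalIdeal (𝓞 K)⁰ K) * J.1 =
          FractionalIdeal.spanSingleton (𝓞 K)⁰ x) then
          ENNReal.ofReal ((Ideal.absNorm I.1 : ℝ) ^ (-s)) else 0 := by
  obtain ⟨C, hC0, hC, h⟩ := exists_lintegral_unitGauss (K := K)
  have hcount : Countable K := (Module.finBasis ℚ K).equivFun.toEquiv.countable_iff.mpr inferInstance
  have htor : (torsionOrder K : ENNReal) ≠ 0 := by
    exact_mod_cast (torsionOrder_pos K).ne'
  have hucount : Countable (𝓞 K)ˣ := by
    refine Function.Injective.countable (f := fun u : (𝓞 K)ˣ => ((u : 𝓞 K) : K)) ?_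
    intro u v huv
    exact Units.ext (RingOfIntegers.ext huv)
  refine ⟨torsionOrder K * C, mul_ne_zero htor hC0, ENNReal.mul_ne_top (by simp) hC,
    fun J s hs => ?_⟩
  obtain ⟨v, hvdef⟩ : ∃ v, v = covol J ^ (-(2 : ℝ) / finrank ℚ K) := ⟨_, rfl⟩
  have hv : 0 < v := hvdef ▸ Real.rpow_pos_of_pos (covol_pos J) _
  obtain ⟨W, hW⟩ : ∃ W : ℝ → ENNReal, W = fun t => ENNReal.ofReal (t ^ (finrank ℚ K * s / 2 - 1)) :=
    ⟨_, rfl⟩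
  have hWm : Measurable W := by rw [hW]; fun_prop
  obtain ⟨A, hA⟩ : ∃ A : K → ENNReal, A = fun x => ∫⁻ t in Ioi 0, W t *
    ∫⁻ c in unitBox (Fin (rank K)), unitGauss x (t * v) c := ⟨_, rfl⟩
  have hmeas : ∀ x : K, Measurable fun t => W t *
      ∫⁻ c in unitBox (Fin (rank K)), unitGauss x (t * v) c := fun x =>
    hWm.mul (measurable_lintegral_unitGauss x v _)
  have step1 : ∫⁻ t in Ioi 0, ENNReal.ofReal (t ^ (finrank ℚ K * s / 2 - 1)) *
      ENNReal.ofReal (heckeTheta J t - 1) = ∑' x : {x : K // x ∈ J.1 ∧ x ≠ 0}, A x.1 := by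
    have hl := lintegral_tsum (μ := volume.restrict (Ioi (0 : ℝ)))
      (f := fun (x : {x : K // x ∈ J.1 ∧ x ≠ 0}) t => W t *
        ∫⁻ c in unitBox (Fin (rank K)), unitGauss (x : K) (t * v) c)
      fun x => (hmeas x.1).aemeasurable
    rw [hA]
    refine Eq.trans ?_ hl
    refine setLIntegral_congr_fun measurableSet_Ioi fun t ht => ?_
    simp only [ofReal_heckeTheta_sub_one J (mem_Ioi.mp ht), hW, hvdef, ENNReal.tsum_mul_left]
  choose φ hφ using exists_ideal_mul_eq J
  have hP : ∀ I : {I : Ideal (𝓞 K) // I ≠ ⊥}, ∀ x, φ x = I ↔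
      (I.1 : FractionalIdeal (𝓞 K)⁰ K) * J.1 = FractionalIdeal.spanSingleton (𝓞 K)⁰ x.1 := by
    intro I x
    constructor
    · rintro rfl
      exact hφ x
    · intro hI
      have h1 := (hφ x).trans hI.symm
      have h2 := J.isUnit.mul_right_cancel h1
      exact Subtype.ext (FractionalIdeal.coeIdeal_injective h2)
  rw [step1, ← (Equiv.sigmaFiberEquiv φ).tsum_eq, ENNReal.tsum_sigma', ← ENNReal.tsum_mul_left]
  refine tsum_congr fun I => ?_
  have e1 : ∑' b : {x // φ x = I}, A ((Equiv.sigmaFiberEquiv φ) ⟨I, b⟩).1 =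
      ∑' x : {x // φ x = I}, A x.1.1 := rfl
  rw [e1]
  split_ifs with hI
  · obtain ⟨x₀, hx₀⟩ := hI
    have h0 : x₀ ≠ 0 := by
      rintro rfl
      rw [FractionalIdeal.spanSingleton_zero] at hx₀
      rcases mul_eq_zero.mp hx₀ with h | h
      · exact I.2 (FractionalIdeal.coeIdeal_eq_zero.mp h)
      · exact J.ne_zero h
    rw [tsum_fiber_eq J A I.1 h0 hx₀ _ (hP I), hA]
    have hl := lintegral_tsum (μ := volume.restrict (Ioi (0 : ℝ)))
      (f := fun (u : (𝓞 K)ˣ) t => W t *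
        ∫⁻ c in unitBox (Fin (rank K)), unitGauss (x₀ * ((u : 𝓞 K) : K)) (t * v) c)
      fun u => (hmeas _).aemeasurable
    refine hl.symm.trans ?_
    have e2 : ∀ t, ∑' u : (𝓞 K)ˣ, W t *
        ∫⁻ c in unitBox (Fin (rank K)), unitGauss (x₀ * ((u : 𝓞 K) : K)) (t * v) c =
        torsionOrder K * (W t * ∫⁻ c, unitGauss x₀ (t * v) c) := by
      intro t
      rw [ENNReal.tsum_mul_left, tsum_unit_unitGauss]
      ring
    simp only [e2]
    have hm : Measurable fun t => W t * ∫⁻ c, unitGauss x₀ (t * v) c :=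
      hWm.mul (measurable_lintegral_unitGauss x₀ v _)
    rw [lintegral_const_mul _ hm, hW,
      h x₀ h0 v hv s hs, mul_assoc, mul_assoc, mul_assoc, ← ENNReal.ofReal_mul
        (by have := gammaWeight_pos (K := K) hs; positivity)]
    congr 3
    have hnorm : ((|Algebra.norm ℚ x₀| : ℚ) : ℝ) =
        (Ideal.absNorm I.1 : ℝ) * ((FractionalIdeal.absNorm J.1 : ℚ) : ℝ) := by
      rw [← FractionalIdeal.absNorm_span_singleton (R := 𝓞 K), ← hx₀, map_mul,
        FractionalIdeal.coeIdeal_absNorm]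
      push_cast
      rfl
    have hn : (0 : ℝ) < finrank ℚ K := by exact_mod_cast finrank_pos
    have hcov := covol_pos J
    have hD : 0 < √|(discr K : ℝ)| := by
      rw [Real.sqrt_pos, abs_pos]; exact_mod_cast discr_ne_zero K
    have hNJ : 0 < ((FractionalIdeal.absNorm J.1 : ℚ) : ℝ) := by
      rw [covol] at hcov
      exact pos_of_mul_pos_left hcov hD.le
    have hv2 : v ^ (-(finrank ℚ K * s / 2)) = covol J ^ s := by
      rw [hvdef, ← Real.rpow_mul hcov.le]
      congr 1
      field_simp
    rw [hv2, hnorm, covol, Real.mul_rpow hNJ.le hD.le, Real.mul_rpow (by positivity) hNJ.le,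
      Real.rpow_neg hNJ.le]
    have := (Real.rpow_pos_of_pos hNJ s).ne'
    field_simp
  · rw [mul_zero, ENNReal.tsum_eq_zero]
    rintro ⟨x, hx⟩
    exact absurd ⟨x.1, (hP I x).mp hx⟩ hI

end Mellin

section ClassSum
open Module nonZeroDivisors MeasureTheory Set NumberField.Units
open scoped Classical

variable {K : Type*} [Field K] [NumberField K]

/-- A family of fractional ideals representing every ideal class exactly once. -/
def IsClassFamily (J : ClassGroup (𝓞 K) → (FractionalIdeal (𝓞 K)⁰ K)ˣ) : Prop :=
  Function.Bijective fun c =>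
    (QuotientGroup.mk (J c) : (FractionalIdeal (𝓞 K)⁰ K)ˣ ⧸ (toPrincipalIdeal (𝓞 K) K).range)

variable (K) in
theorem exists_isClassFamily :
    ∃ J : ClassGroup (𝓞 K) → (FractionalIdeal (𝓞 K)⁰ K)ˣ, IsClassFamily J := by
  refine ⟨fun c => Quotient.out (ClassGroup.equiv K c), ?_⟩
  have h : (fun c : ClassGroup (𝓞 K) => (QuotientGroup.mk (Quotient.out (ClassGroup.equiv K c)) :
      (FractionalIdeal (𝓞 K)⁰ K)ˣ ⧸ (toPrincipalIdeal (𝓞 K) K).range)) = ClassGroup.equiv K := by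
    funext c
    exact QuotientGroup.out_eq' _
  unfold IsClassFamily
  rw [h]
  exact (ClassGroup.equiv K).bijective

theorem IsClassFamily.dualUnit {J : ClassGroup (𝓞 K) → (FractionalIdeal (𝓞 K)⁰ K)ˣ}
    (hJ : IsClassFamily J) : IsClassFamily fun c => dualUnit (J c) := by
  have h1 : ∀ J' : (FractionalIdeal (𝓞 K)⁰ K)ˣ, _root_.dualUnit J' = _root_.dualUnit 1 * J'⁻¹ := by
    intro J'
    ext1
    simp only [_root_.dualUnit, Units.val_mk0, Units.val_mul, Units.val_inv_eq_inv_val, Units.val_one]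
    exact FractionalIdeal.dual_eq_mul_inv ℤ ℚ _
  unfold IsClassFamily
  have h2 : (fun c => (QuotientGroup.mk (_root_.dualUnit (J c)) :
      (FractionalIdeal (𝓞 K)⁰ K)ˣ ⧸ (toPrincipalIdeal (𝓞 K) K).range)) =
      (fun q => QuotientGroup.mk (_root_.dualUnit 1) * q⁻¹) ∘ fun c => QuotientGroup.mk (J c) := by
    funext c
    simp only [Function.comp]
    rw [h1]
    rfl
  rw [h2]
  have h3 := (Equiv.mulLeft (QuotientGroup.mk (_root_.dualUnit 1) :
    (FractionalIdeal (𝓞 K)⁰ K)ˣ ⧸ (toPrincipalIdeal (𝓞 K) K).range)).bijective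
  exact (h3.comp (Equiv.inv _).bijective).comp hJ

theorem IsClassFamily.existsUnique {J : ClassGroup (𝓞 K) → (FractionalIdeal (𝓞 K)⁰ K)ˣ}
    (hJ : IsClassFamily J) {I : Ideal (𝓞 K)} (hI : I ≠ ⊥) :
    ∃! c, ∃ x : K, (I : FractionalIdeal (𝓞 K)⁰ K) * (J c).1 =
      FractionalIdeal.spanSingleton (𝓞 K)⁰ x := by
  have hI' : (I : FractionalIdeal (𝓞 K)⁰ K) ≠ 0 := by
    rwa [ne_eq, FractionalIdeal.coeIdeal_eq_zero]
  have key : ∀ c, (∃ x : K, (I : FractionalIdeal (𝓞 K)⁰ K) * (J c).1 =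
      FractionalIdeal.spanSingleton (𝓞 K)⁰ x) ↔
      (QuotientGroup.mk (J c) : (FractionalIdeal (𝓞 K)⁰ K)ˣ ⧸ (toPrincipalIdeal (𝓞 K) K).range) =
        (QuotientGroup.mk (Units.mk0 _ hI'))⁻¹ := by
    intro c
    rw [eq_inv_iff_mul_eq_one, ← QuotientGroup.mk_mul, QuotientGroup.eq_one_iff,
      mem_principal_ideals_iff]
    refine exists_congr fun x => ?_
    rw [Units.val_mul, Units.val_mk0, mul_comm, eq_comm]
  simp only [key]
  exact Function.Bijective.existsUnique hJ _

/-- The sum over ideal classes of the averaged theta functions. -/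
noncomputable def thetaSum (J : ClassGroup (𝓞 K) → (FractionalIdeal (𝓞 K)⁰ K)ˣ) (t : ℝ) : ℝ :=
  ∑ c, heckeTheta (J c) t

theorem heckeTheta_sub_one_nonneg (J : (FractionalIdeal (𝓞 K)⁰ K)ˣ) {t : ℝ} (ht : 0 < t) :
    0 ≤ heckeTheta J t - 1 := by
  have hvol : volume.real (unitBox (Fin (rank K))) = 1 := by
    rw [Measure.real, volume_unitBox]; rfl
  have hsub : heckeTheta J t - 1 =
      ∫ c in unitBox (Fin (rank K)), (scaledTheta J t c - 1) := by
    rw [integral_sub (integrableOn_scaledTheta J ht)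
      (integrableOn_const (by rw [volume_unitBox]; simp)), setIntegral_const, hvol]
    simp [heckeTheta]
  rw [hsub]
  refine integral_nonneg fun c => ?_
  simp only [Pi.zero_apply, scaledTheta, (idealTheta_eq_one_add J (scale_pos J ht c)).2,
    add_sub_cancel_left]
  exact tsum_nonneg fun _ => (Real.exp_pos _).le

variable (K) in
theorem exists_lintegral_thetaSum : ∃ C : ENNReal, C ≠ 0 ∧ C ≠ ⊤ ∧
    ∀ (J : ClassGroup (𝓞 K) → (FractionalIdeal (𝓞 K)⁰ K)ˣ) (s : ℝ), IsClassFamily J → 0 < s →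
    ∫⁻ t in Ioi 0, ENNReal.ofReal (t ^ (finrank ℚ K * s / 2 - 1)) *
      ENNReal.ofReal (thetaSum J t - Fintype.card (ClassGroup (𝓞 K))) =
    C * ENNReal.ofReal (gammaWeight K s * √|(discr K : ℝ)| ^ s) *
      ∑' I : {I : Ideal (𝓞 K) // I ≠ ⊥}, ENNReal.ofReal ((Ideal.absNorm I.1 : ℝ) ^ (-s)) := by
  obtain ⟨C, hC0, hC, h⟩ := exists_lintegral_heckeTheta K
  refine ⟨C, hC0, hC, fun J s hJ hs => ?_⟩
  have hmeasθ : ∀ c, AEMeasurable (fun t => ENNReal.ofReal (t ^ (finrank ℚ K * s / 2 - 1)) *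
      ENNReal.ofReal (heckeTheta (J c) t - 1)) (volume.restrict (Ioi 0)) := by
    intro c
    have h1 := aemeasurable_restrict_of_antitoneOn (μ := volume) measurableSet_Ioi
      (antitoneOn_heckeTheta (J c))
    have h2 : Measurable fun t : ℝ => ENNReal.ofReal (t ^ (finrank ℚ K * s / 2 - 1)) := by fun_prop
    exact h2.aemeasurable.mul (h1.sub_const 1).ennreal_ofReal
  calc ∫⁻ t in Ioi 0, ENNReal.ofReal (t ^ (finrank ℚ K * s / 2 - 1)) *
        ENNReal.ofReal (thetaSum J t - Fintype.card (ClassGroup (𝓞 K)))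
      = ∫⁻ t in Ioi 0, ∑ c, ENNReal.ofReal (t ^ (finrank ℚ K * s / 2 - 1)) *
          ENNReal.ofReal (heckeTheta (J c) t - 1) := by
        refine setLIntegral_congr_fun measurableSet_Ioi fun t ht => ?_
        rw [← Finset.mul_sum, ← ENNReal.ofReal_sum_of_nonneg fun c _ =>
          heckeTheta_sub_one_nonneg (J c) (mem_Ioi.mp ht), Finset.sum_sub_distrib]
        simp [thetaSum]
    _ = ∑ c, C * ENNReal.ofReal (gammaWeight K s * √|(discr K : ℝ)| ^ s) *
          ∑' I : {I : Ideal (𝓞 K) // I ≠ ⊥},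
            if (∃ x : K, (I.1 : FractionalIdeal (𝓞 K)⁰ K) * (J c).1 =
              FractionalIdeal.spanSingleton (𝓞 K)⁰ x) then
              ENNReal.ofReal ((Ideal.absNorm I.1 : ℝ) ^ (-s)) else 0 := by
        rw [lintegral_finsetSum' _ fun c _ => hmeasθ c]
        exact Finset.sum_congr rfl fun c _ => h (J c) s hs
    _ = _ := by
        rw [← Finset.mul_sum]
        congr 1
        rw [← tsum_fintype (L := SummationFilter.unconditional _), ENNReal.tsum_comm]
        refine tsum_congr fun I => ?_
        obtain ⟨c, hc, hu⟩ := hJ.existsUnique I.2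
        rw [tsum_eq_single c fun c' hc' => if_neg fun hx => hc' (hu c' hx), if_pos hc]

end ClassSum

section StripBounds
open Complex Filter Topology MeasureTheory Set

theorem WeakFEPair.exists_norm_Λ₀_le (P : WeakFEPair ℂ) (a b : ℝ) :
    ∃ B, ∀ s : ℂ, a ≤ s.re → s.re ≤ b → ‖P.Λ₀ s‖ ≤ B := by
  have hc : ∀ x : ℝ, IntegrableOn (fun t : ℝ => t ^ (x - 1) * ‖P.f_modif t‖) (Ioi 0) := by
    intro x
    have hP := P.isStrongFEPair_toStrongFEPair
    have hconv : MellinConvergent P.f_modif (x : ℂ) :=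
      mellinConvergent_of_isBigO_rpow P.toStrongFEPair.hf_int (hP.hf_top (-(x + 1)))
        (by simp) (hP.hf_zero (-(x - 1))) (by simp)
    have h := hconv.norm
    refine h.congr ?_
    filter_upwards [ae_restrict_mem measurableSet_Ioi] with t ht
    rw [norm_smul, norm_cpow_eq_rpow_re_of_pos ht]
    simp
  refine ⟨∫ t in Ioi 0, (t ^ (a - 1) * ‖P.f_modif t‖ + t ^ (b - 1) * ‖P.f_modif t‖),
    fun s h1 h2 => ?_⟩
  refine norm_integral_le_of_norm_le ((hc a).add (hc b)) ?_
  filter_upwards [ae_restrict_mem measurableSet_Ioi] with t ht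
  have ht : 0 < t := ht
  rw [norm_smul, norm_cpow_eq_rpow_re_of_pos ht, ← add_mul]
  refine mul_le_mul_of_nonneg_right ?_ (norm_nonneg _)
  have e : (s - 1).re = s.re - 1 := by simp
  have ha := Real.rpow_nonneg ht.le (a - 1)
  have hb := Real.rpow_nonneg ht.le (b - 1)
  rw [e]
  rcases le_total t 1 with h | h
  · have := Real.rpow_le_rpow_of_exponent_ge ht h (show a - 1 ≤ s.re - 1 by linarith)
    linarith
  · have := Real.rpow_le_rpow_of_exponent_le h (show s.re - 1 ≤ b - 1 by linarith)
    linarith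

theorem norm_sin_le_exp (w : ℂ) : ‖sin w‖ ≤ Real.exp ‖w‖ := by
  have h : ∀ z : ℂ, ‖z‖ = ‖w‖ → ‖exp z‖ ≤ Real.exp ‖w‖ := fun z hz => by
    rw [norm_exp, ← hz]; exact Real.exp_le_exp.mpr (re_le_norm z)
  have h1 := h (-w * I) (by simp)
  have h2 := h (w * I) (by simp)
  rw [sin, norm_div, norm_mul, norm_I, mul_one]
  have h3 := norm_sub_le (exp (-w * I)) (exp (w * I))
  simp only [Complex.norm_ofNat]
  linarith

theorem exists_inv_norm_Gamma_le : ∃ C, 0 ≤ C ∧ ∀ u : ℂ, 1 / 8 ≤ u.re → u.re ≤ 3 / 2 →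
    ‖Gamma u‖⁻¹ ≤ Real.exp (C * (1 + ‖u‖)) := by
  obtain ⟨B1, hB1⟩ := (isCompact_closedBall (1 : ℂ) (1 / 4)).exists_bound_of_continuousOn
    (f := fun s => (Gamma s)⁻¹) differentiable_one_div_Gamma.continuous.continuousOn
  obtain ⟨B2, hB2⟩ := (isCompact_Icc (a := (1 / 2 : ℝ)) (b := 15 / 8)).exists_bound_of_continuousOn
    (f := Real.Gamma) fun x hx => (Real.differentiableAt_Gamma fun m => by
      have : (0 : ℝ) ≤ m := Nat.cast_nonneg m
      have := hx.1
      linarith).continuousAt.continuousWithinAt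
  have hpi := Real.pi_pos
  have hB1' := (norm_nonneg _).trans (hB1 1 (by simp))
  have hB2' := (norm_nonneg _).trans (hB2 1 (by norm_num))
  refine ⟨B1 + 4 * B2 + Real.pi, by positivity, fun u h1 h2 => ?_⟩
  have hu := norm_nonneg u
  rcases le_or_gt ‖u - 1‖ (1 / 4) with h | h
  · have := hB1 u (by rw [mem_closedBall_iff_norm]; exact h)
    rw [norm_inv] at this
    refine this.trans ?_
    have h3 := Real.add_one_le_exp ((B1 + 4 * B2 + Real.pi) * (1 + ‖u‖))
    nlinarith
  · have hu1 : u - 1 ≠ 0 := norm_pos_iff.mp (by linarith)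
    have e1 : Gamma u = (u - 1) * Gamma (u - 1) := by
      rw [← Gamma_add_one _ hu1]; congr 1; ring
    have e2 := Gamma_mul_Gamma_one_sub (u - 1)
    have e3 : (1 : ℂ) - (u - 1) = 2 - u := by ring
    rw [e3] at e2
    have hne : Gamma u ≠ 0 := Gamma_ne_zero_of_re_pos (by linarith)
    have e4 : (Gamma u)⁻¹ * ((u - 1) * Real.pi) = Gamma (2 - u) * sin (Real.pi * (u - 1)) := by
      rcases eq_or_ne (sin (Real.pi * (u - 1))) 0 with h0 | h0
      · exfalso
        rw [h0, div_zero] at e2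
        have hre : 0 < (2 - u).re := by simp; linarith
        rcases mul_eq_zero.mp e2 with h | h
        · rw [e1, h, mul_zero] at hne; exact hne rfl
        · exact Gamma_ne_zero_of_re_pos hre h
      · rw [eq_div_iff h0] at e2
        have hne2 : Gamma (u - 1) ≠ 0 := fun h => hne (by rw [e1, h, mul_zero])
        rw [e1]
        generalize sin (Real.pi * (u - 1)) = S at *
        field_simp
        linear_combination -e2
    have e5 := congrArg norm e4
    rw [norm_mul, norm_mul, norm_mul, norm_inv, Complex.norm_of_nonneg hpi.le] at e5
    have hre : (2 - u).re ∈ Icc (1 / 2 : ℝ) (15 / 8) := by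
      constructor <;> simp <;> linarith
    have h3 : ‖Gamma (2 - u)‖ ≤ B2 := by
      have h4 : ‖Gamma (2 - u)‖ ≤ Real.Gamma (2 - u).re := by
        have hpos : 0 < (2 - u).re := by linarith [hre.1]
        rw [Gamma_eq_integral hpos, Real.Gamma_eq_integral hpos]
        refine (norm_integral_le_integral_norm _).trans_eq ?_
        refine setIntegral_congr_fun measurableSet_Ioi fun x hx => ?_
        simp only [norm_mul, norm_cpow_eq_rpow_re_of_pos (mem_Ioi.mp hx), norm_real,
          Real.norm_of_nonneg (Real.exp_pos _).le, sub_re, one_re]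
      exact h4.trans ((le_abs_self _).trans (hB2 _ hre))
    have h4 : ‖sin (Real.pi * (u - 1))‖ ≤ Real.exp (Real.pi * (1 + ‖u‖)) := by
      refine (norm_sin_le_exp _).trans (Real.exp_le_exp.mpr ?_)
      rw [norm_mul, Complex.norm_of_nonneg hpi.le]
      refine mul_le_mul_of_nonneg_left ?_ hpi.le
      have := norm_sub_le u 1
      rw [norm_one] at this
      linarith
    have h5 : ‖Gamma u‖⁻¹ ≤ 4 * B2 * Real.exp (Real.pi * (1 + ‖u‖)) := by
      have h6 : ‖Gamma (2 - u)‖ * ‖sin (Real.pi * (u - 1))‖ ≤ B2 * Real.exp (Real.pi * (1 + ‖u‖)) :=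
        mul_le_mul h3 h4 (norm_nonneg _) hB2'
      have h7 : ‖Gamma u‖⁻¹ * (1 / 4 * 1) ≤ ‖Gamma u‖⁻¹ * (‖u - 1‖ * Real.pi) :=
        mul_le_mul_of_nonneg_left (by
          refine mul_le_mul h.le ?_ (by norm_num) (norm_nonneg _)
          linarith [Real.pi_gt_three]) (by positivity)
      linarith
    refine h5.trans ?_
    have h6 : 4 * B2 ≤ Real.exp ((B1 + 4 * B2) * (1 + ‖u‖)) := by
      have := Real.add_one_le_exp ((B1 + 4 * B2) * (1 + ‖u‖))
      nlinarith
    calc 4 * B2 * Real.exp (Real.pi * (1 + ‖u‖)) ≤ Real.exp ((B1 + 4 * B2) * (1 + ‖u‖)) *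
          Real.exp (Real.pi * (1 + ‖u‖)) := mul_le_mul_of_nonneg_right h6 (Real.exp_pos _).le
      _ = _ := by rw [← Real.exp_add]; ring_nf

theorem exists_inv_norm_GammaR_le : ∃ C, 0 ≤ C ∧ ∀ s : ℂ, 1 / 4 ≤ s.re → s.re ≤ 3 →
    ‖Gammaℝ s‖⁻¹ ≤ Real.exp (C * (1 + ‖s‖)) := by
  obtain ⟨C, hC, h⟩ := exists_inv_norm_Gamma_le
  refine ⟨C + 2 * Real.pi, by have := Real.pi_pos; positivity, fun s h1 h2 => ?_⟩
  have h3 := h (s / 2) (by simp; linarith) (by simp; linarith)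
  have hs := norm_nonneg s
  rw [Gammaℝ_def, norm_mul, mul_inv, norm_cpow_eq_rpow_re_of_pos Real.pi_pos, norm_div] at *
  have h4 : (Real.pi ^ ((-s / 2).re))⁻¹ ≤ Real.exp (2 * Real.pi * (1 + ‖s‖)) := by
    rw [← Real.rpow_neg Real.pi_pos.le]
    calc Real.pi ^ (-(-s / 2).re) ≤ Real.pi ^ (2 : ℝ) := by
          refine Real.rpow_le_rpow_of_exponent_le (by linarith [Real.pi_gt_three]) ?_
          simp; linarith
      _ ≤ Real.exp (2 * Real.pi * (1 + ‖s‖)) := by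
          have h5 : Real.pi ≤ Real.exp Real.pi := by linarith [Real.add_one_le_exp Real.pi]
          have h6 : Real.pi ^ (2 : ℝ) ≤ Real.exp Real.pi ^ (2 : ℝ) :=
            Real.rpow_le_rpow Real.pi_pos.le h5 (by norm_num)
          refine h6.trans ?_
          rw [← Real.exp_mul, Real.exp_le_exp]
          nlinarith [Real.pi_pos]
  rw [add_mul, add_comm, Real.exp_add]
  refine mul_le_mul h4 (h3.trans (Real.exp_le_exp.mpr ?_)) (by positivity) (Real.exp_pos _).le
  simp only [Complex.norm_ofNat]
  nlinarith

end StripBounds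

section Completed
open Complex Filter Topology MeasureTheory Set

theorem frequently_of_ofReal {P : ℂ → Prop} (h : ∀ σ : ℝ, 2 < σ → P σ) :
    ∃ᶠ z in 𝓝[≠] (3 : ℂ), P z := by
  have ht : Tendsto (fun σ : ℝ => (σ : ℂ)) (𝓝[≠] 3) (𝓝[≠] (3 : ℂ)) := by
    refine tendsto_nhdsWithin_iff.mpr ⟨?_, ?_⟩
    · have := (continuous_ofReal.tendsto (3 : ℝ)).mono_left
        (nhdsWithin_le_nhds (s := ({3}ᶜ : Set ℝ)))
      simpa using this
    · filter_upwards [self_mem_nhdsWithin] with σ hσ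
      simp only [mem_compl_iff, mem_singleton_iff] at hσ ⊢
      exact_mod_cast hσ
  refine ht.frequently (Eventually.frequently ?_)
  have : ∀ᶠ σ : ℝ in 𝓝 3, 2 < σ := lt_mem_nhds (by norm_num)
  filter_upwards [nhdsWithin_le_nhds this] with σ hσ using h σ hσ

theorem eqOn_of_eq_ofReal {f g : ℂ → ℂ} {U : Set ℂ} (hU : IsOpen U) (hc : IsPreconnected U)
    (h3 : (3 : ℂ) ∈ U) (hf : DifferentiableOn ℂ f U) (hg : DifferentiableOn ℂ g U)
    (h : ∀ σ : ℝ, 2 < σ → f σ = g σ) : EqOn f g U :=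
  (hf.analyticOnNhd hU).eqOn_of_preconnected_of_frequently_eq (hg.analyticOnNhd hU) hc h3
    (frequently_of_ofReal h)

theorem ZetaData.of_completed {F Z Xi : ℂ → ℂ} {a b : ℕ} {D A B : ℝ} {c : ℂ} (hD : 0 < D)
    (hF : Differentiable ℂ F) (hne : ∀ s : ℂ, 1 / 2 < s.re → F s ≠ 0) (hc : c ≠ 0)
    (hXi : Differentiable ℂ Xi) (hfe : ∀ s, Xi (1 - s) = Xi s)
    (heq : ∀ σ : ℝ, 2 < σ → Xi σ = c * xiFun F a b D σ)
    (hbd : ∀ s : ℂ, 1 / 4 ≤ s.re → s.re ≤ 2 → ‖Xi s‖ ≤ B * (1 + ‖s‖) ^ 2)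
    (hZ : ∀ s : ℂ, 2 ≤ s.re → F s = (s - 1) * Z s ∧ ‖Z s - 1‖ ≤ A * 2 ^ (-s.re))
    (hreal : ∀ σ : ℝ, 2 < σ → (F σ).im = 0) : ZetaData F a b D := by
  have hopen : IsOpen {s : ℂ | 0 < s.re} := isOpen_lt continuous_const continuous_re
  have hconn : IsPreconnected {s : ℂ | 0 < s.re} :=
    (convex_halfSpace_re_gt 0).isPreconnected
  have hxi : DifferentiableOn ℂ (xiFun F a b D) {s : ℂ | 0 < s.re} := by
    intro s hs
    have h1 : DifferentiableAt ℂ (fun s : ℂ => (D : ℂ) ^ (s / 2)) s :=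
      DifferentiableAt.const_cpow (by fun_prop) (Or.inl (by exact_mod_cast hD.ne'))
    exact ((((differentiableAt_id.mul h1).mul ((differentiableAt_GammaR hs).pow a)).mul
      ((ZetaData.differentiableAt_GammaR_add_one hs).pow b)).mul (hF s)).differentiableWithinAt
  have key : ∀ s : ℂ, 0 < s.re → Xi s = c * xiFun F a b D s := fun s hs =>
    eqOn_of_eq_ofReal hopen hconn (by simp) hXi.differentiableOn (hxi.const_mul c) heq hs
  have hA : 0 ≤ A := by
    have := (norm_nonneg _).trans (hZ 2 (by simp)).2
    have h2 : (0 : ℝ) < 2 ^ (-(2 : ℂ).re) := by positivity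
    exact nonneg_of_mul_nonneg_left this h2
  have hB : 0 ≤ B := by
    have := (norm_nonneg _).trans (hbd 1 (by norm_num) (by norm_num))
    exact nonneg_of_mul_nonneg_left this (by positivity)
  have hupper : ∀ s : ℂ, 2 ≤ s.re → ‖F s‖ ≤ (1 + A) * (1 + ‖s‖) := by
    intro s hs
    obtain ⟨h1, h2⟩ := hZ s hs
    have h3 : ‖Z s‖ ≤ 1 + A := by
      have h4 : (2 : ℝ) ^ (-s.re) ≤ 1 := Real.rpow_le_one_of_one_le_of_nonpos (by norm_num) (by linarith)
      have h5 := norm_add_le (Z s - 1) 1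
      rw [sub_add_cancel, norm_one] at h5
      nlinarith
    rw [h1, norm_mul, mul_comm (1 + A)]
    refine mul_le_mul ?_ h3 (norm_nonneg _) (by positivity)
    have := norm_sub_le s 1
    rw [norm_one] at this
    linarith
  refine ⟨hD, hF.differentiableOn, hne, ?_, ?_, ?_, ?_⟩
  · intro s _
    have hG : Differentiable ℂ fun s => starRingEnd ℂ (F (starRingEnd ℂ s)) := fun s => by
      have := (hF (starRingEnd ℂ s)).conj_conj
      rwa [conj_conj] at this
    have h1 := eqOn_of_eq_ofReal isOpen_univ isPreconnected_univ (mem_univ _)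
      hG.differentiableOn hF.differentiableOn (fun σ hσ => by
        simp only [conj_ofReal]
        exact conj_eq_iff_im.mpr (hreal σ hσ)) (mem_univ s)
    simp only at h1
    rw [← h1, conj_conj]
  · intro s h0 h1
    have h2 := hfe s
    rw [key s h0, key (1 - s) (by simp; linarith)] at h2
    exact mul_left_cancel₀ hc h2
  · obtain ⟨C, hC, hG⟩ := exists_inv_norm_GammaR_le
    have hcn : 0 < ‖c‖ := norm_pos_iff.mpr hc
    obtain ⟨d, hd, hDd⟩ : ∃ d : ℝ, 0 < d ∧ ∀ x : ℝ, 1 / 4 ≤ x → x ≤ 2 → d ≤ D ^ (x / 2) := by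
      refine ⟨min 1 D, by positivity, fun x h1 h2 => ?_⟩
      rcases le_total 1 D with h | h
      · exact (min_le_left _ _).trans (Real.one_le_rpow h (by linarith))
      · refine (min_le_right _ _).trans ?_
        have := Real.rpow_le_rpow_of_exponent_ge hD h (show x / 2 ≤ 1 by linarith)
        rwa [Real.rpow_one] at this
    have hCpos : 0 ≤ 4 * B / (‖c‖ * d) := by positivity
    refine ⟨4 * B / (‖c‖ * d) + 2 + a * C + b * (2 * C) + (1 + A), fun s hs => ?_⟩
    have hsn := norm_nonneg s
    have hexp1 : ∀ x : ℝ, 0 ≤ x → x * (1 + ‖s‖) ≤ Real.exp (x * (1 + ‖s‖)) := fun x _ => by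
      linarith [Real.add_one_le_exp (x * (1 + ‖s‖))]
    rcases le_total 2 s.re with h2 | h2
    · refine (hupper s h2).trans ((hexp1 _ (by linarith)).trans (Real.exp_le_exp.mpr ?_))
      refine mul_le_mul_of_nonneg_right ?_ (by linarith)
      have : 0 ≤ a * C := by positivity
      have : 0 ≤ b * (2 * C) := by positivity
      linarith
    · have h0 : 0 < s.re := by linarith
      have hs0 : s ≠ 0 := fun h => by rw [h] at h0; simp at h0
      have e1 := key s h0
      have hs4 : 1 / 4 ≤ ‖s‖ := hs.trans (re_le_norm s)
      have hG1 := hG s hs (by linarith)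
      have hG2 := hG (s + 1) (by simp; linarith) (by simp; linarith)
      have hg1 : Gammaℝ s ≠ 0 := Gammaℝ_ne_zero_of_re_pos h0
      have hg2 : Gammaℝ (s + 1) ≠ 0 := Gammaℝ_ne_zero_of_re_pos (by simp; linarith)
      have hDs : ‖(D : ℂ) ^ (s / 2)‖ = D ^ (s.re / 2) := by
        rw [norm_cpow_eq_rpow_re_of_pos hD]; simp
      have e2 : ‖F s‖ = ‖Xi s‖ * (‖c‖ * ‖s‖ * D ^ (s.re / 2))⁻¹ * ‖Gammaℝ s‖⁻¹ ^ a *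
          ‖Gammaℝ (s + 1)‖⁻¹ ^ b := by
        have hDp : 0 < D ^ (s.re / 2) := Real.rpow_pos_of_pos hD _
        rw [e1, xiFun]
        simp only [norm_mul, norm_pow, hDs, inv_pow]
        have := norm_pos_iff.mpr hg1
        have := norm_pos_iff.mpr hg2
        have := norm_pos_iff.mpr hs0
        field_simp
      have b1 : ‖Xi s‖ * (‖c‖ * ‖s‖ * D ^ (s.re / 2))⁻¹ ≤
          Real.exp ((4 * B / (‖c‖ * d) + 2) * (1 + ‖s‖)) := by
        have i1 : (‖c‖ * ‖s‖ * D ^ (s.re / 2))⁻¹ ≤ (‖c‖ * (1 / 4) * d)⁻¹ := by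
          refine inv_anti₀ (by positivity) ?_
          exact mul_le_mul (mul_le_mul_of_nonneg_left hs4 hcn.le) (hDd _ hs h2) hd.le (by positivity)
        calc ‖Xi s‖ * (‖c‖ * ‖s‖ * D ^ (s.re / 2))⁻¹
            ≤ B * (1 + ‖s‖) ^ 2 * (‖c‖ * (1 / 4) * d)⁻¹ :=
              mul_le_mul (hbd s hs h2) i1
                (inv_nonneg.mpr (by have := Real.rpow_pos_of_pos hD (s.re / 2); positivity))
                (by positivity)
          _ = (4 * B / (‖c‖ * d)) * (1 + ‖s‖) ^ 2 := by field_simp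
          _ ≤ Real.exp ((4 * B / (‖c‖ * d)) * (1 + ‖s‖)) * Real.exp (2 * (1 + ‖s‖)) := by
              refine mul_le_mul ?_ ?_ (by positivity) (Real.exp_pos _).le
              · refine le_trans ?_ (hexp1 _ hCpos)
                exact le_mul_of_one_le_right hCpos (by linarith)
              · have := hexp1 1 zero_le_one
                rw [one_mul] at this
                calc (1 + ‖s‖) ^ 2 ≤ Real.exp (1 + ‖s‖) ^ 2 :=
                      pow_le_pow_left₀ (by linarith) this 2
                  _ = _ := by rw [← Real.exp_nat_mul]; norm_num
          _ = _ := by rw [← Real.exp_add]; ring_nf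
      have b2 : ‖Gammaℝ s‖⁻¹ ^ a ≤ Real.exp (a * C * (1 + ‖s‖)) := by
        refine (pow_le_pow_left₀ (by positivity) hG1 a).trans_eq ?_
        rw [← Real.exp_nat_mul]; ring_nf
      have b3 : ‖Gammaℝ (s + 1)‖⁻¹ ^ b ≤ Real.exp (b * (2 * C) * (1 + ‖s‖)) := by
        refine (pow_le_pow_left₀ (by positivity) hG2 b).trans ?_
        rw [← Real.exp_nat_mul, Real.exp_le_exp, mul_assoc, mul_assoc]
        refine mul_le_mul_of_nonneg_left ?_ (by positivity)
        have := norm_add_le s 1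
        rw [norm_one] at this
        nlinarith
      rw [e2]
      calc ‖Xi s‖ * (‖c‖ * ‖s‖ * D ^ (s.re / 2))⁻¹ * ‖Gammaℝ s‖⁻¹ ^ a * ‖Gammaℝ (s + 1)‖⁻¹ ^ b
          ≤ Real.exp ((4 * B / (‖c‖ * d) + 2) * (1 + ‖s‖)) * Real.exp (a * C * (1 + ‖s‖)) *
            Real.exp (b * (2 * C) * (1 + ‖s‖)) := by
            refine mul_le_mul (mul_le_mul b1 b2 (by positivity) (Real.exp_pos _).le) b3
              (by positivity) (by positivity)
        _ ≤ _ := by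
            rw [← Real.exp_add, ← Real.exp_add, Real.exp_le_exp, ← add_mul, ← add_mul]
            exact mul_le_mul_of_nonneg_right (by linarith) (by linarith)
  · have ht : Tendsto (fun σ : ℝ => A * 2 ^ (-σ)) atTop (𝓝 (A * 0)) := by
      refine Tendsto.const_mul A ?_
      exact (tendsto_rpow_atBot_of_base_gt_one 2 (by norm_num)).comp tendsto_neg_atTop_atBot
    rw [mul_zero] at ht
    obtain ⟨σ₀, h0⟩ := eventually_atTop.mp (ht.eventually (gt_mem_nhds (show (0 : ℝ) < 1 / 2 by norm_num)))
    refine ⟨max σ₀ 2, 1 / 6, 1 + A, by norm_num, by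
      have := le_max_right σ₀ 2; linarith, fun s hs => ?_⟩
    have h2 : 2 ≤ s.re := (le_max_right _ _).trans hs
    refine ⟨?_, hupper s h2⟩
    obtain ⟨h3, h4⟩ := hZ s h2
    have h5 := h0 s.re ((le_max_left _ _).trans hs)
    have h6 : 1 / 2 ≤ ‖Z s‖ := by
      have := norm_sub_norm_le 1 (1 - Z s)
      rw [sub_sub_cancel, norm_one, norm_sub_rev] at this
      linarith
    have h7 : 1 / 3 * (1 + ‖s‖) ≤ ‖s - 1‖ := by
      have := norm_sub_norm_le s 1
      rw [norm_one] at this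
      have := h2.trans (re_le_norm s)
      linarith
    rw [h3, norm_mul]
    have := norm_nonneg s
    nlinarith [mul_le_mul h7 h6 (by norm_num) (norm_nonneg _)]

end Completed

section DedekindCompleted
open Complex Filter Topology MeasureTheory Set Module nonZeroDivisors NumberField.InfinitePlace
open scoped Classical

variable {K : Type*} [Field K] [NumberField K]

theorem locallyIntegrableOn_ofReal_thetaSum
    (J : ClassGroup (𝓞 K) → (FractionalIdeal (𝓞 K)⁰ K)ˣ) :
    LocallyIntegrableOn (fun t => (thetaSum J t : ℂ)) (Ioi 0) := by
  rw [locallyIntegrableOn_iff isOpen_Ioi.isLocallyClosed]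
  intro k hk hkc
  have : IntegrableOn (thetaSum J) k := by
    unfold thetaSum
    refine integrable_finsetSum _ fun c _ => ?_
    exact ((antitoneOn_heckeTheta (J c)).mono hk).integrableOn_isCompact hkc
  exact Integrable.ofReal this

theorem isBigO_thetaSum_sub (J : ClassGroup (𝓞 K) → (FractionalIdeal (𝓞 K)⁰ K)ˣ) (r : ℝ) :
    (fun t => (thetaSum J t : ℂ) - (Fintype.card (ClassGroup (𝓞 K)) : ℂ)) =O[atTop] (· ^ r) := by
  have h : (fun t => (thetaSum J t : ℂ) - (Fintype.card (ClassGroup (𝓞 K)) : ℂ)) =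
      fun t => ∑ c, ((heckeTheta (J c) t - 1 : ℝ) : ℂ) := by
    funext t
    simp [thetaSum]
  rw [h]
  refine Asymptotics.IsBigO.fun_sum fun c _ => ?_
  obtain ⟨C, δ, hδ, hC⟩ := exists_heckeTheta_sub_one_le (J c)
  refine Asymptotics.IsBigO.trans ?_ (isLittleO_exp_neg_mul_rpow_atTop hδ r).isBigO
  refine Asymptotics.IsBigO.of_bound C ?_
  filter_upwards [eventually_ge_atTop 1] with t ht
  rw [norm_real, Real.norm_eq_abs, Real.norm_eq_abs, Real.abs_exp]
  exact hC t ht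

/-- The functional equation pair of the summed theta functions. -/
noncomputable def thetaPair (J : ClassGroup (𝓞 K) → (FractionalIdeal (𝓞 K)⁰ K)ˣ) :
    WeakFEPair ℂ where
  f t := thetaSum J t
  g t := thetaSum (fun c => dualUnit (J c)) t
  k := (finrank ℚ K : ℝ) / 2
  ε := 1
  f₀ := Fintype.card (ClassGroup (𝓞 K))
  g₀ := Fintype.card (ClassGroup (𝓞 K))
  hf_int := locallyIntegrableOn_ofReal_thetaSum J
  hg_int := locallyIntegrableOn_ofReal_thetaSum _
  hk := by
    have : (0 : ℝ) < finrank ℚ K := by exact_mod_cast finrank_pos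
    positivity
  hε := one_ne_zero
  h_feq x hx := by
    rw [one_mul, smul_eq_mul, ← ofReal_mul]
    congr 1
    simp only [thetaSum, heckeTheta_inv _ (mem_Ioi.mp hx), Finset.mul_sum]
  hf_top := isBigO_thetaSum_sub J
  hg_top := isBigO_thetaSum_sub _

theorem integral_thetaSum {C : ENNReal} (hC0 : C ≠ 0)
    (hlin : ∀ (J : ClassGroup (𝓞 K) → (FractionalIdeal (𝓞 K)⁰ K)ˣ) (s : ℝ), IsClassFamily J → 0 < s →
      ∫⁻ t in Ioi 0, ENNReal.ofReal (t ^ (finrank ℚ K * s / 2 - 1)) *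
        ENNReal.ofReal (thetaSum J t - Fintype.card (ClassGroup (𝓞 K))) =
      C * ENNReal.ofReal (gammaWeight K s * √|(discr K : ℝ)| ^ s) *
        ∑' I : {I : Ideal (𝓞 K) // I ≠ ⊥}, ENNReal.ofReal ((Ideal.absNorm I.1 : ℝ) ^ (-s)))
    (J : ClassGroup (𝓞 K) → (FractionalIdeal (𝓞 K)⁰ K)ˣ) (hJ : IsClassFamily J)
    (P : WeakFEPair ℂ) (hPf : P.f = fun t => (thetaSum J t : ℂ))
    (hPf₀ : P.f₀ = Fintype.card (ClassGroup (𝓞 K))) (hPk : P.k = (finrank ℚ K : ℝ) / 2)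
    {σ : ℝ} (hσ : 1 < σ) :
    Summable (fun I : {I : Ideal (𝓞 K) // I ≠ ⊥} => (Ideal.absNorm I.1 : ℝ) ^ (-σ)) ∧
    P.Λ ((finrank ℚ K : ℂ) * σ / 2) = ((C.toReal * (gammaWeight K σ * √|(discr K : ℝ)| ^ σ) *
      ∑' I : {I : Ideal (𝓞 K) // I ≠ ⊥}, (Ideal.absNorm I.1 : ℝ) ^ (-σ) : ℝ) : ℂ) := by
  have hn : (0 : ℝ) < finrank ℚ K := by exact_mod_cast finrank_pos
  have hM := P.hasMellin (s := (finrank ℚ K : ℂ) * σ / 2) (by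
    rw [hPk]; simp only [div_ofNat_re, mul_re, natCast_re, ofReal_re, natCast_im, zero_mul, sub_zero]
    nlinarith)
  have hfun : EqOn (fun t : ℝ => (t : ℂ) ^ ((finrank ℚ K : ℂ) * σ / 2 - 1) • (P.f t - P.f₀))
      (fun t : ℝ => ((t ^ (finrank ℚ K * σ / 2 - 1) *
        (thetaSum J t - Fintype.card (ClassGroup (𝓞 K))) : ℝ) : ℂ)) (Ioi 0) := by
    intro t ht
    simp only [hPf, hPf₀, smul_eq_mul]
    push_cast
    rw [ofReal_cpow (mem_Ioi.mp ht).le]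
    push_cast
    rfl
  have hnn : ∀ t ∈ Ioi (0 : ℝ), 0 ≤ t ^ (finrank ℚ K * σ / 2 - 1) *
      (thetaSum J t - Fintype.card (ClassGroup (𝓞 K))) := by
    intro t ht
    refine mul_nonneg (Real.rpow_nonneg (mem_Ioi.mp ht).le _) ?_
    have : thetaSum J t - Fintype.card (ClassGroup (𝓞 K)) = ∑ c, (heckeTheta (J c) t - 1) := by
      simp [thetaSum]
    rw [this]
    exact Finset.sum_nonneg fun c _ => heckeTheta_sub_one_nonneg _ ht
  have hInt : IntegrableOn (fun t : ℝ => t ^ (finrank ℚ K * σ / 2 - 1) *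
      (thetaSum J t - Fintype.card (ClassGroup (𝓞 K)))) (Ioi 0) := by
    have h1 : IntegrableOn (fun t : ℝ => (t : ℂ) ^ ((finrank ℚ K : ℂ) * σ / 2 - 1) • (P.f t - P.f₀))
        (Ioi 0) volume := hM.1
    have h2 := (h1.congr_fun hfun measurableSet_Ioi).re
    rw [IntegrableOn]
    simpa using h2
  have hval : P.Λ ((finrank ℚ K : ℂ) * σ / 2) =
      ((∫ t in Ioi (0 : ℝ), t ^ (finrank ℚ K * σ / 2 - 1) *
        (thetaSum J t - Fintype.card (ClassGroup (𝓞 K))) : ℝ) : ℂ) := by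
    rw [← hM.2, mellin, setIntegral_congr_fun measurableSet_Ioi hfun]
    exact integral_ofReal
  have hl := ofReal_integral_eq_lintegral_ofReal hInt (by
    filter_upwards [ae_restrict_mem measurableSet_Ioi] with t ht using hnn t ht)
  have hl2 : ∫⁻ t in Ioi (0 : ℝ), ENNReal.ofReal (t ^ (finrank ℚ K * σ / 2 - 1) *
      (thetaSum J t - Fintype.card (ClassGroup (𝓞 K)))) =
      ∫⁻ t in Ioi (0 : ℝ), ENNReal.ofReal (t ^ (finrank ℚ K * σ / 2 - 1)) *
        ENNReal.ofReal (thetaSum J t - Fintype.card (ClassGroup (𝓞 K))) :=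
    setLIntegral_congr_fun measurableSet_Ioi fun t ht =>
      ENNReal.ofReal_mul (Real.rpow_nonneg (mem_Ioi.mp ht).le _)
  rw [hl2, hlin J σ hJ (by linarith)] at hl
  have hD : 0 < √|(discr K : ℝ)| := by
    rw [Real.sqrt_pos, abs_pos]
    exact_mod_cast discr_ne_zero K
  have hw : 0 < gammaWeight K σ * √|(discr K : ℝ)| ^ σ :=
    mul_pos (gammaWeight_pos (by linarith)) (Real.rpow_pos_of_pos hD _)
  have hT : ∑' I : {I : Ideal (𝓞 K) // I ≠ ⊥}, ENNReal.ofReal ((Ideal.absNorm I.1 : ℝ) ^ (-σ)) ≠ ⊤ := by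
    intro h
    rw [h, ENNReal.mul_top] at hl
    · exact ENNReal.ofReal_ne_top hl
    · exact mul_ne_zero hC0 (by simpa using hw)
  have hnn' : ∀ I : {I : Ideal (𝓞 K) // I ≠ ⊥}, 0 ≤ (Ideal.absNorm I.1 : ℝ) ^ (-σ) :=
    fun I => Real.rpow_nonneg (Nat.cast_nonneg _) _
  have hs : Summable (fun I : {I : Ideal (𝓞 K) // I ≠ ⊥} => (Ideal.absNorm I.1 : ℝ) ^ (-σ)) := by
    have := ENNReal.summable_toReal hT
    simpa only [ENNReal.toReal_ofReal (hnn' _)] using this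
  refine ⟨hs, ?_⟩
  rw [hval]
  congr 1
  rw [← ENNReal.ofReal_tsum_of_nonneg hnn' hs] at hl
  have h := congrArg ENNReal.toReal hl
  rw [ENNReal.toReal_ofReal (setIntegral_nonneg measurableSet_Ioi hnn), ENNReal.toReal_mul,
    ENNReal.toReal_mul, ENNReal.toReal_ofReal hw.le, ENNReal.toReal_ofReal (tsum_nonneg hnn')] at h
  exact h

theorem gammaWeight_eq (s : ℝ) : (gammaWeight K s : ℂ) = (2⁻¹ : ℂ) ^ nrComplexPlaces K *
    (Gammaℝ s ^ (nrRealPlaces K + nrComplexPlaces K) * Gammaℝ (s + 1) ^ nrComplexPlaces K) := by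
  have hpi := Real.pi_pos
  have h : ∀ w : InfinitePlace K, ((Real.Gamma (w.mult * s / 2) *
      (w.mult * Real.pi) ^ (-(w.mult * s / 2)) : ℝ) : ℂ) =
      if w.IsReal then Gammaℝ s else 2⁻¹ * (Gammaℝ s * Gammaℝ (s + 1)) := by
    intro w
    split_ifs with hw
    · rw [mult, if_pos hw, Gammaℝ_def]
      push_cast
      rw [ofReal_cpow (by simpa using hpi.le)]
      push_cast
      rw [← Complex.Gamma_ofReal]
      push_cast
      rw [one_mul, one_mul, neg_div, mul_comm]
    · rw [mult, if_neg hw, Gammaℝ_mul_Gammaℝ_add_one, Gammaℂ_def]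
      push_cast
      rw [ofReal_cpow (by positivity)]
      push_cast
      rw [← Complex.Gamma_ofReal]
      push_cast
      rw [mul_div_cancel_left₀ _ (two_ne_zero' ℂ)]
      ring
  rw [gammaWeight, ofReal_prod, Finset.prod_congr rfl fun w _ => h w, Finset.prod_ite,
    Finset.prod_const, Finset.prod_const]
  have h1 : (Finset.univ.filter fun w : InfinitePlace K => w.IsReal).card = nrRealPlaces K := by
    rw [nrRealPlaces, Fintype.card_subtype]
  have h2 : (Finset.univ.filter fun w : InfinitePlace K => ¬ w.IsReal).card = nrComplexPlaces K := by
    rw [nrComplexPlaces, Fintype.card_subtype]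
    simp only [not_isReal_iff_isComplex]
  rw [h1, h2]
  ring

end DedekindCompleted

section DedekindData
open Complex Filter Topology MeasureTheory Set Module nonZeroDivisors NumberField.InfinitePlace
open scoped Classical

variable (K : Type*) [Field K] [NumberField K]

theorem summable_absNorm_rpow {σ : ℝ} (hσ : 1 < σ) :
    Summable (fun I : {I : Ideal (𝓞 K) // I ≠ ⊥} => (Ideal.absNorm I.1 : ℝ) ^ (-σ)) := by
  obtain ⟨C, hC0, -, hlin⟩ := exists_lintegral_thetaSum K
  obtain ⟨J, hJ⟩ := exists_isClassFamily K
  exact (integral_thetaSum hC0 hlin J hJ (thetaPair J) rfl rfl rfl hσ).1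

variable {K}

theorem absNorm_pos (I : {I : Ideal (𝓞 K) // I ≠ ⊥}) : 0 < Ideal.absNorm I.1 :=
  Nat.pos_of_ne_zero (Ideal.absNorm_ne_zero_iff_mem_nonZeroDivisors.mpr
    (mem_nonZeroDivisors_of_ne_zero I.2))

theorem norm_absNorm_cpow (I : {I : Ideal (𝓞 K) // I ≠ ⊥}) (s : ℂ) :
    ‖(Ideal.absNorm I.1 : ℂ) ^ (-s)‖ = (Ideal.absNorm I.1 : ℝ) ^ (-s.re) := by
  have := norm_cpow_eq_rpow_re_of_pos (x := Ideal.absNorm I.1)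
    (by exact_mod_cast absNorm_pos I) (-s)
  simpa using this

theorem summable_absNorm_cpow {s : ℂ} (hs : 1 < s.re) :
    Summable (fun I : {I : Ideal (𝓞 K) // I ≠ ⊥} => (Ideal.absNorm I.1 : ℂ) ^ (-s)) := by
  refine Summable.of_norm ?_
  simp only [norm_absNorm_cpow]
  exact summable_absNorm_rpow K hs

theorem tsum_absNorm_ofReal (σ : ℝ) :
    ∑' I : {I : Ideal (𝓞 K) // I ≠ ⊥}, (Ideal.absNorm I.1 : ℂ) ^ (-(σ : ℂ)) =
      ((∑' I : {I : Ideal (𝓞 K) // I ≠ ⊥}, (Ideal.absNorm I.1 : ℝ) ^ (-σ) : ℝ) : ℂ) := by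
  rw [ofReal_tsum]
  refine tsum_congr fun I => ?_
  rw [ofReal_cpow (Nat.cast_nonneg _)]
  push_cast
  rfl

theorem norm_tsum_absNorm_sub_one_le {s : ℂ} (hs : 2 ≤ s.re) :
    ‖∑' I : {I : Ideal (𝓞 K) // I ≠ ⊥}, (Ideal.absNorm I.1 : ℂ) ^ (-s) - 1‖ ≤
      (4 * ∑' I : {I : Ideal (𝓞 K) // I ≠ ⊥}, (Ideal.absNorm I.1 : ℝ) ^ (-2 : ℝ)) *
        2 ^ (-s.re) := by
  have h2 := summable_absNorm_rpow K (σ := 2) (by norm_num)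
  have h1 : (⊤ : Ideal (𝓞 K)) ≠ ⊥ := top_ne_bot
  rw [(summable_absNorm_cpow (K := K) (s := s) (by linarith)).tsum_eq_add_tsum_ite ⟨⊤, h1⟩]
  simp only [Ideal.absNorm_top, Nat.cast_one, one_cpow, add_sub_cancel_left]
  rw [mul_right_comm, ← tsum_mul_left]
  refine tsum_of_norm_bounded ((h2.mul_left (4 * 2 ^ (-s.re))).hasSum) fun I => ?_
  split_ifs with h
  · rw [norm_zero]; positivity
  · rw [norm_absNorm_cpow]
    have hI : (2 : ℝ) ≤ Ideal.absNorm I.1 := by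
      have h3 := absNorm_pos I
      have h4 : Ideal.absNorm I.1 ≠ 1 := fun h5 => h (Subtype.ext (Ideal.absNorm_eq_one_iff.mp h5))
      exact_mod_cast (by omega : 2 ≤ Ideal.absNorm I.1)
    have h0 : (0 : ℝ) < Ideal.absNorm I.1 := by linarith
    have e1 : (Ideal.absNorm I.1 : ℝ) ^ (-s.re) =
        (Ideal.absNorm I.1 : ℝ) ^ (2 - s.re) * (Ideal.absNorm I.1 : ℝ) ^ (-2 : ℝ) := by
      rw [← Real.rpow_add h0]; congr 1; ring
    have e2 : (4 : ℝ) * 2 ^ (-s.re) = 2 ^ (2 - s.re) := by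
      rw [sub_eq_add_neg, Real.rpow_add two_pos]; norm_num
    rw [e1, e2]
    exact mul_le_mul_of_nonneg_right (Real.rpow_le_rpow_of_nonpos two_pos hI (by linarith))
      (Real.rpow_nonneg h0.le _)

theorem ZetaData.dedekind {ζK F : ℂ → ℂ}
    (hser : ∀ s : ℂ, 1 < s.re → ζK s = ∑' I : {I : Ideal (𝓞 K) // I ≠ ⊥},
      (Ideal.absNorm (I : Ideal (𝓞 K)) : ℂ) ^ (-s))
    (hF : Differentiable ℂ F) (hFζ : ∀ s : ℂ, s ≠ 1 → F s = (s - 1) * ζK s)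
    (hne : ∀ s : ℂ, 1 / 2 < s.re → F s ≠ 0) :
    ZetaData F (nrRealPlaces K + nrComplexPlaces K) (nrComplexPlaces K) |(discr K : ℝ)| := by
  obtain ⟨C, hC0, hC, hlin⟩ := exists_lintegral_thetaSum K
  obtain ⟨J, hJ⟩ := exists_isClassFamily K
  obtain ⟨h, hh⟩ : ∃ h : ℂ, h = Fintype.card (ClassGroup (𝓞 K)) := ⟨_, rfl⟩
  obtain ⟨n, hn⟩ : ∃ n : ℂ, n = finrank ℚ K := ⟨_, rfl⟩
  have hn0 : n ≠ 0 := by rw [hn]; exact_mod_cast finrank_pos.ne'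
  have hnre : n.re = finrank ℚ K := by rw [hn]; simp
  have hnim : n.im = 0 := by rw [hn]; simp
  have hnpos : 0 < n.re := by rw [hnre]; exact_mod_cast finrank_pos
  have hD : 0 < |(discr K : ℝ)| := abs_pos.mpr (by exact_mod_cast discr_ne_zero K)
  have hCp : 0 < C.toReal := ENNReal.toReal_pos hC0 hC
  obtain ⟨c, hc⟩ : ∃ c : ℂ, c = C.toReal * (2⁻¹ : ℂ) ^ nrComplexPlaces K := ⟨_, rfl⟩
  obtain ⟨G, hG⟩ : ∃ G : WeakFEPair ℂ → ℂ → ℂ,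
      G = fun Q s => s * (s - 1) * Q.Λ₀ (n * s / 2) + 2 * h / n := ⟨_, rfl⟩
  have hGd : ∀ Q, Differentiable ℂ (G Q) := fun Q => by
    rw [hG]
    have := Q.differentiable_Λ₀
    fun_prop
  have hGeq : ∀ (J' : ClassGroup (𝓞 K) → (FractionalIdeal (𝓞 K)⁰ K)ˣ), IsClassFamily J' →
      ∀ Q : WeakFEPair ℂ, Q.f = (fun t => (thetaSum J' t : ℂ)) →
      Q.f₀ = Fintype.card (ClassGroup (𝓞 K)) → Q.g₀ = Fintype.card (ClassGroup (𝓞 K)) →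
      Q.k = (finrank ℚ K : ℝ) / 2 → Q.ε = 1 → ∀ σ : ℝ, 2 < σ →
      G Q σ = c * xiFun F (nrRealPlaces K + nrComplexPlaces K) (nrComplexPlaces K)
        |(discr K : ℝ)| σ := by
    intro J' hJ' Q h1 h2 h3 h4 h5 σ hσ
    have hσ0 : (σ : ℂ) ≠ 0 := by exact_mod_cast (by linarith : σ ≠ 0)
    have hσ1 : (σ : ℂ) ≠ 1 := by exact_mod_cast (by linarith : σ ≠ 1)
    have hσ1' : (1 : ℂ) - σ ≠ 0 := sub_ne_zero.mpr hσ1.symm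
    have e1 := (integral_thetaSum hC0 hlin J' hJ' Q h1 h2 h4 (σ := σ) (by linarith)).2
    rw [← hn] at e1
    have e2 : G Q σ = σ * (σ - 1) * Q.Λ (n * σ / 2) := by
      rw [hG]
      simp only
      rw [Q.Λ₀_eq, h2, h3, h4, h5, ← hh]
      push_cast
      rw [← hn]
      simp only [smul_eq_mul]
      have : n / 2 - n * σ / 2 = n * (1 - σ) / 2 := by ring
      rw [this]
      field_simp
      ring
    have e3 : ((√|(discr K : ℝ)| ^ σ : ℝ) : ℂ) = (|(discr K : ℝ)| : ℝ) ^ ((σ : ℂ) / 2) := by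
      rw [Real.sqrt_eq_rpow, ← Real.rpow_mul hD.le, ofReal_cpow hD.le]
      push_cast
      ring_nf
    rw [e2, e1, ofReal_mul, ofReal_mul, ofReal_mul, e3, gammaWeight_eq, ← tsum_absNorm_ofReal,
      ← hser σ (by simpa using by linarith), xiFun, hFζ _ hσ1, hc]
    ring
  have hP := hGeq J hJ (thetaPair J) rfl rfl rfl rfl rfl
  have hPs := hGeq _ hJ.dualUnit (thetaPair J).symm rfl rfl rfl rfl inv_one
  have hsymm : ∀ s, G (thetaPair J).symm s = G (thetaPair J) s := fun s =>
    eqOn_of_eq_ofReal isOpen_univ isPreconnected_univ (mem_univ _) (hGd _).differentiableOn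
      (hGd _).differentiableOn (fun σ hσ => (hPs σ hσ).trans (hP σ hσ).symm) (mem_univ s)
  obtain ⟨B, hB⟩ := (thetaPair J).exists_norm_Λ₀_le (n.re / 8) n.re
  refine ZetaData.of_completed (Z := ζK) (Xi := G (thetaPair J)) (c := c)
    (A := 4 * ∑' I : {I : Ideal (𝓞 K) // I ≠ ⊥}, (Ideal.absNorm I.1 : ℝ) ^ (-2 : ℝ))
    (B := |B| + ‖2 * h / n‖) hD hF hne ?_ (hGd _) ?_ hP ?_ ?_ ?_
  · rw [hc]
    exact mul_ne_zero (by exact_mod_cast hCp.ne') (pow_ne_zero _ (by norm_num))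
  · intro s
    rw [← hsymm s]
    have h1 := (thetaPair J).functional_equation₀ (n * s / 2)
    have h2 : (((thetaPair J).k : ℝ) : ℂ) - n * s / 2 = n * (1 - s) / 2 := by
      have : (((thetaPair J).k : ℝ) : ℂ) = n / 2 := by
        rw [hn]; simp [thetaPair]
      rw [this]; ring
    rw [h2] at h1
    rw [hG]
    simp only
    rw [h1]
    simp only [thetaPair, one_smul]
    ring
  · intro s h1 h2
    rw [hG]
    simp only
    have h3 : (n * s / 2).re = n.re * s.re / 2 := by
      rw [div_ofNat_re, mul_re, hnim, zero_mul, sub_zero]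
    have h4 := hB (n * s / 2) (by rw [h3]; nlinarith) (by rw [h3]; nlinarith)
    have h5 := norm_sub_le s 1
    rw [norm_one] at h5
    have h6 := norm_nonneg s
    refine (norm_add_le _ _).trans ?_
    rw [add_mul]
    refine add_le_add ?_ (le_mul_of_one_le_right (norm_nonneg _) (by nlinarith))
    rw [norm_mul, norm_mul, mul_comm]
    refine mul_le_mul (h4.trans (le_abs_self B)) ?_ (by positivity) (abs_nonneg _)
    nlinarith [norm_nonneg (s - 1)]
  · intro s hs
    refine ⟨hFζ s fun h => by rw [h] at hs; norm_num at hs, ?_⟩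
    rw [hser s (by linarith)]
    exact norm_tsum_absNorm_sub_one_le hs
  · intro σ hσ
    rw [hFζ _ (by exact_mod_cast (by linarith : σ ≠ 1)), hser _ (by simpa using by linarith),
      tsum_absNorm_ofReal, ← ofReal_one, ← ofReal_sub, ← ofReal_mul, ofReal_im]

end DedekindData

section PrimePowers
open Complex Filter Topology Set Module
open scoped Classical

variable {K : Type*} [Field K] [NumberField K]

theorem absNorm_pos_of_prime {P : Ideal (𝓞 K)} (hP : Prime P) : 1 < Ideal.absNorm P := by
  have h0 := absNorm_pos ⟨P, hP.ne_zero⟩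
  have h1 : Ideal.absNorm P ≠ 1 := fun h =>
    hP.not_isUnit (Ideal.isUnit_iff.mpr (Ideal.absNorm_eq_one_iff.mp h))
  simp only at h0
  omega

theorem hasSum_log_absNorm_prime (I : Ideal (𝓞 K)) (hI : I ≠ 0) :
    HasSum (fun i : {P : Ideal (𝓞 K) // Prime P} × ℕ =>
      if i.1.1 ^ (i.2 + 1) ∣ I then Real.log (Ideal.absNorm i.1.1) else 0)
      (Real.log (Ideal.absNorm I)) := by
  induction I using UniqueFactorizationMonoid.induction_on_prime with
  | h₁ => exact absurd rfl hI
  | h₂ I hu =>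
    have h1 : I = ⊤ := Ideal.isUnit_iff.mp hu
    have h2 : ∀ i : {P : Ideal (𝓞 K) // Prime P} × ℕ, ¬ i.1.1 ^ (i.2 + 1) ∣ I := fun i h =>
      i.1.2.not_isUnit (isUnit_of_dvd_unit ((dvd_pow_self _ (Nat.succ_ne_zero _)).trans h) hu)
    simp only [h2, if_false]
    rw [h1, Ideal.absNorm_top]
    simp
  | h₃ J Q hJ hQ ih =>
    have hfin : FiniteMultiplicity Q J := FiniteMultiplicity.of_prime_left hQ hJ
    have hval : Real.log (Ideal.absNorm (Q * J)) =
        Real.log (Ideal.absNorm J) + Real.log (Ideal.absNorm Q) := by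
      have h1 := absNorm_pos_of_prime hQ
      have h2 := absNorm_pos ⟨J, hJ⟩
      simp only at h2
      rw [map_mul, Nat.cast_mul, Real.log_mul (by positivity) (by positivity), add_comm]
    rw [hval]
    have hs := (ih hJ).add (hasSum_ite_eq
      ((⟨Q, hQ⟩, multiplicity Q J) : {P : Ideal (𝓞 K) // Prime P} × ℕ)
      (Real.log (Ideal.absNorm Q)))
    refine hs.congr_fun ?_
    rintro ⟨⟨P, hP⟩, k⟩
    simp only [Prod.mk.injEq, Subtype.mk.injEq]
    by_cases hPQ : P = Q
    · subst hPQ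
      have e1 : P ^ (k + 1) ∣ P * J ↔ k ≤ multiplicity P J := by
        rw [pow_succ', mul_dvd_mul_iff_left hP.ne_zero, hfin.pow_dvd_iff_le_multiplicity]
      have e2 : P ^ (k + 1) ∣ J ↔ k + 1 ≤ multiplicity P J := hfin.pow_dvd_iff_le_multiplicity
      rw [e1, e2]
      rcases lt_trichotomy k (multiplicity P J) with h | h | h
      · simp [h.ne, h.le, h]
      · simp [h]
      · simp [h.ne', h.not_ge, (h.trans (Nat.lt_succ_self k)).not_ge]
    · have e1 : P ^ (k + 1) ∣ Q * J ↔ P ^ (k + 1) ∣ J := by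
        refine ⟨fun h => ?_, fun h => h.mul_left Q⟩
        refine hP.pow_dvd_of_dvd_mul_left (k + 1) (fun h' => hPQ ?_) h
        exact associated_iff_eq.mp (hP.associated_of_dvd hQ h')
      simp [e1, hPQ]

end PrimePowers

section LogSeries
open Complex Filter Topology Set Module
open scoped Classical

variable (K : Type*) [Field K] [NumberField K]

theorem summable_log_absNorm_mul_rpow {σ : ℝ} (hσ : 1 < σ) :
    Summable (fun I : {I : Ideal (𝓞 K) // I ≠ ⊥} =>
      Real.log (Ideal.absNorm I.1) * (Ideal.absNorm I.1 : ℝ) ^ (-σ)) := by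
  have hε : 0 < (σ - 1) / 2 := by linarith
  refine Summable.of_nonneg_of_le (fun I => mul_nonneg (Real.log_natCast_nonneg _) (by positivity))
    (fun I => ?_) ((summable_absNorm_rpow K (σ := (σ + 1) / 2) (by linarith)).mul_left
      (((σ - 1) / 2)⁻¹))
  have h0 : (0 : ℝ) < Ideal.absNorm I.1 := by exact_mod_cast absNorm_pos I
  have h1 := Real.log_le_rpow_div h0.le hε
  have e1 : (Ideal.absNorm I.1 : ℝ) ^ (-((σ + 1) / 2)) =
      (Ideal.absNorm I.1 : ℝ) ^ ((σ - 1) / 2) * (Ideal.absNorm I.1 : ℝ) ^ (-σ) := by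
    rw [← Real.rpow_add h0]; congr 1; ring
  rw [e1, ← mul_assoc, inv_mul_eq_div]
  exact mul_le_mul_of_nonneg_right h1 (Real.rpow_nonneg h0.le _)

variable {K}

theorem dvd_injective_mul {q : Ideal (𝓞 K)} (hq : q ≠ ⊥) :
    Function.Injective (fun J : {I : Ideal (𝓞 K) // I ≠ ⊥} =>
      (⟨q * J.1, mul_ne_zero hq J.2⟩ : {I : Ideal (𝓞 K) // I ≠ ⊥})) := fun _ _ h =>
  Subtype.ext (mul_left_cancel₀ hq (Subtype.mk.inj h))

theorem tsum_dvd_absNorm_cpow {q : Ideal (𝓞 K)} (hq : q ≠ ⊥) (s : ℂ) :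
    ∑' I : {I : Ideal (𝓞 K) // I ≠ ⊥}, (if q ∣ I.1 then (Ideal.absNorm I.1 : ℂ) ^ (-s) else 0) =
      (Ideal.absNorm q : ℂ) ^ (-s) *
        ∑' I : {I : Ideal (𝓞 K) // I ≠ ⊥}, (Ideal.absNorm I.1 : ℂ) ^ (-s) := by
  rw [← (dvd_injective_mul hq).tsum_eq, ← tsum_mul_left]
  · refine tsum_congr fun J => ?_
    simp only [dvd_mul_right, if_true]
    rw [map_mul, Nat.cast_mul, natCast_mul_natCast_cpow]
  · intro I hI
    have hd : q ∣ I.1 := by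
      by_contra h
      exact hI (if_neg h)
    obtain ⟨J, hJ⟩ := hd
    exact ⟨⟨J, fun h => I.2 (by rw [hJ, h]; exact Ideal.mul_bot q)⟩, Subtype.ext hJ.symm⟩

theorem summable_dvd_log (K : Type*) [Field K] [NumberField K] {σ : ℝ} (hσ : 1 < σ) :
    Summable (fun p : {I : Ideal (𝓞 K) // I ≠ ⊥} × ({P : Ideal (𝓞 K) // Prime P} × ℕ) =>
      (if p.2.1.1 ^ (p.2.2 + 1) ∣ p.1.1 then Real.log (Ideal.absNorm p.2.1.1) else 0) *
        (Ideal.absNorm p.1.1 : ℝ) ^ (-σ)) := by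
  have h0 : ∀ p : {I : Ideal (𝓞 K) // I ≠ ⊥} × ({P : Ideal (𝓞 K) // Prime P} × ℕ),
      0 ≤ (if p.2.1.1 ^ (p.2.2 + 1) ∣ p.1.1 then Real.log (Ideal.absNorm p.2.1.1) else 0) *
        (Ideal.absNorm p.1.1 : ℝ) ^ (-σ) := fun p => by
    refine mul_nonneg ?_ (by positivity)
    split_ifs
    · exact Real.log_natCast_nonneg _
    · exact le_rfl
  rw [summable_prod_of_nonneg h0]
  have hfib := fun I : {I : Ideal (𝓞 K) // I ≠ ⊥} =>
    (hasSum_log_absNorm_prime I.1 I.2).mul_right ((Ideal.absNorm I.1 : ℝ) ^ (-σ))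
  refine ⟨fun I => (hfib I).summable, ?_⟩
  refine (summable_log_absNorm_mul_rpow K hσ).congr fun I => ?_
  exact (hfib I).tsum_eq.symm

omit [NumberField K] in
theorem prime_pow_ne_bot (i : {P : Ideal (𝓞 K) // Prime P} × ℕ) : i.1.1 ^ (i.2 + 1) ≠ ⊥ :=
  pow_ne_zero _ i.1.2.ne_zero

theorem summable_log_prime_pow (K : Type*) [Field K] [NumberField K] {σ : ℝ} (hσ : 1 < σ) :
    Summable (fun i : {P : Ideal (𝓞 K) // Prime P} × ℕ => Real.log (Ideal.absNorm i.1.1) *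
      (Ideal.absNorm (i.1.1 ^ (i.2 + 1)) : ℝ) ^ (-σ)) := by
  have hinj : Function.Injective (fun i : {P : Ideal (𝓞 K) // Prime P} × ℕ =>
      ((⟨i.1.1 ^ (i.2 + 1), prime_pow_ne_bot i⟩, i) :
        {I : Ideal (𝓞 K) // I ≠ ⊥} × ({P : Ideal (𝓞 K) // Prime P} × ℕ))) :=
    fun i j h => (Prod.mk.inj h).2
  have h := (summable_dvd_log K hσ).comp_injective hinj
  refine h.congr fun i => ?_
  simp [Function.comp]

theorem tsum_log_absNorm_cpow {s : ℂ} (hs : 1 < s.re) :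
    ∑' I : {I : Ideal (𝓞 K) // I ≠ ⊥},
      (Real.log (Ideal.absNorm I.1) : ℂ) * (Ideal.absNorm I.1 : ℂ) ^ (-s) =
    (∑' i : {P : Ideal (𝓞 K) // Prime P} × ℕ, (Real.log (Ideal.absNorm i.1.1) : ℂ) *
      (Ideal.absNorm (i.1.1 ^ (i.2 + 1)) : ℂ) ^ (-s)) *
      ∑' I : {I : Ideal (𝓞 K) // I ≠ ⊥}, (Ideal.absNorm I.1 : ℂ) ^ (-s) := by
  obtain ⟨g, hg⟩ : ∃ g : {I : Ideal (𝓞 K) // I ≠ ⊥} → ({P : Ideal (𝓞 K) // Prime P} × ℕ) → ℂ,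
      g = fun I i => ((if i.1.1 ^ (i.2 + 1) ∣ I.1 then Real.log (Ideal.absNorm i.1.1) else 0 : ℝ)
        : ℂ) * (Ideal.absNorm I.1 : ℂ) ^ (-s) := ⟨_, rfl⟩
  have hsum : Summable (Function.uncurry g) := by
    refine Summable.of_norm ((summable_dvd_log K hs).congr fun p => ?_)
    rw [Function.uncurry_def, hg]
    simp only [norm_mul, norm_absNorm_cpow]
    rw [Complex.norm_of_nonneg]
    split_ifs
    · exact Real.log_natCast_nonneg _
    · exact le_rfl
  have hL : ∀ I, ∑' i, g I i =
      (Real.log (Ideal.absNorm I.1) : ℂ) * (Ideal.absNorm I.1 : ℂ) ^ (-s) := fun I => by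
    rw [hg]
    have h1 : HasSum (fun i : {P : Ideal (𝓞 K) // Prime P} × ℕ =>
        ((if i.1.1 ^ (i.2 + 1) ∣ I.1 then Real.log (Ideal.absNorm i.1.1) else 0 : ℝ) : ℂ))
        (Real.log (Ideal.absNorm I.1) : ℂ) :=
      hasSum_ofReal.mpr (hasSum_log_absNorm_prime I.1 I.2)
    exact (h1.mul_right ((Ideal.absNorm I.1 : ℂ) ^ (-s))).tsum_eq
  have hR : ∀ i, ∑' I, g I i = (Real.log (Ideal.absNorm i.1.1) : ℂ) *
      (Ideal.absNorm (i.1.1 ^ (i.2 + 1)) : ℂ) ^ (-s) *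
      ∑' I : {I : Ideal (𝓞 K) // I ≠ ⊥}, (Ideal.absNorm I.1 : ℂ) ^ (-s) := fun i => by
    rw [mul_assoc, ← tsum_dvd_absNorm_cpow (prime_pow_ne_bot i) s, ← tsum_mul_left, hg]
    refine tsum_congr fun I => ?_
    simp only
    split_ifs <;> simp
  rw [← tsum_mul_right, ← tsum_congr hL, ← tsum_congr hR]
  exact hsum.tsum_comm.symm

theorem hasDerivAt_tsum_absNorm_cpow {s : ℂ} (hs : 1 < s.re) :
    HasDerivAt (fun s : ℂ => ∑' I : {I : Ideal (𝓞 K) // I ≠ ⊥}, (Ideal.absNorm I.1 : ℂ) ^ (-s))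
      (-∑' I : {I : Ideal (𝓞 K) // I ≠ ⊥},
        (Real.log (Ideal.absNorm I.1) : ℂ) * (Ideal.absNorm I.1 : ℂ) ^ (-s)) s := by
  obtain ⟨σ, h1, h2⟩ := exists_between hs
  have hd : ∀ (I : {I : Ideal (𝓞 K) // I ≠ ⊥}) (w : ℂ),
      HasDerivAt (fun w : ℂ => (Ideal.absNorm I.1 : ℂ) ^ (-w))
        (-((Real.log (Ideal.absNorm I.1) : ℂ) * (Ideal.absNorm I.1 : ℂ) ^ (-w))) w := fun I w => by
    have h0 : (Ideal.absNorm I.1 : ℂ) ≠ 0 := by exact_mod_cast (absNorm_pos I).ne'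
    have h := (hasDerivAt_id w).neg.const_cpow (c := (Ideal.absNorm I.1 : ℂ)) (Or.inl h0)
    refine h.congr_deriv ?_
    rw [← natCast_log]
    simp only [id, Pi.neg_apply]
    ring
  have hU : IsOpen {w : ℂ | σ < w.re} := isOpen_lt continuous_const continuous_re
  have hle : ∀ (I : {I : Ideal (𝓞 K) // I ≠ ⊥}) (w : ℂ), w ∈ {w : ℂ | σ < w.re} →
      ‖(Ideal.absNorm I.1 : ℂ) ^ (-w)‖ ≤ (Ideal.absNorm I.1 : ℝ) ^ (-σ) := fun I w hw => by
    rw [norm_absNorm_cpow]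
    have h3 : (1 : ℝ) ≤ Ideal.absNorm I.1 := by exact_mod_cast absNorm_pos I
    exact Real.rpow_le_rpow_of_exponent_le h3 (by simpa using hw.le)
  have hdiff : ∀ I : {I : Ideal (𝓞 K) // I ≠ ⊥},
      DifferentiableOn ℂ (fun w : ℂ => (Ideal.absNorm I.1 : ℂ) ^ (-w)) {w : ℂ | σ < w.re} :=
    fun I w _ => (hd I w).differentiableAt.differentiableWithinAt
  have hsum := summable_absNorm_rpow K h1
  have hH := hasSum_deriv_of_summable_norm hsum hdiff hU hle (z := s) h2
  have hD := (differentiableOn_tsum_of_summable_norm hsum hdiff hU hle).differentiableAt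
    (hU.mem_nhds h2)
  have h3 := hD.hasDerivAt
  rw [← hH.tsum_eq] at h3
  refine h3.congr_deriv ?_
  rw [← tsum_neg]
  exact tsum_congr fun I => (hd I s).deriv

theorem hasSum_log_prime_pow {s : ℂ} (hs : 1 < s.re)
    (h : ∑' I : {I : Ideal (𝓞 K) // I ≠ ⊥}, (Ideal.absNorm I.1 : ℂ) ^ (-s) ≠ 0) :
    HasSum (fun i : {P : Ideal (𝓞 K) // Prime P} × ℕ => (Real.log (Ideal.absNorm i.1.1) : ℂ) *
      (Ideal.absNorm (i.1.1 ^ (i.2 + 1)) : ℂ) ^ (-s))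
      (-logDeriv (fun s : ℂ => ∑' I : {I : Ideal (𝓞 K) // I ≠ ⊥},
        (Ideal.absNorm I.1 : ℂ) ^ (-s)) s) := by
  have hsum : Summable (fun i : {P : Ideal (𝓞 K) // Prime P} × ℕ =>
      (Real.log (Ideal.absNorm i.1.1) : ℂ) *
      (Ideal.absNorm (i.1.1 ^ (i.2 + 1)) : ℂ) ^ (-s)) := by
    refine Summable.of_norm ((summable_log_prime_pow K hs).congr fun i => ?_)
    rw [norm_mul, norm_absNorm_cpow ⟨_, prime_pow_ne_bot i⟩,
      Complex.norm_of_nonneg (Real.log_natCast_nonneg _)]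
  refine hsum.hasSum_iff.mpr ?_
  rw [logDeriv_apply, (hasDerivAt_tsum_absNorm_cpow hs).deriv, tsum_log_absNorm_cpow hs]
  field_simp

end LogSeries

section VonMangoldtCoeff
open Complex Filter Topology Set Module
open scoped Classical ArithmeticFunction.vonMangoldt

variable {K : Type*} [Field K] [NumberField K]

omit [NumberField K] in
theorem exists_prime_natCast_mem {P : Ideal (𝓞 K)} (hP : P.IsPrime) {m : ℕ} (hm : m ≠ 0)
    (h : (m : 𝓞 K) ∈ P) : ∃ p : ℕ, p.Prime ∧ (p : 𝓞 K) ∈ P := by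
  rw [← Nat.prod_primeFactorsList hm, Nat.cast_list_prod] at h
  rw [← Multiset.prod_coe] at h
  obtain ⟨x, hx, hxP⟩ := (hP.multiset_prod_mem_iff_exists_mem _).mp h
  rw [Multiset.mem_coe] at hx
  obtain ⟨p, hp, rfl⟩ := List.mem_map.mp hx
  exact ⟨p, Nat.prime_of_mem_primeFactorsList hp, hxP⟩

theorem fiber_log_le (m : ℕ) :
    Summable (fun i : {i : {P : Ideal (𝓞 K) // Prime P} × ℕ //
      Ideal.absNorm (i.1.1 ^ (i.2 + 1)) = m} => Real.log (Ideal.absNorm i.1.1.1)) ∧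
    ∑' i : {i : {P : Ideal (𝓞 K) // Prime P} × ℕ // Ideal.absNorm (i.1.1 ^ (i.2 + 1)) = m},
      Real.log (Ideal.absNorm i.1.1.1) ≤ finrank ℚ K * Λ m := by
  by_cases hne : Nonempty {i : {P : Ideal (𝓞 K) // Prime P} × ℕ //
      Ideal.absNorm (i.1.1 ^ (i.2 + 1)) = m}
  swap
  · rw [not_nonempty_iff] at hne
    refine ⟨summable_empty, ?_⟩
    rw [tsum_empty]
    exact mul_nonneg (Nat.cast_nonneg _) ArithmeticFunction.vonMangoldt_nonneg
  obtain ⟨⟨⟨⟨P, hP⟩, k⟩, hm⟩⟩ := hne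
  simp only at hm
  have hPp : P.IsPrime := Ideal.isPrime_of_prime hP
  obtain ⟨p, hp, hpP⟩ := exists_prime_natCast_mem hPp
    (absNorm_pos ⟨P, hP.ne_zero⟩).ne' (Ideal.absNorm_mem P)
  have hN : Ideal.absNorm (Ideal.span {(p : 𝓞 K)}) = p ^ finrank ℚ K := by
    rw [Ideal.absNorm_span_natCast, RingOfIntegers.rank]
  have hspan : Ideal.span {(p : 𝓞 K)} ≠ 0 := by
    rw [Ne, Submodule.zero_eq_bot, Ideal.span_singleton_eq_bot]
    exact_mod_cast hp.ne_zero
  have hdvd : P ∣ Ideal.span {(p : 𝓞 K)} := by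
    rwa [Ideal.dvd_span_singleton]
  have h1 := map_dvd Ideal.absNorm hdvd
  rw [hN] at h1
  obtain ⟨f, -, hf⟩ := (Nat.dvd_prime_pow hp).mp h1
  have hf0 : f ≠ 0 := by
    rintro rfl
    have := absNorm_pos_of_prime hP
    rw [hf, pow_zero] at this
    exact lt_irrefl _ this
  have hmp : m = p ^ (f * (k + 1)) := by rw [← hm, map_pow, hf, pow_mul]
  have hΛ : Λ m = Real.log p := by
    rw [hmp, ArithmeticFunction.vonMangoldt_apply_pow (mul_ne_zero hf0 (Nat.succ_ne_zero k)),
      ArithmeticFunction.vonMangoldt_apply_prime hp]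
  have hall : ∀ i : {i : {P : Ideal (𝓞 K) // Prime P} × ℕ //
      Ideal.absNorm (i.1.1 ^ (i.2 + 1)) = m}, i.1.1.1 ∣ Ideal.span {(p : 𝓞 K)} := fun i => by
    obtain ⟨⟨⟨Q, hQ⟩, l⟩, hi⟩ := i
    have hQp : Q.IsPrime := Ideal.isPrime_of_prime hQ
    rw [Ideal.dvd_span_singleton]
    simp only [hmp, map_pow] at hi ⊢
    have h2 : ((p ^ (f * (k + 1)) : ℕ) : 𝓞 K) ∈ Q := by
      rw [← hi, Nat.cast_pow]
      exact Ideal.pow_mem_of_mem _ (Ideal.absNorm_mem _) _ (Nat.succ_pos _)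
    rw [Nat.cast_pow] at h2
    exact hQp.mem_of_pow_mem _ h2
  have hinj : Function.Injective (fun i : {i : {P : Ideal (𝓞 K) // Prime P} × ℕ //
      Ideal.absNorm (i.1.1 ^ (i.2 + 1)) = m} => ((i.1.1, 0) : {P : Ideal (𝓞 K) // Prime P} × ℕ)) := by
    rintro ⟨⟨Q, k⟩, hi⟩ ⟨⟨Q', k'⟩, hj⟩ h
    obtain rfl : Q = Q' := (Prod.mk.inj h).1
    simp only [map_pow] at hi hj
    have h2 := Nat.pow_right_injective (absNorm_pos_of_prime Q.2) (hi.trans hj.symm)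
    have h3 : k = k' := by omega
    subst h3
    rfl
  have hs := hasSum_log_absNorm_prime _ hspan
  have hterm : ∀ i : {i : {P : Ideal (𝓞 K) // Prime P} × ℕ //
      Ideal.absNorm (i.1.1 ^ (i.2 + 1)) = m},
      (if i.1.1.1 ^ (0 + 1) ∣ Ideal.span {(p : 𝓞 K)} then Real.log (Ideal.absNorm i.1.1.1) else 0) =
        Real.log (Ideal.absNorm i.1.1.1) := fun i => by
    rw [zero_add, pow_one, if_pos (hall i)]
  refine ⟨(hs.summable.comp_injective hinj).congr hterm, ?_⟩
  have h4 := hasSum_le_inj _ hinj (fun i _ => by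
    split_ifs
    · exact Real.log_natCast_nonneg _
    · exact le_rfl) (fun i => (hterm i).ge)
    ((hs.summable.comp_injective hinj).congr hterm).hasSum hs
  rwa [hN, Nat.cast_pow, Real.log_pow, ← hΛ] at h4

theorem exists_vonMangoldt_coeff (K : Type*) [Field K] [NumberField K] :
    ∃ c : ℕ → ℝ, (∀ m, 0 ≤ c m ∧ c m ≤ finrank ℚ K * Λ m) ∧ ∀ s : ℂ, 1 < s.re →
      ∑' I : {I : Ideal (𝓞 K) // I ≠ ⊥}, (Ideal.absNorm I.1 : ℂ) ^ (-s) ≠ 0 →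
      HasSum (fun m : ℕ => (c m : ℂ) * (m : ℂ) ^ (-s))
        (-logDeriv (fun s : ℂ => ∑' I : {I : Ideal (𝓞 K) // I ≠ ⊥},
          (Ideal.absNorm I.1 : ℂ) ^ (-s)) s) := by
  refine ⟨fun m => ∑' i : {i : {P : Ideal (𝓞 K) // Prime P} × ℕ //
    Ideal.absNorm (i.1.1 ^ (i.2 + 1)) = m}, Real.log (Ideal.absNorm i.1.1.1),
    fun m => ⟨tsum_nonneg fun i => Real.log_natCast_nonneg _, (fiber_log_le m).2⟩,
    fun s hs h => ?_⟩
  have hH := hasSum_log_prime_pow hs h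
  rw [← (Equiv.sigmaFiberEquiv (fun i : {P : Ideal (𝓞 K) // Prime P} × ℕ =>
    Ideal.absNorm (i.1.1 ^ (i.2 + 1)))).hasSum_iff] at hH
  refine hH.sigma fun m => ?_
  have h1 := (hasSum_ofReal.mpr (fiber_log_le (K := K) m).1.hasSum).mul_right ((m : ℂ) ^ (-s))
  refine h1.congr_fun ?_
  rintro ⟨i, rfl⟩
  rfl

end VonMangoldtCoeff

section RiemannData
open Complex Filter Topology

/-- The entire function `(s - 1) ζ(s)`. -/
noncomputable def zetaMulSub : ℂ → ℂ :=
  Function.update (fun s => (s - 1) * riemannZeta s) 1 1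

theorem zetaMulSub_of_ne {s : ℂ} (hs : s ≠ 1) : zetaMulSub s = (s - 1) * riemannZeta s :=
  Function.update_of_ne hs _ _

theorem zetaMulSub_one : zetaMulSub 1 = 1 := Function.update_self _ _ _

theorem differentiable_zetaMulSub : Differentiable ℂ zetaMulSub := by
  rw [← differentiableOn_univ, ← Complex.differentiableOn_compl_singleton_and_continuousAt_iff
    (c := 1) Filter.univ_mem]
  refine ⟨?_, continuousAt_update_same.mpr riemannZeta_residue_one⟩
  have h : DifferentiableOn ℂ (fun s => (s - 1) * riemannZeta s) (Set.univ \ {1}) := fun s hs =>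
    (DifferentiableAt.mul (by fun_prop) (differentiableAt_riemannZeta hs.2)).differentiableWithinAt
  exact h.congr fun s hs => zetaMulSub_of_ne hs.2

theorem summable_natCast_rpow_succ {σ : ℝ} (hσ : 1 < σ) :
    Summable fun n : ℕ => ((n : ℝ) + 1) ^ (-σ) := by
  have := (summable_nat_add_iff (f := fun n : ℕ => (n : ℝ) ^ (-σ)) 1).mpr
    (Real.summable_nat_rpow.mpr (by linarith))
  simpa using this

theorem exists_norm_riemannZeta_sub_one_le : ∃ A, ∀ s : ℂ, 2 ≤ s.re →
    ‖riemannZeta s - 1‖ ≤ A * 2 ^ (-s.re) := by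
  refine ⟨4 * ∑' n : ℕ, ((n : ℝ) + 1) ^ (-2 : ℝ), fun s hs => ?_⟩
  have hnorm : ∀ n : ℕ, ‖1 / ((n : ℂ) + 1) ^ s‖ = ((n : ℝ) + 1) ^ (-s.re) := fun n => by
    have := norm_cpow_eq_rpow_re_of_pos (x := (n : ℝ) + 1) (by positivity) s
    push_cast at this
    rw [norm_div, norm_one, this, Real.rpow_neg (by positivity), one_div]
  have hsum : Summable fun n : ℕ => 1 / ((n : ℂ) + 1) ^ s := by
    refine Summable.of_norm ?_
    simp only [hnorm]
    exact summable_natCast_rpow_succ (by linarith)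
  rw [zeta_eq_tsum_one_div_nat_add_one_cpow (by linarith), hsum.tsum_eq_add_tsum_ite 0]
  simp only [Nat.cast_zero, zero_add, one_cpow, div_one, add_sub_cancel_left]
  rw [mul_right_comm, ← tsum_mul_left]
  refine tsum_of_norm_bounded (((summable_natCast_rpow_succ (σ := 2) (by norm_num)).mul_left
    (4 * 2 ^ (-s.re))).hasSum) fun n => ?_
  split_ifs with h
  · rw [norm_zero]; positivity
  · rw [hnorm]
    have hn : (2 : ℝ) ≤ n + 1 := by
      have : (1 : ℝ) ≤ n := by exact_mod_cast Nat.one_le_iff_ne_zero.mpr h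
      linarith
    have h0 : (0 : ℝ) < n + 1 := by linarith
    have e1 : ((n : ℝ) + 1) ^ (-s.re) = ((n : ℝ) + 1) ^ (2 - s.re) * ((n : ℝ) + 1) ^ (-2 : ℝ) := by
      rw [← Real.rpow_add h0]; congr 1; ring
    have e2 : (4 : ℝ) * 2 ^ (-s.re) = 2 ^ (2 - s.re) := by
      rw [sub_eq_add_neg, Real.rpow_add two_pos]; norm_num
    rw [e1, e2]
    exact mul_le_mul_of_nonneg_right (Real.rpow_le_rpow_of_nonpos two_pos hn (by linarith))
      (Real.rpow_nonneg h0.le _)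

theorem exists_norm_completedRiemannZeta₀_le : ∃ B, ∀ s : ℂ, 1 / 4 ≤ s.re → s.re ≤ 2 →
    ‖completedRiemannZeta₀ s‖ ≤ B := by
  obtain ⟨B, hB⟩ := (HurwitzZeta.hurwitzEvenFEPair 0).exists_norm_Λ₀_le (1 / 8) 1
  refine ⟨B, fun s h1 h2 => ?_⟩
  have h := hB (s / 2) (by simp; linarith) (by simp; linarith)
  have e : completedRiemannZeta₀ s = (HurwitzZeta.hurwitzEvenFEPair 0).Λ₀ (s / 2) / 2 := rfl
  rw [e, norm_div, Complex.norm_ofNat]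
  linarith [norm_nonneg ((HurwitzZeta.hurwitzEvenFEPair 0).Λ₀ (s / 2))]

theorem ZetaData.riemann (hne : ∀ s : ℂ, 1 / 2 < s.re → zetaMulSub s ≠ 0) :
    ZetaData zetaMulSub 1 0 1 := by
  obtain ⟨A, hA⟩ := exists_norm_riemannZeta_sub_one_le
  obtain ⟨B, hB⟩ := exists_norm_completedRiemannZeta₀_le
  have hne1 : ∀ σ : ℝ, 2 < σ → (σ : ℂ) ≠ 1 := fun σ hσ => by exact_mod_cast (by linarith : σ ≠ 1)
  refine ZetaData.of_completed (Z := riemannZeta) (A := A) (B := |B| + 1) (c := 1)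
    (Xi := fun s => s * (s - 1) * completedRiemannZeta₀ s + 1) one_pos
    differentiable_zetaMulSub hne one_ne_zero ?_ ?_ ?_ ?_ ?_ ?_
  · have := differentiable_completedZeta₀
    fun_prop
  · intro s
    simp only [completedRiemannZeta₀_one_sub]
    ring
  · intro σ hσ
    have h0 : (σ : ℂ) ≠ 0 := by exact_mod_cast (by linarith : σ ≠ 0)
    have h1 := hne1 σ hσ
    have h1' : (1 : ℂ) - σ ≠ 0 := sub_ne_zero.mpr h1.symm
    have hΓ : Gammaℝ σ ≠ 0 := Gammaℝ_ne_zero_of_re_pos (by simp; linarith)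
    rw [xiFun, zetaMulSub_of_ne h1, riemannZeta_def_of_ne_zero h0, completedRiemannZeta_eq]
    simp only [ofReal_one, one_cpow, pow_one, pow_zero]
    field_simp
    ring
  · intro s h1 h2
    have h5 := norm_sub_le s 1
    rw [norm_one] at h5
    have h6 := norm_nonneg s
    refine (norm_add_le _ _).trans ?_
    rw [add_mul, norm_one]
    refine add_le_add ?_ (by nlinarith)
    rw [norm_mul, norm_mul, mul_comm]
    refine mul_le_mul ((hB s h1 h2).trans (le_abs_self B)) ?_ (by positivity) (abs_nonneg _)
    nlinarith [norm_nonneg (s - 1)]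
  · intro s hs
    exact ⟨zetaMulSub_of_ne fun h => by rw [h] at hs; norm_num at hs, hA s hs⟩
  · intro σ hσ
    have : riemannZeta σ = ((∑' n : ℕ, 1 / ((n : ℝ) + 1) ^ σ : ℝ) : ℂ) := by
      rw [zeta_eq_tsum_one_div_nat_add_one_cpow (by simpa using by linarith), ofReal_tsum]
      refine tsum_congr fun n => ?_
      push_cast
      rw [ofReal_cpow (by positivity)]
      push_cast
      rfl
    rw [zetaMulSub_of_ne (hne1 σ hσ), this, ← ofReal_one, ← ofReal_sub, ← ofReal_mul, ofReal_im]

end RiemannData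

section Comparison
open Complex Filter Topology
open scoped ArithmeticFunction.vonMangoldt

theorem hasSum_vonMangoldt_zetaMulSub {s : ℂ} (hs : 1 < s.re) :
    HasSum (fun m : ℕ => (Λ m : ℂ) * (m : ℂ) ^ (-s)) (1 / (s - 1) - logDeriv zetaMulSub s) := by
  have hs1 : s ≠ 1 := by rintro rfl; simp at hs
  have h1 := (ArithmeticFunction.LSeriesSummable_vonMangoldt hs).hasSum
  have h2 := ArithmeticFunction.LSeries_vonMangoldt_eq_deriv_riemannZeta_div hs
  rw [LSeries] at h2
  rw [h2] at h1
  have hz : riemannZeta s ≠ 0 := riemannZeta_ne_zero_of_one_lt_re hs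
  have e : logDeriv zetaMulSub s = 1 / (s - 1) + logDeriv riemannZeta s := by
    have h3 : zetaMulSub =ᶠ[𝓝 s] fun s => (s - 1) * riemannZeta s := by
      filter_upwards [isOpen_ne.mem_nhds hs1] with w hw
      exact zetaMulSub_of_ne hw
    rw [logDeriv_apply, h3.deriv_eq, h3.eq_of_nhds]
    have h4 := logDeriv_mul (f := fun s : ℂ => s - 1) (g := riemannZeta) s (sub_ne_zero.2 hs1) hz
      (by fun_prop) (differentiableAt_riemannZeta hs1)
    rw [logDeriv_apply] at h4
    rw [h4, logDeriv_apply]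
    simp
  have e2 : 1 / (s - 1) - logDeriv zetaMulSub s = -deriv riemannZeta s / riemannZeta s := by
    rw [e, logDeriv_apply]
    ring
  rw [e2]
  refine h1.congr_fun fun m => ?_
  rcases eq_or_ne m 0 with rfl | hm
  · simp
  · rw [LSeries.term_of_ne_zero hm, cpow_neg, div_eq_mul_inv]

theorem norm_logDeriv_GammaR_sub_le {s : ℂ} (hs : 1 / 2 < s.re) :
    ‖logDeriv Gammaℝ s - logDeriv Gammaℝ (s + 1)‖ ≤ 1.6 := by
  rw [logDeriv_GammaR (by linarith), logDeriv_GammaR (by rw [add_re, one_re]; linarith)]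
  have h := norm_digamma_add_half_sub_le (u := s / 2) (by
    rw [div_ofNat_re]; linarith)
  have e : -(Real.log Real.pi : ℂ) / 2 + digamma (s / 2) / 2 -
      (-(Real.log Real.pi : ℂ) / 2 + digamma ((s + 1) / 2) / 2) =
      -((digamma (s / 2 + 1 / 2) - digamma (s / 2)) / 2) := by
    rw [add_div]; ring
  rw [e, norm_neg, norm_div, Complex.norm_ofNat]
  linarith

theorem isOpen_half_re : IsOpen {s : ℂ | 1 / 2 < s.re} := isOpen_lt continuous_const continuous_re

theorem ZetaData.differentiableOn_logDeriv_xiFun {F : ℂ → ℂ} {a b : ℕ} {D : ℝ}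
    (h : ZetaData F a b D) : DifferentiableOn ℂ (logDeriv (xiFun F a b D)) {s | 1 / 2 < s.re} := by
  have h1 : DifferentiableOn ℂ (xiFun F a b D) {s | 1 / 2 < s.re} := fun s hs =>
    (h.differentiableAt_xiFun (by
      have : 1 / 2 < s.re := hs
      linarith)).differentiableWithinAt
  exact (h1.deriv isOpen_half_re).div h1 fun s hs => h.xiFun_ne_zero hs

theorem differentiableOn_logDeriv_GammaR :
    DifferentiableOn ℂ (logDeriv Gammaℝ) {s | 0 < s.re} := by
  have h1 : DifferentiableOn ℂ Gammaℝ {s | 0 < s.re} := fun s hs =>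
    (differentiableAt_GammaR hs).differentiableWithinAt
  exact (h1.deriv (isOpen_lt continuous_const continuous_re)).div h1
    fun s hs => Gammaℝ_ne_zero_of_re_pos hs

/-- The comparison of `n` copies of the Riemann zeta function with the zeta function of a number
field. -/
theorem ZetaData.comparisonData {F : ℂ → ℂ} {a b n : ℕ} {D : ℝ} {c : ℕ → ℝ}
    (h : ZetaData F a b D) (hζ : ZetaData zetaMulSub 1 0 1) (hab : a + b = n) (hn : 1 ≤ n)
    (hc : ∀ m, 0 ≤ c m ∧ c m ≤ n * Λ m)
    (hsum : ∀ s : ℂ, 1 < s.re → HasSum (fun m : ℕ => (c m : ℂ) * (m : ℂ) ^ (-s))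
      (1 / (s - 1) - logDeriv F s)) :
    ComparisonData (fun s => n * logDeriv (xiFun zetaMulSub 1 0 1) s) (logDeriv (xiFun F a b D))
      (fun s => b * (logDeriv Gammaℝ s - logDeriv Gammaℝ (s + 1))) (fun m => n * Λ m - c m)
      (n - 1) (Real.log D / 2) (1.6 * b) := by
  have hsumd : ∀ s : ℂ, 1 < s.re →
      HasSum (fun m : ℕ => ((n * Λ m - c m : ℝ) : ℂ) * (m : ℂ) ^ (-s))
      (n * (1 / (s - 1) - logDeriv zetaMulSub s) - (1 / (s - 1) - logDeriv F s)) := by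
    intro s hs
    refine (((hasSum_vonMangoldt_zetaMulSub hs).mul_left (n : ℂ)).sub (hsum s hs)).congr_fun
      fun m => ?_
    push_cast
    ring
  constructor
  · exact (hζ.differentiableOn_logDeriv_xiFun).const_mul _
  · exact h.differentiableOn_logDeriv_xiFun
  · refine DifferentiableOn.const_mul (DifferentiableOn.sub ?_ ?_) _
    · exact differentiableOn_logDeriv_GammaR.mono fun s (hs : 1 / 2 < s.re) =>
        show 0 < s.re by linarith
    · refine differentiableOn_logDeriv_GammaR.comp (by fun_prop) fun s (hs : 1 / 2 < s.re) => ?_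
      change 0 < (s + 1).re
      rw [add_re, one_re]
      linarith
  · intro s hs
    have e : ((n : ℂ) * logDeriv (xiFun zetaMulSub 1 0 1) s).re =
        n * (logDeriv (xiFun zetaMulSub 1 0 1) s).re := by
      rw [← ofReal_natCast, re_ofReal_mul]
    rw [e]
    exact mul_nonneg (Nat.cast_nonneg _) (hζ.re_logDeriv_xiFun_nonneg hs)
  · exact fun s hs => h.re_logDeriv_xiFun_nonneg hs
  · intro δ hδ
    obtain ⟨A, hA, h1⟩ := h.exists_logDeriv_xiFun_bound hδ
    obtain ⟨B, hB, h2⟩ := hζ.exists_logDeriv_xiFun_bound hδ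
    refine ⟨A + n * B, by positivity, fun s hs => ⟨?_, ?_⟩⟩
    · rw [norm_mul, norm_natCast]
      have h3 := mul_le_mul_of_nonneg_left (h2 s hs) (Nat.cast_nonneg (α := ℝ) n)
      have h4 : 0 ≤ A * (1 + ‖s‖) := by positivity
      linarith
    · have h4 : 0 ≤ n * B * (1 + ‖s‖) := by positivity
      linarith [h1 s hs]
  · intro s hs
    rw [norm_mul, norm_natCast, mul_comm]
    exact mul_le_mul_of_nonneg_right (norm_logDeriv_GammaR_sub_le hs) (Nat.cast_nonneg _)
  · have : (1 : ℝ) ≤ n := by exact_mod_cast hn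
    linarith
  · exact fun m => sub_nonneg.2 (hc m).2
  · intro σ hσ
    have h1 := (hsumd σ (by simpa using hσ)).summable.norm
    refine h1.congr fun m => ?_
    rw [norm_mul, norm_real, Real.norm_of_nonneg (sub_nonneg.2 (hc m).2), ← ofReal_neg]
    congr 1
    rcases eq_or_ne m 0 with rfl | hm
    · simp [Real.zero_rpow (show (-σ) ≠ 0 by linarith), zero_cpow, show σ ≠ 0 by linarith]
    · rw [norm_natCast_cpow_of_pos (Nat.pos_of_ne_zero hm), ofReal_re]
  · intro s hs
    have h1 : 1 / 2 < s.re := by linarith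
    have h2 := hsumd s hs
    rw [h.logDeriv_xiFun h1, hζ.logDeriv_xiFun h1]
    convert h2 using 1
    simp only [Real.log_one, ofReal_zero, zero_div, Nat.cast_one, Nat.cast_zero, zero_mul, one_mul,
      add_zero]
    have hn' : (n : ℂ) = a + b := by exact_mod_cast hab.symm
    push_cast
    rw [hn']
    ring

end Comparison

section Tail
open Complex Filter Topology
open scoped ArithmeticFunction.vonMangoldt

theorem ComparisonData.exp_mul_le_tsum {H₁ H₂ g : ℂ → ℂ} {d : ℕ → ℝ} {N C cg n A Y u : ℝ}
    (h : ComparisonData H₁ H₂ g d N C cg) (hd : ∀ m, d m ≤ n * Λ m)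
    (hC : 0 ≤ C) (hA : 2 * ((H₁ (5 / 4 : ℝ)).re + (H₂ (5 / 4 : ℝ)).re) ≤ A)
    (hA' : C + (H₂ (5 / 4 : ℝ)).re ≤ A) (hY : 0 ≤ Y) (hu : 0 < u) :
    Real.exp (-(u * Y)) * (N / u -
      (n * (Chebyshev.psi (Real.exp Y) / Real.exp Y) - N +
        3 / 2 * (Real.exp (-(Y / 2)) * (1 + Real.exp (-(Y / 2))) * A) +
        cg * Real.exp (-(Y / 2))) -
      (N + 4 / 3 * (Real.exp (-(Y / 2)) * (1 + Real.exp (-(Y / 2))) * A)) * u) ≤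
      ∑' m, d m * (m : ℝ) ^ (-(1 + u)) := by
  have hN := h.N_nonneg
  have hσ : 1 < 1 + u := by linarith
  obtain ⟨S, hS⟩ : ∃ S : Finset ℕ, S = Finset.Ioc 0 ⌊Real.exp Y⌋₊ := ⟨_, rfl⟩
  have hmem : ∀ m ∈ S, 1 ≤ m ∧ Real.log m ≤ Y := by
    intro m hm
    rw [hS, Finset.mem_Ioc] at hm
    refine ⟨hm.1, ?_⟩
    rw [Real.log_le_iff_le_exp (by exact_mod_cast hm.1)]
    exact (Nat.le_floor_iff (Real.exp_pos _).le).1 hm.2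
  have hnot : ∀ m : ℕ, 1 ≤ m → m ∉ S → Y ≤ Real.log m := by
    intro m hm hm'
    rw [hS, Finset.mem_Ioc, not_and, not_le] at hm'
    rw [Real.le_log_iff_exp_le (by exact_mod_cast hm)]
    exact ((Nat.floor_lt (Real.exp_pos _).le).1 (hm' hm)).le
  have h0 := h.le_exp_mul_tail hY hmem hnot hσ
  have hS0 : 0 ≤ ∑ m ∈ S, d m * (m : ℝ) ^ (-(1 + u)) :=
    Finset.sum_nonneg fun m _ => mul_nonneg (h.d_nonneg m) (by positivity)
  have hSψ : ∑ m ∈ S, d m * (m : ℝ) ^ (1 + u - 1) ≤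
      n * Chebyshev.psi (Real.exp Y) * Real.exp (u * Y) := by
    rw [Chebyshev.psi, ← hS, Finset.mul_sum, Finset.sum_mul]
    refine Finset.sum_le_sum fun m hm => ?_
    have hm0 : (0 : ℝ) < m := by exact_mod_cast (hmem m hm).1
    have h1 : (m : ℝ) ^ (1 + u - 1) ≤ Real.exp (u * Y) := by
      rw [Real.rpow_def_of_pos hm0, Real.exp_le_exp]
      nlinarith [(hmem m hm).2]
    exact (mul_le_mul_of_nonneg_left h1 (h.d_nonneg m)).trans
      (mul_le_mul_of_nonneg_right (hd m) (Real.exp_pos _).le)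
  have hH₁ := re_le_mul_re_five_quarters h.diff₁ h.re₁ hσ.le
  have hH₂ := re_le_mul_re_five_quarters h.diff₂ h.re₂ hσ.le
  have hp₁ := h.re₁ (1 + u : ℝ) (by rw [ofReal_re]; linarith)
  have hy₁ := h.re₁ (5 / 4 : ℝ) (by rw [ofReal_re]; norm_num)
  have hy₂ := h.re₂ (5 / 4 : ℝ) (by rw [ofReal_re]; norm_num)
  obtain ⟨k, hk⟩ : ∃ k, k = 3 / 2 + 4 / 3 * (1 + u - 1) := ⟨_, rfl⟩
  have hk1 : 1 ≤ k := by linarith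
  rw [← hk] at hH₁ hH₂
  generalize (H₁ (1 + u : ℝ)).re = x₁ at *
  generalize (H₂ (1 + u : ℝ)).re = x₂ at *
  generalize (H₁ (5 / 4 : ℝ)).re = y₁ at *
  generalize (H₂ (5 / 4 : ℝ)).re = y₂ at *
  generalize (∑ m ∈ S, d m * (m : ℝ) ^ (1 + u - 1)) = s₁ at *
  generalize (∑ m ∈ S, d m * (m : ℝ) ^ (-(1 + u))) = s₂ at *
  generalize (∑' m, d m * (m : ℝ) ^ (-(1 + u))) = t at *
  generalize Chebyshev.psi (Real.exp Y) = ψ at *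
  have e1 : Real.exp Y = Real.exp (Y / 2) ^ 2 := by
    rw [← Real.exp_nat_mul]; congr 1; push_cast; ring
  have e2 : Real.exp (Y * (1 + u - 1 / 2)) = Real.exp (u * Y) * Real.exp (Y / 2) := by
    rw [← Real.exp_add]; congr 1; ring
  rw [Real.exp_neg, e2] at h0
  rw [Real.exp_neg, Real.exp_neg, e1]
  have hq := Real.exp_pos (Y / 2)
  have hv : 1 ≤ Real.exp (u * Y) := Real.one_le_exp (by positivity)
  generalize Real.exp (u * Y) = v at *
  generalize Real.exp (Y / 2) = q at *
  have hv0 : 0 < v := by linarith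
  have b1 : 2 * (x₁ + x₂) ≤ k * A := by nlinarith
  have b2 : C - (x₁ - x₂) ≤ k * A := by nlinarith
  have hA0 : 0 ≤ k * A := mul_nonneg (by linarith) (by linarith)
  have b3 : (v * q)⁻¹ * (C - (x₁ - x₂) + s₁) ≤ q⁻¹ * (k * A) + q⁻¹ * (n * ψ) := by
    have c1 : (v * q)⁻¹ * (C - (x₁ - x₂) + s₁) ≤ (v * q)⁻¹ * (k * A + n * ψ * v) :=
      mul_le_mul_of_nonneg_left (by linarith) (by positivity)
    have c2 : (v * q)⁻¹ * (k * A) ≤ q⁻¹ * (k * A) :=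
      mul_le_mul_of_nonneg_right (inv_anti₀ hq (by nlinarith)) hA0
    have c3 : (v * q)⁻¹ * (n * ψ * v) = q⁻¹ * (n * ψ) := by field_simp
    rw [mul_add _ (k * A), c3] at c1
    linarith
  have b4 : N * q * (1 - u) ≤ N * q * (1 / (1 + u)) := by
    refine mul_le_mul_of_nonneg_left ?_ (by positivity)
    rw [le_div_iff₀ (by linarith)]
    nlinarith
  have b5 : v * q * (t - s₂) ≤ v * q * t := by
    have : 0 ≤ v * q * s₂ := by positivity
    linarith
  rw [add_sub_cancel_left, mul_add] at h0
  have b6 : N * q * (1 / u) + N * q * (1 - u) - k * A - cg - q⁻¹ * (k * A) - q⁻¹ * (n * ψ) ≤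
      v * q * t := by linarith
  have hvq : 0 < v * q := by positivity
  refine le_of_mul_le_mul_left (le_trans (le_of_eq ?_) b6) hvq
  rw [hk]
  field_simp
  ring

end Tail

section LogRealPart
open Complex Filter Topology
open scoped ArithmeticFunction.vonMangoldt ComplexConjugate

theorem ZetaData.ofReal_re {F : ℂ → ℂ} {a b : ℕ} {D : ℝ} (h : ZetaData F a b D) {σ : ℝ}
    (hσ : 0 < σ) : (((F σ).re : ℝ) : ℂ) = F σ := by
  have := h.conj σ (by simpa using hσ)
  rw [conj_ofReal] at this
  exact (conj_eq_iff_re.1 this.symm)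

theorem ZetaData.re_ne_zero {F : ℂ → ℂ} {a b : ℕ} {D : ℝ} (h : ZetaData F a b D) {σ : ℝ}
    (hσ : 1 / 2 < σ) : (F σ).re ≠ 0 := by
  intro h0
  have h1 := h.ofReal_re (σ := σ) (by linarith)
  rw [h0, ofReal_zero] at h1
  exact h.ne_zero σ (by simpa using hσ) h1.symm

theorem ZetaData.hasDerivAt_log_re {F : ℂ → ℂ} {a b : ℕ} {D : ℝ} (h : ZetaData F a b D) {u : ℝ}
    (hu : 0 < u) : HasDerivAt (fun u : ℝ => Real.log (F (1 + u : ℝ)).re)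
      (logDeriv F (1 + u : ℝ)).re u := by
  have h1 : HasDerivAt F (deriv F (1 + u : ℝ)) (1 + u : ℝ) :=
    (h.diffAt (by rw [Complex.ofReal_re]; linarith)).hasDerivAt
  have h2 := (h1.real_of_complex.comp_const_add 1 u).log (h.re_ne_zero (by linarith))
  convert h2 using 1
  rw [logDeriv_apply, ← h.ofReal_re (by linarith), div_ofReal_re, Complex.ofReal_re]

theorem ZetaData.tendsto_log_re_nhdsGT {F : ℂ → ℂ} {a b : ℕ} {D κ : ℝ} (h : ZetaData F a b D)
    (h1 : F 1 = κ) : Tendsto (fun u : ℝ => Real.log (F (1 + u : ℝ)).re) (𝓝[>] 0)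
      (𝓝 (Real.log κ)) := by
  have hκ : κ ≠ 0 := by
    have := h.re_ne_zero (σ := 1) (by norm_num)
    rwa [ofReal_one, h1, Complex.ofReal_re] at this
  have hc : ContinuousAt F ((1 + 0 : ℝ) : ℂ) := (h.diffAt (by simp)).continuousAt
  have h2 : ContinuousAt (fun u : ℝ => (F ((1 + u : ℝ) : ℂ)).re) 0 :=
    continuous_re.continuousAt.comp (ContinuousAt.comp (g := F)
      (f := fun u : ℝ => ((1 + u : ℝ) : ℂ)) hc (by fun_prop))
  have h3 := h2.log (by simpa [h1] using hκ)
  have h4 := h3.tendsto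
  simp only [add_zero, ofReal_one, h1, Complex.ofReal_re] at h4
  exact h4.mono_left nhdsWithin_le_nhds

theorem tendsto_log_re_sub_log_atTop {F f : ℂ → ℂ} (hF : ∀ s, s ≠ 1 → F s = (s - 1) * f s)
    (hf : Tendsto (fun u : ℝ => f (1 + u : ℝ)) atTop (𝓝 1)) :
    Tendsto (fun u : ℝ => Real.log (F (1 + u : ℝ)).re - Real.log u) atTop (𝓝 0) := by
  have h1 : Tendsto (fun u : ℝ => (f (1 + u : ℝ)).re) atTop (𝓝 1) := by
    have := (continuous_re.tendsto _).comp hf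
    rwa [one_re] at this
  have h2 := h1.log one_ne_zero
  rw [Real.log_one] at h2
  refine h2.congr' ?_
  filter_upwards [eventually_gt_atTop 0, h1.eventually_ne one_ne_zero] with u hu hne
  have h3 : ((1 + u : ℝ) : ℂ) ≠ 1 := by
    exact_mod_cast (show (1 + u : ℝ) ≠ 1 by linarith)
  have h4 : ((1 + u : ℝ) : ℂ) - 1 = (u : ℂ) := by push_cast; ring
  rw [hF _ h3, h4, re_ofReal_mul, Real.log_mul hu.ne' hne]
  ring

/-- The bound for the residue in terms of the cutoff `exp Y`. -/
theorem ZetaData.log_residue_le {F f : ℂ → ℂ} {a b n : ℕ} {D κ A Y : ℝ} {c : ℕ → ℝ}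
    (h : ZetaData F a b D) (hζ : ZetaData zetaMulSub 1 0 1) (hab : a + b = n) (hn : 1 ≤ n)
    (hc : ∀ m, 0 ≤ c m ∧ c m ≤ n * Λ m)
    (hsum : ∀ s : ℂ, 1 < s.re → HasSum (fun m : ℕ => (c m : ℂ) * (m : ℂ) ^ (-s))
      (1 / (s - 1) - logDeriv F s))
    (hF : ∀ s, s ≠ 1 → F s = (s - 1) * f s) (hκ : F 1 = κ)
    (hf : Tendsto (fun u : ℝ => f (1 + u : ℝ)) atTop (𝓝 1))
    (hf' : Tendsto (fun u : ℝ => riemannZeta (1 + u : ℝ)) atTop (𝓝 1))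
    (hD : 1 ≤ D)
    (hA : 2 * (n * (logDeriv (xiFun zetaMulSub 1 0 1) (5 / 4 : ℝ)).re +
      (logDeriv (xiFun F a b D) (5 / 4 : ℝ)).re) ≤ A)
    (hA' : Real.log D / 2 + (logDeriv (xiFun F a b D) (5 / 4 : ℝ)).re ≤ A) (hY : 0 < Y) :
    Real.log κ ≤ (n - 1) * (Real.eulerMascheroniConstant + Real.log Y) +
      (n * (Chebyshev.psi (Real.exp Y) / Real.exp Y) - (n - 1) +
        3 / 2 * (Real.exp (-(Y / 2)) * (1 + Real.exp (-(Y / 2))) * A) +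
        1.6 * b * Real.exp (-(Y / 2))) / Y +
      ((n - 1) + 4 / 3 * (Real.exp (-(Y / 2)) * (1 + Real.exp (-(Y / 2))) * A)) / Y ^ 2 := by
  have hcd := h.comparisonData hζ hab hn hc hsum
  have key := neg_mul_log_add_le_of_hasDerivAt (N := n - 1) (R := -Real.log κ)
    (G := fun u : ℝ => n * Real.log (zetaMulSub (1 + u : ℝ)).re - Real.log (F (1 + u : ℝ)).re -
      (n - 1) * Real.log u)
    (G' := fun u => n * (logDeriv zetaMulSub (1 + u : ℝ)).re - (logDeriv F (1 + u : ℝ)).re -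
      (n - 1) * u⁻¹)
    (P := n * (Chebyshev.psi (Real.exp Y) / Real.exp Y) - (n - 1) +
        3 / 2 * (Real.exp (-(Y / 2)) * (1 + Real.exp (-(Y / 2))) * A) +
        1.6 * b * Real.exp (-(Y / 2)))
    (Q := (n - 1) + 4 / 3 * (Real.exp (-(Y / 2)) * (1 + Real.exp (-(Y / 2))) * A)) hY
    (fun u hu => (((hζ.hasDerivAt_log_re hu).const_mul (n : ℝ)).sub (h.hasDerivAt_log_re hu)).sub
      ((Real.hasDerivAt_log hu.ne').const_mul _)) ?_ ?_ ?_
  · linarith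
  · intro u hu
    have h1 := hcd.exp_mul_le_tsum (n := n) (A := A) (fun m => sub_le_self _ (hc m).1)
      (div_nonneg (Real.log_nonneg hD) zero_le_two)
      (by
        have e : ((n : ℂ) * logDeriv (xiFun zetaMulSub 1 0 1) (5 / 4 : ℝ)).re =
            n * (logDeriv (xiFun zetaMulSub 1 0 1) (5 / 4 : ℝ)).re := by
          rw [← ofReal_natCast, re_ofReal_mul]
        rw [e]
        exact hA) hA' hY.le hu
    have hσ : 1 < ((1 + u : ℝ) : ℂ).re := by rw [Complex.ofReal_re]; linarith
    have h2 := hcd.hasSum_ofReal_one_lt (σ := 1 + u) (by linarith)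
    have h3 := hcd.hasSum (1 + u : ℝ) hσ
    rw [ofReal_sub, ofReal_natCast, ofReal_one] at h2 h3
    have h4 := ((hasSum_vonMangoldt_zetaMulSub hσ).mul_left (n : ℂ)).sub (hsum _ hσ)
    have h5 := h3.unique (h4.congr_fun fun m => by push_cast; ring)
    rw [h2] at h5
    have h6 := congrArg re h5
    have e1 : (1 : ℂ) / ((1 + u : ℝ) - 1) = ((u⁻¹ : ℝ) : ℂ) := by
      push_cast
      rw [add_sub_cancel_left, one_div]
    rw [e1, Complex.ofReal_re, sub_re, sub_re, ← ofReal_natCast n, re_ofReal_mul, sub_re,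
      Complex.ofReal_re] at h6
    linarith
  · have h1 := ((tendsto_log_re_sub_log_atTop (fun s hs => zetaMulSub_of_ne hs) hf').const_mul
      (n : ℝ)).sub (tendsto_log_re_sub_log_atTop hF hf)
    rw [mul_zero, sub_zero] at h1
    refine h1.congr fun u => ?_
    ring
  · have h1 := ((hζ.tendsto_log_re_nhdsGT (κ := 1) (by rw [zetaMulSub_one, ofReal_one])).const_mul
      (n : ℝ)).sub (h.tendsto_log_re_nhdsGT hκ)
    rw [Real.log_one, mul_zero, zero_sub] at h1
    refine h1.congr fun u => ?_
    ring

end LogRealPart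

section NumericalBounds
open Real Filter Topology

theorem eulerMascheroniConstant_le_harmonic_sub_log (m : ℕ) :
    eulerMascheroniConstant ≤ harmonic m - log (m + 1 / 2) := by
  have hanti : Antitone fun n : ℕ => (harmonic n : ℝ) - log (n + 1 / 2) := by
    refine antitone_nat_of_succ_le fun n => ?_
    have h1 := hasSum_log_one_add_inv (a := (n : ℝ) + 1 / 2) (by positivity)
    have h2 := h1.summable.le_tsum 0 (fun j _ => by positivity)
    rw [h1.tsum_eq] at h2
    have h3 : log (((n + 1 : ℕ) : ℝ) + 1 / 2) =
        log (1 + ((n : ℝ) + 1 / 2)⁻¹) + log (n + 1 / 2) := by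
      rw [← log_mul (by positivity) (by positivity)]
      congr 1
      push_cast
      field_simp
      ring
    rw [harmonic_succ, h3]
    push_cast
    have h4 : 2 * (1 / (2 * ((0 : ℕ) : ℝ) + 1)) * (1 / (2 * ((n : ℝ) + 1 / 2) + 1)) ^ (2 * 0 + 1) =
        ((n : ℝ) + 1)⁻¹ := by
      push_cast
      field_simp
      ring
    rw [h4] at h2
    linarith
  have hlim : Tendsto (fun n : ℕ => (harmonic n : ℝ) - log (n + 1 / 2)) atTop
      (𝓝 eulerMascheroniConstant) := by
    have h1 : Tendsto (fun n : ℕ => log (1 + (1 / 2) / (n : ℝ))) atTop (𝓝 0) := by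
      have h2 : Tendsto (fun n : ℕ => 1 + (1 / 2) / (n : ℝ)) atTop (𝓝 (1 + 0)) :=
        (tendsto_const_div_atTop_nhds_zero_nat (1 / 2)).const_add 1
      rw [add_zero] at h2
      simpa using h2.log one_ne_zero
    have h2 := tendsto_harmonic_sub_log.sub h1
    rw [sub_zero] at h2
    refine h2.congr' ?_
    filter_upwards [eventually_gt_atTop 0] with n hn
    have hn' : (0 : ℝ) < n := by exact_mod_cast hn
    rw [sub_sub, ← log_mul hn'.ne' (by positivity)]
    congr 2
    field_simp
  exact hanti.le_of_tendsto hlim m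

theorem exp_le_of_taylor {x B : ℝ} (hx : 0 ≤ x) (hx1 : x ≤ 1)
    (h : 1 + x + x ^ 2 / 2 + x ^ 3 / 6 + x ^ 4 / 24 + x ^ 5 / 120 + x ^ 6 / 720 + x ^ 7 / 5040 +
      x ^ 8 * 9 / (40320 * 8) ≤ B) : exp x ≤ B := by
  refine (exp_bound' hx hx1 (n := 8) (by norm_num)).trans (le_trans (le_of_eq ?_) h)
  simp only [Finset.sum_range_succ, Finset.sum_range_zero, Nat.factorial]
  push_cast
  ring

theorem le_exp_of_taylor {x B : ℝ} (hx : 0 ≤ x)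
    (h : B ≤ 1 + x + x ^ 2 / 2 + x ^ 3 / 6 + x ^ 4 / 24 + x ^ 5 / 120 + x ^ 6 / 720 +
      x ^ 7 / 5040) : B ≤ exp x := by
  refine h.trans (le_trans (le_of_eq ?_) (sum_le_exp_of_nonneg hx 8))
  simp only [Finset.sum_range_succ, Finset.sum_range_zero, Nat.factorial]
  push_cast
  ring

theorem eulerMascheroniConstant_add_log_two_le : eulerMascheroniConstant + log 2 ≤ 1.271 := by
  have h1 := eulerMascheroniConstant_le_harmonic_sub_log 10
  have h2 : (2.3513 : ℝ) ≤ log (((10 : ℕ) : ℝ) + 1 / 2) := by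
    rw [le_log_iff_exp_le (by positivity)]
    have h3 : exp (2.3513 / 4) ≤ 1.80007 :=
      exp_le_of_taylor (by norm_num) (by norm_num) (by norm_num)
    have h4 : exp 2.3513 = exp (2.3513 / 4) ^ 4 := by
      rw [← exp_nat_mul]; congr 1; norm_num
    rw [h4]
    refine (pow_le_pow_left₀ (exp_pos _).le h3 4).trans ?_
    norm_num
  have h3 : (harmonic 10 : ℝ) = 7381 / 2520 := by
    have : harmonic 10 = 7381 / 2520 := by
      simp only [harmonic, Finset.sum_range_succ, Finset.sum_range_zero]
      norm_num
    rw [this]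
    norm_num
  have h4 := log_two_lt_d9
  rw [h3] at h1
  norm_num at *
  linarith

theorem log_seven_halves_bounds : 1.2527 ≤ log 3.5 ∧ log 3.5 ≤ 1.2528 := by
  constructor
  · rw [le_log_iff_exp_le (by norm_num)]
    have h3 : exp (1.2527 / 2) ≤ 1.8708 :=
      exp_le_of_taylor (by norm_num) (by norm_num) (by norm_num)
    have h4 : exp 1.2527 = exp (1.2527 / 2) ^ 2 := by
      rw [← exp_nat_mul]; congr 1; norm_num
    rw [h4]
    refine (pow_le_pow_left₀ (exp_pos _).le h3 2).trans ?_
    norm_num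
  · rw [log_le_iff_le_exp (by norm_num)]
    have h3 : 1.87083 ≤ exp (1.2528 / 2) := le_exp_of_taylor (by norm_num) (by norm_num)
    have h4 : exp 1.2528 = exp (1.2528 / 2) ^ 2 := by
      rw [← exp_nat_mul]; congr 1; norm_num
    rw [h4]
    refine le_trans ?_ (pow_le_pow_left₀ (by norm_num) h3 2)
    norm_num

theorem le_log_log_of_le {D : ℝ} (hD : 5.4e6 ≤ D) : 15.33 ≤ exp 2.73 ∧ 2.73 ≤ log (log D) := by
  have e : exp 2.73 = exp (2.73 / 3) ^ 3 := by
    rw [← exp_nat_mul]; congr 1; norm_num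
  refine ⟨?_, ?_⟩
  · have h3 : 2.48427 ≤ exp (2.73 / 3) := le_exp_of_taylor (by norm_num) (by norm_num)
    rw [e]
    refine le_trans ?_ (pow_le_pow_left₀ (by norm_num) h3 3)
    norm_num
  · have h1 : 67 * log 2 ≤ 3 * log D := by
      have h2 : log ((2 : ℝ) ^ 67) ≤ log (D ^ 3) := by
        refine log_le_log (by positivity) (le_trans ?_ (pow_le_pow_left₀ (by norm_num) hD 3))
        norm_num
      rw [log_pow, log_pow] at h2
      exact_mod_cast h2
    have h2 := log_two_gt_d9
    have h3 : 15.4 ≤ log D := by norm_num at *; linarith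
    have h4 : exp (2.73 / 3) ≤ 2.48433 :=
      exp_le_of_taylor (by norm_num) (by norm_num) (by norm_num)
    rw [le_log_iff_exp_le (by norm_num at *; linarith), e]
    refine (pow_le_pow_left₀ (exp_pos _).le h4 3).trans (le_trans ?_ h3)
    norm_num

theorem log_one_add_le {u : ℝ} (hu : 0 ≤ u) : log (1 + u) ≤ u * (2 + u) / (2 * (1 + u)) := by
  have hd : ∀ x : ℝ, 0 ≤ x → HasDerivAt (fun x : ℝ => (1 + x) / 2 - (1 + x)⁻¹ / 2 - log (1 + x))
      (1 / 2 + (1 / (1 + x) ^ 2) / 2 - 1 / (1 + x)) x := by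
    intro x hx
    have h0 : (1 + x) ≠ 0 := by positivity
    have h1 : HasDerivAt (fun x : ℝ => 1 + x) 1 x := (hasDerivAt_id x).const_add 1
    have h2 : HasDerivAt (fun x : ℝ => (1 + x) / 2 - (1 + x)⁻¹ / 2 - log (1 + x)) _ x :=
      ((h1.div_const 2).sub ((h1.inv h0).div_const 2)).sub (h1.log h0)
    convert h2 using 1
    ring
  have hmono : MonotoneOn (fun x : ℝ => (1 + x) / 2 - (1 + x)⁻¹ / 2 - log (1 + x))
      (Set.Ici 0) := by
    refine monotoneOn_of_deriv_nonneg (convex_Ici 0)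
      (fun x hx => (hd x hx).continuousAt.continuousWithinAt) ?_ ?_
    · rw [interior_Ici]
      exact fun x hx => (hd x (le_of_lt hx)).differentiableAt.differentiableWithinAt
    · rw [interior_Ici]
      intro x hx
      rw [(hd x (le_of_lt hx)).deriv]
      have h0 : 0 < 1 + x := by
        have : 0 < x := hx
        linarith
      have : 1 / 2 + (1 / (1 + x) ^ 2) / 2 - 1 / (1 + x) = (1 - 1 / (1 + x)) ^ 2 / 2 := by
        field_simp
        ring
      rw [this]
      positivity
  have h := hmono Set.self_mem_Ici hu hu
  norm_num at h
  have e : u * (2 + u) / (2 * (1 + u)) = (1 + u) / 2 - (1 + u)⁻¹ / 2 := by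
    field_simp
    ring
  linarith

theorem four_mul_sq_le {a β q r : ℝ} (ha : 0 ≤ a) (hβ : 1.2527 ≤ β) (hβ' : β ≤ 1.2528)
    (hq : 0 ≤ q) (hr : r * (1 + a + a ^ 2 / 2) = 1) (hqr : q ≤ 0.01864 * r) :
    4 * β * (2 * (2.73 + a) + β) * (2.73 + a + β) / 2 +
      2 * (2.73 + a) * (2.73 + a + β) * (2 * 1.386295 - 1 +
        3 / 2 * ((1 + q) * (28.8 * q + 2 / 7)) + 1.6 * q) +
      16 * q * (2.73 + a) * (2.73 + a + β) ^ 2 +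
      (2.73 + a) * (1 + 4 / 3 * ((1 + q) * (28.8 * q + 2 / 7))) ≤ 9.9 * (2.73 + a + β) ^ 2 := by
  have hs : 0 < 1 + a + a ^ 2 / 2 := by positivity
  have hr0 : 0 < r := by
    by_contra h
    have := mul_nonpos_of_nonpos_of_nonneg (not_lt.1 h) hs.le
    linarith
  have hr1 : r ≤ 1 := by nlinarith [mul_nonneg hr0.le ha, mul_nonneg hr0.le (sq_nonneg a)]
  have hq1 : q ≤ 0.01864 := by linarith
  have hW : (1 + q) * (28.8 * q + 2 / 7) ≤ 0.28572 + 0.5522 * r := by nlinarith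
  have hW0 : 0 ≤ (1 + q) * (28.8 * q + 2 / 7) := by positivity
  obtain ⟨W, hWe⟩ : ∃ W, W = (1 + q) * (28.8 * q + 2 / 7) := ⟨_, rfl⟩
  rw [← hWe] at hW hW0 ⊢
  obtain ⟨M, hM⟩ : ∃ M, M = a + 3.9828 := ⟨_, rfl⟩
  have hMl : a + 3.9827 ≤ 2.73 + a + β := by norm_num at *; linarith
  have hMu : 2.73 + a + β ≤ M := by norm_num at *; linarith
  have hM0 : 0 ≤ 2.73 + a + β := by norm_num at *; linarith
  have hβ0 : 0 ≤ β := by norm_num at *; linarith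
  have hL0 : 0 ≤ 2.73 + a := by positivity
  have hM1 : 0 ≤ M := hM0.trans hMu
  have t1 : 4 * β * (2 * (2.73 + a) + β) * (2.73 + a + β) / 2 ≤
      4 * 1.2528 * (2 * (2.73 + a) + 1.2528) * M / 2 := by gcongr
  have t2 : 2 * (2.73 + a) * (2.73 + a + β) * (2 * 1.386295 - 1 + 3 / 2 * W + 1.6 * q) ≤
      2 * (2.73 + a) * M * (2 * 1.386295 - 1 + 3 / 2 * (0.28572 + 0.5522 * r) +
        1.6 * (0.01864 * r)) := by
    have : 0 ≤ 2 * 1.386295 - 1 + 3 / 2 * W + 1.6 * q := by norm_num at *; linarith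
    gcongr
  have t3 : 16 * q * (2.73 + a) * (2.73 + a + β) ^ 2 ≤
      16 * (0.01864 * r) * (2.73 + a) * M ^ 2 := by gcongr
  have t4 : (2.73 + a) * (1 + 4 / 3 * W) ≤ (2.73 + a) * (1 + 4 / 3 * (0.28572 + 0.5522 * r)) := by
    gcongr
  have t5 : 9.9 * (a + 3.9827) ^ 2 ≤ 9.9 * (2.73 + a + β) ^ 2 := by gcongr
  refine le_trans (add_le_add (add_le_add (add_le_add t1 t2) t3) t4) (le_trans ?_ t5)
  have hpoly : 2 * (2.73 + a) * M * (3 / 2 * 0.5522 + 1.6 * 0.01864) +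
      16 * 0.01864 * (2.73 + a) * M ^ 2 + (2.73 + a) * (4 / 3 * 0.5522) ≤
      (1 + a + a ^ 2 / 2) * (9.9 * (a + 3.9827) ^ 2 -
        4 * 1.2528 * (2 * (2.73 + a) + 1.2528) * M / 2 -
        2 * (2.73 + a) * M * (2 * 1.386295 - 1 + 3 / 2 * 0.28572) -
        (2.73 + a) * (1 + 4 / 3 * 0.28572)) := by
    rw [← sub_nonneg, hM]
    ring_nf
    positivity
  have h := mul_le_mul_of_nonneg_left hpoly hr0.le
  rw [← mul_assoc r (1 + a + a ^ 2 / 2), hr, one_mul] at h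
  clear hpoly t1 t2 t3 t4 t5
  rw [← sub_nonneg] at h ⊢
  refine le_of_le_of_eq h ?_
  ring

/-- The numerical inequality behind the choice of cutoff `x = (3.5 log D) ^ 2`. -/
theorem cutoff_bound_le {D ℓ Y q : ℝ} (hD : 5.4e6 ≤ D) (hℓ : ℓ = log D)
    (hYe : Y = 2 * log (3.5 * ℓ)) (hqe : q = exp (-(Y / 2))) :
    0 < Y ∧ eulerMascheroniConstant + log Y + (2 * (log 4 + 2 * Y * q) - 1 +
        3 / 2 * (q * (1 + q) * (28.8 + ℓ)) + 1.6 * q) / Y +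
      (1 + 4 / 3 * (q * (1 + q) * (28.8 + ℓ))) / Y ^ 2 ≤
      1.271 + 2.475 / log ℓ + log (log ℓ) := by
  obtain ⟨he, hL⟩ := le_log_log_of_le hD
  rw [← hℓ] at hL
  obtain ⟨a, ha⟩ : ∃ a, a = log ℓ - 2.73 := ⟨_, rfl⟩
  have hLa : log ℓ = 2.73 + a := by rw [ha]; ring
  have ha0 : 0 ≤ a := by rw [ha]; exact sub_nonneg.2 hL
  have hℓ0 : 0 < ℓ := by
    rw [hℓ]
    refine log_pos (lt_of_lt_of_le ?_ hD)
    norm_num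
  have hs : 0 < 1 + a + a ^ 2 / 2 := by positivity
  have hℓs : 15.33 * (1 + a + a ^ 2 / 2) ≤ ℓ := by
    have h1 : ℓ = exp 2.73 * exp a := by rw [← exp_add, ← hLa, exp_log hℓ0]
    rw [h1]
    exact mul_le_mul he (quadratic_le_exp_of_nonneg ha0) hs.le (exp_pos _).le
  obtain ⟨β, hβ⟩ : ∃ β, β = log 3.5 := ⟨_, rfl⟩
  obtain ⟨hβ1, hβ2⟩ := log_seven_halves_bounds
  rw [← hβ] at hβ1 hβ2
  have hY : Y = 2 * (2.73 + a + β) := by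
    rw [hYe, log_mul (by norm_num) hℓ0.ne', hLa, ← hβ]; ring
  have hq : q = (3.5 * ℓ)⁻¹ := by
    rw [hqe, hYe, mul_div_cancel_left₀ _ two_ne_zero, exp_neg, exp_log (by positivity)]
  have hqℓ : q * ℓ = 2 / 7 := by
    rw [hq]; field_simp; norm_num
  have hq0 : 0 ≤ q := by rw [hqe]; exact (exp_pos _).le
  have hqr : q ≤ 0.01864 * (1 + a + a ^ 2 / 2)⁻¹ := by
    rw [hq, ← div_eq_mul_inv, inv_eq_one_div, div_le_div_iff₀ (by positivity) hs]
    norm_num at *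
    linarith
  have hmain := four_mul_sq_le ha0 hβ1 hβ2 hq0 (inv_mul_cancel₀ hs.ne') hqr
  have hW : q * (1 + q) * (28.8 + ℓ) = (1 + q) * (28.8 * q + 2 / 7) := by
    rw [← hqℓ]; ring
  rw [hW, hLa]
  have hlog4 : log 4 ≤ 1.386295 := by
    have h1 : log 4 = 2 * log 2 := by
      rw [show (4 : ℝ) = 2 ^ 2 by norm_num, log_pow]; norm_num
    have := log_two_lt_d9
    rw [h1]
    norm_num at *
    linarith
  have hL0 : 0 < 2.73 + a := by positivity
  have hβ0 : 0 < β := lt_of_lt_of_le (by norm_num) hβ1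
  have hM0 : 0 < 2.73 + a + β := by positivity
  have hY0 : 0 < Y := by rw [hY]; positivity
  refine ⟨hY0, ?_⟩
  have hlogY : log Y ≤ log 2 + log (2.73 + a) +
      β * (2 * (2.73 + a) + β) / (2 * (2.73 + a) * (2.73 + a + β)) := by
    have h1 := log_one_add_le (u := β / (2.73 + a)) (by positivity)
    have h2 : Y = 2 * (2.73 + a) * (1 + β / (2.73 + a)) := by
      rw [hY]; field_simp
    rw [h2, log_mul (by positivity) (by positivity), log_mul two_ne_zero hL0.ne']
    have h3 : β / (2.73 + a) * (2 + β / (2.73 + a)) / (2 * (1 + β / (2.73 + a))) =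
        β * (2 * (2.73 + a) + β) / (2 * (2.73 + a) * (2.73 + a + β)) := by
      field_simp
    linarith
  have hγ := eulerMascheroniConstant_add_log_two_le
  have hP : (2 * (log 4 + 2 * Y * q) - 1 + 3 / 2 * ((1 + q) * (28.8 * q + 2 / 7)) + 1.6 * q) / Y ≤
      (2 * 1.386295 - 1 + 3 / 2 * ((1 + q) * (28.8 * q + 2 / 7)) + 1.6 * q) / Y + 4 * q := by
    rw [← sub_nonneg]
    have : (2 * 1.386295 - 1 + 3 / 2 * ((1 + q) * (28.8 * q + 2 / 7)) + 1.6 * q) / Y + 4 * q -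
      (2 * (log 4 + 2 * Y * q) - 1 + 3 / 2 * ((1 + q) * (28.8 * q + 2 / 7)) + 1.6 * q) / Y =
      2 * (1.386295 - log 4) / Y := by field_simp; ring
    rw [this]
    have := sub_nonneg.2 hlog4
    positivity
  generalize (1 + q) * (28.8 * q + 2 / 7) = W at *
  have hfin : β * (2 * (2.73 + a) + β) / (2 * (2.73 + a) * (2.73 + a + β)) +
      ((2 * 1.386295 - 1 + 3 / 2 * W + 1.6 * q) / Y + 4 * q) + (1 + 4 / 3 * W) / Y ^ 2 ≤
      2.475 / (2.73 + a) := by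
    generalize 2 * 1.386295 - 1 + 3 / 2 * W + 1.6 * q = V at *
    generalize 1 + 4 / 3 * W = U at *
    rw [hY]
    generalize 2.73 + a + β = M at *
    generalize 2.73 + a = L at *
    have e : β * (2 * L + β) / (2 * L * M) + (V / (2 * M) + 4 * q) + U / (2 * M) ^ 2 =
        (4 * β * (2 * L + β) * M / 2 + 2 * L * M * V + 16 * q * L * M ^ 2 + L * U) /
          (4 * L * M ^ 2) := by
      field_simp
      ring
    rw [e, div_le_div_iff₀ (by positivity) hL0]
    have := mul_le_mul_of_nonneg_right hmain hL0.le
    refine this.trans (le_of_eq ?_)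
    norm_num
    ring
  linarith

end NumericalBounds

section FiveQuarters
open Complex Filter Topology
open scoped ArithmeticFunction.vonMangoldt

theorem re_logDeriv_GammaR_nonpos {x : ℝ} (hx : 0 < x) (hx' : x ≤ 6) :
    (logDeriv Gammaℝ (x : ℂ)).re ≤ 0 := by
  rw [logDeriv_GammaR (by rwa [Complex.ofReal_re])]
  have h := (re_digamma_bounds (x := x / 2) (by linarith)).1
  rw [ofReal_div, ofReal_ofNat] at h
  have h2 : Real.log (x / 2) ≤ Real.log Real.pi :=
    Real.log_le_log (by linarith) (by linarith [Real.pi_gt_three])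
  rw [add_re, div_ofNat_re, div_ofNat_re, neg_re, Complex.ofReal_re]
  linarith

theorem ZetaData.re_logDeriv_xiFun_five_quarters_le {F : ℂ → ℂ} {a b : ℕ} {D : ℝ} {c : ℕ → ℝ}
    (h : ZetaData F a b D) (hc : ∀ m, 0 ≤ c m)
    (hsum : ∀ s : ℂ, 1 < s.re → HasSum (fun m : ℕ => (c m : ℂ) * (m : ℂ) ^ (-s))
      (1 / (s - 1) - logDeriv F s)) :
    (logDeriv (xiFun F a b D) (5 / 4 : ℝ)).re ≤ 4.8 + Real.log D / 2 := by
  have h1 := Complex.hasSum_re (hsum (5 / 4 : ℝ) (by rw [Complex.ofReal_re]; norm_num))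
  have h2 : 0 ≤ ((1 : ℂ) / ((5 / 4 : ℝ) - 1) - logDeriv F (5 / 4 : ℝ)).re := by
    refine h1.nonneg fun m => ?_
    have e : (m : ℂ) ^ (-((5 / 4 : ℝ) : ℂ)) = (((m : ℝ) ^ (-(5 / 4 : ℝ)) : ℝ) : ℂ) := by
      rw [ofReal_cpow (Nat.cast_nonneg m)]
      push_cast
      rfl
    rw [e, ← ofReal_mul, Complex.ofReal_re]
    exact mul_nonneg (hc m) (Real.rpow_nonneg (Nat.cast_nonneg m) _)
  have e1 : (1 : ℂ) / ((5 / 4 : ℝ) - 1) = ((4 : ℝ) : ℂ) := by norm_num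
  rw [e1, sub_re, Complex.ofReal_re] at h2
  rw [h.logDeriv_xiFun (by rw [Complex.ofReal_re]; norm_num)]
  have e2 : (1 : ℂ) / (5 / 4 : ℝ) + Real.log D / 2 = ((0.8 + Real.log D / 2 : ℝ) : ℂ) := by
    push_cast
    norm_num
  have e3 : ((5 / 4 : ℝ) : ℂ) + 1 = ((9 / 4 : ℝ) : ℂ) := by norm_num
  rw [e2, e3, add_re, add_re, add_re, Complex.ofReal_re, ← ofReal_natCast a, ← ofReal_natCast b,
    re_ofReal_mul, re_ofReal_mul]
  have h3 := mul_nonpos_of_nonneg_of_nonpos (Nat.cast_nonneg (α := ℝ) a)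
    (re_logDeriv_GammaR_nonpos (x := 5 / 4) (by norm_num) (by norm_num))
  have h4 := mul_nonpos_of_nonneg_of_nonpos (Nat.cast_nonneg (α := ℝ) b)
    (re_logDeriv_GammaR_nonpos (x := 9 / 4) (by norm_num) (by norm_num))
  norm_num at *
  linarith

theorem psi_exp_div_exp_le {Y : ℝ} (hY : 0 ≤ Y) :
    Chebyshev.psi (Real.exp Y) / Real.exp Y ≤ Real.log 4 + 2 * Y * Real.exp (-(Y / 2)) := by
  have h := Chebyshev.psi_le (Real.one_le_exp hY)
  rw [Real.log_exp, ← Real.exp_half] at h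
  rw [div_le_iff₀ (Real.exp_pos _), add_mul]
  have e : Real.exp (Y / 2) = Real.exp (-(Y / 2)) * Real.exp Y := by
    rw [← Real.exp_add]
    congr 1
    ring
  rw [e] at h
  linarith

theorem ZetaData.residue_le {F f : ℂ → ℂ} {a b n : ℕ} {D κ : ℝ} {c : ℕ → ℝ}
    (h : ZetaData F a b D) (hζ : ZetaData zetaMulSub 1 0 1) (hab : a + b = n) (hba : b ≤ a)
    (hn : 2 ≤ n) (hc : ∀ m, 0 ≤ c m ∧ c m ≤ n * Λ m)
    (hsum : ∀ s : ℂ, 1 < s.re → HasSum (fun m : ℕ => (c m : ℂ) * (m : ℂ) ^ (-s))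
      (1 / (s - 1) - logDeriv F s))
    (hF : ∀ s, s ≠ 1 → F s = (s - 1) * f s) (hκ : F 1 = κ)
    (hf : Tendsto (fun u : ℝ => f (1 + u : ℝ)) atTop (𝓝 1))
    (hf' : Tendsto (fun u : ℝ => riemannZeta (1 + u : ℝ)) atTop (𝓝 1))
    (hD : 5.4e6 ≤ D) (hκ0 : 0 < κ) :
    κ ≤ (Real.exp (1.271 + 2.475 / Real.log (Real.log D)) * Real.log (Real.log D)) ^ (n - 1) := by
  obtain ⟨N, hN⟩ : ∃ N : ℝ, N = n - 1 := ⟨_, rfl⟩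
  have hnN : (n : ℝ) = N + 1 := by rw [hN]; ring
  have hN1 : 1 ≤ N := by
    have : (2 : ℝ) ≤ n := by exact_mod_cast hn
    linarith
  obtain ⟨ℓ, hℓ⟩ : ∃ ℓ, ℓ = Real.log D := ⟨_, rfl⟩
  obtain ⟨Y, hYe⟩ : ∃ Y, Y = 2 * Real.log (3.5 * ℓ) := ⟨_, rfl⟩
  obtain ⟨q, hqe⟩ : ∃ q, q = Real.exp (-(Y / 2)) := ⟨_, rfl⟩
  obtain ⟨hY, hcut⟩ := cutoff_bound_le hD hℓ hYe hqe
  have hD1 : 1 ≤ D := le_trans (by norm_num) hD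
  have hℓ0 : 0 ≤ ℓ := by rw [hℓ]; exact Real.log_nonneg hD1
  have hL : 0 < Real.log ℓ := by
    have := (le_log_log_of_le hD).2
    rw [← hℓ] at this
    exact lt_of_lt_of_le (by norm_num) this
  have b1 := hζ.re_logDeriv_xiFun_five_quarters_le (c := fun m => Λ m)
    (fun m => ArithmeticFunction.vonMangoldt_nonneg) fun s hs => hasSum_vonMangoldt_zetaMulSub hs
  have b2 := h.re_logDeriv_xiFun_five_quarters_le (fun m => (hc m).1) hsum
  rw [Real.log_one, zero_div, add_zero] at b1
  rw [← hℓ] at b2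
  have hℓN : ℓ ≤ N * ℓ := le_mul_of_one_le_left hℓ0 hN1
  have key := h.log_residue_le (A := N * (28.8 + ℓ)) hζ hab (by omega) hc hsum hF hκ hf hf' hD1
    (by
      have := mul_le_mul_of_nonneg_left b1 (Nat.cast_nonneg (α := ℝ) n)
      rw [hnN] at this ⊢
      norm_num at *
      linarith)
    (by
      rw [← hℓ]
      norm_num at *
      linarith) hY
  have hψ := psi_exp_div_exp_le hY.le
  obtain ⟨P, hP⟩ : ∃ P, P = Chebyshev.psi (Real.exp Y) / Real.exp Y := ⟨_, rfl⟩
  rw [← hqe, ← hP] at hψ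
  rw [← hqe, ← hP, ← hN] at key
  have hq0 : 0 ≤ q := by rw [hqe]; exact (Real.exp_pos _).le
  have hlog4 : 0 ≤ Real.log 4 := Real.log_nonneg (by norm_num)
  have hnP : n * P ≤ N * (2 * (Real.log 4 + 2 * Y * q)) := by
    have h0 : 0 ≤ Real.log 4 + 2 * Y * q := by positivity
    calc n * P ≤ n * (Real.log 4 + 2 * Y * q) := by gcongr
      _ ≤ (2 * N) * (Real.log 4 + 2 * Y * q) := by
        gcongr
        linarith
      _ = _ := by ring
  have hbN : (b : ℝ) ≤ N := by
    have h1 : (a : ℝ) + b = n := by exact_mod_cast hab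
    have h2 : (b : ℝ) ≤ a := by exact_mod_cast hba
    linarith
  have hbq : 1.6 * b * q ≤ N * (1.6 * q) := by
    have := mul_le_mul_of_nonneg_right hbN hq0
    norm_num at *
    linarith
  have hlog : Real.log κ ≤ N * (1.271 + 2.475 / Real.log ℓ + Real.log (Real.log ℓ)) := by
    refine le_trans ?_ (mul_le_mul_of_nonneg_left hcut (by linarith))
    refine key.trans ?_
    have e : N * (Real.eulerMascheroniConstant + Real.log Y + (2 * (Real.log 4 + 2 * Y * q) - 1 +
        3 / 2 * (q * (1 + q) * (28.8 + ℓ)) + 1.6 * q) / Y +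
        (1 + 4 / 3 * (q * (1 + q) * (28.8 + ℓ))) / Y ^ 2) =
        N * (Real.eulerMascheroniConstant + Real.log Y) +
        (N * (2 * (Real.log 4 + 2 * Y * q)) - N + 3 / 2 * (q * (1 + q) * (N * (28.8 + ℓ))) +
          N * (1.6 * q)) / Y +
        (N + 4 / 3 * (q * (1 + q) * (N * (28.8 + ℓ)))) / Y ^ 2 := by
      ring
    rw [e]
    gcongr
  have hexp : κ ≤ Real.exp (N * (1.271 + 2.475 / Real.log ℓ + Real.log (Real.log ℓ))) := by
    rw [← Real.exp_log hκ0]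
    exact Real.exp_le_exp.2 hlog
  refine hexp.trans (le_of_eq ?_)
  have hNn : N = ((n - 1 : ℕ) : ℝ) := by
    rw [hN, Nat.cast_sub (by omega), Nat.cast_one]
  rw [hNn, Real.exp_nat_mul, Real.exp_add, Real.exp_log hL, ← hℓ]

end FiveQuarters

section Assembly
open Complex Filter Topology NumberField.InfinitePlace
open scoped ArithmeticFunction.vonMangoldt

theorem tendsto_one_add_of_norm_sub_one_le {f : ℂ → ℂ} {A : ℝ}
    (h : ∀ s : ℂ, 2 ≤ s.re → ‖f s - 1‖ ≤ A * 2 ^ (-s.re)) :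
    Tendsto (fun u : ℝ => f (1 + u : ℝ)) atTop (𝓝 1) := by
  rw [tendsto_iff_norm_sub_tendsto_zero]
  have h2 : Tendsto (fun u : ℝ => A * (2 : ℝ) ^ (-(1 + u))) atTop (𝓝 0) := by
    have h3 : Tendsto (fun x : ℝ => (2 : ℝ) ^ x) atBot (𝓝 0) :=
      tendsto_rpow_atBot_of_base_gt_one 2 one_lt_two
    have h4 : Tendsto (fun u : ℝ => -(1 + u)) atTop atBot :=
      tendsto_neg_atTop_atBot.comp (tendsto_atTop_add_const_left _ _ tendsto_id)
    simpa using (h3.comp h4).const_mul A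
  refine squeeze_zero' (Eventually.of_forall fun _ => norm_nonneg _) ?_ h2
  filter_upwards [eventually_ge_atTop 1] with u hu
  have := h (1 + u : ℝ) (by rw [Complex.ofReal_re]; linarith)
  rwa [Complex.ofReal_re] at this

theorem logDeriv_sub_one_mul {F f g : ℂ → ℂ} {s : ℂ} (hs : 1 < s.re)
    (hF : ∀ s, s ≠ 1 → F s = (s - 1) * f s) (hfg : ∀ s : ℂ, 1 < s.re → f s = g s)
    (hd : DifferentiableOn ℂ f {1}ᶜ) (hg : g s ≠ 0) :
    logDeriv F s = 1 / (s - 1) + logDeriv g s := by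
  have hs1 : s ≠ 1 := by rintro rfl; simp at hs
  have h3 : F =ᶠ[𝓝 s] fun s => (s - 1) * f s := by
    filter_upwards [isOpen_ne.mem_nhds hs1] with w hw
    exact hF w hw
  have h5 : f =ᶠ[𝓝 s] g := by
    filter_upwards [(isOpen_lt continuous_const continuous_re).mem_nhds hs] with w hw
    exact hfg w hw
  have hfs : f s ≠ 0 := by rwa [hfg s hs]
  rw [logDeriv_apply, h3.deriv_eq, h3.eq_of_nhds]
  have h4 := logDeriv_mul (f := fun s : ℂ => s - 1) (g := f) s (sub_ne_zero.2 hs1) hfs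
    (by fun_prop) (hd.differentiableAt (isOpen_ne.mem_nhds hs1))
  rw [logDeriv_apply] at h4
  rw [h4, logDeriv_apply, logDeriv_apply, logDeriv_apply, h5.deriv_eq, h5.eq_of_nhds]
  simp

end Assembly

theorem stmt16 (K : Type) [Field K] [NumberField K]
    (hdeg : 2 ≤ Module.finrank ℚ K)
    (hdisc : 5.4e6 ≤ |(discr K : ℝ)|)
    (ζK : ℂ → ℂ)
    -- `ζK` agrees with the Dedekind zeta series of `K` on `Re s > 1`
    (hser : ∀ s : ℂ, 1 < s.re →
      ζK s = ∑' I : {I : Ideal (𝓞 K) // I ≠ ⊥},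
        (Ideal.absNorm (I : Ideal (𝓞 K)) : ℂ) ^ (-s))
    -- `ζK` is the meromorphic continuation, holomorphic away from `s = 1`
    (hdiff : DifferentiableOn ℂ ζK {(1 : ℂ)}ᶜ)
    -- GRH for `ζK`
    (hGRH : ∀ s : ℂ, 1 / 2 < s.re → ζK s ≠ 0)
    -- the Dedekind conjecture: `ζK/ζ` extends to an entire function
    (hDed : ∃ g : ℂ → ℂ, Differentiable ℂ g ∧
      ∀ s : ℂ, s ≠ 1 → ζK s = g s * riemannZeta s)
    -- `κ` is the residue of `ζK` at `s = 1`
    (κ : ℝ)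
    (hκ : Filter.Tendsto (fun s : ℂ => (s - 1) * ζK s)
      (nhdsWithin 1 {(1 : ℂ)}ᶜ) (nhds (κ : ℂ))) :
    κ ≤ (Real.exp (1.271 + 2.475 / Real.log (Real.log |(discr K : ℝ)|)) *
        Real.log (Real.log |(discr K : ℝ)|)) ^ (Module.finrank ℚ K - 1) := by
  obtain ⟨g, hg, hgζ⟩ := hDed
  rcases le_or_gt κ 0 with hκ0 | hκ0
  · refine hκ0.trans (pow_nonneg (mul_nonneg (Real.exp_pos _).le ?_) _)
    exact le_trans (by norm_num) (le_log_log_of_le hdisc).2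
  obtain ⟨F, hFe⟩ : ∃ F : ℂ → ℂ, F = fun s => g s * zetaMulSub s := ⟨_, rfl⟩
  have hF : Differentiable ℂ F := hFe ▸ hg.mul differentiable_zetaMulSub
  have hFζ : ∀ s, s ≠ 1 → F s = (s - 1) * ζK s := fun s hs => by
    rw [hFe, hgζ s hs]
    simp only [zetaMulSub_of_ne hs]
    ring
  have hF1 : F 1 = κ := by
    refine tendsto_nhds_unique ((hF.continuous.tendsto 1).mono_left nhdsWithin_le_nhds)
      (hκ.congr' ?_)
    filter_upwards [self_mem_nhdsWithin] with s hs
    exact (hFζ s hs).symm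
  have hFne : ∀ s : ℂ, 1 / 2 < s.re → F s ≠ 0 := fun s hs => by
    rcases eq_or_ne s 1 with rfl | h1
    · rw [hF1]
      exact_mod_cast hκ0.ne'
    · rw [hFζ s h1]
      exact mul_ne_zero (sub_ne_zero.2 h1) (hGRH s hs)
  have hζne : ∀ s : ℂ, 1 / 2 < s.re → zetaMulSub s ≠ 0 := fun s hs h0 =>
    hFne s hs (by simp only [hFe, h0, mul_zero])
  obtain ⟨c, hc, hcsum⟩ := exists_vonMangoldt_coeff K
  obtain ⟨A, hA⟩ := exists_norm_riemannZeta_sub_one_le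
  have hrank := InfinitePlace.card_add_two_mul_card_eq_rank K
  refine (ZetaData.dedekind hser hF hFζ hFne).residue_le (ZetaData.riemann hζne) (by omega)
    (by omega) hdeg hc (fun s hs => ?_) hFζ hF1 (tendsto_one_add_of_norm_sub_one_le (A := 4 *
      ∑' I : {I : Ideal (𝓞 K) // I ≠ ⊥}, (Ideal.absNorm I.1 : ℝ) ^ (-2 : ℝ)) fun s hs => ?_)
    (tendsto_one_add_of_norm_sub_one_le hA) hdisc hκ0
  · have hne : (∑' I : {I : Ideal (𝓞 K) // I ≠ ⊥},
        (Ideal.absNorm (I : Ideal (𝓞 K)) : ℂ) ^ (-s)) ≠ 0 := by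
      rw [← hser s hs]
      exact hGRH s (by linarith)
    rw [logDeriv_sub_one_mul hs hFζ hser hdiff hne, sub_add_cancel_left]
    exact hcsum s hs hne
  · rw [hser s (by linarith)]
    exact norm_tsum_absNorm_sub_one_le hs
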